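/- Let Ω ⊂ ℝⁿ be an open domain with compact boundary of class C³, let p ∈ [1,∞), and suppose ρ satisfies Assumptions (A1) and (A2). Then there exists a constant C_Ω > 0, depending only on Ω, ρ and p, such that for all ε ∈ (0,1] and all u ∈ W^{3,p}_M(Ω): ‖L_ε^Ω u − L^Ω u‖_{L^p(Ω)} ≤ C_Ω ε^{1/p} ‖u‖_{W^{3,p}(Ω)}, where L^Ω u := −div(M∇u). -/

import Mathlib

open MeasureTheory Filter Topology ENNReal Matrix

noncomputable section

abbrev EV (n : ℕ) := EuclideanSpace ℝ (Fin n)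

/-- The kernel `J(x) = ρ(x)/|x|²`. -/
def kernelJ {n : ℕ} (ρ : EV n → ℝ) (x : EV n) : ℝ := ρ x / ‖x‖ ^ 2

/-- The rescaled density `ρ_ε(x) = ε^{-n} ρ(x/ε)`. -/
def scaled {n : ℕ} (ρ : EV n → ℝ) (ε : ℝ) (x : EV n) : ℝ := (ε ^ n)⁻¹ * ρ (ε⁻¹ • x)

/-- Assumption (A1): `ρ` is measurable, nonnegative, not a.e. zero, even,
and `∫ ρ(x)(1+|x|) dx < ∞`. -/
def A1 {n : ℕ} (ρ : EV n → ℝ) : Prop :=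
  Measurable ρ ∧ (∀ x, 0 ≤ ρ x) ∧ ¬ (ρ =ᵐ[volume] (fun _ => (0 : ℝ))) ∧
  (∀ᵐ x : EV n ∂volume, ρ (-x) = ρ x) ∧
  Integrable (fun x : EV n => ρ x * (1 + ‖x‖)) volume

/-- `L_ε u (x) = ∫_{ℝⁿ} J_ε(x-y) (u(x) - u(y) - ∇u(x)·(x-y)) dy`. -/
def nlOp {n : ℕ} (ρ : EV n → ℝ) (ε : ℝ) (u : EV n → ℝ) (x : EV n) : ℝ :=
  ∫ y : EV n, kernelJ (scaled ρ ε) (x - y) * (u x - u y - fderiv ℝ u x (x - y))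

/-- The classical partial derivative `∂ᵢ u`. -/
def partialD {n : ℕ} (i : Fin n) (u : EV n → ℝ) : EV n → ℝ :=
  fun x => fderiv ℝ u x (EuclideanSpace.single i 1)

/-- Iterated classical partial derivatives along a list of directions. -/
def partialDList {n : ℕ} : List (Fin n) → (EV n → ℝ) → (EV n → ℝ)
  | [], u => u
  | i :: l, u => partialD i (partialDList l u)

/-- The momentum matrix `M = (1/2)∫_{ℝⁿ} J(z) z ⊗ z dz`. -/
def momentum {n : ℕ} (ρ : EV n → ℝ) : Matrix (Fin n) (Fin n) ℝ :=
  Matrix.of fun i j => (1 / 2 : ℝ) * ∫ z : EV n, kernelJ ρ z * z i * z j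

/-- Multiplication of a vector of `ℝⁿ` by a matrix. -/
def mulVecE {m : ℕ} (Q : Matrix (Fin m) (Fin m) ℝ) (x : EV m) : EV m :=
  (WithLp.equiv 2 (Fin m → ℝ)).symm (Q.mulVec ((WithLp.equiv 2 (Fin m → ℝ)) x))

/-- The point `(z', zₙ) ∈ ℝⁿ` with first coordinates `z' ∈ ℝ^{n-1}` and last coordinate `zₙ`. -/
def snocE {n : ℕ} (z' : EV n) (t : ℝ) : EV (n + 1) :=
  (WithLp.equiv 2 (Fin (n + 1) → ℝ)).symm
    (Fin.snoc ((WithLp.equiv 2 (Fin n → ℝ)) z') t)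

/-- `v = ∂ᵢ u` weakly on `Ω`. -/
def WeakDerivOn {n : ℕ} (Ω : Set (EV n)) (i : Fin n) (u v : EV n → ℝ) : Prop :=
  ∀ φ : EV n → ℝ, ContDiff ℝ (⊤ : ℕ∞) φ → HasCompactSupport φ → tsupport φ ⊆ Ω →
    ∫ x in Ω, u x * partialD i φ x = - ∫ x in Ω, v x * φ x

/-- `D` is a system of weak partial derivatives of `u` on `Ω` up to order `k`,
all lying in `L^p(Ω)`; i.e. `D` witnesses that `u ∈ W^{k,p}(Ω)`. -/
def IsSobDerivs {n : ℕ} (Ω : Set (EV n)) (k : ℕ) (p : ℝ≥0∞) (u : EV n → ℝ)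
    (D : List (Fin n) → EV n → ℝ) : Prop :=
  D [] = u ∧
  (∀ l : List (Fin n), l.length < k → ∀ i : Fin n, WeakDerivOn Ω i (D l) (D (i :: l))) ∧
  (∀ l : List (Fin n), l.length ≤ k → MemLp (D l) p (volume.restrict Ω))

/-- `u ∈ W^{k,p}(Ω)`. -/
def MemW {n : ℕ} (Ω : Set (EV n)) (k : ℕ) (p : ℝ≥0∞) (u : EV n → ℝ) : Prop :=
  ∃ D, IsSobDerivs Ω k p u D

/-- The `W^{k,p}`-norm computed from a system `D` of weak derivatives:
the sum of the `L^p` norms of all weak derivatives of order at most `k`. -/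
def WNormD {n : ℕ} (k : ℕ) (p : ℝ≥0∞) (μ : Measure (EV n))
    (D : List (Fin n) → EV n → ℝ) : ℝ≥0∞ :=
  ∑' l : List (Fin n), if l.length ≤ k then eLpNorm (D l) p μ else 0

/-- The first `n` coordinates of a point of `ℝ^{n+1}`. -/
def firstCoords {n : ℕ} (x : EV (n + 1)) : EV n :=
  (WithLp.equiv 2 (Fin n → ℝ)).symm (fun i => x i.castSucc)

/-- The curved half space `ℝⁿ_γ = {x : xₙ > γ(x₁,…,x_{n-1})}`. -/
def halfSpace {n : ℕ} (γ : EV n → ℝ) : Set (EV (n + 1)) :=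
  {x : EV (n + 1) | γ (firstCoords x) < x (Fin.last n)}

/-- `γ ∈ C^k_b`: `γ` is `k` times continuously differentiable with bounded derivatives. -/
def Ckb {n : ℕ} (k : ℕ) (γ : EV n → ℝ) : Prop :=
  ContDiff ℝ k γ ∧ ∀ m : ℕ, m ≤ k → ∃ C : ℝ, ∀ x, ‖iteratedFDeriv ℝ m γ x‖ ≤ C

/-- Assumption (A2): `ρ ∈ C¹(ℝⁿ∖{0})` with singularity bounds
`|ρ(x)| ≤ c₀|x|^{2-α-n}(1+|x|)^{-N}`, `|∇ρ(x)| ≤ c₁|x|^{1-α-n}(1+|x|)^{-N}` for some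
`c₀, c₁ > 0`, `α ∈ (0,2)`, `N > 3-α`; and, with `A := √M`, the kernel satisfies
`∫_{ℝ^{n-1}} J(AQ(z', zₙ)) z' dz' = 0` for all `zₙ ∈ ℝ` and `Q ∈ SO(n)`.
(The ambient dimension is `n + 1`.) -/
def A2 {n : ℕ} (ρ : EV (n + 1) → ℝ) : Prop :=
  ContDiffOn ℝ 1 ρ {(0 : EV (n + 1))}ᶜ ∧
  (∃ c₀ c₁ α N : ℝ, 0 < c₀ ∧ 0 < c₁ ∧ 0 < α ∧ α < 2 ∧ 3 - α < N ∧
    ∀ x : EV (n + 1), x ≠ 0 →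
      |ρ x| ≤ c₀ * ‖x‖ ^ ((2 : ℝ) - α - (n + 1 : ℝ)) * (1 + ‖x‖) ^ (-N) ∧
      ‖fderiv ℝ ρ x‖ ≤ c₁ * ‖x‖ ^ ((1 : ℝ) - α - (n + 1 : ℝ)) * (1 + ‖x‖) ^ (-N)) ∧
  (∃ A : Matrix (Fin (n + 1)) (Fin (n + 1)) ℝ, A.PosDef ∧ A * A = momentum ρ ∧
    ∀ t : ℝ, ∀ Q : Matrix (Fin (n + 1)) (Fin (n + 1)) ℝ, Qᵀ * Q = 1 → Q.det = 1 →
      (∫ z' : EV n, kernelJ ρ (mulVecE (A * Q) (snocE z' t)) • z') = 0)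

/-- The homogeneous conormal boundary condition `M∇u · n = 0` on `∂Ω`, formulated weakly:
for any system of weak derivatives of `u ∈ W^{2,p}(Ω)` and any test function
`φ ∈ C_c^∞(ℝⁿ)`, Green's formula holds on `Ω` with no boundary contribution. -/
def NeumannBC {m : ℕ} (Ω : Set (EV m)) (Mm : Matrix (Fin m) (Fin m) ℝ) (p : ℝ≥0∞)
    (u : EV m → ℝ) : Prop :=
  ∀ D : List (Fin m) → EV m → ℝ, IsSobDerivs Ω 2 p u D →
    ∀ φ : EV m → ℝ, ContDiff ℝ (⊤ : ℕ∞) φ → HasCompactSupport φ →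
      (∑ i : Fin m, ∑ j : Fin m, Mm i j * ∫ x in Ω, D [i, j] x * φ x)
        = - ∑ i : Fin m, ∑ j : Fin m, Mm i j * ∫ x in Ω, D [j] x * partialD i φ x

/-- `u ∈ W^{k,p}(Ω)` together with the boundary condition `M∇u · n = 0` on `∂Ω`. -/
def MemWN {m : ℕ} (Ω : Set (EV m)) (Mm : Matrix (Fin m) (Fin m) ℝ) (k : ℕ) (p : ℝ≥0∞)
    (u : EV m → ℝ) : Prop :=
  MemW Ω k p u ∧ NeumannBC Ω Mm p u

/-- `l` is the principal value `P.V. ∫_Ω J_ε(x-y)(u(x)-u(y)) dy` at the point `x`. -/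
def pvAt {m : ℕ} (Ω : Set (EV m)) (ρ : EV m → ℝ) (ε : ℝ) (u : EV m → ℝ) (x : EV m)
    (l : ℝ) : Prop :=
  Tendsto
    (fun r : ℝ =>
      ∫ y in Ω ∩ {y : EV m | r ≤ dist x y}, kernelJ (scaled ρ ε) (x - y) * (u x - u y))
    (𝓝[>] 0) (𝓝 l)

/-- `L` is a bounded linear extension to `W^{2,p}_M(Ω)` (Sobolev functions with the
boundary condition `M∇u · n = 0`), with operator bound `C`, of the nonlocal operator
`P.V. ∫_Ω J_ε(·-y)(u(·)-u(y)) dy` defined on `C_c²(cl Ω) ∩ W^{2,p}_M(Ω)`. -/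
def IsNLExtOn {m : ℕ} (Ω : Set (EV m)) (Mm : Matrix (Fin m) (Fin m) ℝ) (ρ : EV m → ℝ)
    (p : ℝ≥0∞) (ε C : ℝ) (L : (EV m → ℝ) → EV m → ℝ) : Prop :=
  (∀ u : EV m → ℝ, ContDiff ℝ 2 u → HasCompactSupport u → MemWN Ω Mm 2 p u →
    ∀ᵐ x ∂(volume.restrict Ω), pvAt Ω ρ ε u x (L u x)) ∧
  (∀ u v : EV m → ℝ, MemWN Ω Mm 2 p u → MemWN Ω Mm 2 p v → ∀ a b : ℝ,
    L (fun x => a * u x + b * v x) =ᵐ[volume.restrict Ω] fun x => a * L u x + b * L v x) ∧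
  (∀ u : EV m → ℝ, MemWN Ω Mm 2 p u → MemLp (L u) p (volume.restrict Ω)) ∧
  (∀ u D, MemWN Ω Mm 2 p u → IsSobDerivs Ω 2 p u D →
    eLpNorm (L u) p (volume.restrict Ω)
      ≤ ENNReal.ofReal C * WNormD 2 p (volume.restrict Ω) D)

/-- `Ω ⊆ ℝ^{n+1}` is an open set whose boundary is locally, up to a rotation, the region
above the graph of a `C^k` function with bounded derivatives (a domain of class `C^k`). -/
def IsGraphDomain {n : ℕ} (k : ℕ) (Ω : Set (EV (n + 1))) : Prop :=
  IsOpen Ω ∧ ∀ z ∈ frontier Ω,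
    ∃ (U : Set (EV (n + 1))) (Q : Matrix (Fin (n + 1)) (Fin (n + 1)) ℝ) (γ : EV n → ℝ),
      IsOpen U ∧ z ∈ U ∧ Qᵀ * Q = 1 ∧ Q.det = 1 ∧ Ckb k γ ∧
      Ω ∩ U = (mulVecE Q '' halfSpace γ) ∩ U


section
open Metric
open ENNReal (ofReal)
open Set (Icc Ioc Ioo indicator_of_mem indicator_of_notMem)
open Finset (sum_congr sum_mul mul_sum sum_le_sum sum_add_distrib)
open EuclideanSpace (single)
open Real (smoothTransition)
set_option linter.unusedVariables false
set_option linter.unusedSimpArgs false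
set_option linter.deprecated false
set_option maxSynthPendingDepth 5

section
/-- the `q`-th power of the `L^q` norm over a set -/
def Lq {m : ℕ} {F : Type*} [NormedAddCommGroup F] (q : ℝ) (S : Set (EV m)) (f : EV m → F) : ℝ≥0∞ :=
  ∫⁻ x in S, ‖f x‖ₑ ^ q

lemma jensen_lint {α : Type*} [MeasurableSpace α] (μ : Measure α) {q : ℝ} (hq : 1 ≤ q)
    {k f : α → ℝ≥0∞} (hk : AEMeasurable k μ) (hf : AEMeasurable f μ) :
    (∫⁻ z, k z * f z ∂μ) ^ q ≤ (∫⁻ z, k z ∂μ) ^ (q - 1) * ∫⁻ z, k z * f z ^ q ∂μ := by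
  have hq0 : 0 < q := by linarith
  have h := ENNReal.lintegral_mul_norm_pow_le (μ := μ) (f := k) (g := fun z => k z * f z ^ q)
    hk (hk.mul (hf.pow_const q)) (p := 1 - 1 / q) (q := 1 / q)
    (by rw [sub_nonneg, div_le_one hq0]; exact hq) (by positivity) (by ring)
  have e : ∀ z, k z ^ (1 - 1 / q) * (k z * f z ^ q) ^ (1 / q) = k z * f z := by
    intro z
    rw [ENNReal.mul_rpow_of_nonneg _ _ (by positivity), ← mul_assoc,
      ← ENNReal.rpow_add_of_nonneg _ _ (by rw [sub_nonneg, div_le_one hq0]; exact hq) (by positivity),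
      ← ENNReal.rpow_mul]
    congr 1
    · rw [show 1 - 1 / q + 1 / q = (1 : ℝ) by ring, ENNReal.rpow_one]
    · rw [mul_one_div_cancel hq0.ne', ENNReal.rpow_one]
  simp only [e] at h
  calc (∫⁻ z, k z * f z ∂μ) ^ q ≤ _ := ENNReal.rpow_le_rpow h hq0.le
    _ = _ := by
      rw [ENNReal.mul_rpow_of_nonneg _ _ hq0.le, ← ENNReal.rpow_mul, ← ENNReal.rpow_mul]
      congr 2
      · field_simp
      · rw [one_div_mul_cancel hq0.ne', ENNReal.rpow_one]

lemma jensen_fubini {m m' : ℕ} {q : ℝ} (hq : 1 ≤ q) (S : Set (EV m))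
    (T : Set (EV m'))
    {k : EV m' → ℝ≥0∞} {F : EV m → EV m' → ℝ≥0∞} (hk : Measurable k)
    (hF : Measurable (Function.uncurry F)) :
    ∫⁻ x in S, (∫⁻ z in T, k z * F x z) ^ q ≤
      (∫⁻ z in T, k z) ^ (q - 1) * ∫⁻ z in T, k z * ∫⁻ x in S, F x z ^ q := by
  calc _ ≤ ∫⁻ x in S, (∫⁻ z in T, k z) ^ (q - 1) * ∫⁻ z in T, k z * F x z ^ q := by
        apply lintegral_mono
        intro x
        exact jensen_lint _ hq hk.aemeasurable (hF.comp measurable_prodMk_left).aemeasurable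
    _ = (∫⁻ z in T, k z) ^ (q - 1) * ∫⁻ x in S, ∫⁻ z in T, k z * F x z ^ q := by
        rw [lintegral_const_mul]
        refine Measurable.lintegral_prod_right' (f := fun p : EV m × EV m' => k p.2 * F p.1 p.2 ^ q) ?_
        exact (hk.comp measurable_snd).mul (hF.pow_const q)
    _ = _ := by
        rw [lintegral_lintegral_swap]
        · congr 1
          apply lintegral_congr
          intro z
          rw [lintegral_const_mul]
          exact ((hF.comp measurable_prodMk_right).pow_const q)
        · exact ((hk.comp measurable_snd).mul (hF.pow_const q)).aemeasurable

lemma lintegral_set_translate_le {m : ℕ} (S T : Set (EV m)) (hS : MeasurableSet S) (hT : MeasurableSet T)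
    (g : EV m → ℝ≥0∞) (w : EV m) (h : ∀ x ∈ S, x + w ∈ T) :
    ∫⁻ x in S, g (x + w) ≤ ∫⁻ x in T, g x := by
  rw [← lintegral_indicator hS, ← lintegral_indicator hT,
    ← lintegral_add_right_eq_self (T.indicator g) w]
  apply lintegral_mono
  intro x
  by_cases hx : x ∈ S
  · simp [hx, h x hx]
  · simp [hx]

lemma path_avg {m : ℕ} {F : Type*} [NormedAddCommGroup F] {q : ℝ} (hq : 1 ≤ q)
    (S T : Set (EV m)) (hS : MeasurableSet S) (hT : MeasurableSet T)
    (f : EV m → F) (hf : Continuous f) (b w : EV m) (b' : ℝ) (hb' : 0 ≤ b')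
    (h : ∀ x ∈ S, ∀ s ∈ Icc (0 : ℝ) b', x + (b + s • w) ∈ T) :
    ∫⁻ x in S, (∫⁻ s in Icc (0 : ℝ) b', ‖f (x + (b + s • w))‖ₑ) ^ q ≤ ofReal b' ^ q * Lq q T f := by
  have hq0 : 0 < q := by linarith
  have hm : Measurable (fun p : EV m × ℝ => ‖f (p.1 + (b + p.2 • w))‖ₑ ^ q) := by
    apply Measurable.pow_const
    apply Continuous.measurable
    apply Continuous.enorm
    fun_prop
  calc _ ≤ ∫⁻ x in S, ofReal b' ^ (q - 1) * ∫⁻ s in Icc (0 : ℝ) b', ‖f (x + (b + s • w))‖ₑ ^ q := by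
        apply lintegral_mono
        intro x
        have := jensen_lint (volume.restrict (Icc (0 : ℝ) b')) hq (k := fun _ => 1)
          (f := fun s => ‖f (x + (b + s • w))‖ₑ) aemeasurable_const
          (Continuous.enorm (by fun_prop)).measurable.aemeasurable
        simpa using this
    _ = ofReal b' ^ (q - 1) * ∫⁻ s in Icc (0 : ℝ) b', ∫⁻ x in S, ‖f (x + (b + s • w))‖ₑ ^ q := by
        rw [lintegral_const_mul _ hm.lintegral_prod_right']
        rw [lintegral_lintegral_swap]
        exact hm.aemeasurable
    _ ≤ ofReal b' ^ (q - 1) * ∫⁻ s in Icc (0 : ℝ) b', Lq q T f := by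
        refine mul_le_mul_right ?_ _
        apply setLIntegral_mono' measurableSet_Icc
        intro s hs
        exact lintegral_set_translate_le S T hS hT (fun x => ‖f x‖ₑ ^ q) (b + s • w) (fun x hx => h x hx s hs)
    _ = _ := by
        rw [setLIntegral_const, Real.volume_Icc, sub_zero, mul_comm (Lq q T f), ← mul_assoc]
        congr 1
        rcases eq_or_ne b' 0 with h0 | h0
        · subst h0
          simp [hq0]
        · nth_rewrite 2 [← ENNReal.rpow_one (ofReal b')]
          rw [← ENNReal.rpow_add]
          · ring_nf
          · simpa using lt_of_le_of_ne hb' h0.symm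
          · simp

lemma Lq_mono_set {m : ℕ} {F : Type*} [NormedAddCommGroup F] {q : ℝ}
    {S T : Set (EV m)} (h : S ⊆ T) (f : EV m → F) : Lq q S f ≤ Lq q T f :=
  lintegral_mono_set h

lemma rpow_add_le {q : ℝ} (hq : 1 ≤ q) (a b : ℝ≥0∞) :
    (a + b) ^ q ≤ 2 ^ (q - 1) * (a ^ q + b ^ q) := by
  have := ENNReal.rpow_add_le_mul_rpow_add_rpow a b hq
  exact this

lemma lint_sum_rpow_le {α : Type*} [MeasurableSpace α] (μ : Measure α) {ι : Type*} (s : Finset ι) {q : ℝ}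
    (hq : 1 ≤ q) (f : α → ℝ≥0∞) (g : ι → α → ℝ≥0∞) (hg : ∀ i ∈ s, AEMeasurable (g i) μ)
    (h : ∀ᵐ x ∂μ, f x ≤ ∑ i ∈ s, g i x) :
    ∫⁻ x, f x ^ q ∂μ ≤ (s.card : ℝ≥0∞) ^ (q - 1) * ∑ i ∈ s, ∫⁻ x, g i x ^ q ∂μ := by
  rw [← lintegral_finsetSum' s (fun i hi => (hg i hi).pow_const q), ← lintegral_const_mul'']
  · apply lintegral_mono_ae
    filter_upwards [h] with x hx
    calc f x ^ q ≤ (∑ i ∈ s, g i x) ^ q := ENNReal.rpow_le_rpow hx (by linarith)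
      _ ≤ _ := ENNReal.rpow_sum_le_const_mul_sum_rpow s (fun i => g i x) hq
  · exact Finset.aemeasurable_fun_sum s (fun i hi => (hg i hi).pow_const q)

lemma lint_add_rpow_le {α : Type*} [MeasurableSpace α] (μ : Measure α) {q : ℝ}
    (hq : 1 ≤ q) (f g h : α → ℝ≥0∞) (hg : AEMeasurable g μ)
    (hf : ∀ᵐ x ∂μ, f x ≤ g x + h x) :
    ∫⁻ x, f x ^ q ∂μ ≤ 2 ^ (q - 1) * (∫⁻ x, g x ^ q ∂μ + ∫⁻ x, h x ^ q ∂μ) := by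
  rw [← lintegral_add_left' (hg.pow_const q), ← lintegral_const_mul' _ _ (by
    apply ENNReal.rpow_ne_top_of_nonneg (by linarith) (by simp))]
  apply lintegral_mono_ae
  filter_upwards [hf] with x hx
  exact (ENNReal.rpow_le_rpow hx (by linarith)).trans (rpow_add_le hq _ _)

lemma lint_const_mul_rpow {α : Type*} [MeasurableSpace α] (μ : Measure α) {q : ℝ}
    (hq : 0 ≤ q) (f : α → ℝ≥0∞) (c : ℝ≥0∞) (hc : c ≠ ∞) :
    ∫⁻ x, (c * f x) ^ q ∂μ = c ^ q * ∫⁻ x, f x ^ q ∂μ := by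
  rw [← lintegral_const_mul' _ _ (ENNReal.rpow_ne_top_of_nonneg hq hc)]
  simp_rw [ENNReal.mul_rpow_of_nonneg _ _ hq]

/-! ### Calculus along segments -/

section calc1
variable {m : ℕ} {F : Type*} [NormedAddCommGroup F] [NormedSpace ℝ F]

lemma hasDerivAt_line {f : EV m → F} (a w : EV m) (s : ℝ) (hf : DifferentiableAt ℝ f (a + s • w)) :
    HasDerivAt (fun s : ℝ => f (a + s • w)) (fderiv ℝ f (a + s • w) w) s := by
  have h1 : HasDerivAt (fun s : ℝ => a + s • w) w s := by
    simpa using ((hasDerivAt_id s).smul_const w).const_add a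
  exact hf.hasFDerivAt.comp_hasDerivAt s h1

lemma c1_diff_real {f : EV m → F} (hf : ContDiff ℝ 1 f) (a w : EV m)
    {b : ℝ} (hb : 0 ≤ b) {s : ℝ} (hs : s ∈ Icc (0 : ℝ) b) [CompleteSpace F] :
    ‖f (a + s • w) - f a‖ ≤ ‖w‖ * ∫ τ in Icc (0 : ℝ) b, ‖fderiv ℝ f (a + τ • w)‖ := by
  have hc : Continuous (fun τ : ℝ => fderiv ℝ f (a + τ • w)) :=
    (hf.continuous_fderiv one_ne_zero).comp (by fun_prop)
  have hd : ∀ τ : ℝ, HasDerivAt (fun s : ℝ => f (a + s • w)) (fderiv ℝ f (a + τ • w) w) τ :=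
    fun τ => hasDerivAt_line a w τ (hf.differentiable one_ne_zero _)
  have h1 : ∫ τ in (0 : ℝ)..s, fderiv ℝ f (a + τ • w) w = f (a + s • w) - f (a + (0 : ℝ) • w) :=
    intervalIntegral.integral_eq_sub_of_hasDerivAt (fun τ _ => hd τ)
      (Continuous.intervalIntegrable (hc.clm_apply continuous_const) _ _)
  rw [zero_smul, add_zero] at h1
  rw [← h1]
  calc _ ≤ ∫ τ in (0 : ℝ)..s, ‖fderiv ℝ f (a + τ • w) w‖ := intervalIntegral.norm_integral_le_integral_norm hs.1
    _ ≤ ∫ τ in (0 : ℝ)..s, ‖w‖ * ‖fderiv ℝ f (a + τ • w)‖ := by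
      apply intervalIntegral.integral_mono_on hs.1
      · exact (Continuous.norm (hc.clm_apply continuous_const)).intervalIntegrable _ _
      · exact (Continuous.mul continuous_const hc.norm).intervalIntegrable _ _
      · intro τ _
        rw [mul_comm]
        exact ContinuousLinearMap.le_opNorm _ _
    _ = ‖w‖ * ∫ τ in (0 : ℝ)..s, ‖fderiv ℝ f (a + τ • w)‖ := by rw [intervalIntegral.integral_const_mul]
    _ ≤ _ := by
      gcongr
      rw [intervalIntegral.integral_of_le hs.1]
      apply setIntegral_mono_set
      · exact hc.norm.continuousOn.integrableOn_Icc
      · exact ae_of_all _ fun _ => norm_nonneg _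
      · exact LE.le.eventuallyLE fun τ hτ => ⟨hτ.1.le, hτ.2.trans hs.2⟩

/-- the average of `‖Df‖` along a segment -/
def segAvg (f : EV m → F) (a w : EV m) : ℝ := ∫ τ in Icc (0 : ℝ) 1, ‖fderiv ℝ f (a + τ • w)‖

lemma segAvg_nonneg (f : EV m → F) (a w : EV m) : 0 ≤ segAvg f a w :=
  integral_nonneg fun _ => norm_nonneg _

lemma segAvg_ofReal {f : EV m → F} (hf : ContDiff ℝ 1 f) (a w : EV m) :
    ofReal (segAvg f a w) = ∫⁻ τ in Icc (0 : ℝ) 1, ‖fderiv ℝ f (a + τ • w)‖ₑ := by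
  have hc : Continuous (fun τ : ℝ => fderiv ℝ f (a + τ • w)) :=
    (hf.continuous_fderiv one_ne_zero).comp (by fun_prop)
  unfold segAvg
  rw [ofReal_integral_norm_eq_lintegral_enorm]
  exact hc.continuousOn.integrableOn_Icc

lemma c1_diff [CompleteSpace F] {f : EV m → F} (hf : ContDiff ℝ 1 f) (a w : EV m)
    {s : ℝ} (hs : s ∈ Icc (0 : ℝ) 1) :
    ‖f (a + s • w) - f a‖ ≤ ‖w‖ * segAvg f a w := c1_diff_real hf a w zero_le_one hs

lemma mvt_unit {k k' : ℝ → F} {C : ℝ} (hk : ∀ s, HasDerivAt k (k' s) s)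
    (hC : ∀ s ∈ Icc (0 : ℝ) 1, ‖k' s‖ ≤ C) {s : ℝ} (hs : s ∈ Icc (0 : ℝ) 1) :
    ‖k s - k 0‖ ≤ C := by
  have hC0 : 0 ≤ C := (norm_nonneg _).trans (hC 0 (by simp))
  have := norm_image_sub_le_of_norm_deriv_le_segment' (f := k) (f' := k') (C := C) (a := 0) (b := 1)
    (fun x _ => (hk x).hasDerivWithinAt) (fun x hx => hC x ⟨hx.1, hx.2.le⟩) s hs
  calc _ ≤ C * (s - 0) := this
    _ ≤ C * 1 := by gcongr; linarith [hs.2]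
    _ = C := mul_one C

lemma c2_taylor {v : EV m → ℝ} (hv : ContDiff ℝ 2 v) (a w : EV m) {s : ℝ} (hs : s ∈ Icc (0 : ℝ) 1) :
    ‖v (a + s • w) - v a - s * fderiv ℝ v a w‖ ≤ ‖w‖ ^ 2 * segAvg (fderiv ℝ v) a w := by
  have hF : ContDiff ℝ 1 (fderiv ℝ v) := hv.fderiv_right (by norm_num)
  have := mvt_unit (k := fun s : ℝ => v (a + s • w) - v a - s * fderiv ℝ v a w)
    (k' := fun s => fderiv ℝ v (a + s • w) w - fderiv ℝ v a w)
    (C := ‖w‖ ^ 2 * segAvg (fderiv ℝ v) a w) ?_ ?_ hs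
  · simpa using this
  · intro s
    have h1 := hasDerivAt_line (f := v) a w s (hv.differentiable (by norm_num) _)
    simpa using (h1.sub_const (v a)).fun_sub ((hasDerivAt_id s).mul_const (fderiv ℝ v a w))
  · intro s hs
    have := c1_diff hF a w hs
    calc _ = ‖(fderiv ℝ v (a + s • w) - fderiv ℝ v a) w‖ := by simp
      _ ≤ ‖fderiv ℝ v (a + s • w) - fderiv ℝ v a‖ * ‖w‖ := ContinuousLinearMap.le_opNorm _ _
      _ ≤ (‖w‖ * segAvg (fderiv ℝ v) a w) * ‖w‖ := by gcongr
      _ = _ := by ring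

lemma c3_taylor {v : EV m → ℝ} (hv : ContDiff ℝ 3 v) (a w : EV m) :
    ‖v (a + w) - v a - fderiv ℝ v a w - 1 / 2 * fderiv ℝ (fderiv ℝ v) a w w‖
      ≤ ‖w‖ ^ 3 * segAvg (fderiv ℝ (fderiv ℝ v)) a w := by
  have hF : ContDiff ℝ 2 (fderiv ℝ v) := hv.fderiv_right (by norm_num)
  have hF2 : ContDiff ℝ 1 (fderiv ℝ (fderiv ℝ v)) := hF.fderiv_right (by norm_num)
  set B := segAvg (fderiv ℝ (fderiv ℝ v)) a w with hB
  have step : ∀ s ∈ Icc (0 : ℝ) 1,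
      ‖fderiv ℝ v (a + s • w) - fderiv ℝ v a - s • fderiv ℝ (fderiv ℝ v) a w‖ ≤ ‖w‖ ^ 2 * B := by
    intro s hs
    have := mvt_unit (k := fun s : ℝ => fderiv ℝ v (a + s • w) - fderiv ℝ v a - s • fderiv ℝ (fderiv ℝ v) a w)
      (k' := fun s => fderiv ℝ (fderiv ℝ v) (a + s • w) w - fderiv ℝ (fderiv ℝ v) a w)
      (C := ‖w‖ ^ 2 * B) ?_ ?_ hs
    · simpa using this
    · intro s
      have h1 := hasDerivAt_line (f := fderiv ℝ v) a w s (hF.differentiable (by norm_num) _)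
      simpa using (h1.sub_const (fderiv ℝ v a)).fun_sub ((hasDerivAt_id s).smul_const (fderiv ℝ (fderiv ℝ v) a w))
    · intro s hs
      have := c1_diff hF2 a w hs
      calc _ = ‖(fderiv ℝ (fderiv ℝ v) (a + s • w) - fderiv ℝ (fderiv ℝ v) a) w‖ := by simp
        _ ≤ ‖fderiv ℝ (fderiv ℝ v) (a + s • w) - fderiv ℝ (fderiv ℝ v) a‖ * ‖w‖ := ContinuousLinearMap.le_opNorm _ _
        _ ≤ (‖w‖ * B) * ‖w‖ := by gcongr
        _ = _ := by ring
  have := mvt_unit (k := fun s : ℝ => v (a + s • w) - v a - s * fderiv ℝ v a w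
        - s ^ 2 / 2 * fderiv ℝ (fderiv ℝ v) a w w)
    (k' := fun s => fderiv ℝ v (a + s • w) w - fderiv ℝ v a w - s * fderiv ℝ (fderiv ℝ v) a w w)
    (C := ‖w‖ ^ 3 * B) ?_ ?_ (s := 1) (by simp)
  · simpa using this
  · intro s
    have h1 := hasDerivAt_line (f := v) a w s (hv.differentiable (by norm_num) _)
    have h2 : HasDerivAt (fun s : ℝ => s ^ 2 / 2) s s := by
      have := (hasDerivAt_pow 2 s).div_const 2
      have e : ((2 : ℕ) : ℝ) * s ^ (2 - 1) / 2 = s := by norm_num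
      rwa [e] at this
    simpa using ((h1.sub_const (v a)).fun_sub ((hasDerivAt_id s).mul_const (fderiv ℝ v a w))).fun_sub
      (h2.mul_const (fderiv ℝ (fderiv ℝ v) a w w))
  · intro s hs
    calc _ = ‖(fderiv ℝ v (a + s • w) - fderiv ℝ v a - s • fderiv ℝ (fderiv ℝ v) a w) w‖ := by simp
      _ ≤ ‖(fderiv ℝ v (a + s • w) - fderiv ℝ v a - s • fderiv ℝ (fderiv ℝ v) a w)‖ * ‖w‖ := ContinuousLinearMap.le_opNorm _ _
      _ ≤ (‖w‖ ^ 2 * B) * ‖w‖ := by gcongr; exact step s hs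
      _ = _ := by ring

end calc1
end

section
/-! ### Layer lemma -/

lemma layer_swap {m : ℕ} (S Ω : Set (EV m)) (hS : MeasurableSet S) (hΩ : MeasurableSet Ω) (e : EV m)
    (g : EV m → ℝ≥0∞) (hg : Measurable g) (s0 : ℝ) (ℓ : ℝ≥0∞)
    (h : ∀ x ∈ S, ∀ s ∈ Icc (0 : ℝ) s0, x + s • e ∈ Ω)
    (hℓ : ∀ y, volume {s ∈ Icc (0 : ℝ) s0 | y - s • e ∈ S} ≤ ℓ) :
    ∫⁻ x in S, ∫⁻ s in Icc (0 : ℝ) s0, g (x + s • e) ≤ ℓ * ∫⁻ x in Ω, g x := by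
  have hm : Measurable (fun p : EV m × ℝ => g (p.1 + p.2 • e)) :=
    hg.comp (by fun_prop)
  rw [lintegral_lintegral_swap hm.aemeasurable]
  have h1 : ∀ s ∈ Icc (0 : ℝ) s0, ∫⁻ x in S, g (x + s • e)
      = ∫⁻ y in Ω, g y * S.indicator 1 (y - s • e) := by
    intro s hs
    rw [← lintegral_indicator hS, ← lintegral_indicator hΩ,
      ← lintegral_sub_right_eq_self _ (s • e)]
    apply lintegral_congr
    intro y
    by_cases hy : y - s • e ∈ S
    · have : y ∈ Ω := by simpa using h _ hy s hs
      simp [hy, this]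
    · by_cases hy' : y ∈ Ω <;> simp [hy, hy']
  rw [setLIntegral_congr_fun measurableSet_Icc h1]
  have hm2 : Measurable (fun p : ℝ × EV m => g p.2 * S.indicator 1 (p.2 - p.1 • e)) := by
    apply (hg.comp measurable_snd).mul
    exact (measurable_one.indicator hS).comp (by fun_prop)
  rw [lintegral_lintegral_swap hm2.aemeasurable]
  rw [← lintegral_const_mul _ hg]
  apply lintegral_mono
  intro y
  have hms : MeasurableSet {s : ℝ | y - s • e ∈ S} := by
    have : Measurable (fun s : ℝ => y - s • e) := by fun_prop
    exact this hS
  show ∫⁻ s in Icc (0 : ℝ) s0, g y * S.indicator 1 (y - s • e) ≤ ℓ * g y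
  rw [lintegral_const_mul, mul_comm]
  · refine mul_le_mul_left ?_ _
    refine le_trans (le_of_eq ?_) (hℓ y)
    have e1 : (fun s : ℝ => S.indicator (1 : EV m → ℝ≥0∞) (y - s • e))
        = {s : ℝ | y - s • e ∈ S}.indicator 1 := by
      ext s; simp [Set.indicator]
    rw [e1, lintegral_indicator_one hms, Measure.restrict_apply hms]
    congr 1
    ext s; simp [and_comm]
  · exact (measurable_one.indicator hS).comp (by fun_prop)

lemma layer_lemma {m : ℕ} {F : Type*} [NormedAddCommGroup F] [NormedSpace ℝ F] [CompleteSpace F]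
    {q : ℝ} (hq : 1 ≤ q)
    (S Ω : Set (EV m)) (hS : MeasurableSet S) (hΩ : MeasurableSet Ω) (e : EV m) (he : ‖e‖ = 1)
    (f : EV m → F) (hf : ContDiff ℝ 1 f) (s0 : ℝ) (hs0 : 0 < s0) (ℓ : ℝ≥0∞)
    (h : ∀ x ∈ S, ∀ s ∈ Icc (0 : ℝ) s0, x + s • e ∈ Ω)
    (hℓ : ∀ y, volume {s ∈ Icc (0 : ℝ) s0 | y - s • e ∈ S} ≤ ℓ) :
    Lq q S f ≤ ofReal s0⁻¹ * (2 ^ (q - 1) *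
      (ℓ * (Lq q Ω f + ofReal s0 ^ q * Lq q Ω (fderiv ℝ f)))) := by
  have hq0 : 0 < q := by linarith
  have hfc : Continuous (fderiv ℝ f) := hf.continuous_fderiv one_ne_zero
  have hm1 : Measurable (fun y => ‖f y‖ₑ ^ q) := (hf.continuous.enorm.measurable).pow_const q
  have hm2 : Measurable (fun y => ofReal s0 ^ q * ‖fderiv ℝ f y‖ₑ ^ q) :=
    ((hfc.enorm.measurable).pow_const q).const_mul _
  set g : EV m → ℝ≥0∞ := fun y => ‖f y‖ₑ ^ q + ofReal s0 ^ q * ‖fderiv ℝ f y‖ₑ ^ q with hg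
  have hgm : Measurable g := hm1.add hm2
  have hs0' : ofReal s0 ≠ 0 := by simpa using hs0
  have key : ∀ x, ofReal s0 * ‖f x‖ₑ ^ q ≤
      2 ^ (q - 1) * ∫⁻ s in Icc (0 : ℝ) s0, g (x + s • e) := by
    intro x
    set I := ∫⁻ τ in Icc (0 : ℝ) s0, ‖fderiv ℝ f (x + τ • e)‖ₑ with hI
    have hc : Continuous (fun τ : ℝ => fderiv ℝ f (x + τ • e)) := hfc.comp (by fun_prop)
    have h1 : ∀ s ∈ Icc (0 : ℝ) s0, ‖f x‖ₑ ^ q ≤ 2 ^ (q - 1) * (‖f (x + s • e)‖ₑ ^ q + I ^ q) := by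
      intro s hs
      refine le_trans (ENNReal.rpow_le_rpow ?_ hq0.le) (rpow_add_le hq _ _)
      have h2 := c1_diff_real hf x e hs0.le hs
      rw [he, one_mul] at h2
      have h3 : ‖f (x + s • e) - f x‖ₑ ≤ I := by
        rw [hI, ← ofReal_integral_norm_eq_lintegral_enorm (hc.continuousOn.integrableOn_Icc),
          ← ofReal_norm]
        exact ofReal_le_ofReal h2
      calc ‖f x‖ₑ = ‖f (x + s • e) - (f (x + s • e) - f x)‖ₑ := by congr 1; abel
        _ ≤ ‖f (x + s • e)‖ₑ + ‖f (x + s • e) - f x‖ₑ := enorm_sub_le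
        _ ≤ _ := by gcongr
    have hIq : ofReal s0 * I ^ q ≤ ofReal s0 ^ q * ∫⁻ τ in Icc (0 : ℝ) s0, ‖fderiv ℝ f (x + τ • e)‖ₑ ^ q := by
      have := jensen_lint (volume.restrict (Icc (0 : ℝ) s0)) hq (k := fun _ => 1)
          (f := fun s => ‖fderiv ℝ f (x + s • e)‖ₑ) aemeasurable_const
          hc.enorm.measurable.aemeasurable
      simp only [one_mul, lintegral_const, Measure.restrict_apply MeasurableSet.univ, Set.univ_inter,
        Real.volume_Icc, sub_zero] at this
      calc _ ≤ ofReal s0 * _ := mul_le_mul_right this _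
        _ = _ := by
          rw [← mul_assoc]
          congr 1
          nth_rewrite 1 [← ENNReal.rpow_one (ofReal s0)]
          rw [← ENNReal.rpow_add _ _ hs0' (by simp)]
          ring_nf
    have hmx1 : Measurable (fun s : ℝ => ‖f (x + s • e)‖ₑ ^ q) := hm1.comp (by fun_prop)
    have hmx2 : Measurable (fun s : ℝ => ‖fderiv ℝ f (x + s • e)‖ₑ ^ q) :=
      (hc.enorm.measurable).pow_const q
    calc ofReal s0 * ‖f x‖ₑ ^ q = ∫⁻ s in Icc (0 : ℝ) s0, ‖f x‖ₑ ^ q := by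
          rw [setLIntegral_const, Real.volume_Icc, sub_zero, mul_comm]
      _ ≤ ∫⁻ s in Icc (0 : ℝ) s0, 2 ^ (q - 1) * (‖f (x + s • e)‖ₑ ^ q + I ^ q) :=
          setLIntegral_mono' measurableSet_Icc h1
      _ = 2 ^ (q - 1) * ((∫⁻ s in Icc (0 : ℝ) s0, ‖f (x + s • e)‖ₑ ^ q) + ofReal s0 * I ^ q) := by
          rw [lintegral_const_mul' _ _ (ENNReal.rpow_ne_top_of_nonneg (by linarith) (by simp)), lintegral_add_left hmx1,
            setLIntegral_const, Real.volume_Icc, sub_zero, mul_comm (I ^ q)]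
      _ ≤ 2 ^ (q - 1) * ((∫⁻ s in Icc (0 : ℝ) s0, ‖f (x + s • e)‖ₑ ^ q) + ofReal s0 ^ q * ∫⁻ τ in Icc (0 : ℝ) s0, ‖fderiv ℝ f (x + τ • e)‖ₑ ^ q) := by
          gcongr
      _ = _ := by
          rw [hg, lintegral_add_left hmx1, lintegral_const_mul _ hmx2]
  have hmg : Measurable (fun x => ∫⁻ s in Icc (0 : ℝ) s0, g (x + s • e)) := by
    have hm : Measurable (fun p : EV m × ℝ => g (p.1 + p.2 • e)) := hgm.comp (by fun_prop)
    exact hm.lintegral_prod_right'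
  have h5 : ofReal s0 * Lq q S f ≤ 2 ^ (q - 1) *
      (ℓ * (Lq q Ω f + ofReal s0 ^ q * Lq q Ω (fderiv ℝ f))) := by
    calc _ = ∫⁻ x in S, ofReal s0 * ‖f x‖ₑ ^ q := by
          rw [lintegral_const_mul _ hm1]; rfl
      _ ≤ ∫⁻ x in S, 2 ^ (q - 1) * ∫⁻ s in Icc (0 : ℝ) s0, g (x + s • e) :=
          lintegral_mono key
      _ = 2 ^ (q - 1) * ∫⁻ x in S, ∫⁻ s in Icc (0 : ℝ) s0, g (x + s • e) :=
          lintegral_const_mul _ hmg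
      _ ≤ 2 ^ (q - 1) * (ℓ * ∫⁻ x in Ω, g x) :=
          mul_le_mul_right (layer_swap S Ω hS hΩ e g hgm s0 ℓ h hℓ) _
      _ = _ := by
          rw [hg, lintegral_add_left hm1, lintegral_const_mul]
          · rfl
          · exact (hfc.enorm.measurable).pow_const q
  calc Lq q S f = ofReal s0⁻¹ * (ofReal s0 * Lq q S f) := by
        rw [← mul_assoc, ← ofReal_mul (by positivity), inv_mul_cancel₀ hs0.ne']
        simp
    _ ≤ _ := mul_le_mul_right h5 _

/-! ### Charts -/

/-- A chart of the boundary: near `K`, `Ω` is given by `t > 0`, where `t` has slope one in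
direction `e`. -/
structure IsChart {m : ℕ} (Ω : Set (EV m)) (Λ R : ℝ) (K : Set (EV m)) (e : EV m) (t : EV m → ℝ) :
    Prop where
  e_norm : ‖e‖ = 1
  t_smooth : ContDiff ℝ 3 t
  t_shift : ∀ x s, t (x + s • e) = t x + s
  t_lip : ∀ x, ‖fderiv ℝ t x‖ ≤ Λ
  t_lip2 : ∀ x y, ‖fderiv ℝ t x - fderiv ℝ t y‖ ≤ Λ * ‖x - y‖
  mem_iff : ∀ x ∈ cthickening R K, (x ∈ Ω ↔ 0 < t x)

lemma cthick_move {m : ℕ} {K : Set (EV m)} {r s : ℝ} {x y : EV m} (hx : x ∈ cthickening r K)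
    (hr : 0 ≤ r) (hd : dist y x ≤ s) : y ∈ cthickening (r + s) K := by
  have hs : 0 ≤ s := dist_nonneg.trans hd
  rw [mem_cthickening_iff] at hx ⊢
  calc infEDist y K ≤ edist y x + infEDist x K := by
        rw [add_comm]; exact infEDist_le_infEDist_add_edist
    _ ≤ ofReal s + ofReal r := by
        gcongr
        rw [edist_dist]; exact ofReal_le_ofReal hd
    _ = _ := by rw [← ofReal_add hs hr, add_comm]

lemma cthick_self {m : ℕ} {K : Set (EV m)} {r : ℝ} {x : EV m} (hx : x ∈ K) :
    x ∈ cthickening r K := self_subset_cthickening K hx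

namespace IsChart
variable {m : ℕ} {Ω : Set (EV m)} {Λ R : ℝ} {K : Set (EV m)} {e : EV m} {t : EV m → ℝ}

lemma diff (h : IsChart Ω Λ R K e t) : Differentiable ℝ t := h.t_smooth.differentiable (by norm_num)

lemma fderiv_e (h : IsChart Ω Λ R K e t) (x : EV m) : fderiv ℝ t x e = 1 := by
  have h1 := hasDerivAt_line x e 0 (h.diff (x + (0 : ℝ) • e))
  have h2 : HasDerivAt (fun s : ℝ => t (x + s • e)) 1 0 := by
    simp only [h.t_shift]
    exact (hasDerivAt_id (0 : ℝ)).const_add (t x)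
  have := h1.unique h2
  simpa using this

lemma fderiv_shift (h : IsChart Ω Λ R K e t) (x : EV m) (s : ℝ) :
    fderiv ℝ t (x + s • e) = fderiv ℝ t x := by
  have h1 : (fun y => t (y + s • e)) = fun y => t y + s := by ext y; exact h.t_shift y s
  have := fderiv_comp_add_right (𝕜 := ℝ) (f := t) (x := x) (s • e)
  rw [← this, h1]
  exact fderiv_add_const s

lemma lam_ge (h : IsChart Ω Λ R K e t) : 1 ≤ Λ := by
  have := (fderiv ℝ t 0).le_opNorm e
  rw [h.fderiv_e, h.e_norm] at this
  simp at this
  exact this.trans (h.t_lip 0)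

lemma lip (h : IsChart Ω Λ R K e t) (x y : EV m) : |t x - t y| ≤ Λ * ‖x - y‖ := by
  have := Convex.norm_image_sub_le_of_norm_fderiv_le (𝕜 := ℝ) (f := t) (s := Set.univ) (C := Λ)
    (fun x _ => h.diff x) (fun x _ => h.t_lip x) convex_univ (Set.mem_univ y) (Set.mem_univ x)
  simpa using this

lemma taylor0 (h : IsChart Ω Λ R K e t) (x w : EV m) :
    |t (x + w) - t x - fderiv ℝ t x w| ≤ Λ * ‖w‖ ^ 2 := by
  have := mvt_unit (k := fun s : ℝ => t (x + s • w) - t x - s * fderiv ℝ t x w)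
    (k' := fun s => fderiv ℝ t (x + s • w) w - fderiv ℝ t x w)
    (C := Λ * ‖w‖ ^ 2) ?_ ?_ (s := 1) (by simp)
  · simpa using this
  · intro s
    have h1 := hasDerivAt_line (f := t) x w s (h.diff _)
    simpa using (h1.sub_const (t x)).fun_sub ((hasDerivAt_id s).mul_const (fderiv ℝ t x w))
  · intro s hs
    have h0 : 0 ≤ Λ := by linarith [h.lam_ge]
    calc _ = ‖(fderiv ℝ t (x + s • w) - fderiv ℝ t x) w‖ := by simp
      _ ≤ ‖fderiv ℝ t (x + s • w) - fderiv ℝ t x‖ * ‖w‖ := ContinuousLinearMap.le_opNorm _ _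
      _ ≤ (Λ * ‖x + s • w - x‖) * ‖w‖ := by gcongr; exact h.t_lip2 _ _
      _ = Λ * s * ‖w‖ ^ 2 := by
        rw [add_sub_cancel_left, norm_smul, Real.norm_of_nonneg hs.1]; ring
      _ ≤ Λ * 1 * ‖w‖ ^ 2 := by gcongr; exact hs.2
      _ = _ := by ring

lemma frontier_zero (h : IsChart Ω Λ R K e t) (hΩ : IsOpen Ω) {x : EV m} {r : ℝ} (hr0 : 0 ≤ r) (hr : r < R)
    (hx : x ∈ cthickening r K) (hf : x ∈ frontier Ω) : t x = 0 := by
  apply le_antisymm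
  · by_contra hc
    push Not at hc
    have := (h.mem_iff x (cthickening_mono hr.le _ hx)).2 hc
    rw [hΩ.frontier_eq] at hf
    exact hf.2 this
  · by_contra hc
    push Not at hc
    have hcl : x ∈ closure Ω := frontier_subset_closure hf
    have hn : {y | t y < 0} ∩ ball x (R - r) ∈ 𝓝 x := by
      apply Filter.inter_mem
      · exact (isOpen_lt h.t_smooth.continuous continuous_const).mem_nhds hc
      · exact ball_mem_nhds _ (by linarith)
    obtain ⟨y, hy, hyΩ⟩ := mem_closure_iff_nhds.1 hcl _ hn
    have := cthick_move hx hr0 (le_of_lt (mem_ball.1 hy.2))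
    rw [add_sub_cancel] at this
    have := (h.mem_iff y this).1 hyΩ
    exact absurd hy.1 (not_lt.2 this.le)

lemma zero_frontier (h : IsChart Ω Λ R K e t) (hΩ : IsOpen Ω) {x : EV m} {r : ℝ} (hr0 : 0 ≤ r) (hr : r < R)
    (hx : x ∈ cthickening r K) (hf : t x = 0) : x ∈ frontier Ω := by
  rw [hΩ.frontier_eq]
  constructor
  · rw [Metric.mem_closure_iff]
    intro ε hε
    refine ⟨x + (min (ε / 2) (R - r)) • e, ?_, ?_⟩
    · have hpos : 0 < min (ε / 2) (R - r) := lt_min (by linarith) (by linarith)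
      refine (h.mem_iff _ ?_).2 ?_
      · have := cthick_move (y := x + (min (ε / 2) (R - r)) • e) (s := R - r) hx hr0 ?_
        · rwa [add_sub_cancel] at this
        · rw [dist_eq_norm, add_sub_cancel_left, norm_smul, h.e_norm, mul_one, Real.norm_of_nonneg hpos.le]
          exact min_le_right _ _
      · rw [h.t_shift, hf, zero_add]; exact hpos
    · have hpos : 0 < min (ε / 2) (R - r) := lt_min (by linarith) (by linarith)
      rw [dist_eq_norm, sub_add_cancel_left, norm_neg, norm_smul, h.e_norm, mul_one, Real.norm_of_nonneg hpos.le]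
      exact (min_le_left _ _).trans_lt (by linarith)
  · intro hxΩ
    have := (h.mem_iff x (cthickening_mono hr.le _ hx)).1 hxΩ
    linarith

end IsChart
end

section
/-- the part of `Ω` near `K` where `t ≤ τ` -/
def chartLayer {m : ℕ} (Ω : Set (EV m)) (r : ℝ) (K : Set (EV m)) (t : EV m → ℝ) (τ : ℝ) : Set (EV m) :=
  Ω ∩ cthickening r K ∩ {x | t x ≤ τ}

lemma chartLayer_meas {m : ℕ} {Ω : Set (EV m)} (hΩ : IsOpen Ω) (r : ℝ) (K : Set (EV m)) {t : EV m → ℝ}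
    (ht : Continuous t) (τ : ℝ) : MeasurableSet (chartLayer Ω r K t τ) :=
  (hΩ.measurableSet.inter isClosed_cthickening.measurableSet).inter
    (isClosed_le ht continuous_const).measurableSet

lemma chartLayer_sub {m : ℕ} {Ω : Set (EV m)} (r : ℝ) (K : Set (EV m)) {t : EV m → ℝ} (τ : ℝ) :
    chartLayer Ω r K t τ ⊆ Ω := fun _ hx => hx.1.1

namespace IsChart
variable {m : ℕ} {Ω : Set (EV m)} {Λ R : ℝ} {K : Set (EV m)} {e : EV m} {t : EV m → ℝ}
variable {F : Type*} [NormedAddCommGroup F] [NormedSpace ℝ F] [CompleteSpace F]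

lemma up_mem (h : IsChart Ω Λ R K e t) {r s0 : ℝ} (hr : 0 ≤ r) (hrs : r + s0 ≤ R) {x : EV m} (hx : x ∈ Ω)
    (hxK : x ∈ cthickening r K) {s : ℝ} (hs : s ∈ Icc (0 : ℝ) s0) : x + s • e ∈ Ω := by
  have hs0 : 0 ≤ s0 := hs.1.trans hs.2
  refine (h.mem_iff _ ?_).2 ?_
  · refine cthickening_mono hrs _ (cthick_move hxK hr ?_)
    rw [dist_eq_norm, add_sub_cancel_left, norm_smul, h.e_norm, mul_one, Real.norm_of_nonneg hs.1]
    exact hs.2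
  · rw [h.t_shift]
    have := (h.mem_iff x (cthickening_mono (by linarith) _ hxK)).1 hx
    linarith [hs.1]

lemma layer_gen (h : IsChart Ω Λ R K e t) (hΩ : IsOpen Ω) {q : ℝ} (hq : 1 ≤ q) {r s0 : ℝ} (hr : 0 ≤ r)
    (hs0 : 0 < s0) (hrs : r + s0 ≤ R) (φ : EV m → ℝ) (hφc : Continuous φ) (hφ : ∀ x s, φ (x + s • e) = φ x + s)
    (b c : ℝ) (f : EV m → F) (hf : ContDiff ℝ 1 f) :
    Lq q (Ω ∩ cthickening r K ∩ {x | φ x ∈ Icc b c}) f ≤ ofReal s0⁻¹ * (2 ^ (q - 1) *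
      (ofReal (c - b) * (Lq q Ω f + ofReal s0 ^ q * Lq q Ω (fderiv ℝ f)))) := by
  apply layer_lemma hq _ Ω _ hΩ.measurableSet e h.e_norm f hf s0 hs0
  · rintro x ⟨⟨hx, hxK⟩, hxt⟩ s hs
    exact h.up_mem hr hrs hx hxK hs
  · intro y
    rw [← sub_sub_sub_cancel_left b c (φ y), ← Real.volume_Icc]
    apply measure_mono
    rintro s ⟨hs, hy⟩
    have h1 := hφ (y - s • e) s
    rw [sub_add_cancel] at h1
    have := hy.2
    simp only [Set.mem_setOf_eq, Set.mem_Icc] at this ⊢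
    constructor <;> linarith
  · exact (hΩ.measurableSet.inter isClosed_cthickening.measurableSet).inter
      (isClosed_Icc.preimage hφc).measurableSet

lemma layer_t (h : IsChart Ω Λ R K e t) (hΩ : IsOpen Ω) {q : ℝ} (hq : 1 ≤ q) {r s0 : ℝ} (hr : 0 ≤ r)
    (hs0 : 0 < s0) (hrs : r + s0 ≤ R) (τ : ℝ) (f : EV m → F) (hf : ContDiff ℝ 1 f) :
    Lq q (chartLayer Ω r K t τ) f ≤ ofReal s0⁻¹ * (2 ^ (q - 1) *
      (ofReal τ * (Lq q Ω f + ofReal s0 ^ q * Lq q Ω (fderiv ℝ f)))) := by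
  have := h.layer_gen hΩ hq hr hs0 hrs t h.t_smooth.continuous h.t_shift 0 τ f hf
  rw [sub_zero] at this
  refine le_trans (Lq_mono_set ?_ f) this
  rintro x ⟨⟨hx, hxK⟩, hxt⟩
  exact ⟨⟨hx, hxK⟩, ((h.mem_iff x (cthickening_mono (by linarith) _ hxK)).1 hx).le, hxt⟩

lemma layer_z (h : IsChart Ω Λ R K e t) (hΩ : IsOpen Ω) {q : ℝ} (hq : 1 ≤ q) {r s0 : ℝ} (hr : 0 ≤ r)
    (hs0 : 0 < s0) (hrs : r + s0 ≤ R) (z : EV m) (b : ℝ) (f : EV m → F) (hf : ContDiff ℝ 1 f) :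
    Lq q (Ω ∩ cthickening r K ∩ {x | |t x - fderiv ℝ t x z| ≤ b}) f ≤ ofReal s0⁻¹ * (2 ^ (q - 1) *
      (ofReal (2 * b) * (Lq q Ω f + ofReal s0 ^ q * Lq q Ω (fderiv ℝ f)))) := by
  have hc : Continuous (fun x => t x - fderiv ℝ t x z) :=
    h.t_smooth.continuous.sub ((h.t_smooth.continuous_fderiv (by norm_num)).clm_apply continuous_const)
  have := h.layer_gen hΩ hq hr hs0 hrs (fun x => t x - fderiv ℝ t x z) hc
    (by intro x s; rw [h.t_shift, h.fderiv_shift]; ring) (-b) b f hf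
  rw [show b - -b = 2 * b by ring] at this
  simpa only [abs_le, Set.mem_Icc] using this

end IsChart

/-! ### The quadratic remainder -/

open Classical in
/-- the remainder in the pointwise estimate -/
def remQ {m : ℕ} (Ω : Set (EV m)) (v : EV m → ℝ) (x z : EV m) : ℝ :=
  (if x - z ∈ Ω then v x - v (x - z) - fderiv ℝ v x z else 0) + 1 / 2 * fderiv ℝ (fderiv ℝ v) x z z

/-- `remQ` normalised -/
def remP {m : ℕ} (Ω : Set (EV m)) (v : EV m → ℝ) (x z : EV m) : ℝ := remQ Ω v x z / ‖z‖ ^ 2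

section perz
variable {m : ℕ} {Ω : Set (EV m)}

lemma half_hess (v : EV m → ℝ) (x z : EV m) :
    |1 / 2 * fderiv ℝ (fderiv ℝ v) x z z| ≤ ‖fderiv ℝ (fderiv ℝ v) x‖ * ‖z‖ ^ 2 := by
  have h := (fderiv ℝ (fderiv ℝ v) x).le_opNorm₂ z z
  rw [abs_mul, abs_of_pos (by norm_num : (0:ℝ) < 1 / 2)]
  rw [Real.norm_eq_abs] at h
  have : 0 ≤ ‖fderiv ℝ (fderiv ℝ v) x‖ * ‖z‖ ^ 2 := by positivity
  nlinarith [abs_nonneg (fderiv ℝ (fderiv ℝ v) x z z)]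

lemma div_sq_le {a b : ℝ} {z : EV m} (h : |a| ≤ b * ‖z‖ ^ 2) (hb : 0 ≤ b) : |a / ‖z‖ ^ 2| ≤ b := by
  rcases eq_or_ne z 0 with rfl | hz
  · simpa using hb
  · have : 0 < ‖z‖ ^ 2 := by positivity
    rw [abs_div, abs_of_pos this, div_le_iff₀ this]
    exact h

lemma enorm_le_of_abs {a b : ℝ} (h : |a| ≤ b) : ‖a‖ₑ ≤ ofReal b := by
  rw [Real.enorm_eq_ofReal_abs]
  exact ofReal_le_ofReal h

lemma perz_int3 {q : ℝ} (hq : 1 ≤ q) (hΩ : IsOpen Ω) (v : EV m → ℝ) (hv : ContDiff ℝ 3 v) (z : EV m) :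
    ∫⁻ x in (cthickening ‖z‖ Ωᶜ)ᶜ, ‖remP Ω v x z‖ₑ ^ q ≤
      ‖z‖ₑ ^ q * Lq q Ω (fderiv ℝ (fderiv ℝ (fderiv ℝ v))) := by
  have hq0 : 0 < q := by linarith
  have hF2 : ContDiff ℝ 1 (fderiv ℝ (fderiv ℝ v)) :=
    (hv.fderiv_right (m := 2) (by norm_num)).fderiv_right (by norm_num)
  have hseg : ∀ x ∈ (cthickening ‖z‖ Ωᶜ)ᶜ, ∀ s ∈ Icc (0 : ℝ) 1, x + (0 + s • (-z)) ∈ Ω := by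
    intro x hx s hs
    by_contra hc
    refine hx (mem_cthickening_of_dist_le x _ _ _ hc ?_)
    rw [dist_eq_norm]
    simp only [zero_add, sub_add_cancel_left, norm_neg, norm_smul, smul_neg, neg_neg, Real.norm_of_nonneg hs.1]
    nlinarith [norm_nonneg z, hs.2]
  have h1 := path_avg hq (cthickening ‖z‖ Ωᶜ)ᶜ Ω
    isClosed_cthickening.measurableSet.compl hΩ.measurableSet
    (fderiv ℝ (fderiv ℝ (fderiv ℝ v))) (hF2.continuous_fderiv one_ne_zero) 0 (-z) 1 zero_le_one hseg
  rw [ofReal_one, ENNReal.one_rpow, one_mul] at h1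
  calc _ ≤ ∫⁻ x in (cthickening ‖z‖ Ωᶜ)ᶜ, (‖z‖ₑ * ∫⁻ s in Icc (0 : ℝ) 1,
          ‖fderiv ℝ (fderiv ℝ (fderiv ℝ v)) (x + (0 + s • (-z)))‖ₑ) ^ q := by
        apply setLIntegral_mono' isClosed_cthickening.measurableSet.compl
        intro x hx
        apply ENNReal.rpow_le_rpow _ hq0.le
        have hmem : x - z ∈ Ω := by
          have := hseg x hx 1 (by simp)
          simpa [sub_eq_add_neg] using this
        have h2 := c3_taylor hv x (-z)
        simp only [zero_add]
        rw [← segAvg_ofReal hF2, ← ofReal_norm z, ← ofReal_mul (norm_nonneg _)]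
        apply enorm_le_of_abs
        apply div_sq_le _ (mul_nonneg (norm_nonneg _) (segAvg_nonneg _ _ _))
        rw [remQ, if_pos hmem]
        rw [norm_neg] at h2
        calc _ = ‖v (x + -z) - v x - fderiv ℝ v x (-z) - 1 / 2 * fderiv ℝ (fderiv ℝ v) x (-z) (-z)‖ := by
              rw [Real.norm_eq_abs, ← abs_neg]
              congr 1
              simp only [map_neg, ContinuousLinearMap.neg_apply, sub_eq_add_neg]
              ring
          _ ≤ _ := h2
          _ = _ := by ring
    _ = _ := lint_const_mul_rpow _ hq0.le _ _ (by simp)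
    _ ≤ _ := by
        exact mul_le_mul_right h1 _

lemma perz_int2 {q : ℝ} (hq : 1 ≤ q) (hΩ : IsOpen Ω) (v : EV m → ℝ) (hv : ContDiff ℝ 2 v) (z : EV m) :
    ∫⁻ x in (cthickening ‖z‖ Ωᶜ)ᶜ, ‖remP Ω v x z‖ₑ ^ q ≤
      2 ^ q * Lq q Ω (fderiv ℝ (fderiv ℝ v)) := by
  have hq0 : 0 < q := by linarith
  have hF2 : ContDiff ℝ 1 (fderiv ℝ v) := (hv.fderiv_right (m := 1) (by norm_num))
  have hseg : ∀ x ∈ (cthickening ‖z‖ Ωᶜ)ᶜ, ∀ s ∈ Icc (0 : ℝ) 1, x + (0 + s • (-z)) ∈ Ω := by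
    intro x hx s hs
    by_contra hc
    refine hx (mem_cthickening_of_dist_le x _ _ _ hc ?_)
    rw [dist_eq_norm]
    simp only [zero_add, sub_add_cancel_left, norm_neg, norm_smul, smul_neg, neg_neg, Real.norm_of_nonneg hs.1]
    nlinarith [norm_nonneg z, hs.2]
  have hc2 := (hF2.continuous_fderiv one_ne_zero)
  have h1 := path_avg hq (cthickening ‖z‖ Ωᶜ)ᶜ Ω
    isClosed_cthickening.measurableSet.compl hΩ.measurableSet
    (fderiv ℝ (fderiv ℝ v)) hc2 0 (-z) 1 zero_le_one hseg
  rw [ofReal_one, ENNReal.one_rpow, one_mul] at h1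
  have hsub : (cthickening ‖z‖ Ωᶜ)ᶜ ⊆ Ω := by
    intro x hx
    simpa using hseg x hx 0 (by simp)
  refine (lint_add_rpow_le _ hq _ (fun x => ‖fderiv ℝ (fderiv ℝ v) x‖ₑ) (fun x => ∫⁻ s in Icc (0 : ℝ) 1,
          ‖fderiv ℝ (fderiv ℝ v) (x + (0 + s • (-z)))‖ₑ) hc2.enorm.measurable.aemeasurable ?_).trans ?_
  · rw [ae_restrict_iff' isClosed_cthickening.measurableSet.compl]
    refine ae_of_all _ fun x hx => ?_
    have hmem : x - z ∈ Ω := by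
      have := hseg x hx 1 (by simp)
      simpa [sub_eq_add_neg] using this
    have h2 := c2_taylor hv x (-z) (s := 1) (by simp)
    simp only [zero_add]
    rw [← segAvg_ofReal hF2, ← ofReal_norm (fderiv ℝ (fderiv ℝ v) x), ← ofReal_add (norm_nonneg _) (segAvg_nonneg _ _ _)]
    apply enorm_le_of_abs
    apply div_sq_le _ (add_nonneg (norm_nonneg _) (segAvg_nonneg _ _ _))
    rw [remQ, if_pos hmem]
    rw [norm_neg, Real.norm_eq_abs] at h2
    have h3 := half_hess v x z
    have e1 : v (x + (1 : ℝ) • -z) - v x - 1 * fderiv ℝ v x (-z) = -(v x - v (x - z) - fderiv ℝ v x z) := by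
      simp only [map_neg, one_smul, sub_eq_add_neg]; ring
    rw [e1, abs_neg] at h2
    calc _ ≤ _ := abs_add_le _ _
      _ ≤ _ := add_le_add h2 h3
      _ = _ := by ring
  · calc _ ≤ (2 : ℝ≥0∞) ^ (q - 1) * (Lq q Ω (fderiv ℝ (fderiv ℝ v)) + Lq q Ω (fderiv ℝ (fderiv ℝ v))) := by
          refine mul_le_mul_right (add_le_add ?_ h1) _
          exact Lq_mono_set hsub _
      _ = _ := by
          rw [← two_mul, ← mul_assoc]
          congr 1
          nth_rewrite 2 [← ENNReal.rpow_one 2]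
          rw [← ENNReal.rpow_add _ _ (by simp) (by simp)]
          ring_nf

lemma polyline_bound {v : EV m → ℝ} (hv : ContDiff ℝ 2 v) (a z H : EV m) {Λ : ℝ} (hΛ : 1 ≤ Λ)
    (hH : ‖H‖ = 2 * Λ * ‖z‖) :
    |v a - v (a - z) - fderiv ℝ v a z| ≤ (10 * Λ ^ 2 * (segAvg (fderiv ℝ v) a H
      + segAvg (fderiv ℝ v) (a + H) (-z) + segAvg (fderiv ℝ v) (a - z) H)) * ‖z‖ ^ 2 := by
  have hF : ContDiff ℝ 1 (fderiv ℝ v) := (hv.fderiv_right (m := 1) (by norm_num))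
  have I1 := c2_taylor hv a H (s := 1) (by simp)
  have I2 := c2_taylor hv (a + H) (-z) (s := 1) (by simp)
  have I3 := c2_taylor hv (a - z) H (s := 1) (by simp)
  have J1 := c1_diff hF a H (s := 1) (by simp)
  have J2 := c1_diff hF (a + H) (-z) (s := 1) (by simp)
  have J3 := c1_diff hF (a - z) H (s := 1) (by simp)
  have n1 := segAvg_nonneg (fderiv ℝ v) a H
  have n2 := segAvg_nonneg (fderiv ℝ v) (a + H) (-z)
  have n3 := segAvg_nonneg (fderiv ℝ v) (a - z) H
  set s1 := segAvg (fderiv ℝ v) a H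
  set s2 := segAvg (fderiv ℝ v) (a + H) (-z)
  set s3 := segAvg (fderiv ℝ v) (a - z) H
  simp only [one_smul, one_mul, norm_neg] at I1 I2 I3 J1 J2 J3
  have eq1 : a - z + H = a + H + -z := by abel
  rw [eq1] at I3 J3
  set A := fderiv ℝ v a
  set B := fderiv ℝ v (a + H)
  set C := fderiv ℝ v (a + H + -z)
  set E := fderiv ℝ v (a - z)
  have k1 : ‖(B - A) z‖ ≤ ‖H‖ * s1 * ‖z‖ := ((B - A).le_opNorm z).trans (by gcongr)
  have k2 : ‖(A - E) H‖ ≤ (‖H‖ * s1 + ‖z‖ * s2 + ‖H‖ * s3) * ‖H‖ := by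
    refine ((A - E).le_opNorm H).trans ?_
    gcongr
    have : A - E = -(B - A) - (C - B) + (C - E) := by abel
    rw [this]
    calc _ ≤ ‖-(B - A) - (C - B)‖ + ‖C - E‖ := norm_add_le _ _
      _ ≤ ‖-(B - A)‖ + ‖C - B‖ + ‖C - E‖ := by gcongr; exact norm_sub_le _ _
      _ ≤ _ := by rw [norm_neg]; gcongr
  have e : v a - v (a - z) - A z = -(v (a + H) - v a - A H) - (v (a + H + -z) - v (a + H) - B (-z))
      + (v (a + H + -z) - v (a - z) - E H) + (B - A) z - (A - E) H := by
    simp only [map_neg, ContinuousLinearMap.sub_apply]; ring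
  rw [e]
  have hz := norm_nonneg z
  have : |-(v (a + H) - v a - A H) - (v (a + H + -z) - v (a + H) - B (-z))
      + (v (a + H + -z) - v (a - z) - E H) + (B - A) z - (A - E) H| ≤
      ‖H‖ ^ 2 * s1 + ‖z‖ ^ 2 * s2 + ‖H‖ ^ 2 * s3 + ‖H‖ * s1 * ‖z‖ + (‖H‖ * s1 + ‖z‖ * s2 + ‖H‖ * s3) * ‖H‖ := by
    rw [Real.norm_eq_abs, abs_le] at I1 I2 I3 k1 k2
    rw [abs_le]
    constructor <;> linarith
  refine this.trans ?_
  rw [hH]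
  have hz2 : 0 ≤ ‖z‖ ^ 2 := by positivity
  have c1 : 0 ≤ s1 * ‖z‖ ^ 2 := by positivity
  have c2 : 0 ≤ s2 * ‖z‖ ^ 2 := by positivity
  have c3 : 0 ≤ s3 * ‖z‖ ^ 2 := by positivity
  have e2 : (2 * Λ * ‖z‖) ^ 2 * s1 + ‖z‖ ^ 2 * s2 + (2 * Λ * ‖z‖) ^ 2 * s3 + 2 * Λ * ‖z‖ * s1 * ‖z‖ +
      (2 * Λ * ‖z‖ * s1 + ‖z‖ * s2 + 2 * Λ * ‖z‖ * s3) * (2 * Λ * ‖z‖) =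
      (8 * Λ ^ 2 + 2 * Λ) * (s1 * ‖z‖ ^ 2) + (1 + 2 * Λ) * (s2 * ‖z‖ ^ 2) + 8 * Λ ^ 2 * (s3 * ‖z‖ ^ 2) := by ring
  rw [e2]
  have h1 : 8 * Λ ^ 2 + 2 * Λ ≤ 10 * Λ ^ 2 := by nlinarith
  have h2 : 1 + 2 * Λ ≤ 10 * Λ ^ 2 := by nlinarith
  have h3 : 8 * Λ ^ 2 ≤ 10 * Λ ^ 2 := by nlinarith
  calc _ ≤ 10 * Λ ^ 2 * (s1 * ‖z‖ ^ 2) + 10 * Λ ^ 2 * (s2 * ‖z‖ ^ 2) + 10 * Λ ^ 2 * (s3 * ‖z‖ ^ 2) := by gcongr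
    _ = _ := by ring

end perz
end

section
lemma two_pow_ne_top {q : ℝ} (hq : 0 ≤ q) {c : ℝ≥0∞} (hc : c ≠ ⊤) : c ^ q ≠ ⊤ :=
  ENNReal.rpow_ne_top_of_nonneg hq hc

/-- constant in the boundary layer estimate -/
def cBd (q Λ : ℝ) : ℝ≥0∞ := 4 ^ (q - 1) * (1 + 3 * ofReal (10 * Λ ^ 2) ^ q) + 1

lemma cBd_ne_top {q : ℝ} (hq : 1 ≤ q) (Λ : ℝ) : cBd q Λ ≠ ⊤ := by
  unfold cBd
  have h1 : (4 : ℝ≥0∞) ^ (q - 1) ≠ ⊤ := two_pow_ne_top (by linarith) (by first | exact ofReal_ne_top | simp)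
  have h2 : ofReal (10 * Λ ^ 2) ^ q ≠ ⊤ := two_pow_ne_top (by linarith) (by first | exact ofReal_ne_top | simp)
  exact ENNReal.add_ne_top.2 ⟨ENNReal.mul_ne_top h1 (ENNReal.add_ne_top.2 ⟨by simp, ENNReal.mul_ne_top (by simp) h2⟩), by simp⟩

lemma remP_notin {m : ℕ} {Ω : Set (EV m)} (v : EV m → ℝ) {x z : EV m} (h : x - z ∉ Ω) :
    |remP Ω v x z| ≤ ‖fderiv ℝ (fderiv ℝ v) x‖ := by
  apply div_sq_le _ (norm_nonneg _)
  rw [remQ, if_neg h, zero_add]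
  exact half_hess v x z

lemma perz_bd {m : ℕ} {Ω : Set (EV m)} {Λ R : ℝ} {K : Set (EV m)} {e : EV m} {t : EV m → ℝ}
    (h : IsChart Ω Λ R K e t) (hΩ : IsOpen Ω) {q : ℝ} (hq : 1 ≤ q) {r0 : ℝ} (hr0 : 0 ≤ r0)
    (hR : (2 * Λ + 2) * r0 ≤ R) (z : EV m) (hz : ‖z‖ ≤ r0) (v : EV m → ℝ) (hv : ContDiff ℝ 2 v) :
    ∫⁻ x in chartLayer Ω r0 K t (Λ * ‖z‖), ‖remP Ω v x z‖ₑ ^ q ≤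
      cBd q Λ * Lq q (chartLayer Ω ((2 * Λ + 2) * r0) K t (4 * Λ * ‖z‖)) (fderiv ℝ (fderiv ℝ v)) := by
  have hq0 : 0 < q := by linarith
  have hΛ := h.lam_ge
  have hz0 := norm_nonneg z
  have hF : ContDiff ℝ 1 (fderiv ℝ v) := (hv.fderiv_right (m := 1) (by norm_num))
  have hc2 := (hF.continuous_fderiv one_ne_zero)
  set S := chartLayer Ω r0 K t (Λ * ‖z‖) with hSdef
  set T := chartLayer Ω ((2 * Λ + 2) * r0) K t (4 * Λ * ‖z‖) with hTdef
  have hSm : MeasurableSet S := chartLayer_meas hΩ _ _ h.t_smooth.continuous _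
  have hTm : MeasurableSet T := chartLayer_meas hΩ _ _ h.t_smooth.continuous _
  set A : Set (EV m) := {x | x - z ∈ Ω} with hA
  have hAm : MeasurableSet A := by
    have : Measurable (fun x : EV m => x - z) := by fun_prop
    exact this hΩ.measurableSet
  have hr01 : r0 ≤ (2 * Λ + 2) * r0 := by nlinarith
  have hST : S ⊆ T := by
    rintro x ⟨⟨hx, hxK⟩, hxt⟩
    refine ⟨⟨hx, cthickening_mono hr01 _ hxK⟩, ?_⟩
    have : t x ≤ Λ * ‖z‖ := hxt
    show t x ≤ 4 * Λ * ‖z‖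
    nlinarith
  -- membership for points of the polyline
  have memT : ∀ x ∈ S, ∀ w : EV m, ‖w‖ ≤ (2 * Λ + 1) * ‖z‖ → 0 < t (x + w) → t (x + w) ≤ 4 * Λ * ‖z‖ → x + w ∈ T := by
    rintro x ⟨⟨hx, hxK⟩, hxt⟩ w hw h0 h1
    have hk : x + w ∈ cthickening ((2 * Λ + 2) * r0) K := by
      have := cthick_move (y := x + w) (s := (2 * Λ + 1) * r0) hxK hr0 (by
        rw [dist_eq_norm, add_sub_cancel_left]
        exact hw.trans (by gcongr))
      rwa [show r0 + (2 * Λ + 1) * r0 = (2 * Λ + 2) * r0 by ring] at this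
    exact ⟨⟨(h.mem_iff _ (cthickening_mono hR _ hk)).2 h0, hk⟩, h1⟩
  set H : EV m := (2 * Λ * ‖z‖) • e with hH
  have hHn : ‖H‖ = 2 * Λ * ‖z‖ := by
    rw [hH, norm_smul, h.e_norm, mul_one, Real.norm_of_nonneg (by positivity)]
  have tlow : ∀ x w, |t (x + w) - t x| ≤ Λ * ‖w‖ := fun x w => by simpa using h.lip (x + w) x
  have tpos : ∀ x ∈ S, 0 < t x := fun x hx =>
    (h.mem_iff x (cthickening_mono (hr01.trans hR) _ hx.1.2)).1 hx.1.1
  have m1 : ∀ x ∈ S ∩ A, ∀ s ∈ Icc (0 : ℝ) 1, x + (0 + s • H) ∈ T := by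
    intro x hx s hs
    have e1 : t (x + (0 + s • H)) = t x + s * (2 * Λ * ‖z‖) := by
      rw [zero_add, hH, smul_smul, h.t_shift]
    have hxt : t x ≤ Λ * ‖z‖ := hx.1.2
    have hs1 : s * (2 * Λ * ‖z‖) ≤ 2 * Λ * ‖z‖ := mul_le_of_le_one_left (by positivity) hs.2
    have hs2 : 0 ≤ s * (2 * Λ * ‖z‖) := mul_nonneg hs.1 (by positivity)
    have := tpos x hx.1
    have hΛz : 0 ≤ Λ * ‖z‖ := by positivity
    apply memT x hx.1
    · rw [zero_add, norm_smul, hHn, Real.norm_of_nonneg hs.1]; linarith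
    · rw [e1]; linarith
    · rw [e1]; linarith
  have m2 : ∀ x ∈ S ∩ A, ∀ s ∈ Icc (0 : ℝ) 1, x + (H + s • (-z)) ∈ T := by
    intro x hx s hs
    have e1 : t (x + (H + s • (-z))) = t (x + s • (-z)) + 2 * Λ * ‖z‖ := by
      rw [hH, add_comm _ (s • (-z)), ← add_assoc, h.t_shift]
    have hxt : t x ≤ Λ * ‖z‖ := hx.1.2
    have := tpos x hx.1
    have hsn : ‖s • (-z)‖ ≤ ‖z‖ := by
      rw [norm_smul, norm_neg, Real.norm_of_nonneg hs.1]; exact mul_le_of_le_one_left hz0 hs.2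
    have h3 := abs_le.1 (tlow x (s • (-z)))
    have h4 : Λ * ‖s • (-z)‖ ≤ Λ * ‖z‖ := by gcongr
    have hΛz : 0 ≤ Λ * ‖z‖ := by positivity
    apply memT x hx.1
    · calc _ ≤ ‖H‖ + ‖s • (-z)‖ := norm_add_le _ _
        _ ≤ _ := by rw [hHn]; linarith
    · rw [e1]; linarith [h3.1]
    · rw [e1]; linarith [h3.2]
  have m3 : ∀ x ∈ S ∩ A, ∀ s ∈ Icc (0 : ℝ) 1, x + (-z + s • H) ∈ T := by
    intro x hx s hs
    have e1 : t (x + (-z + s • H)) = t (x + -z) + s * (2 * Λ * ‖z‖) := by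
      rw [hH, smul_smul, ← add_assoc, h.t_shift]
    have hxt : t x ≤ Λ * ‖z‖ := hx.1.2
    have h3 := abs_le.1 (tlow x (-z))
    rw [norm_neg] at h3
    have hpos : 0 < t (x + -z) := by
      refine (h.mem_iff _ ?_).1 (by rw [← sub_eq_add_neg]; exact hx.2)
      refine cthickening_mono (le_trans ?_ hR) _ (cthick_move (s := r0) hx.1.1.2 hr0 ?_)
      · nlinarith
      · rw [dist_eq_norm, add_sub_cancel_left, norm_neg]; exact hz
    have hs1 : s * (2 * Λ * ‖z‖) ≤ 2 * Λ * ‖z‖ := mul_le_of_le_one_left (by positivity) hs.2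
    have hs2 : 0 ≤ s * (2 * Λ * ‖z‖) := mul_nonneg hs.1 (by positivity)
    have hΛz : 0 ≤ Λ * ‖z‖ := by positivity
    apply memT x hx.1
    · calc _ ≤ ‖-z‖ + ‖s • H‖ := norm_add_le _ _
        _ ≤ _ := by rw [norm_neg, norm_smul, hHn, Real.norm_of_nonneg hs.1]; linarith
    · rw [e1]; linarith
    · rw [e1]; linarith [h3.2]
  have p1 := path_avg hq (S ∩ A) T (hSm.inter hAm) hTm _ hc2 0 H 1 zero_le_one m1
  have p2 := path_avg hq (S ∩ A) T (hSm.inter hAm) hTm _ hc2 H (-z) 1 zero_le_one m2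
  have p3 := path_avg hq (S ∩ A) T (hSm.inter hAm) hTm _ hc2 (-z) H 1 zero_le_one m3
  simp only [ofReal_one, ENNReal.one_rpow, one_mul] at p1 p2 p3
  set X := Lq q T (fderiv ℝ (fderiv ℝ v)) with hX
  set c := ofReal (10 * Λ ^ 2) with hc
  have hmeas : ∀ b w : EV m, Measurable (fun x => c * ∫⁻ s in Icc (0 : ℝ) 1, ‖fderiv ℝ (fderiv ℝ v) (x + (b + s • w))‖ₑ) := by
    intro b w
    apply Measurable.const_mul
    have : Measurable (fun p : EV m × ℝ => ‖fderiv ℝ (fderiv ℝ v) (p.1 + (b + p.2 • w))‖ₑ) :=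
      (hc2.comp (by fun_prop)).enorm.measurable
    exact this.lintegral_prod_right'
  rw [← lintegral_inter_add_diff _ S hAm]
  have hin : ∫⁻ x in S ∩ A, ‖remP Ω v x z‖ₑ ^ q ≤ 4 ^ (q - 1) * (1 + 3 * c ^ q) * X := by
    have := lint_sum_rpow_le (volume.restrict (S ∩ A)) (Finset.univ : Finset (Fin 4)) hq
      (fun x => ‖remP Ω v x z‖ₑ)
      ![fun x => ‖fderiv ℝ (fderiv ℝ v) x‖ₑ,
        fun x => c * ∫⁻ s in Icc (0 : ℝ) 1, ‖fderiv ℝ (fderiv ℝ v) (x + (0 + s • H))‖ₑ,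
        fun x => c * ∫⁻ s in Icc (0 : ℝ) 1, ‖fderiv ℝ (fderiv ℝ v) (x + (H + s • (-z)))‖ₑ,
        fun x => c * ∫⁻ s in Icc (0 : ℝ) 1, ‖fderiv ℝ (fderiv ℝ v) (x + (-z + s • H))‖ₑ] ?_ ?_
    · refine this.trans ?_
      rw [mul_assoc]
      simp only [Finset.card_univ, Fintype.card_fin]
      refine mul_le_mul' (by norm_num) ?_
      simp only [Fin.sum_univ_four, Matrix.cons_val_zero, Matrix.cons_val_one, Matrix.cons_val]
      rw [lint_const_mul_rpow _ hq0.le _ _ ofReal_ne_top, lint_const_mul_rpow _ hq0.le _ _ ofReal_ne_top,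
        lint_const_mul_rpow _ hq0.le _ _ ofReal_ne_top]
      calc _ ≤ X + c ^ q * X + c ^ q * X + c ^ q * X :=
            add_le_add (add_le_add (add_le_add (Lq_mono_set (Set.inter_subset_left.trans hST) _)
              (mul_le_mul_right p1 _)) (mul_le_mul_right p2 _)) (mul_le_mul_right p3 _)
        _ = _ := by ring
    · intro i _
      fin_cases i
      · exact hc2.enorm.measurable.aemeasurable
      · exact (hmeas _ _).aemeasurable
      · exact (hmeas _ _).aemeasurable
      · exact (hmeas _ _).aemeasurable
    · rw [ae_restrict_iff' (hSm.inter hAm)]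
      refine ae_of_all _ fun x hx => ?_
      simp only [Fin.sum_univ_four, Matrix.cons_val_zero, Matrix.cons_val_one, Matrix.cons_val]
      simp only [zero_add, ← add_assoc]
      have n1 := segAvg_nonneg (fderiv ℝ v) x H
      have n2 := segAvg_nonneg (fderiv ℝ v) (x + H) (-z)
      have n3 := segAvg_nonneg (fderiv ℝ v) (x - z) H
      have hL : (0 : ℝ) ≤ 10 * Λ ^ 2 := by positivity
      rw [← segAvg_ofReal hF, ← segAvg_ofReal hF, ← segAvg_ofReal hF, ← ofReal_norm (fderiv ℝ (fderiv ℝ v) x), hc,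
        ← ofReal_mul hL, ← ofReal_mul hL, ← ofReal_mul hL,
        ← ofReal_add (by positivity) (by positivity), ← ofReal_add (by positivity) (by positivity),
        ← sub_eq_add_neg, ← ofReal_add (by positivity) (by positivity)]
      apply enorm_le_of_abs
      apply div_sq_le _ (by positivity)
      have hxA : x - z ∈ Ω := hx.2
      rw [remQ, if_pos hxA]
      have h2 := polyline_bound hv x z H hΛ hHn
      have h3 := half_hess v x z
      calc _ ≤ _ := abs_add_le _ _
        _ ≤ _ := add_le_add h2 h3
        _ = _ := by ring
  have hout : ∫⁻ x in S \ A, ‖remP Ω v x z‖ₑ ^ q ≤ X := by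
    refine le_trans (setLIntegral_mono' (hSm.diff hAm) fun x hx => ?_) (Lq_mono_set (Set.diff_subset.trans hST) _)
    apply ENNReal.rpow_le_rpow _ hq0.le
    rw [← ofReal_norm (fderiv ℝ (fderiv ℝ v) x)]
    exact enorm_le_of_abs (remP_notin v hx.2)
  calc _ ≤ 4 ^ (q - 1) * (1 + 3 * c ^ q) * X + X := add_le_add hin hout
    _ = _ := by rw [cBd, add_mul, one_mul]

/-- constant in the far field estimate -/
def cFar (q r0 : ℝ) : ℝ≥0∞ := 4 ^ (q - 1) * (2 * ofReal (r0 ^ 2)⁻¹ ^ q + ofReal r0⁻¹ ^ q + 1)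

lemma cFar_ne_top {q : ℝ} (hq : 1 ≤ q) (r0 : ℝ) : cFar q r0 ≠ ⊤ := by
  unfold cFar
  have h1 : (4 : ℝ≥0∞) ^ (q - 1) ≠ ⊤ := two_pow_ne_top (by linarith) (by first | exact ofReal_ne_top | simp)
  have h2 : ofReal (r0 ^ 2)⁻¹ ^ q ≠ ⊤ := two_pow_ne_top (by linarith) (by first | exact ofReal_ne_top | simp)
  have h3 : ofReal r0⁻¹ ^ q ≠ ⊤ := two_pow_ne_top (by linarith) (by first | exact ofReal_ne_top | simp)
  exact ENNReal.mul_ne_top h1 (ENNReal.add_ne_top.2 ⟨ENNReal.add_ne_top.2 ⟨ENNReal.mul_ne_top (by simp) h2, h3⟩, by simp⟩)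

/-- sum of the `q`-th powers of the norms of the first two derivatives -/
def N2 {m : ℕ} (q : ℝ) (Ω : Set (EV m)) (v : EV m → ℝ) : ℝ≥0∞ :=
  Lq q Ω v + Lq q Ω (fderiv ℝ v) + Lq q Ω (fderiv ℝ (fderiv ℝ v))

/-- sum of the `q`-th powers of the norms of the first three derivatives -/
def N3 {m : ℕ} (q : ℝ) (Ω : Set (EV m)) (v : EV m → ℝ) : ℝ≥0∞ :=
  N2 q Ω v + Lq q Ω (fderiv ℝ (fderiv ℝ (fderiv ℝ v)))

lemma perz_far {m : ℕ} {Ω : Set (EV m)} (hΩ : IsOpen Ω) {q : ℝ} (hq : 1 ≤ q) {r0 : ℝ} (hr0 : 0 < r0)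
    (z : EV m) (hz : r0 ≤ ‖z‖) (v : EV m → ℝ) (hv : ContDiff ℝ 2 v) :
    ∫⁻ x in Ω, ‖remP Ω v x z‖ₑ ^ q ≤ cFar q r0 * N2 q Ω v := by
  have hq0 : 0 < q := by linarith
  have hF : ContDiff ℝ 1 (fderiv ℝ v) := (hv.fderiv_right (m := 1) (by norm_num))
  have hc2 := (hF.continuous_fderiv one_ne_zero)
  set A : Set (EV m) := {x | x + -z ∈ Ω} with hA
  have hAm : MeasurableSet A := by
    have : Measurable (fun x : EV m => x + -z) := by fun_prop
    exact this hΩ.measurableSet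
  have hvm : Measurable (fun x => ‖v x‖ₑ) := hv.continuous.enorm.measurable
  have hvm2 : Measurable (fun x => ‖v (x + -z)‖ₑ) := hvm.comp (by fun_prop)
  set c1 := ofReal (r0 ^ 2)⁻¹
  set c2 := ofReal r0⁻¹
  have := lint_sum_rpow_le (volume.restrict Ω) (Finset.univ : Finset (Fin 4)) hq
      (fun x => ‖remP Ω v x z‖ₑ)
      ![fun x => ‖fderiv ℝ (fderiv ℝ v) x‖ₑ, fun x => c1 * ‖v x‖ₑ,
        fun x => c1 * A.indicator (fun x => ‖v (x + -z)‖ₑ) x, fun x => c2 * ‖fderiv ℝ v x‖ₑ] ?_ ?_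
  · refine this.trans ?_
    rw [cFar, mul_assoc]
    simp only [Finset.card_univ, Fintype.card_fin]
    refine mul_le_mul' (by norm_num) ?_
    simp only [Fin.sum_univ_four, Matrix.cons_val_zero, Matrix.cons_val_one, Matrix.cons_val]
    rw [lint_const_mul_rpow _ hq0.le _ _ (by simp [c1]), lint_const_mul_rpow _ hq0.le _ _ (by simp [c1]),
        lint_const_mul_rpow _ hq0.le _ _ (by simp [c2])]
    have h4 : ∫⁻ x in Ω, A.indicator (fun x => ‖v (x + -z)‖ₑ) x ^ q ≤ Lq q Ω v := by
      have e1 : ∀ x, A.indicator (fun x => ‖v (x + -z)‖ₑ) x ^ q = A.indicator (fun x => ‖v (x + -z)‖ₑ ^ q) x := by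
        intro x
        by_cases hx : x ∈ A <;> simp [hx, hq0]
      simp only [e1]
      rw [lintegral_indicator hAm, Measure.restrict_restrict hAm]
      exact lintegral_set_translate_le (A ∩ Ω) Ω (hAm.inter hΩ.measurableSet) hΩ.measurableSet
        (fun x => ‖v x‖ₑ ^ q) (-z) (fun x hx => hx.1)
    calc _ ≤ Lq q Ω (fderiv ℝ (fderiv ℝ v)) + c1 ^ q * Lq q Ω v + c1 ^ q * Lq q Ω v + c2 ^ q * Lq q Ω (fderiv ℝ v) :=
          add_le_add (add_le_add le_rfl (mul_le_mul_right h4 _)) le_rfl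
      _ ≤ _ := by
        rw [N2]
        set a := Lq q Ω v
        set b := Lq q Ω (fderiv ℝ v)
        set d := Lq q Ω (fderiv ℝ (fderiv ℝ v))
        calc d + c1 ^ q * a + c1 ^ q * a + c2 ^ q * b = 2 * c1 ^ q * a + c2 ^ q * b + 1 * d := by ring
          _ ≤ (2 * c1 ^ q + c2 ^ q + 1) * a + (2 * c1 ^ q + c2 ^ q + 1) * b + (2 * c1 ^ q + c2 ^ q + 1) * d := by
            gcongr
            · rw [add_assoc]; exact le_self_add
            · rw [add_comm (2 * c1 ^ q), add_assoc]; exact le_self_add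
            · exact le_add_self
          _ = _ := by ring
  · intro i _
    fin_cases i
    · exact hc2.enorm.measurable.aemeasurable
    · exact (hvm.const_mul _).aemeasurable
    · exact ((hvm2.indicator hAm).const_mul _).aemeasurable
    · exact (hF.continuous.enorm.measurable.const_mul _).aemeasurable
  · refine ae_of_all _ fun x => ?_
    simp only [Fin.sum_univ_four, Matrix.cons_val_zero, Matrix.cons_val_one, Matrix.cons_val]
    by_cases hx : x - z ∈ Ω
    · have hxA : x ∈ A := by rw [hA]; show x + -z ∈ Ω; rwa [← sub_eq_add_neg]
      rw [indicator_of_mem hxA, ← ofReal_norm (fderiv ℝ (fderiv ℝ v) x), ← ofReal_norm (v x), ← ofReal_norm (v (x + -z)),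
        ← ofReal_norm (fderiv ℝ v x), ← ofReal_mul (by positivity), ← ofReal_mul (by positivity),
        ← ofReal_mul (by positivity), ← ofReal_add (by positivity) (by positivity), ← ofReal_add (by positivity) (by positivity), ← ofReal_add (by positivity) (by positivity)]
      apply enorm_le_of_abs
      apply div_sq_le _ (by positivity)
      rw [remQ, if_pos hx, ← sub_eq_add_neg]
      have h3 := half_hess v x z
      have h5 : ‖fderiv ℝ v x z‖ ≤ ‖fderiv ℝ v x‖ * ‖z‖ := (fderiv ℝ v x).le_opNorm z
      have hz2 : 1 ≤ (r0 ^ 2)⁻¹ * ‖z‖ ^ 2 := by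
        rw [inv_mul_eq_div, le_div_iff₀ (by positivity), one_mul]; gcongr
      have hz1 : ‖z‖ ≤ r0⁻¹ * ‖z‖ ^ 2 := by
        rw [inv_mul_eq_div, le_div_iff₀ (by positivity), pow_two]; gcongr
      simp only [Real.norm_eq_abs] at *
      have k1 : |v x| ≤ |v x| * ((r0 ^ 2)⁻¹ * ‖z‖ ^ 2) := le_mul_of_one_le_right (abs_nonneg _) hz2
      have k2 : |v (x - z)| ≤ |v (x - z)| * ((r0 ^ 2)⁻¹ * ‖z‖ ^ 2) := le_mul_of_one_le_right (abs_nonneg _) hz2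
      have k3 : ‖fderiv ℝ v x‖ * ‖z‖ ≤ ‖fderiv ℝ v x‖ * (r0⁻¹ * ‖z‖ ^ 2) := by gcongr
      calc _ ≤ |v x - v (x - z) - fderiv ℝ v x z| + _ := abs_add_le _ _
        _ ≤ (|v x| + |v (x - z)| + |fderiv ℝ v x z|) + _ := by
          gcongr
          exact (abs_sub _ _).trans (by gcongr; exact abs_sub _ _)
        _ ≤ _ := by nlinarith
    · refine le_trans ?_ ((le_self_add).trans (le_self_add.trans le_self_add))
      rw [← ofReal_norm (fderiv ℝ (fderiv ℝ v) x)]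
      exact enorm_le_of_abs (remP_notin v hx)
end

section
/-- A finite atlas of boundary charts with a partition of unity near the boundary. -/
structure IsAtlas {m : ℕ} {ι : Type} [Fintype ι] (Ω : Set (EV m)) (Λ R : ℝ) (e : ι → EV m)
    (t : ι → EV m → ℝ) (ζ : ι → EV m → ℝ) : Prop where
  isOpen : IsOpen Ω
  R_pos : 0 < R
  lam_ge : 1 ≤ Λ
  chart : ∀ j, IsChart Ω Λ R (tsupport (ζ j)) (e j) (t j)
  ζ_smooth : ∀ j, ContDiff ℝ (⊤ : ℕ∞) (ζ j)
  ζ_compact : ∀ j, HasCompactSupport (ζ j)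
  ζ_nonneg : ∀ j x, 0 ≤ ζ j x
  sum_one : ∀ x ∈ cthickening R (frontier Ω), ∑ j, ζ j x = 1

namespace IsAtlas
variable {m : ℕ} {ι : Type} [Fintype ι] {Ω : Set (EV m)} {Λ R : ℝ} {e : ι → EV m}
    {t : ι → EV m → ℝ} {ζ : ι → EV m → ℝ}

lemma exists_frontier (hΩ : IsOpen Ω) {x : EV m} (hx : x ∈ Ω) {δ : ℝ} (hδ : 0 ≤ δ)
    (hc : x ∈ cthickening δ Ωᶜ) : ∃ y ∈ frontier Ω, dist x y ≤ δ := by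
  rw [hΩ.isClosed_compl.cthickening_eq_biUnion_closedBall hδ] at hc
  simp only [Set.mem_iUnion] at hc
  obtain ⟨w, hw, hxw⟩ := hc
  have hpre : IsPreconnected (closedBall x δ) := (convex_closedBall x δ).isPreconnected
  by_contra hcon
  push Not at hcon
  have hno : ∀ y ∈ closedBall x δ, y ∉ frontier Ω := fun y hy hyf =>
    absurd (hcon y hyf) (not_lt.2 (by rw [dist_comm]; exact hy))
  have hwb : w ∈ closedBall x δ := by rw [mem_closedBall, dist_comm]; exact hxw
  obtain ⟨y, -, hy1, hy2⟩ := hpre Ω (closure Ω)ᶜ hΩ isClosed_closure.isOpen_compl (by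
    intro y hy
    by_cases hyΩ : y ∈ Ω
    · exact Or.inl hyΩ
    · refine Or.inr fun hyc => hno y hy ?_
      rw [hΩ.frontier_eq]
      exact ⟨hyc, hyΩ⟩) ⟨x, mem_closedBall_self hδ, hx⟩ ⟨w, hwb, fun hwc => hno w hwb (by
        rw [hΩ.frontier_eq]; exact ⟨hwc, hw⟩)⟩
  exact hy2 (subset_closure hy1)

lemma exists_tsupport (h : IsAtlas Ω Λ R e t ζ) {x y : EV m} (hy : y ∈ frontier Ω) (hd : dist x y ≤ R) :
    ∃ j, x ∈ tsupport (ζ j) := by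
  have h1 := h.sum_one x (mem_cthickening_of_dist_le x y _ _ hy hd)
  by_contra hcon
  push Not at hcon
  have : ∑ j, ζ j x = 0 := Finset.sum_eq_zero fun j _ => image_eq_zero_of_notMem_tsupport (hcon j)
  linarith

lemma cover (h : IsAtlas Ω Λ R e t ζ) {x : EV m} (hx : x ∈ Ω) {δ r0 : ℝ} (hδ : 0 ≤ δ) (hr0 : δ ≤ r0) (hR : r0 < R)
    (hc : x ∈ cthickening δ Ωᶜ) :
    ∃ j, x ∈ tsupport (ζ j) ∧ x ∈ chartLayer Ω r0 (tsupport (ζ j)) (t j) (Λ * δ) := by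
  obtain ⟨y, hy, hd⟩ := exists_frontier h.isOpen hx hδ hc
  obtain ⟨j, hj⟩ := h.exists_tsupport hy (hd.trans (hr0.trans hR.le))
  refine ⟨j, hj, ⟨hx, cthick_self hj⟩, ?_⟩
  have hc := h.chart j
  have hyK : y ∈ cthickening δ (tsupport (ζ j)) :=
    mem_cthickening_of_dist_le y x _ _ hj (by rwa [dist_comm])
  have h0 := hc.frontier_zero h.isOpen hδ (hr0.trans_lt hR) hyK hy
  have h1 := hc.lip x y
  rw [h0, sub_zero, ← dist_eq_norm] at h1
  have hΛ := h.lam_ge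
  calc t j x ≤ |t j x| := le_abs_self _
    _ ≤ _ := h1.trans (by gcongr)

lemma r0_ex (h : IsAtlas Ω Λ R e t ζ) : ∃ r0 : ℝ, 0 < r0 ∧ r0 ≤ 1 ∧ (2 * Λ + 2) * r0 ≤ R / 2 ∧ r0 < R := by
  have hΛ := h.lam_ge
  have hR := h.R_pos
  refine ⟨min 1 (R / 2 / (2 * Λ + 2)), lt_min one_pos (by positivity), min_le_left _ _, ?_, ?_⟩
  · calc _ ≤ (2 * Λ + 2) * (R / 2 / (2 * Λ + 2)) := by gcongr; exact min_le_right _ _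
      _ = _ := by field_simp
  · calc _ ≤ R / 2 / (2 * Λ + 2) := min_le_right _ _
      _ ≤ R / 2 := div_le_self (by positivity) (by linarith)
      _ < R := by linarith

lemma perz_near (h : IsAtlas Ω Λ R e t ζ) {q : ℝ} (hq : 1 ≤ q) {r0 : ℝ} (h0 : 0 < r0) (h2 : (2 * Λ + 2) * r0 ≤ R) (h3 : r0 < R)
    (v : EV m → ℝ) (hv : ContDiff ℝ 2 v) (z : EV m) (hz : ‖z‖ ≤ r0) :
    ∫⁻ x in Ω, ‖remP Ω v x z‖ₑ ^ q ≤ (∫⁻ x in (cthickening ‖z‖ Ωᶜ)ᶜ, ‖remP Ω v x z‖ₑ ^ q) +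
      ∑ j, cBd q Λ * Lq q (chartLayer Ω ((2 * Λ + 2) * r0) (tsupport (ζ j)) (t j) (4 * Λ * ‖z‖)) (fderiv ℝ (fderiv ℝ v)) := by
  have hsub : Ω ⊆ (cthickening ‖z‖ Ωᶜ)ᶜ ∪ ⋃ j, chartLayer Ω r0 (tsupport (ζ j)) (t j) (Λ * ‖z‖) := by
    intro x hx
    by_cases hc : x ∈ cthickening ‖z‖ Ωᶜ
    · obtain ⟨j, _, hj⟩ := h.cover hx (norm_nonneg z) hz h3 hc
      right
      simp only [Set.mem_iUnion]
      exact ⟨j, hj⟩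
    · left; exact hc
  refine (lintegral_mono_set hsub).trans ((lintegral_union_le _ _ _).trans (add_le_add le_rfl ?_))
  refine (lintegral_iUnion_le _ _).trans ?_
  rw [tsum_fintype]
  refine (sum_le_sum fun j _ => ?_)
  exact perz_bd (h.chart j) h.isOpen hq h0.le h2 z hz v hv

lemma perz_smooth (h : IsAtlas Ω Λ R e t ζ) {q : ℝ} (hq : 1 ≤ q) :
    ∃ C : ℝ≥0∞, C ≠ ⊤ ∧ ∀ (v : EV m → ℝ), ContDiff ℝ 3 v → ∀ z : EV m,
      ∫⁻ x in Ω, ‖remP Ω v x z‖ₑ ^ q ≤ C * ‖z‖ₑ * N3 q Ω v := by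
  obtain ⟨r0, h0, h1, h2, h3⟩ := h.r0_ex
  have hR := h.R_pos
  have hΛ := h.lam_ge
  have hq0 : 0 ≤ q := by linarith
  set cL : ℝ≥0∞ := cBd q Λ * (ofReal (R/2)⁻¹ * (2 ^ (q - 1) * (ofReal (4 * Λ) * (1 + ofReal (R/2) ^ q)))) with hcL
  have hcL' : cL ≠ ⊤ := by
    refine ENNReal.mul_ne_top (cBd_ne_top hq _) (ENNReal.mul_ne_top ofReal_ne_top (ENNReal.mul_ne_top
      (two_pow_ne_top (by linarith) (by simp)) (ENNReal.mul_ne_top ofReal_ne_top (ENNReal.add_ne_top.2 ⟨by simp, two_pow_ne_top hq0 ofReal_ne_top⟩))))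
  refine ⟨1 + (Fintype.card ι) * cL + cFar q r0 * ofReal r0⁻¹, ?_, ?_⟩
  · exact ENNReal.add_ne_top.2 ⟨ENNReal.add_ne_top.2 ⟨by simp, ENNReal.mul_ne_top (by simp) hcL'⟩, ENNReal.mul_ne_top (cFar_ne_top hq _) ofReal_ne_top⟩
  intro v hv z
  by_cases hz : ‖z‖ ≤ r0
  · refine (h.perz_near hq h0 (by linarith) h3 v (hv.of_le (by norm_num)) z hz).trans ?_
    have ze : ‖z‖ₑ = ofReal ‖z‖ := (ofReal_norm z).symm
    have z1 : ‖z‖ₑ ^ q ≤ ‖z‖ₑ := by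
      have : ‖z‖ₑ ≤ 1 := by rw [ze, ← ofReal_one]; exact ofReal_le_ofReal (hz.trans h1)
      calc ‖z‖ₑ ^ q ≤ ‖z‖ₑ ^ (1 : ℝ) := ENNReal.rpow_le_rpow_of_exponent_ge this hq
        _ = _ := ENNReal.rpow_one _
    have hb : ∀ j, cBd q Λ * Lq q (chartLayer Ω ((2 * Λ + 2) * r0) (tsupport (ζ j)) (t j) (4 * Λ * ‖z‖)) (fderiv ℝ (fderiv ℝ v))
        ≤ cL * ‖z‖ₑ * N3 q Ω v := by
      intro j
      have hl := (h.chart j).layer_t h.isOpen hq (r := (2 * Λ + 2) * r0) (s0 := R / 2) (by positivity) (by positivity) (by linarith)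
        (4 * Λ * ‖z‖) (fderiv ℝ (fderiv ℝ v)) ((hv.fderiv_right (m := 2) (by norm_num)).fderiv_right (m := 1) (by norm_num))
      refine (mul_le_mul_right hl _).trans ?_
      rw [hcL, ofReal_mul (by positivity : (0:ℝ) ≤ 4 * Λ), ← ze]
      have : Lq q Ω (fderiv ℝ (fderiv ℝ v)) + ofReal (R / 2) ^ q * Lq q Ω (fderiv ℝ (fderiv ℝ (fderiv ℝ v)))
          ≤ (1 + ofReal (R/2) ^ q) * N3 q Ω v := by
        rw [N3, N2, add_mul, one_mul]
        refine add_le_add ?_ (mul_le_mul_right le_add_self _)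
        exact le_add_self.trans le_self_add
      refine (mul_le_mul_right (mul_le_mul_right (mul_le_mul_right (mul_le_mul_right this _) _) _) _).trans (le_of_eq ?_)
      ring
    have ha := perz_int3 hq h.isOpen v hv z
    calc _ ≤ ‖z‖ₑ * N3 q Ω v + ∑ j : ι, cL * ‖z‖ₑ * N3 q Ω v :=
          add_le_add (ha.trans (mul_le_mul' z1 le_add_self)) (sum_le_sum fun j _ => hb j)
      _ = (1 + (Fintype.card ι) * cL) * ‖z‖ₑ * N3 q Ω v := by
        rw [Finset.sum_const, Finset.card_univ, nsmul_eq_mul]; ring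
      _ ≤ _ := by
        refine mul_le_mul' ?_ le_rfl
        first
          | exact le_self_add
          | exact mul_le_mul' le_self_add le_rfl
  · push Not at hz
    refine (perz_far h.isOpen hq h0 z hz.le v (hv.of_le (by norm_num))).trans ?_
    have : (1 : ℝ≥0∞) ≤ ofReal r0⁻¹ * ‖z‖ₑ := by
      rw [← ofReal_norm z, ← ofReal_mul (by positivity), ← ofReal_one]
      apply ofReal_le_ofReal
      rw [inv_mul_eq_div, le_div_iff₀ h0]; linarith
    calc cFar q r0 * N2 q Ω v ≤ cFar q r0 * (ofReal r0⁻¹ * ‖z‖ₑ) * N3 q Ω v := by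
          refine mul_le_mul' ?_ le_self_add
          exact le_mul_of_one_le_right' this
      _ = (cFar q r0 * ofReal r0⁻¹) * ‖z‖ₑ * N3 q Ω v := by ring
      _ ≤ _ := by gcongr; exact le_add_self

lemma perz_C2 (h : IsAtlas Ω Λ R e t ζ) {q : ℝ} (hq : 1 ≤ q) :
    ∃ C : ℝ≥0∞, C ≠ ⊤ ∧ ∀ (v : EV m → ℝ), ContDiff ℝ 2 v → ∀ z : EV m,
      ∫⁻ x in Ω, ‖remP Ω v x z‖ₑ ^ q ≤ C * N2 q Ω v := by
  obtain ⟨r0, h0, h1, h2, h3⟩ := h.r0_ex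
  have hR := h.R_pos
  have hq0 : 0 ≤ q := by linarith
  refine ⟨2 ^ q + (Fintype.card ι) * cBd q Λ + cFar q r0, ?_, ?_⟩
  · exact ENNReal.add_ne_top.2 ⟨ENNReal.add_ne_top.2 ⟨two_pow_ne_top hq0 (by simp), ENNReal.mul_ne_top (by simp) (cBd_ne_top hq _)⟩, cFar_ne_top hq _⟩
  intro v hv z
  by_cases hz : ‖z‖ ≤ r0
  · refine (h.perz_near hq h0 (by linarith) h3 v hv z hz).trans ?_
    calc _ ≤ 2 ^ q * N2 q Ω v + ∑ j : ι, cBd q Λ * N2 q Ω v := by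
          refine add_le_add ((perz_int2 hq h.isOpen v hv z).trans (mul_le_mul_right le_add_self _))
            (sum_le_sum fun j _ => mul_le_mul_right ?_ _)
          exact (Lq_mono_set (chartLayer_sub _ _ _) _).trans le_add_self
      _ = (2 ^ q + (Fintype.card ι) * cBd q Λ) * N2 q Ω v := by
        rw [Finset.sum_const, Finset.card_univ, nsmul_eq_mul]; ring
      _ ≤ _ := by
        refine mul_le_mul' ?_ le_rfl
        first
          | exact le_self_add
          | exact mul_le_mul' le_self_add le_rfl
  · push Not at hz
    refine (perz_far h.isOpen hq h0 z hz.le v hv).trans ?_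
    gcongr; exact le_add_self

end IsAtlas
end

section
section PV
variable {m : ℕ} {Ω : Set (EV m)} {κ : EV m → ℝ}

lemma A1.int0 (h : A1 κ) : Integrable κ := by
  obtain ⟨hm, hn, -, -, hi⟩ := h
  refine hi.mono' hm.aestronglyMeasurable (ae_of_all _ fun x => ?_)
  rw [Real.norm_of_nonneg (hn x)]
  nlinarith [hn x, norm_nonneg x]

lemma A1.int1 (h : A1 κ) : Integrable (fun x => κ x * ‖x‖) := by
  obtain ⟨hm, hn, -, -, hi⟩ := h
  refine hi.mono' (by fun_prop) (ae_of_all _ fun x => ?_)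
  rw [Real.norm_of_nonneg (mul_nonneg (hn x) (norm_nonneg x))]
  nlinarith [hn x, norm_nonneg x]

lemma kernelJ_meas (h : A1 κ) : Measurable (kernelJ κ) := by
  have := h.1
  unfold kernelJ
  fun_prop

lemma kernelJ_mul (a : ℝ) (z : EV m) : kernelJ κ z * a = κ z * (a / ‖z‖ ^ 2) := by
  unfold kernelJ; ring

open Classical in
/-- `β(x) · ℓ` -/
def betaD (κ : EV m → ℝ) (Ω : Set (EV m)) (ℓ : EV m →L[ℝ] ℝ) (x : EV m) : ℝ :=
  ∫ z, if x - z ∈ Ω then 0 else kernelJ κ z * ℓ z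

/-- `M : D²v` -/
def MHess (M : Matrix (Fin m) (Fin m) ℝ) (v : EV m → ℝ) (x : EV m) : ℝ :=
  ∑ i, ∑ j, M i j * fderiv ℝ (fderiv ℝ v) x (single i 1) (single j 1)

lemma vec_sum (z : EV m) : z = ∑ i, z i • (single i (1 : ℝ) : EV m) := by
  have := (EuclideanSpace.basisFun (Fin m) ℝ).sum_repr z
  simpa using this.symm

lemma bilin_expand (B : EV m →L[ℝ] EV m →L[ℝ] ℝ) (z : EV m) :
    B z z = ∑ i, ∑ j, z i * z j * B (single i 1) (single j 1) := by
  conv_lhs => rw [vec_sum z]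
  simp only [map_sum, map_smul, ContinuousLinearMap.sum_apply, ContinuousLinearMap.smul_apply, smul_eq_mul,
    mul_sum]
  rw [Finset.sum_comm]
  exact sum_congr rfl fun i _ => sum_congr rfl fun j _ => by ring

lemma abs_coord_le (z : EV m) (i : Fin m) : |z i| ≤ ‖z‖ := by
  have := EuclideanSpace.norm_eq z
  have h2 := PiLp.norm_apply_le z i
  simpa using h2

lemma int_quad (h : A1 κ) (i j : Fin m) : Integrable (fun z => kernelJ κ z * z i * z j) := by
  refine h.int0.mono' ?_ (ae_of_all _ fun z => ?_)
  · have := kernelJ_meas h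
    exact Measurable.aestronglyMeasurable (by fun_prop)
  · rw [mul_assoc, kernelJ_mul, norm_mul, Real.norm_of_nonneg (h.2.1 z)]
    refine mul_le_of_le_one_right (h.2.1 z) ?_
    rw [Real.norm_eq_abs]
    apply div_sq_le _ zero_le_one
    rw [abs_mul, one_mul, pow_two]
    exact mul_le_mul (abs_coord_le _ _) (abs_coord_le _ _) (abs_nonneg _) (norm_nonneg _)

lemma MHess_eq (h : A1 κ) (v : EV m → ℝ) (x : EV m) :
    MHess (momentum κ) v x = ∫ z, kernelJ κ z * (1 / 2 * fderiv ℝ (fderiv ℝ v) x z z) := by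
  have : ∀ z : EV m, kernelJ κ z * (1 / 2 * fderiv ℝ (fderiv ℝ v) x z z) =
      ∑ i, ∑ j, (1 / 2 * fderiv ℝ (fderiv ℝ v) x (single i 1) (single j 1)) * (kernelJ κ z * z i * z j) := by
    intro z
    rw [bilin_expand, mul_sum, mul_sum]
    refine sum_congr rfl fun i _ => ?_
    rw [mul_sum, mul_sum]
    exact sum_congr rfl fun j _ => by ring
  simp only [this]
  rw [integral_finset_sum _ fun i _ => integrable_finset_sum _ fun j _ => (int_quad h i j).const_mul _]
  refine sum_congr rfl fun i _ => ?_
  rw [integral_finset_sum _ fun j _ => (int_quad h i j).const_mul _]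
  refine sum_congr rfl fun j _ => ?_
  rw [integral_const_mul, momentum]
  simp only [Matrix.of_apply]
  ring

lemma c2c_taylor {v : EV m → ℝ} (hv : ContDiff ℝ 2 v) (hc : HasCompactSupport v) :
    ∃ C : ℝ, 0 ≤ C ∧ ∀ x z : EV m, |v x - v (x - z) - fderiv ℝ v x z| ≤ C * ‖z‖ ^ 2 := by
  have hF : ContDiff ℝ 1 (fderiv ℝ v) := (hv.fderiv_right (m := 1) (by norm_num))
  have hc2 := (hF.continuous_fderiv one_ne_zero)
  obtain ⟨C, hC⟩ := hc2.bounded_above_of_compact_support ((hc.fderiv ℝ).fderiv ℝ)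
  have hC0 : 0 ≤ C := (norm_nonneg _).trans (hC 0)
  refine ⟨C, hC0, fun x z => ?_⟩
  have h1 := c2_taylor hv x (-z) (s := 1) ⟨zero_le_one, le_rfl⟩
  rw [one_smul, one_mul, map_neg, norm_neg, ← sub_eq_add_neg, Real.norm_eq_abs] at h1
  have h2 : segAvg (fderiv ℝ v) x (-z) ≤ C := by
    unfold segAvg
    have : ∫ τ in Icc (0 : ℝ) 1, ‖fderiv ℝ (fderiv ℝ v) (x + τ • -z)‖ ≤ ∫ τ in Icc (0 : ℝ) 1, C := by
      apply integral_mono_of_nonneg (ae_of_all _ fun _ => norm_nonneg _) (by simp) (ae_of_all _ fun τ => hC _)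
    simpa using this
  calc |v x - v (x - z) - fderiv ℝ v x z| = |v (x - z) - v x - -fderiv ℝ v x z| := by rw [← abs_neg]; congr 1; ring
    _ ≤ _ := h1
    _ ≤ ‖z‖ ^ 2 * C := by gcongr
    _ = _ := mul_comm _ _

lemma odd_int_zero (h : A1 κ) (ℓ : EV m →L[ℝ] ℝ) {r : ℝ} :
    ∫ z in {z : EV m | r ≤ ‖z‖}, kernelJ κ z * ℓ z = 0 := by
  have hm : MeasurableSet {z : EV m | r ≤ ‖z‖} := measurableSet_le measurable_const measurable_norm
  rw [← integral_indicator hm]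
  set f : EV m → ℝ := {z : EV m | r ≤ ‖z‖}.indicator fun z => kernelJ κ z * ℓ z with hf
  have h1 : ∫ z, f (-z) = ∫ z, f z := integral_neg_eq_self f volume
  have h2 : ∫ z, f (-z) = ∫ z, - f z := by
    refine integral_congr_ae ?_
    filter_upwards [h.2.2.2.1] with z hz
    by_cases hr : r ≤ ‖z‖
    · have e1 : -z ∈ {z : EV m | r ≤ ‖z‖} := by simpa using hr
      have e2 : z ∈ {z : EV m | r ≤ ‖z‖} := hr
      rw [hf, indicator_of_mem e1, indicator_of_mem e2]
      simp only [kernelJ, hz, norm_neg, map_neg]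
      ring
    · have e1 : -z ∉ {z : EV m | r ≤ ‖z‖} := by simpa using hr
      have e2 : z ∉ {z : EV m | r ≤ ‖z‖} := hr
      rw [hf, indicator_of_notMem e1, indicator_of_notMem e2, neg_zero]
  rw [integral_neg] at h2
  linarith

lemma int_odd (h : A1 κ) (ℓ : EV m →L[ℝ] ℝ) {r : ℝ} (hr : 0 < r) :
    IntegrableOn (fun z => kernelJ κ z * ℓ z) {z : EV m | r ≤ ‖z‖} := by
  have hm : MeasurableSet {z : EV m | r ≤ ‖z‖} := measurableSet_le measurable_const measurable_norm
  refine Integrable.mono' ((h.int0.mul_const (‖ℓ‖ * r⁻¹)).integrableOn) ?_ ?_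
  · have := kernelJ_meas h
    exact Measurable.aestronglyMeasurable (by fun_prop)
  · rw [ae_restrict_iff' hm]
    refine ae_of_all _ fun z hz => ?_
    have hz : r ≤ ‖z‖ := hz
    rw [kernelJ_mul, norm_mul, Real.norm_of_nonneg (h.2.1 z)]
    refine mul_le_mul_of_nonneg_left ?_ (h.2.1 z)
    rw [Real.norm_eq_abs]
    apply div_sq_le _ (by positivity)
    have h5 : ‖ℓ z‖ ≤ ‖ℓ‖ * ‖z‖ := ℓ.le_opNorm z
    have hz1 : ‖z‖ ≤ r⁻¹ * ‖z‖ ^ 2 := by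
      rw [inv_mul_eq_div, le_div_iff₀ (by positivity), pow_two]; gcongr
    calc _ ≤ ‖ℓ‖ * ‖z‖ := h5
      _ ≤ ‖ℓ‖ * (r⁻¹ * ‖z‖ ^ 2) := by gcongr
      _ = _ := by ring

lemma ball_in (hΩ : IsOpen Ω) {x : EV m} (hx : x ∈ Ω) : ∃ r1 > 0, ∀ z : EV m, x - z ∉ Ω → r1 ≤ ‖z‖ := by
  obtain ⟨r1, h1, h2⟩ := isOpen_iff.1 hΩ x hx
  refine ⟨r1, h1, fun z hz => ?_⟩
  by_contra hcon
  exact hz (h2 (by rw [mem_ball, dist_eq_norm, sub_sub_cancel_left, norm_neg]; linarith))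

open Classical in
/-- the principal value of the nonlocal operator in closed form -/
lemma pv_formula (h : A1 κ) (hΩ : IsOpen Ω) {v : EV m → ℝ} (hv : ContDiff ℝ 2 v)
    (hc : HasCompactSupport v) {x : EV m} (hx : x ∈ Ω) :
    ∃ l, Tendsto (fun r : ℝ => ∫ y in Ω ∩ {y : EV m | r ≤ dist x y}, kernelJ κ (x - y) * (v x - v y)) (𝓝[>] 0) (𝓝 l) ∧
      ‖l + betaD κ Ω (fderiv ℝ v x) x + MHess (momentum κ) v x‖ₑ ≤ ∫⁻ z, ofReal (κ z) * ‖remP Ω v x z‖ₑ := by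
  obtain ⟨r1, hr1, hball⟩ := ball_in hΩ hx
  obtain ⟨C, hC0, hC⟩ := c2c_taylor hv hc
  have hJm := kernelJ_meas h
  set ℓ := fderiv ℝ v x with hℓ
  set A : Set (EV m) := {z | x - z ∈ Ω} with hA
  have hAm : MeasurableSet A := by
    have : Measurable (fun z : EV m => x - z) := by fun_prop
    exact this hΩ.measurableSet
  set g : EV m → ℝ := A.indicator fun z => kernelJ κ z * (v x - v (x - z) - ℓ z) with hg
  have hvx : Measurable (fun z => v (x - z)) := hv.continuous.measurable.comp (by fun_prop)
  have hgm : Measurable g := Measurable.indicator (hJm.mul ((measurable_const.sub hvx).sub (by fun_prop))) hAm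
  have hgb : ∀ z, ‖g z‖ ≤ κ z * C := by
    intro z
    rw [hg]
    refine (norm_indicator_le_norm_self _ _).trans ?_
    rw [kernelJ_mul, norm_mul, Real.norm_of_nonneg (h.2.1 z)]
    refine mul_le_mul_of_nonneg_left ?_ (h.2.1 z)
    exact div_sq_le (hC x z) hC0
  have hgi : Integrable g := (h.int0.mul_const C).mono' hgm.aestronglyMeasurable (ae_of_all _ hgb)
  have hSm : ∀ r : ℝ, MeasurableSet {z : EV m | r ≤ ‖z‖} := fun r => measurableSet_le measurable_const measurable_norm
  have key : ∀ r : ℝ, 0 < r → r ≤ r1 → ∫ y in Ω ∩ {y : EV m | r ≤ dist x y}, kernelJ κ (x - y) * (v x - v y)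
      = (∫ z in {z : EV m | r ≤ ‖z‖}, g z) - betaD κ Ω ℓ x := by
    intro r hr hrr
    have hΩm : MeasurableSet (Ω ∩ {y : EV m | r ≤ dist x y}) :=
      hΩ.measurableSet.inter (measurableSet_le measurable_const (by fun_prop))
    rw [← integral_indicator hΩm, ← integral_sub_left_eq_self _ volume x, ← integral_indicator (hSm r)]
    have e1 : ∫ z, {z : EV m | r ≤ ‖z‖}.indicator (fun z => kernelJ κ z * ℓ z) z = 0 := by
      rw [integral_indicator (hSm r)]; exact odd_int_zero h ℓ
    have i1 : Integrable ({z : EV m | r ≤ ‖z‖}.indicator (fun z => kernelJ κ z * ℓ z)) :=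
      (int_odd h ℓ hr).integrable_indicator (hSm r)
    have i2 : Integrable (fun z => if x - z ∈ Ω then 0 else kernelJ κ z * ℓ z) := by
      have : (fun z => if x - z ∈ Ω then 0 else kernelJ κ z * ℓ z) = Aᶜ.indicator ({z : EV m | r ≤ ‖z‖}.indicator (fun z => kernelJ κ z * ℓ z)) := by
        ext z
        by_cases hz : x - z ∈ Ω
        · have : z ∉ Aᶜ := fun hh => hh hz
          rw [indicator_of_notMem this, if_pos hz]
        · have h1 : z ∈ Aᶜ := hz
          have h2 : z ∈ {z : EV m | r ≤ ‖z‖} := hrr.trans (hball z hz)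
          rw [indicator_of_mem h1, if_neg hz, indicator_of_mem h2]
      rw [this]
      exact i1.indicator hAm.compl
    have i3 : Integrable ({z : EV m | r ≤ ‖z‖}.indicator g) := hgi.indicator (hSm r)
    have e3 : ∫ z, {z : EV m | r ≤ ‖z‖}.indicator g z = ∫ z, ({z : EV m | r ≤ ‖z‖}.indicator g + {z : EV m | r ≤ ‖z‖}.indicator (fun z => kernelJ κ z * ℓ z)) z := by
      rw [integral_add' i3 i1, e1, add_zero]
    rw [betaD, e3, ← integral_sub (i3.add i1) i2]
    refine integral_congr_ae (ae_of_all _ fun z => ?_)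
    simp only [Pi.add_apply]
    by_cases hz : x - z ∈ Ω
    · have hzA : z ∈ A := hz
      rw [if_pos hz]
      by_cases hzr : r ≤ ‖z‖
      · have h2 : z ∈ {z : EV m | r ≤ ‖z‖} := hzr
        have h3 : x - z ∈ Ω ∩ {y : EV m | r ≤ dist x y} := ⟨hz, by
          show r ≤ dist x (x - z)
          rwa [dist_eq_norm, _root_.sub_sub_cancel]⟩
        rw [indicator_of_mem h2, indicator_of_mem h2, indicator_of_mem h3, hg, indicator_of_mem hzA]
        simp only [_root_.sub_sub_cancel]; ring
      · have h2 : z ∉ {z : EV m | r ≤ ‖z‖} := hzr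
        have h3 : x - z ∉ Ω ∩ {y : EV m | r ≤ dist x y} := fun hh => hzr (by
          have : r ≤ dist x (x - z) := hh.2
          rwa [dist_eq_norm, _root_.sub_sub_cancel] at this)
        rw [indicator_of_notMem h2, indicator_of_notMem h2, indicator_of_notMem h3]
        ring
    · have hzA : z ∉ A := hz
      have h2 : z ∈ {z : EV m | r ≤ ‖z‖} := hrr.trans (hball z hz)
      have h3 : x - z ∉ Ω ∩ {y : EV m | r ≤ dist x y} := fun hh => hz hh.1
      rw [if_neg hz, indicator_of_mem h2, indicator_of_mem h2, indicator_of_notMem h3, hg, indicator_of_notMem hzA]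
      ring
  refine ⟨(∫ z, g z) - betaD κ Ω ℓ x, ?_, ?_⟩
  · have hlim : Tendsto (fun r : ℝ => ∫ z in {z : EV m | r ≤ ‖z‖}, g z) (𝓝[>] 0) (𝓝 (∫ z, g z)) := by
      have e : ∀ r : ℝ, ∫ z in {z : EV m | r ≤ ‖z‖}, g z = ∫ z, {z : EV m | r ≤ ‖z‖}.indicator g z := fun r => (integral_indicator (hSm r)).symm
      simp only [e]
      refine tendsto_integral_filter_of_dominated_convergence (fun z => ‖g z‖) ?_ ?_ hgi.norm ?_
      · exact Eventually.of_forall fun r => (hgm.indicator (hSm r)).aestronglyMeasurable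
      · exact Eventually.of_forall fun r => ae_of_all _ fun z => norm_indicator_le_norm_self _ _
      · refine ae_of_all _ fun z => ?_
        by_cases hz : z = 0
        · have : g z = 0 := by
            rw [hg, hz]
            simp [Set.indicator, kernelJ]
          have e2 : ∀ r : ℝ, {z : EV m | r ≤ ‖z‖}.indicator g z = 0 := by
            intro r
            by_cases hh : z ∈ {z : EV m | r ≤ ‖z‖} <;> simp [hh, this]
          simp only [e2, this]
          exact tendsto_const_nhds
        · refine tendsto_const_nhds.congr' ?_
          have hz' : 0 < ‖z‖ := norm_pos_iff.2 hz
          filter_upwards [Ioo_mem_nhdsGT hz'] with r hr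
          have : z ∈ {z : EV m | r ≤ ‖z‖} := hr.2.le
          rw [indicator_of_mem this]
    refine (hlim.sub_const _).congr' ?_
    filter_upwards [Ioo_mem_nhdsGT hr1] with r hr
    exact (key r hr.1 hr.2.le).symm
  · have hMi : Integrable (fun z => kernelJ κ z * (1 / 2 * fderiv ℝ (fderiv ℝ v) x z z)) := by
      refine (h.int0.mul_const ‖fderiv ℝ (fderiv ℝ v) x‖).mono' ?_ (ae_of_all _ fun z => ?_)
      · refine Measurable.aestronglyMeasurable (hJm.mul (Measurable.const_mul ?_ _))
        have : Continuous fun z => fderiv ℝ (fderiv ℝ v) x z z := by fun_prop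
        exact this.measurable
      · rw [kernelJ_mul, norm_mul, Real.norm_of_nonneg (h.2.1 z)]
        refine mul_le_mul_of_nonneg_left ?_ (h.2.1 z)
        exact div_sq_le (half_hess v x z) (norm_nonneg _)
    rw [sub_add_cancel, MHess_eq h, ← integral_add hgi hMi]
    refine (enorm_integral_le_lintegral_enorm _).trans (le_of_eq (lintegral_congr fun z => ?_))
    have : g z + kernelJ κ z * (1 / 2 * fderiv ℝ (fderiv ℝ v) x z z) = κ z * remP Ω v x z := by
      rw [remP, ← kernelJ_mul, remQ, mul_add]
      congr 1
      by_cases hz : x - z ∈ Ω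
      · have hzA : z ∈ A := hz
        rw [hg, indicator_of_mem hzA, if_pos hz]
      · have hzA : z ∉ A := hz
        rw [hg, indicator_of_notMem hzA, if_neg hz, mul_zero]
    rw [this, enorm_mul, Real.enorm_of_nonneg (h.2.1 z)]

end PV
end

section
section rem
variable {m : ℕ} {Ω : Set (EV m)} {κ : EV m → ℝ}

lemma fderiv_sub' {u w : EV m → ℝ} (hu : ContDiff ℝ 2 u) (hw : ContDiff ℝ 2 w) :
    fderiv ℝ (fun x => u x - w x) = fun x => fderiv ℝ u x - fderiv ℝ w x := by
  ext1 x
  exact fderiv_fun_sub (hu.differentiable (by norm_num) x) (hw.differentiable (by norm_num) x)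

lemma fderiv2_sub' {u w : EV m → ℝ} (hu : ContDiff ℝ 2 u) (hw : ContDiff ℝ 2 w) :
    fderiv ℝ (fderiv ℝ (fun x => u x - w x)) = fun x => fderiv ℝ (fderiv ℝ u) x - fderiv ℝ (fderiv ℝ w) x := by
  rw [fderiv_sub' hu hw]
  ext1 x
  exact fderiv_fun_sub ((hu.fderiv_right (m := 1) (by norm_num)).differentiable one_ne_zero x)
    ((hw.fderiv_right (m := 1) (by norm_num)).differentiable one_ne_zero x)

lemma remP_sub {u w : EV m → ℝ} (hu : ContDiff ℝ 2 u) (hw : ContDiff ℝ 2 w) (x z : EV m) :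
    remP Ω (fun x => u x - w x) x z = remP Ω u x z - remP Ω w x z := by
  unfold remP remQ
  rw [fderiv2_sub' hu hw, fderiv_sub' hu hw, ← sub_div]
  congr 1
  simp only [ContinuousLinearMap.sub_apply]
  split_ifs <;> ring

lemma remP_meas (hΩ : IsOpen Ω) {v : EV m → ℝ} (hv : ContDiff ℝ 2 v) :
    Measurable (fun p : EV m × EV m => remP Ω v p.1 p.2) := by
  have hF : ContDiff ℝ 1 (fderiv ℝ v) := (hv.fderiv_right (m := 1) (by norm_num))
  have hc1 := hF.continuous
  have hc2 := (hF.continuous_fderiv one_ne_zero)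
  have hc := hv.continuous
  unfold remP remQ
  apply Measurable.div
  · apply Measurable.add
    · refine Measurable.ite ?_ ?_ measurable_const
      · have : Measurable (fun p : EV m × EV m => p.1 - p.2) := by fun_prop
        exact this hΩ.measurableSet
      · have : Continuous (fun p : EV m × EV m => v p.1 - v (p.1 - p.2) - fderiv ℝ v p.1 p.2) := by fun_prop
        exact this.measurable
    · have : Continuous (fun p : EV m × EV m => 1 / 2 * fderiv ℝ (fderiv ℝ v) p.1 p.2 p.2) := by fun_prop
      exact this.measurable
  · fun_prop

lemma remP_meas_enorm (hΩ : IsOpen Ω) {v : EV m → ℝ} (hv : ContDiff ℝ 2 v) :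
    Measurable (fun p : EV m × EV m => ‖remP Ω v p.1 p.2‖ₑ) := (remP_meas hΩ hv).enorm

lemma remP_meas_left (hΩ : IsOpen Ω) {v : EV m → ℝ} (hv : ContDiff ℝ 2 v) (z : EV m) :
    Measurable (fun x : EV m => ‖remP Ω v x z‖ₑ) := by
  have h5 := (remP_meas_enorm hΩ hv).comp (measurable_prodMk_right (y := z))
  simpa only [Function.comp_def] using h5

set_option maxHeartbeats 600000 in
lemma IsAtlas.rem_est {ι : Type} [Fintype ι] {Λ R : ℝ} {e : ι → EV m}
    {t : ι → EV m → ℝ} {ζ : ι → EV m → ℝ} (hA : IsAtlas Ω Λ R e t ζ) {q : ℝ} (hq : 1 ≤ q) :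
    ∃ C : ℝ≥0∞, C ≠ ⊤ ∧ ∀ κ : EV m → ℝ, A1 κ → ∀ u w : EV m → ℝ, ContDiff ℝ 3 u → ContDiff ℝ 2 w →
      ∫⁻ x in Ω, (∫⁻ z, ofReal (κ z) * ‖remP Ω (fun x => u x - w x) x z‖ₑ) ^ q ≤
        C * (∫⁻ z, ofReal (κ z)) ^ (q - 1) *
          ((∫⁻ z, ofReal (κ z) * ‖z‖ₑ) * N3 q Ω u + (∫⁻ z, ofReal (κ z)) * N2 q Ω w) := by
  obtain ⟨C1, hC1, h1⟩ := hA.perz_smooth hq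
  obtain ⟨C2, hC2, h2⟩ := hA.perz_C2 hq
  have hq0 : 0 ≤ q := by linarith
  refine ⟨2 ^ (q - 1) * (C1 + C2), ENNReal.mul_ne_top (two_pow_ne_top (by linarith) (by simp)) (ENNReal.add_ne_top.2 ⟨hC1, hC2⟩), ?_⟩
  intro κ hκ u w hu hw
  have hu2 : ContDiff ℝ 2 u := hu.of_le (by norm_num)
  have hkm : Measurable (fun z => ofReal (κ z)) := hκ.1.ennreal_ofReal
  have hv : ContDiff ℝ 2 (fun x => u x - w x) := hu2.sub hw
  have hj := jensen_fubini hq Ω Set.univ hkm (F := fun x z => ‖remP Ω (fun x => u x - w x) x z‖ₑ)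
    (remP_meas_enorm hA.isOpen hv)
  simp only [Measure.restrict_univ] at hj
  refine hj.trans ?_
  have hper : ∀ z, ∫⁻ x in Ω, ‖remP Ω (fun x => u x - w x) x z‖ₑ ^ q ≤
      2 ^ (q - 1) * (C1 + C2) * (‖z‖ₑ * N3 q Ω u + N2 q Ω w) := by
    intro z
    have hmz := remP_meas_left hA.isOpen hu2 z
    have := lint_add_rpow_le (volume.restrict Ω) hq (fun x => ‖remP Ω (fun x => u x - w x) x z‖ₑ)
      (fun x => ‖remP Ω u x z‖ₑ) (fun x => ‖remP Ω w x z‖ₑ) hmz.aemeasurable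
      (ae_of_all _ fun x => by rw [remP_sub hu2 hw]; exact enorm_sub_le)
    refine this.trans ?_
    rw [mul_assoc]
    refine mul_le_mul_right ?_ _
    calc _ ≤ C1 * ‖z‖ₑ * N3 q Ω u + C2 * N2 q Ω w := add_le_add (h1 u hu z) (h2 w hw z)
      _ = C1 * (‖z‖ₑ * N3 q Ω u) + C2 * N2 q Ω w := by ring
      _ ≤ (C1 + C2) * (‖z‖ₑ * N3 q Ω u) + (C1 + C2) * N2 q Ω w :=
        add_le_add (mul_le_mul_left le_self_add _) (mul_le_mul_left le_add_self _)
      _ = _ := by ring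
  have hcne : 2 ^ (q - 1) * (C1 + C2) ≠ ⊤ := ENNReal.mul_ne_top (two_pow_ne_top (by linarith) (by simp)) (ENNReal.add_ne_top.2 ⟨hC1, hC2⟩)
  set c := 2 ^ (q - 1) * (C1 + C2) with hc
  calc _ ≤ (∫⁻ z, ofReal (κ z)) ^ (q - 1) * ∫⁻ z, c * ((ofReal (κ z) * ‖z‖ₑ) * N3 q Ω u + ofReal (κ z) * N2 q Ω w) := by
        refine mul_le_mul_right (lintegral_mono fun z => ?_) _
        refine (mul_le_mul_right (hper z) _).trans (le_of_eq ?_)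
        ring
    _ = _ := by
      have hm1 : Measurable (fun z : EV m => ofReal (κ z) * ‖z‖ₑ) := by fun_prop
      rw [lintegral_const_mul' _ _ hcne, lintegral_add_left (hm1.mul_const _),
        lintegral_mul_const _ hm1, lintegral_mul_const _ hkm]
      ring

end rem
end

section
section supE
variable {m : ℕ}

lemma lint_smul (f : EV m → ℝ≥0∞) (hf : Measurable f) {c : ℝ} (hc : 0 < c) :
    ∫⁻ x, f (c • x) = ofReal ((c ^ m)⁻¹) * ∫⁻ x, f x := by
  have h1 : Measurable (fun x : EV m => c • x) := by fun_prop
  rw [← lintegral_map hf h1, Measure.map_addHaar_smul _ hc.ne', lintegral_smul_measure]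
  rw [finrank_euclideanSpace_fin, abs_of_pos (by positivity), smul_eq_mul]

lemma supE_gen (ψ : ℝ → ℝ≥0∞) (hψ : Measurable ψ) (hψa : AntitoneOn ψ (Set.Ioi 0)) {e : EV m} (he : ‖e‖ = 1)
    {ν : EV m →L[ℝ] ℝ} (hν : ν e = 1) {Θ : ℝ} (hΘ : 0 ≤ Θ) (τ : ℝ) :
    ∫⁻ z in {z | |τ - ν z| ≤ Θ * ‖z‖ ^ 2}, ψ ‖z‖ ≤ ofReal (24 * Θ) * ∫⁻ y : EV m, ψ (2 / 3 * ‖y‖) * ‖y‖ₑ := by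
  have hνc : Measurable fun z => ν z := ν.continuous.measurable
  set S : Set (EV m) := {z | |τ - ν z| ≤ Θ * ‖z‖ ^ 2} with hS
  have hSm : MeasurableSet S := measurableSet_le (by fun_prop) (by fun_prop)
  have he0 : e ≠ 0 := by intro h; simp [h] at he
  have : Nontrivial (EV m) := ⟨e, 0, he0⟩
  set W : Set (EV m × ℝ) := {p | p.1 ∈ S ∧ 0 ≤ p.2 ∧ p.2 ≤ ‖p.1‖ / 2 ∧ p.1 ≠ 0} with hW
  have hWm : MeasurableSet W := by
    have a1 : MeasurableSet {p : EV m × ℝ | p.1 ∈ S} := measurable_fst hSm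
    have a2 : MeasurableSet {p : EV m × ℝ | 0 ≤ p.2} := measurableSet_le measurable_const measurable_snd
    have a3 : MeasurableSet {p : EV m × ℝ | p.2 ≤ ‖p.1‖ / 2} := measurableSet_le measurable_snd (by fun_prop)
    have a4 : MeasurableSet {p : EV m × ℝ | p.1 ≠ 0} := measurable_fst (measurableSet_singleton 0).compl
    exact a1.inter (a2.inter (a3.inter a4))
  set G : EV m × ℝ → ℝ≥0∞ := W.indicator fun p => ofReal (2 / ‖p.1‖) * ψ (2 / 3 * ‖p.1 + p.2 • e‖) with hG
  have hGm : Measurable G := by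
    refine Measurable.indicator (Measurable.mul (by fun_prop) (hψ.comp (by fun_prop))) hWm
  have step1 : ∫⁻ z in S, ψ ‖z‖ ≤ ∫⁻ z, ∫⁻ σ, G (z, σ) := by
    rw [← lintegral_indicator hSm]
    have h0 : ∀ᵐ z : EV m, z ≠ 0 := by
      rw [ae_iff]; simp
    refine lintegral_mono_ae ?_
    filter_upwards [h0] with z hz
    by_cases hzS : z ∈ S
    · rw [indicator_of_mem hzS]
      have hzp : 0 < ‖z‖ := norm_pos_iff.2 hz
      calc ψ ‖z‖ = ∫⁻ σ in Icc 0 (‖z‖ / 2), ofReal (2 / ‖z‖) * ψ ‖z‖ := by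
            rw [setLIntegral_const, Real.volume_Icc, sub_zero, mul_comm, ← mul_assoc, ← ofReal_mul (by positivity)]
            rw [show ‖z‖ / 2 * (2 / ‖z‖) = 1 by field_simp]
            simp
        _ ≤ ∫⁻ σ in Icc 0 (‖z‖ / 2), G (z, σ) := by
            refine setLIntegral_mono' measurableSet_Icc fun σ hσ => ?_
            have hw : (z, σ) ∈ W := ⟨hzS, hσ.1, hσ.2, hz⟩
            rw [hG, indicator_of_mem hw]
            refine mul_le_mul_right ?_ _
            have n1 : ‖σ • e‖ = σ := by rw [norm_smul, he, mul_one, Real.norm_of_nonneg hσ.1]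
            have n2 : ‖z + σ • e‖ ≤ ‖z‖ + σ := (norm_add_le _ _).trans (by rw [n1])
            have n3 : ‖z‖ - σ ≤ ‖z + σ • e‖ := by
              have := norm_sub_norm_le z (-(σ • e)); rw [norm_neg, n1, sub_neg_eq_add] at this; exact this
            have h2 := hσ.2
            refine hψa ?_ ?_ ?_
            · show 0 < 2 / 3 * ‖z + σ • e‖; linarith
            · exact hzp
            · show 2 / 3 * ‖z + σ • e‖ ≤ ‖z‖; linarith
        _ ≤ _ := setLIntegral_le_lintegral _ _
    · rw [indicator_of_notMem hzS]; exact zero_le'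
  have step2 : ∫⁻ z, ∫⁻ σ, G (z, σ) = ∫⁻ y, ∫⁻ σ, G (y - σ • e, σ) := by
    rw [lintegral_lintegral_swap (f := fun z σ => G (z, σ)) hGm.aemeasurable, lintegral_lintegral_swap (f := fun y σ => G (y - σ • e, σ))]
    · refine lintegral_congr fun σ => ?_
      exact (lintegral_sub_right_eq_self (fun z => G (z, σ)) (σ • e)).symm
    · exact (hGm.comp (by fun_prop)).aemeasurable
  refine step1.trans (step2.le.trans ?_)
  rw [← lintegral_const_mul' _ _ ofReal_ne_top]
  refine lintegral_mono fun y => ?_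
  set I : Set ℝ := Icc (ν y - τ - 4 * Θ * ‖y‖ ^ 2) (ν y - τ + 4 * Θ * ‖y‖ ^ 2) with hI
  have hle : ∀ σ, G (y - σ • e, σ) ≤ I.indicator (fun _ => ofReal (3 / ‖y‖) * ψ (2 / 3 * ‖y‖)) σ := by
    intro σ
    by_cases hw : (y - σ • e, σ) ∈ W
    · obtain ⟨w1, w2, w3, w4⟩ := hw
      have hw : (y - σ • e, σ) ∈ W := ⟨w1, w2, w3, w4⟩
      simp only at w1 w2 w3 w4
      have hzp : 0 < ‖y - σ • e‖ := norm_pos_iff.2 w4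
      have n1 : ‖σ • e‖ = σ := by rw [norm_smul, he, mul_one, Real.norm_of_nonneg w2]
      have n2 : ‖y - σ • e‖ ≤ ‖y‖ + σ := (norm_sub_le _ _).trans (by rw [n1])
      have n3 : ‖y‖ - σ ≤ ‖y - σ • e‖ := by
        have := norm_sub_norm_le y (σ • e); rwa [n1] at this
      have n4 : ‖y - σ • e‖ ≤ 2 * ‖y‖ := by linarith
      have n5 : 2 / 3 * ‖y‖ ≤ ‖y - σ • e‖ := by linarith
      have hyp : 0 < ‖y‖ := by linarith
      have hσI : σ ∈ I := by
        have s1 : |τ - ν (y - σ • e)| ≤ Θ * ‖y - σ • e‖ ^ 2 := w1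
        rw [map_sub, map_smul, hν, smul_eq_mul, mul_one] at s1
        have s2 : Θ * ‖y - σ • e‖ ^ 2 ≤ 4 * Θ * ‖y‖ ^ 2 := by
          calc _ ≤ Θ * (2 * ‖y‖) ^ 2 := by gcongr
            _ = _ := by ring
        have s3 := abs_le.1 (s1.trans s2)
        constructor <;> linarith [s3.1, s3.2]
      rw [hG, indicator_of_mem hw, indicator_of_mem hσI]
      simp only [sub_add_cancel]
      refine mul_le_mul_left (ofReal_le_ofReal ?_) _
      rw [div_le_div_iff₀ hzp hyp]
      linarith
    · rw [hG, indicator_of_notMem hw]; exact zero_le'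
  refine (lintegral_mono hle).trans ?_
  rw [lintegral_indicator measurableSet_Icc, setLIntegral_const, Real.volume_Icc]
  rw [show ν y - τ + 4 * Θ * ‖y‖ ^ 2 - (ν y - τ - 4 * Θ * ‖y‖ ^ 2) = 8 * Θ * ‖y‖ ^ 2 by ring]
  have r1 : ofReal (24 * Θ) * (ψ (2 / 3 * ‖y‖) * ‖y‖ₑ) = ψ (2 / 3 * ‖y‖) * ofReal (24 * Θ * ‖y‖) := by
    rw [ofReal_mul (p := 24 * Θ) (by positivity), ofReal_norm y]; ring
  have r2 : ofReal (3 / ‖y‖) * ψ (2 / 3 * ‖y‖) * ofReal (8 * Θ * ‖y‖ ^ 2)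
      = ψ (2 / 3 * ‖y‖) * ofReal (3 / ‖y‖ * (8 * Θ * ‖y‖ ^ 2)) := by
    rw [ofReal_mul (p := 3 / ‖y‖) (by positivity)]; ring
  rw [r1, r2]
  refine mul_le_mul_right (ofReal_le_ofReal (le_of_eq ?_)) _
  by_cases hy : ‖y‖ = 0
  · rw [hy]; ring
  · field_simp; ring

/-- `κ(z)/|z|` -/
def kap1 (κ : EV m → ℝ) (z : EV m) : ℝ≥0∞ := ofReal (κ z / ‖z‖)

lemma radial_int {n : ℕ} {α N : ℝ} (hα : α < 2) (hN : 3 - α < N) :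
    Integrable (fun x : EV (n + 1) => ‖x‖ ^ ((2 : ℝ) - α - (n + 1 : ℝ)) * (1 + ‖x‖) ^ (-N)) := by
  have := (integrable_fun_norm_addHaar (volume : Measure (EV (n + 1))) (f := fun r : ℝ => r ^ ((2 : ℝ) - α - (n + 1 : ℝ)) * (1 + r) ^ (-N))).2 ?_
  · exact this
  · rw [finrank_euclideanSpace_fin, Nat.add_sub_cancel]
    have hmeas : Measurable (fun y : ℝ => y ^ n • (y ^ ((2 : ℝ) - α - (n + 1 : ℝ)) * (1 + y) ^ (-N))) := by
      simp only [smul_eq_mul]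
      fun_prop
    have e1 : ∀ y : ℝ, 0 < y → y ^ n • (y ^ ((2 : ℝ) - α - (n + 1 : ℝ)) * (1 + y) ^ (-N)) = y ^ (1 - α) * (1 + y) ^ (-N) := by
      intro y hy
      rw [smul_eq_mul, ← mul_assoc, ← Real.rpow_natCast, ← Real.rpow_add hy]
      congr 2; ring
    have hsplit : Set.Ioi (0 : ℝ) = Ioc 0 1 ∪ Set.Ioi 1 := by
      rw [Set.Ioc_union_Ioi_eq_Ioi zero_le_one]
    rw [hsplit]
    refine IntegrableOn.union ?_ ?_
    · have h1 : IntegrableOn (fun y : ℝ => y ^ (1 - α)) (Ioc 0 1) := by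
        rw [← intervalIntegrable_iff_integrableOn_Ioc_of_le zero_le_one]
        exact intervalIntegral.intervalIntegrable_rpow' (by linarith)
      refine Integrable.mono' h1 hmeas.aestronglyMeasurable ?_
      rw [ae_restrict_iff' measurableSet_Ioc]
      refine ae_of_all _ fun y hy => ?_
      rw [e1 y hy.1, Real.norm_of_nonneg (mul_nonneg (Real.rpow_nonneg hy.1.le _) (Real.rpow_nonneg (by linarith [hy.1]) _))]
      refine mul_le_of_le_one_right (Real.rpow_nonneg hy.1.le _) ?_
      exact Real.rpow_le_one_of_one_le_of_nonpos (by linarith [hy.1]) (by linarith)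
    · have h1 : IntegrableOn (fun y : ℝ => y ^ (1 - α - N)) (Set.Ioi 1) :=
        integrableOn_Ioi_rpow_of_lt (by linarith) one_pos
      refine Integrable.mono' h1 hmeas.aestronglyMeasurable ?_
      rw [ae_restrict_iff' measurableSet_Ioi]
      refine ae_of_all _ fun y hy => ?_
      have hy1 : (1 : ℝ) < y := hy
      have hy0 : 0 < y := by linarith
      rw [e1 y hy0, Real.norm_of_nonneg (mul_nonneg (Real.rpow_nonneg hy0.le _) (Real.rpow_nonneg (by linarith) _))]
      rw [show 1 - α - N = (1 - α) + (-N) by ring, Real.rpow_add hy0]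
      refine mul_le_mul_of_nonneg_left ?_ (Real.rpow_nonneg hy0.le _)
      exact Real.rpow_le_rpow_of_nonpos hy0 (by linarith) (by linarith)

lemma supE {n : ℕ} {ρ : EV (n + 1) → ℝ} (h2 : A2 ρ) {Θ : ℝ} (hΘ : 0 ≤ Θ) :
    ∃ C : ℝ≥0∞, C ≠ ⊤ ∧ ∀ ε : ℝ, 0 < ε → ∀ (e : EV (n + 1)) (ν : EV (n + 1) →L[ℝ] ℝ) (τ : ℝ), ‖e‖ = 1 → ν e = 1 →
      ∫⁻ z in {z | |τ - ν z| ≤ Θ * ‖z‖ ^ 2}, kap1 (scaled ρ ε) z ≤ C := by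
  obtain ⟨-, ⟨c₀, c₁, α, N, hc₀, hc₁, hα0, hα2, hN, hb⟩, -⟩ := h2
  have hitg := (radial_int (n := n) hα2 hN).const_mul c₀
  set B : EV (n + 1) → ℝ := fun x => c₀ * (‖x‖ ^ ((2 : ℝ) - α - (n + 1 : ℝ)) * (1 + ‖x‖) ^ (-N)) with hB
  have hBn : ∀ x, 0 ≤ B x := fun x => by positivity
  have hfin : ∫⁻ x, ofReal (B x) ≠ ⊤ := by
    have := hitg.2
    rw [hasFiniteIntegral_iff_ofReal (ae_of_all _ hBn)] at this
    exact this.ne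
  refine ⟨ofReal (24 * Θ) * (ofReal ((3 / 2) ^ (n + 2)) * ∫⁻ x, ofReal (B x)), ?_, ?_⟩
  · exact ENNReal.mul_ne_top ofReal_ne_top (ENNReal.mul_ne_top ofReal_ne_top hfin)
  intro ε hε e ν τ he hν
  set ψ : ℝ → ℝ≥0∞ := fun r => ofReal ((ε ^ (n + 1))⁻¹ * (c₀ * ε⁻¹ * ((ε⁻¹ * r) ^ ((1 : ℝ) - α - (n + 1 : ℝ)) * (1 + ε⁻¹ * r) ^ (-N)))) with hψ
  have hψm : Measurable ψ := by rw [hψ]; fun_prop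
  have hψa : AntitoneOn ψ (Set.Ioi 0) := by
    intro a ha b hb' hab
    have ha0 : 0 < a := ha
    have hb0 : 0 < b := hb'
    have hn : (0 : ℝ) ≤ n := Nat.cast_nonneg n
    refine ofReal_le_ofReal ?_
    have k1 : ε⁻¹ * a ≤ ε⁻¹ * b := by gcongr
    have k2 : (ε⁻¹ * b) ^ ((1 : ℝ) - α - (n + 1 : ℝ)) ≤ (ε⁻¹ * a) ^ ((1 : ℝ) - α - (n + 1 : ℝ)) :=
      Real.rpow_le_rpow_of_nonpos (by positivity) k1 (by linarith)
    have k3 : (1 + ε⁻¹ * b) ^ (-N) ≤ (1 + ε⁻¹ * a) ^ (-N) :=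
      Real.rpow_le_rpow_of_nonpos (by positivity) (by linarith) (by linarith)
    gcongr
  have hpow : ∀ x : ℝ, 0 < x → x ^ ((2 : ℝ) - α - (n + 1 : ℝ)) = x ^ ((1 : ℝ) - α - (n + 1 : ℝ)) * x := by
    intro x hx
    rw [show (2 : ℝ) - α - (n + 1 : ℝ) = ((1 : ℝ) - α - (n + 1 : ℝ)) + 1 by ring, Real.rpow_add hx, Real.rpow_one]
  have hle : ∀ z : EV (n + 1), z ≠ 0 → kap1 (scaled ρ ε) z ≤ ψ ‖z‖ := by
    intro z hz
    have hzp : 0 < ‖z‖ := norm_pos_iff.2 hz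
    refine ofReal_le_ofReal ?_
    have hz' : ε⁻¹ • z ≠ 0 := smul_ne_zero (by positivity) hz
    have h1 := (le_abs_self _).trans (hb _ hz').1
    rw [norm_smul, Real.norm_of_nonneg (by positivity), hpow _ (by positivity)] at h1
    rw [scaled, mul_div_assoc]
    refine mul_le_mul_of_nonneg_left ?_ (by positivity)
    rw [div_le_iff₀ hzp]
    refine h1.trans (le_of_eq ?_)
    ring
  have he0 : e ≠ 0 := by intro h; simp [h] at he
  have : Nontrivial (EV (n + 1)) := ⟨e, 0, he0⟩
  have h0 : ∀ᵐ z : EV (n + 1), z ≠ 0 := by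
    rw [ae_iff]; simp
  have s1 : ∫⁻ z in {z | |τ - ν z| ≤ Θ * ‖z‖ ^ 2}, kap1 (scaled ρ ε) z ≤ ∫⁻ z in {z | |τ - ν z| ≤ Θ * ‖z‖ ^ 2}, ψ ‖z‖ :=
    lintegral_mono_ae ((ae_restrict_of_ae h0).mono hle)
  refine s1.trans ((supE_gen ψ hψm hψa he hν hΘ τ).trans (mul_le_mul_right ?_ _))
  set f : EV (n + 1) → ℝ≥0∞ := fun y => ψ (2 / 3 * ‖y‖) * ‖y‖ₑ with hf
  have hfm : Measurable f := Measurable.mul (hψm.comp (by fun_prop)) (by fun_prop)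
  have hs := lint_smul f hfm (c := 3 / 2 * ε) (by positivity)
  have e2 : ∫⁻ x, f ((3 / 2 * ε) • x) = ofReal (3 / 2 * (ε ^ (n + 1))⁻¹) * ∫⁻ x, ofReal (B x) := by
    rw [← lintegral_const_mul' _ _ ofReal_ne_top]
    refine lintegral_congr_ae ?_
    filter_upwards [h0] with x hx
    have hxp : 0 < ‖x‖ := norm_pos_iff.2 hx
    rw [hf, hψ, hB]
    simp only
    rw [← ofReal_norm ((3 / 2 * ε) • x), norm_smul, Real.norm_of_nonneg (by positivity), hpow _ hxp,
      ← ofReal_mul (by positivity), ← ofReal_mul (by positivity)]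
    rw [show ε⁻¹ * (2 / 3 * (3 / 2 * ε * ‖x‖)) = ‖x‖ by field_simp]
    congr 1
    field_simp
  rw [e2] at hs
  have hpos : 0 < (3 / 2 * ε) ^ (n + 1) := by positivity
  have e3 : ∫⁻ x, f x = ofReal ((3 / 2 * ε) ^ (n + 1)) * (ofReal (((3 / 2 * ε) ^ (n + 1))⁻¹) * ∫⁻ x, f x) := by
    rw [← mul_assoc, ← ofReal_mul hpos.le, mul_inv_cancel₀ hpos.ne', ofReal_one, one_mul]
  rw [e3, ← hs, ← mul_assoc, ← ofReal_mul hpos.le]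
  refine mul_le_mul_left (ofReal_le_ofReal (le_of_eq ?_)) _
  rw [mul_pow]
  field_simp
  ring
end supE
end

section
section scaling
variable {m : ℕ} {ρ : EV m → ℝ} {ε : ℝ}

lemma lint_scaled (hm : Measurable ρ) (hε : 0 < ε) (g : EV m → ℝ≥0∞) (hg : Measurable g) :
    ∫⁻ z, ofReal (scaled ρ ε z) * g (ε⁻¹ • z) = ∫⁻ z, ofReal (ρ z) * g z := by
  have h := lint_smul (fun z => ofReal (ρ z) * g z) (by fun_prop) (c := ε⁻¹) (by positivity)
  have e1 : ∀ z, ofReal (scaled ρ ε z) * g (ε⁻¹ • z) =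
      ofReal ((ε ^ m)⁻¹) * (ofReal (ρ (ε⁻¹ • z)) * g (ε⁻¹ • z)) := by
    intro z
    rw [scaled, ofReal_mul (by positivity), mul_assoc]
  simp_rw [e1]
  rw [lintegral_const_mul' _ _ ofReal_ne_top, h, ← mul_assoc, ← ofReal_mul (by positivity)]
  rw [inv_pow, inv_inv, inv_mul_cancel₀ (by positivity), ofReal_one, one_mul]

lemma lint_scaled0 (hm : Measurable ρ) (hε : 0 < ε) :
    ∫⁻ z, ofReal (scaled ρ ε z) = ∫⁻ z, ofReal (ρ z) := by
  simpa using lint_scaled hm hε (fun _ => 1) measurable_const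

lemma lint_scaled1 (hm : Measurable ρ) (hε : 0 < ε) :
    ∫⁻ z, ofReal (scaled ρ ε z) * ‖z‖ₑ = ofReal ε * ∫⁻ z, ofReal (ρ z) * ‖z‖ₑ := by
  rw [← lint_scaled hm hε (fun z => ‖z‖ₑ) (by fun_prop), ← lintegral_const_mul' _ _ ofReal_ne_top]
  refine lintegral_congr fun z => ?_
  rw [← ofReal_norm z, ← ofReal_norm (ε⁻¹ • z), norm_smul, Real.norm_of_nonneg (by positivity),
    ofReal_mul (p := ε⁻¹) (by positivity)]
  have : ofReal ε * ofReal ε⁻¹ = 1 := by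
    rw [← ofReal_mul hε.le, mul_inv_cancel₀ hε.ne', ofReal_one]
  calc _ = (ofReal ε * ofReal ε⁻¹) * (ofReal (scaled ρ ε z) * ofReal ‖z‖) := by rw [this, one_mul]
    _ = _ := by ring

lemma A1.scaled (h : A1 ρ) (hε : 0 < ε) : A1 (scaled ρ ε) := by
  obtain ⟨hm, hn, hz, he, hi⟩ := id h
  have hms : Measurable (_root_.scaled ρ ε) := by
    unfold _root_.scaled
    exact (hm.comp (by fun_prop)).const_mul _
  have hns : ∀ x, 0 ≤ _root_.scaled ρ ε x := fun x => mul_nonneg (by positivity) (hn _)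
  refine ⟨hms, hns, ?_, ?_, ?_⟩
  · intro hc
    apply hz
    have h0 := lint_scaled0 hm hε
    rw [(lintegral_eq_zero_iff (by fun_prop)).2, eq_comm, lintegral_eq_zero_iff (by fun_prop)] at h0
    · filter_upwards [h0] with x hx
      exact le_antisymm (ENNReal.ofReal_eq_zero.1 hx) (hn x)
    · filter_upwards [hc] with x hx
      simp [hx]
  · have hq : Measure.QuasiMeasurePreserving (fun x : EV m => ε⁻¹ • x) volume volume := by
      refine ⟨by fun_prop, ?_⟩
      rw [Measure.map_addHaar_smul _ (by positivity)]
      exact Measure.smul_absolutelyContinuous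
    filter_upwards [hq.ae he] with x hx
    unfold _root_.scaled
    rw [smul_neg, hx]
  · have h1 : Integrable (fun x => (ε ^ m)⁻¹ * (ρ (ε⁻¹ • x) + ε * (ρ (ε⁻¹ • x) * ‖ε⁻¹ • x‖))) := by
      have := (h.int0.add (h.int1.const_mul ε)).comp_smul (R := ε⁻¹) (by positivity)
      exact this.const_mul _
    refine h1.congr (ae_of_all _ fun x => ?_)
    simp only [_root_.scaled]
    rw [norm_smul, Real.norm_of_nonneg (by positivity)]
    field_simp

lemma kernelJ_scaled (hε : 0 < ε) (z : EV m) : kernelJ (scaled ρ ε) z = (ε ^ m)⁻¹ * ((ε ^ 2)⁻¹ * kernelJ ρ (ε⁻¹ • z)) := by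
  unfold kernelJ scaled
  rw [norm_smul, Real.norm_of_nonneg (by positivity)]
  by_cases hz : ‖z‖ = 0
  · simp [hz]
  · field_simp

lemma int_smul_inv (hε : 0 < ε) (f : EV m → ℝ) : ∫ z, (ε ^ m)⁻¹ * f (ε⁻¹ • z) = ∫ z, f z := by
  rw [integral_const_mul, Measure.integral_comp_smul]
  rw [finrank_euclideanSpace_fin, inv_pow, inv_inv, abs_of_pos (by positivity), smul_eq_mul, ← mul_assoc, inv_mul_cancel₀ (by positivity), one_mul]

lemma momentum_scaled (hε : 0 < ε) : momentum (scaled ρ ε) = momentum ρ := by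
  ext i j
  simp only [momentum, Matrix.of_apply]
  congr 1
  rw [← int_smul_inv hε (fun z => kernelJ ρ z * z i * z j)]
  refine integral_congr_ae (ae_of_all _ fun z => ?_)
  simp only [kernelJ_scaled hε, PiLp.smul_apply, smul_eq_mul]
  field_simp

/-- `M ν` -/
def MV (M : Matrix (Fin m) (Fin m) ℝ) (ν : EV m →L[ℝ] ℝ) : EV m :=
  WithLp.toLp 2 fun k => ∑ i, M i k * ν (single i 1)

lemma clm_sum (ν : EV m →L[ℝ] ℝ) (z : EV m) : ν z = ∑ i, z i * ν (single i 1) := by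
  conv_lhs => rw [vec_sum z]
  simp

lemma apply_MV (M : Matrix (Fin m) (Fin m) ℝ) (ν ℓ : EV m →L[ℝ] ℝ) :
    ℓ (MV M ν) = ∑ k, ∑ i, M i k * ν (single i 1) * ℓ (single k 1) := by
  rw [clm_sum ℓ]
  simp [MV, sum_mul]

lemma norm_MV_le (M : Matrix (Fin m) (Fin m) ℝ) : ∃ C : ℝ, 0 ≤ C ∧ ∀ ν : EV m →L[ℝ] ℝ, ‖MV M ν‖ ≤ C * ‖ν‖ := by
  refine ⟨∑ k, ∑ i, |M i k|, by positivity, fun ν => ?_⟩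
  rw [vec_sum (MV M ν)]
  refine (norm_sum_le _ _).trans ?_
  rw [sum_mul]
  refine sum_le_sum fun k _ => ?_
  rw [norm_smul, EuclideanSpace.norm_single, norm_one, mul_one, sum_mul]
  simp only [MV]
  refine (norm_sum_le _ _).trans (sum_le_sum fun i _ => ?_)
  rw [norm_mul, Real.norm_eq_abs]
  gcongr
  refine (ν.le_opNorm _).trans ?_
  rw [EuclideanSpace.norm_single, norm_one, mul_one]

end scaling
end

section
section slice
variable {m : ℕ}

lemma mulVecE_apply (Q : Matrix (Fin m) (Fin m) ℝ) (x : EV m) (i : Fin m) :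
    mulVecE Q x i = ∑ j, Q i j * x j := by
  simp [mulVecE, Matrix.mulVec, dotProduct]

lemma mulVecE_mul (P Q : Matrix (Fin m) (Fin m) ℝ) (x : EV m) : mulVecE (P * Q) x = mulVecE P (mulVecE Q x) := by
  simp [mulVecE, Matrix.mulVec_mulVec]

lemma mulVecE_one (x : EV m) : mulVecE (1 : Matrix (Fin m) (Fin m) ℝ) x = x := by
  simp [mulVecE]

/-- `mulVecE` as a linear map -/
def mvL (Q : Matrix (Fin m) (Fin m) ℝ) : EV m →ₗ[ℝ] EV m where
  toFun := mulVecE Q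
  map_add' x y := by simp [mulVecE, Matrix.mulVec_add]
  map_smul' c x := by simp [mulVecE, Matrix.mulVec_smul]

lemma mvL_apply (Q : Matrix (Fin m) (Fin m) ℝ) (x : EV m) : mvL Q x = mulVecE Q x := rfl

lemma mvL_det {Q P : Matrix (Fin m) (Fin m) ℝ} (h : P * Q = 1) : LinearMap.det (mvL Q) ≠ 0 := by
  have h1 : mvL P ∘ₗ mvL Q = LinearMap.id := by
    ext1 x
    simp [mvL_apply, ← mulVecE_mul, h, mulVecE_one]
  intro h0
  have := congrArg LinearMap.det h1
  rw [LinearMap.det_comp, h0, mul_zero, LinearMap.det_id] at this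
  exact zero_ne_one this

lemma mulVecE_cont (Q : Matrix (Fin m) (Fin m) ℝ) : Continuous (mulVecE Q) := (mvL Q).continuous_of_finiteDimensional

lemma inner_mulVecE (Q : Matrix (Fin m) (Fin m) ℝ) (x y : EV m) :
    inner ℝ x (mulVecE Q y) = inner ℝ (mulVecE Qᵀ x) y := by
  simp only [PiLp.inner_apply, mulVecE_apply, RCLike.inner_apply, conj_trivial, Matrix.transpose_apply]
  simp_rw [sum_mul, mul_sum]
  rw [Finset.sum_comm]
  exact sum_congr rfl fun j _ => sum_congr rfl fun i _ => by ring

/-- representing vector -/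
def hatV (ν : EV m →L[ℝ] ℝ) : EV m := WithLp.toLp 2 fun i => ν (single i 1)

lemma hatV_inner (ν : EV m →L[ℝ] ℝ) (z : EV m) : inner ℝ (hatV ν) z = ν z := by
  rw [clm_sum ν z]
  simp [PiLp.inner_apply, hatV]

lemma MV_eq {M : Matrix (Fin m) (Fin m) ℝ} (hM : Mᵀ = M) (ν : EV m →L[ℝ] ℝ) : MV M ν = mulVecE M (hatV ν) := by
  ext k
  rw [mulVecE_apply]
  simp only [MV, hatV]
  refine sum_congr rfl fun i _ => ?_
  rw [← hM, Matrix.transpose_apply, hM]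

lemma exists_SO {n : ℕ} {b : EV (n + 1)} (hb : ‖b‖ = 1) :
    ∃ Q : Matrix (Fin (n + 1)) (Fin (n + 1)) ℝ, Qᵀ * Q = 1 ∧ Q.det = 1 ∧
      ∃ s : ℝ, s ≠ 0 ∧ ∀ y, inner ℝ b (mulVecE Q y) = s * y (Fin.last n) := by
  obtain ⟨B, hB⟩ := Orthonormal.exists_orthonormalBasis_extension_of_card_eq (𝕜 := ℝ) (E := EV (n + 1)) (ι := Fin (n + 1))
    (by simp) (v := fun _ => b) (s := {Fin.last n}) (by
      refine ⟨fun i => by simpa using hb, fun i j hij => (hij (Subsingleton.elim i j)).elim⟩)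
  have hBl : B (Fin.last n) = b := hB _ rfl
  set P : Matrix (Fin (n + 1)) (Fin (n + 1)) ℝ := Matrix.of fun i k => B k i with hP
  have hPP : Pᵀ * P = 1 := by
    ext j k
    have := B.inner_eq_ite j k
    rw [Matrix.mul_apply, Matrix.one_apply, ← this, PiLp.inner_apply]
    refine sum_congr rfl fun i _ => ?_
    simp [hP, mul_comm]
  have key : ∀ y, inner ℝ b (mulVecE P y) = y (Fin.last n) := by
    intro y
    have e : mulVecE P y = ∑ k, y k • B k := by
      ext i
      rw [mulVecE_apply]
      simp [hP, mul_comm]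
    rw [e, inner_sum, ← hBl]
    simp [inner_smul_right, B.inner_eq_ite]
  have hdet : P.det = 1 ∨ P.det = -1 := by
    have := congrArg Matrix.det hPP
    rw [Matrix.det_mul, Matrix.det_transpose, Matrix.det_one] at this
    exact mul_self_eq_one_iff.1 this
  rcases hdet with hd | hd
  · exact ⟨P, hPP, hd, 1, one_ne_zero, fun y => by rw [key, one_mul]⟩
  · set Dg : Matrix (Fin (n + 1)) (Fin (n + 1)) ℝ := Matrix.diagonal fun i => if i = Fin.last n then -1 else 1 with hDg
    refine ⟨P * Dg, ?_, ?_, -1, by norm_num, fun y => ?_⟩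
    · rw [Matrix.transpose_mul, Matrix.mul_assoc, ← Matrix.mul_assoc Pᵀ, hPP, Matrix.one_mul, hDg,
        Matrix.diagonal_transpose, Matrix.diagonal_mul_diagonal, ← Matrix.diagonal_one]
      congr 1; ext i; split_ifs <;> norm_num
    · rw [Matrix.det_mul, hd, hDg, Matrix.det_diagonal, Finset.prod_ite_eq']
      simp
    · rw [mulVecE_mul, key, mulVecE_apply]
      simp [hDg, Matrix.diagonal_apply]

lemma snocE_mp (n : ℕ) : MeasurePreserving (fun p : EV n × ℝ => snocE p.1 p.2) (volume.prod volume) volume := by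
  have h1 : MeasurePreserving (WithLp.ofLp : EV n → (Fin n → ℝ)) := PiLp.volume_preserving_ofLp (Fin n)
  have h2 : MeasurePreserving (WithLp.toLp 2 : (Fin (n + 1) → ℝ) → EV (n + 1)) := PiLp.volume_preserving_toLp (Fin (n + 1))
  have h3 := (volume_preserving_piFinSuccAbove (fun _ : Fin (n + 1) => ℝ) (Fin.last n)).symm
  have h4 : MeasurePreserving (Prod.map (id : ℝ → ℝ) (WithLp.ofLp : EV n → (Fin n → ℝ))) (volume.prod volume) (volume.prod volume) :=
    (MeasurePreserving.id _).prod h1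
  have h5 : MeasurePreserving (Prod.swap : EV n × ℝ → ℝ × EV n) (volume.prod volume) (volume.prod volume) := Measure.measurePreserving_swap
  have h6 := h2.comp (h3.comp (h4.comp h5))
  have hf : (fun p : EV n × ℝ => snocE p.1 p.2) = (WithLp.toLp 2 : (Fin (n + 1) → ℝ) → EV (n + 1)) ∘
      ((MeasurableEquiv.piFinSuccAbove (fun _ : Fin (n + 1) => ℝ) (Fin.last n)).symm ∘
        (Prod.map (id : ℝ → ℝ) (WithLp.ofLp : EV n → (Fin n → ℝ)) ∘ (Prod.swap : EV n × ℝ → ℝ × EV n))) := by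
    funext p
    show WithLp.toLp 2 _ = WithLp.toLp 2 (Fin.insertNth (α := fun _ => ℝ) (Fin.last n) p.2 (fun i => p.1 i))
    rw [Fin.insertNth_last']
    rfl
  rw [hf]
  exact h6

lemma snocE_castSucc {n : ℕ} (y : EV n) (s : ℝ) (i : Fin n) : snocE y s i.castSucc = y i := by
  simp [snocE]

lemma snocE_last {n : ℕ} (y : EV n) (s : ℝ) : snocE y s (Fin.last n) = s := by
  simp [snocE]

lemma int_odd_half {ρ : EV m → ℝ} (h : A1 ρ) (ν ℓ : EV m →L[ℝ] ℝ) {τ : ℝ} (hτ : 0 < τ) :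
    IntegrableOn (fun z => kernelJ ρ z * ℓ z) {z : EV m | τ ≤ ν z} := by
  refine (int_odd h ℓ (r := τ / (‖ν‖ + 1)) (by positivity)).mono_set fun z hz => ?_
  have h1 : τ ≤ ν z := hz
  have h2 := (le_abs_self _).trans (ν.le_opNorm z)
  show τ / (‖ν‖ + 1) ≤ ‖z‖
  rw [div_le_iff₀ (by positivity)]
  nlinarith [norm_nonneg z]

lemma half_meas (ν : EV m →L[ℝ] ℝ) (τ : ℝ) : MeasurableSet {z : EV m | τ ≤ ν z} :=
  measurableSet_le measurable_const ν.continuous.measurable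

lemma slice_coord {n : ℕ} {ρ : EV (n + 1) → ℝ} (h : A1 ρ) {B Bi : Matrix (Fin (n + 1)) (Fin (n + 1)) ℝ}
    (hB : Bi * B = 1) {ν : EV (n + 1) →L[ℝ] ℝ} {c τ : ℝ} (hτ : 0 < τ)
    (hν : ∀ y, ν (mulVecE B y) = c * y (Fin.last n))
    (h0 : ∀ s : ℝ, ∫ y : EV n, kernelJ ρ (mulVecE B (snocE y s)) • y = 0) (i : Fin n) :
    ∫ z in {z | τ ≤ ν z}, kernelJ ρ z * (mulVecE Bi z) i.castSucc = 0 := by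
  have hdet := mvL_det hB
  have hBm : Measurable (mvL B) := (mulVecE_cont B).measurable
  set H : Fin n → EV (n + 1) → ℝ := fun i => {z | τ ≤ ν z}.indicator fun z => kernelJ ρ z * (mulVecE Bi z) i.castSucc with hH
  have hKm := kernelJ_meas h
  have hcm : ∀ i : Fin (n + 1), Measurable fun z => (mulVecE Bi z) i := fun i => by
    exact ((EuclideanSpace.proj i : EV (n + 1) →L[ℝ] ℝ).continuous.comp (mulVecE_cont Bi)).measurable
  have hHm : ∀ i, Measurable (H i) := fun i => (hKm.mul (hcm _)).indicator (half_meas ν τ)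
  have hHi : ∀ i, Integrable (H i) := by
    intro i
    rw [integrable_indicator_iff (half_meas ν τ)]
    let ℓ : EV (n + 1) →L[ℝ] ℝ := (EuclideanSpace.proj i.castSucc : EV (n + 1) →L[ℝ] ℝ).comp (LinearMap.toContinuousLinearMap (mvL Bi))
    exact int_odd_half h ν ℓ hτ
  rw [← integral_indicator (half_meas ν τ)]
  show ∫ z, H i z = 0
  have hmap := Measure.map_linearMap_addHaar_eq_smul_addHaar (volume : Measure (EV (n + 1))) hdet
  have hcne : ofReal |(LinearMap.det (mvL B))⁻¹| ≠ 0 := by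
    rw [ne_eq, ENNReal.ofReal_eq_zero, not_le]; positivity
  have hHi' : ∀ i, Integrable (fun p : EV n × ℝ => H i (mvL B (snocE p.1 p.2))) (volume.prod volume) := by
    intro i
    have e1 : Integrable (H i) (Measure.map (mvL B) volume) := by
      rw [hmap]; exact (hHi i).smul_measure ofReal_ne_top
    have e2 := (integrable_map_measure (hHm i).aestronglyMeasurable hBm.aemeasurable).1 e1
    exact (snocE_mp n).integrable_comp_of_integrable e2
  have e3 : ∫ z, H i z ∂(Measure.map (mvL B) volume) = ∫ p : EV n × ℝ, H i (mvL B (snocE p.1 p.2)) ∂(volume.prod volume) := by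
    rw [integral_map hBm.aemeasurable (hHm i).aestronglyMeasurable, ← (snocE_mp n).map_eq, integral_map (snocE_mp n).aemeasurable]
    exact ((hHm i).comp hBm).aestronglyMeasurable
  have e4 : ∫ p : EV n × ℝ, H i (mvL B (snocE p.1 p.2)) ∂(volume.prod volume) = 0 := by
    rw [integral_prod_symm _ (hHi' i)]
    refine integral_eq_zero_of_ae ?_
    have hall : ∀ᵐ s : ℝ, ∀ i, Integrable (fun y : EV n => H i (mvL B (snocE y s))) :=
      ae_all_iff.2 fun i => (hHi' i).prod_left_ae
    filter_upwards [hall] with s hs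
    have hval : ∀ i y, H i (mvL B (snocE y s)) = if τ ≤ c * s then kernelJ ρ (mulVecE B (snocE y s)) * y i else 0 := by
      intro i y
      simp only [hH, Set.indicator_apply, Set.mem_setOf_eq, mvL_apply, hν, snocE_last]
      rw [← mulVecE_mul, hB, mulVecE_one, snocE_castSucc]
    simp_rw [hval] at hs ⊢
    by_cases hc : τ ≤ c * s
    · simp only [hc, if_true] at hs ⊢
      have hitg : Integrable (fun y : EV n => kernelJ ρ (mulVecE B (snocE y s)) • y) := by
        have : (fun y : EV n => kernelJ ρ (mulVecE B (snocE y s)) • y) =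
            fun y => ∑ i, (kernelJ ρ (mulVecE B (snocE y s)) * y i) • (single i (1 : ℝ) : EV n) := by
          funext y
          simp_rw [mul_smul, ← Finset.smul_sum]
          rw [← vec_sum y]
        rw [this]
        exact integrable_finset_sum _ fun i _ => (hs i).smul_const _
      have := (EuclideanSpace.proj i : EV n →L[ℝ] ℝ).integral_comp_comm hitg
      rw [h0 s, map_zero] at this
      simpa using this
    · simp [hc]
  rw [e4, hmap, integral_smul_measure, smul_eq_zero] at e3
  rcases e3 with e3 | e3
  · rw [ENNReal.toReal_eq_zero_iff] at e3
    rcases e3 with e3 | e3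
    · exact absurd e3 hcne
    · exact absurd e3 ofReal_ne_top
  · exact e3

lemma slice_zero {n : ℕ} {ρ : EV (n + 1) → ℝ} (h : A1 ρ) (h2 : A2 ρ) {ν ℓ : EV (n + 1) →L[ℝ] ℝ} (hν : ν ≠ 0)
    (hℓ : ℓ (MV (momentum ρ) ν) = 0) {τ : ℝ} (hτ : 0 < τ) :
    ∫ z in {z | τ ≤ ν z}, kernelJ ρ z * ℓ z = 0 := by
  obtain ⟨-, -, A, hA, hAA, hslice⟩ := h2
  have hAt : Aᵀ = A := by
    have := hA.isHermitian
    rwa [Matrix.IsHermitian, Matrix.conjTranspose_eq_transpose_of_trivial] at this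
  have hAu : A⁻¹ * A = 1 := Matrix.nonsing_inv_mul _ hA.det_pos.ne'.isUnit
  have hMt : (momentum ρ)ᵀ = momentum ρ := by rw [← hAA, Matrix.transpose_mul, hAt]
  set b0 := mulVecE A (hatV ν) with hb0
  have hb0n : b0 ≠ 0 := by
    intro hc
    apply hν
    have : hatV ν = 0 := by
      rw [← mulVecE_one (hatV ν), ← hAu, mulVecE_mul, ← hb0, hc]
      exact (mvL A⁻¹).map_zero
    ext z
    rw [← hatV_inner ν z, this]; simp
  obtain ⟨Q, hQ, hQd, s, hs, hbQ⟩ := exists_SO (b := (‖b0‖⁻¹ • b0)) (norm_smul_inv_norm hb0n)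
  have hQ' : Q * Qᵀ = 1 := mul_eq_one_comm.1 hQ
  set B := A * Q with hB
  have hBB : (Qᵀ * A⁻¹) * B = 1 := by
    rw [hB, Matrix.mul_assoc, ← Matrix.mul_assoc A⁻¹, hAu, Matrix.one_mul, hQ]
  have hBB' : B * (Qᵀ * A⁻¹) = 1 := mul_eq_one_comm.1 hBB
  have hνB : ∀ y, ν (mulVecE B y) = (‖b0‖ * s) * y (Fin.last n) := by
    intro y
    rw [← hatV_inner, hB, mulVecE_mul, inner_mulVecE, hAt, ← hb0, mul_assoc, ← hbQ y, inner_smul_left]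
    simp only [conj_trivial]
    rw [← mul_assoc, mul_inv_cancel₀ (norm_ne_zero_iff.2 hb0n), one_mul]
  set d := mulVecE Bᵀ (hatV ℓ) with hd
  have hdy : ∀ y, ℓ (mulVecE B y) = inner ℝ d y := fun y => by
    rw [← hatV_inner, inner_mulVecE]
  have hdl : d (Fin.last n) = 0 := by
    have e1 : inner ℝ d (mulVecE Qᵀ b0) = 0 := by
      rw [← hdy, hB, mulVecE_mul, ← mulVecE_mul Q, hQ', mulVecE_one, hb0, ← mulVecE_mul, hAA, ← MV_eq hMt]
      exact hℓ
    have e2 : inner ℝ (mulVecE Qᵀ b0) d = (‖b0‖ * s) * d (Fin.last n) := by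
      rw [← inner_mulVecE, ← hνB, ← hatV_inner ν, hB, mulVecE_mul, inner_mulVecE A, hAt]
    rw [real_inner_comm, e2] at e1
    rcases mul_eq_zero.1 e1 with h3 | h3
    · exact absurd h3 (mul_ne_zero (norm_ne_zero_iff.2 hb0n) hs)
    · exact h3
  have hcoord := fun i => slice_coord h hBB hτ hνB (fun t => hslice t Q hQ hQd) i
  have hitg : ∀ i : Fin n, IntegrableOn (fun z => kernelJ ρ z * (mulVecE (Qᵀ * A⁻¹) z) i.castSucc) {z | τ ≤ ν z} := fun i =>
    int_odd_half h ν ((EuclideanSpace.proj i.castSucc : EV (n + 1) →L[ℝ] ℝ).comp (LinearMap.toContinuousLinearMap (mvL (Qᵀ * A⁻¹)))) hτ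
  have hexp : ∀ z, kernelJ ρ z * ℓ z = ∑ i : Fin n, d i.castSucc * (kernelJ ρ z * (mulVecE (Qᵀ * A⁻¹) z) i.castSucc) := by
    intro z
    have : ℓ z = inner ℝ d (mulVecE (Qᵀ * A⁻¹) z) := by
      rw [← hdy, ← mulVecE_mul, hBB', mulVecE_one]
    rw [this, PiLp.inner_apply, Fin.sum_univ_castSucc, hdl]
    simp only [RCLike.inner_apply, conj_trivial, mul_zero, add_zero, inner_zero_left]
    rw [mul_sum]
    exact sum_congr rfl fun i _ => by ring
  simp_rw [hexp]
  rw [integral_finsetSum _ fun i _ => (hitg i).const_mul _]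
  refine Finset.sum_eq_zero fun i _ => ?_
  rw [integral_const_mul, hcoord i, mul_zero]

lemma slice_zero_scaled {n : ℕ} {ρ : EV (n + 1) → ℝ} (h : A1 ρ) (h2 : A2 ρ) {ν ℓ : EV (n + 1) →L[ℝ] ℝ} (hν : ν ≠ 0)
    (hℓ : ℓ (MV (momentum ρ) ν) = 0) {τ ε : ℝ} (hτ : 0 < τ) (hε : 0 < ε) :
    ∫ z in {z | τ ≤ ν z}, kernelJ (scaled ρ ε) z * ℓ z = 0 := by
  have h0 := slice_zero h h2 hν hℓ (τ := ε⁻¹ * τ) (by positivity)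
  rw [← integral_indicator (half_meas _ _)] at h0 ⊢
  rw [← int_smul_inv hε] at h0
  have e : ∀ z, {z | τ ≤ ν z}.indicator (fun z => kernelJ (scaled ρ ε) z * ℓ z) z =
      ε⁻¹ * ((ε ^ (n + 1))⁻¹ * {z | ε⁻¹ * τ ≤ ν z}.indicator (fun z => kernelJ ρ z * ℓ z) (ε⁻¹ • z)) := by
    intro z
    simp only [Set.indicator_apply, Set.mem_setOf_eq, map_smul, smul_eq_mul, kernelJ_scaled hε]
    have : (ε⁻¹ * τ ≤ ε⁻¹ * ν z) ↔ τ ≤ ν z := mul_le_mul_iff_right₀ (by positivity)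
    simp only [this]
    split_ifs
    · field_simp
    · simp
  simp_rw [e]
  rw [integral_const_mul, h0, mul_zero]

lemma gpos {n : ℕ} {ρ : EV (n + 1) → ℝ} (h2 : A2 ρ) :
    ∃ lam : ℝ, 0 < lam ∧ ∀ ν : EV (n + 1) →L[ℝ] ℝ, lam * ‖ν‖ ^ 2 ≤ ν (MV (momentum ρ) ν) := by
  obtain ⟨-, -, A, hA, hAA, -⟩ := h2
  have hAt : Aᵀ = A := by
    have := hA.isHermitian
    rwa [Matrix.IsHermitian, Matrix.conjTranspose_eq_transpose_of_trivial] at this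
  have hAu : A⁻¹ * A = 1 := Matrix.nonsing_inv_mul _ hA.det_pos.ne'.isUnit
  have hMt : (momentum ρ)ᵀ = momentum ρ := by rw [← hAA, Matrix.transpose_mul, hAt]
  set T := LinearMap.toContinuousLinearMap (mvL A⁻¹)
  refine ⟨((‖T‖ + 1) ^ 2)⁻¹, by positivity, fun ν => ?_⟩
  have e1 : ν (MV (momentum ρ) ν) = ‖mulVecE A (hatV ν)‖ ^ 2 := by
    rw [MV_eq hMt, ← hatV_inner, ← hAA, mulVecE_mul, inner_mulVecE, hAt, real_inner_self_eq_norm_sq]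
  have e2 : ‖hatV ν‖ ≤ (‖T‖ + 1) * ‖mulVecE A (hatV ν)‖ := by
    have : hatV ν = T (mulVecE A (hatV ν)) := by
      show _ = mulVecE A⁻¹ _
      rw [← mulVecE_mul, hAu, mulVecE_one]
    calc ‖hatV ν‖ = ‖T (mulVecE A (hatV ν))‖ := by rw [← this]
      _ ≤ ‖T‖ * ‖mulVecE A (hatV ν)‖ := T.le_opNorm _
      _ ≤ _ := by gcongr; linarith
  have e3 : ‖ν‖ ≤ ‖hatV ν‖ := by
    refine ν.opNorm_le_bound (norm_nonneg _) fun z => ?_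
    rw [← hatV_inner]
    exact norm_inner_le_norm _ _
  rw [e1, inv_mul_le_iff₀ (by positivity), ← mul_pow]
  gcongr
  exact e3.trans e2
end slice
end

section
section hardy
variable {m : ℕ}

lemma path_gen {q : ℝ} (hq : 1 ≤ q) (g : EV m → ℝ≥0∞) (hg : Measurable g) (w : EV m) {b' : ℝ} (hb' : 0 ≤ b') :
    ∫⁻ x, (∫⁻ s in Icc (0 : ℝ) b', g (x + s • w)) ^ q ≤ ofReal b' ^ q * ∫⁻ x, g x ^ q := by
  have hq0 : 0 < q := by linarith
  have hm : Measurable (fun p : EV m × ℝ => g (p.1 + p.2 • w) ^ q) :=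
    (hg.comp (by fun_prop)).pow_const q
  calc _ ≤ ∫⁻ x, ofReal b' ^ (q - 1) * ∫⁻ s in Icc (0 : ℝ) b', g (x + s • w) ^ q := by
        apply lintegral_mono
        intro x
        have := jensen_lint (volume.restrict (Icc (0 : ℝ) b')) hq (k := fun _ => 1)
          (f := fun s => g (x + s • w)) aemeasurable_const
          (hg.comp (by fun_prop)).aemeasurable
        simpa using this
    _ = ofReal b' ^ (q - 1) * ∫⁻ s in Icc (0 : ℝ) b', ∫⁻ x, g (x + s • w) ^ q := by
        rw [lintegral_const_mul _ hm.lintegral_prod_right']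
        rw [lintegral_lintegral_swap]
        exact hm.aemeasurable
    _ = ofReal b' ^ (q - 1) * ∫⁻ s in Icc (0 : ℝ) b', ∫⁻ x, g x ^ q := by
        congr 1
        refine lintegral_congr fun s => ?_
        exact lintegral_add_right_eq_self (fun x => g x ^ q) (s • w)
    _ = _ := by
        rw [setLIntegral_const, Real.volume_Icc, sub_zero, mul_comm (∫⁻ x, g x ^ q), ← mul_assoc]
        congr 1
        rcases eq_or_ne b' 0 with h0 | h0
        · subst h0
          simp [hq0]
        · nth_rewrite 2 [← ENNReal.rpow_one (ofReal b')]
          rw [← ENNReal.rpow_add]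
          · ring_nf
          · simpa using lt_of_le_of_ne hb' h0.symm
          · simp

lemma IsChart.hardy {Ω : Set (EV m)} {Λ R : ℝ} {K : Set (EV m)} {e : EV m} {t : EV m → ℝ}
    (h : IsChart Ω Λ R K e t) (hΩ : IsOpen Ω) {q : ℝ} (hq : 1 ≤ q) {r τ Cv : ℝ} (hr : 0 ≤ r) (hτ : 0 ≤ τ)
    (hR : r + τ < R) {v : EV m → ℝ} (hv : ContDiff ℝ 2 v) (V : EV m → EV m) (hV : ∀ x (s : ℝ), V (x + s • e) = V x)
    (hCv : ∀ x, ‖V x‖ ≤ Cv)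
    (hbc : ∀ x ∈ frontier Ω, x ∈ cthickening (r + τ) K → fderiv ℝ v x (V x) = 0) :
    Lq q (chartLayer Ω r K t τ) (fun x => fderiv ℝ v x (V x)) ≤
      ofReal (Cv * τ) ^ q * Lq q (chartLayer Ω (r + τ) K t τ) (fderiv ℝ (fderiv ℝ v)) := by
  have hq0 : 0 < q := by linarith
  have hv1 : ContDiff ℝ 1 (fderiv ℝ v) := hv.fderiv_right (by norm_num)
  have hv2 : Continuous (fderiv ℝ (fderiv ℝ v)) := hv1.continuous_fderiv (by norm_num)
  have htc : Continuous t := h.t_smooth.continuous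
  have hCv0 : 0 ≤ Cv := (norm_nonneg _).trans (hCv 0)
  set T := chartLayer Ω (r + τ) K t τ with hT
  have hTm : MeasurableSet T := chartLayer_meas hΩ _ _ htc _
  set g : EV m → ℝ≥0∞ := T.indicator fun x => ‖fderiv ℝ (fderiv ℝ v) x‖ₑ with hg
  have hgm : Measurable g := (hv2.enorm).measurable.indicator hTm
  have key : ∀ x ∈ chartLayer Ω r K t τ, ‖fderiv ℝ v x (V x)‖ₑ ≤ ofReal Cv * ∫⁻ s in Icc (0 : ℝ) τ, g (x + s • (-e)) := by
    rintro x ⟨⟨hxΩ, hxK⟩, hxt⟩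
    have hxt : t x ≤ τ := hxt
    have hxR : x ∈ cthickening R K := cthickening_mono (by linarith) _ hxK
    have ht0 : 0 < t x := (h.mem_iff x hxR).1 hxΩ
    have hpt : ∀ s : ℝ, 0 ≤ s → s ≤ t x → x + s • (-e) ∈ cthickening (r + τ) K ∧ t (x + s • (-e)) = t x - s := by
      intro s hs hst
      refine ⟨cthick_move hxK hr ?_, ?_⟩
      · rw [dist_eq_norm, add_sub_cancel_left, norm_smul, norm_neg, h.e_norm, mul_one, Real.norm_of_nonneg hs]
        linarith
      · rw [smul_neg, ← neg_smul, h.t_shift]; ring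
    have hend := hpt (t x) ht0.le le_rfl
    have hf0 : fderiv ℝ v (x + t x • (-e)) (V x) = 0 := by
      have := hbc _ (h.zero_frontier hΩ (by linarith) hR hend.1 (by rw [hend.2]; ring)) hend.1
      rwa [smul_neg, ← neg_smul, hV, neg_smul, ← smul_neg] at this
    have h1 := c1_diff_real hv1 x (-e) ht0.le (s := t x) ⟨ht0.le, le_rfl⟩
    rw [norm_neg, h.e_norm, one_mul] at h1
    have h2 : ‖fderiv ℝ v x (V x)‖ ≤ Cv * ∫ s in Icc (0 : ℝ) (t x), ‖fderiv ℝ (fderiv ℝ v) (x + s • (-e))‖ := by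
      calc ‖fderiv ℝ v x (V x)‖ = ‖(fderiv ℝ v (x + t x • (-e)) - fderiv ℝ v x) (V x)‖ := by
            rw [ContinuousLinearMap.sub_apply, hf0, zero_sub, norm_neg]
        _ ≤ ‖fderiv ℝ v (x + t x • (-e)) - fderiv ℝ v x‖ * ‖V x‖ := ContinuousLinearMap.le_opNorm _ _
        _ ≤ (∫ s in Icc (0 : ℝ) (t x), ‖fderiv ℝ (fderiv ℝ v) (x + s • (-e))‖) * Cv := by
            gcongr
            exact hCv x
        _ = _ := mul_comm _ _
    rw [← ofReal_norm]
    refine (ofReal_le_ofReal h2).trans ?_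
    rw [ofReal_mul hCv0]
    refine mul_le_mul_right ?_ _
    have hcont : Continuous fun s : ℝ => ‖fderiv ℝ (fderiv ℝ v) (x + s • (-e))‖ := by fun_prop
    rw [ofReal_integral_eq_lintegral_ofReal (hcont.continuousOn.integrableOn_compact isCompact_Icc) (ae_of_all _ fun _ => norm_nonneg _)]
    rw [← restrict_Ico_eq_restrict_Icc (a := (0 : ℝ)) (b := t x)]
    calc _ ≤ ∫⁻ s in Set.Ico (0 : ℝ) (t x), g (x + s • (-e)) := by
          refine setLIntegral_mono' measurableSet_Ico fun s hs => ?_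
          obtain ⟨p1, p2⟩ := hpt s hs.1 hs.2.le
          have : x + s • (-e) ∈ T := by
            refine ⟨⟨(h.mem_iff _ (cthickening_mono hR.le _ p1)).2 (by rw [p2]; linarith [hs.2]), p1⟩, ?_⟩
            show t _ ≤ τ
            rw [p2]; linarith [hs.1]
          rw [hg, indicator_of_mem this, ofReal_norm]
      _ ≤ _ := lintegral_mono_set (t := Icc (0 : ℝ) τ) fun s hs => ⟨hs.1, by linarith [hs.2]⟩
  have hSm : MeasurableSet (chartLayer Ω r K t τ) := chartLayer_meas hΩ _ _ htc _
  calc Lq q (chartLayer Ω r K t τ) (fun x => fderiv ℝ v x (V x))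
      ≤ ∫⁻ x in chartLayer Ω r K t τ, (ofReal Cv * ∫⁻ s in Icc (0 : ℝ) τ, g (x + s • (-e))) ^ q := by
        refine setLIntegral_mono' hSm fun x hx => ?_
        exact ENNReal.rpow_le_rpow (key x hx) hq0.le
    _ ≤ ∫⁻ x, (ofReal Cv * ∫⁻ s in Icc (0 : ℝ) τ, g (x + s • (-e))) ^ q := setLIntegral_le_lintegral _ _
    _ = ofReal Cv ^ q * ∫⁻ x, (∫⁻ s in Icc (0 : ℝ) τ, g (x + s • (-e))) ^ q :=
        lint_const_mul_rpow _ hq0.le _ _ ofReal_ne_top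
    _ ≤ ofReal Cv ^ q * (ofReal τ ^ q * ∫⁻ x, g x ^ q) := mul_le_mul_right (path_gen hq g hgm _ hτ) _
    _ = _ := by
        rw [← mul_assoc, ← ENNReal.mul_rpow_of_nonneg _ _ hq0.le, ← ofReal_mul hCv0]
        congr 1
        rw [Lq, ← lintegral_indicator hTm]
        refine lintegral_congr fun x => ?_
        by_cases hx : x ∈ T
        · simp [hg, hx]
        · simp [hg, hx, hq0]

end hardy

section pointwise
variable {n : ℕ} {ρ : EV (n + 1) → ℝ} {Ω : Set (EV (n + 1))} {κ : EV (n + 1) → ℝ}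

lemma kap1_bound {m : ℕ} {κ : EV m → ℝ} (h : A1 κ) (ℓ : EV m →L[ℝ] ℝ) (z : EV m) :
    ‖kernelJ κ z * ℓ z‖ₑ ≤ ‖ℓ‖ₑ * kap1 κ z := by
  rw [kap1, ← ofReal_norm ℓ, ← ofReal_mul (norm_nonneg _)]
  apply enorm_le_of_abs
  rw [abs_mul, kernelJ, abs_div, abs_of_nonneg (h.2.1 z), abs_of_nonneg (by positivity : (0 : ℝ) ≤ ‖z‖ ^ 2)]
  have hk := h.2.1 z
  by_cases hz : ‖z‖ = 0
  · simp [hz]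
  calc κ z / ‖z‖ ^ 2 * |ℓ z| ≤ κ z / ‖z‖ ^ 2 * (‖ℓ‖ * ‖z‖) := by gcongr; exact ℓ.le_opNorm z
    _ = _ := by field_simp

lemma kap1_meas {m : ℕ} {κ : EV m → ℝ} (h : A1 κ) : Measurable (kap1 κ) := by
  have := h.1
  unfold kap1; fun_prop

lemma kap1_far {m : ℕ} {κ : EV m → ℝ} (h : A1 κ) {r : ℝ} (hr : 0 < r) :
    ∫⁻ z in {z | r ≤ ‖z‖}, kap1 κ z ≤ ofReal (r ^ 2)⁻¹ * ∫⁻ z, ofReal (κ z) * ‖z‖ₑ := by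
  rw [← lintegral_const_mul' _ _ ofReal_ne_top]
  refine le_trans (setLIntegral_mono' (measurableSet_le measurable_const (by fun_prop)) fun z hz => ?_) (setLIntegral_le_lintegral _ _)
  have hz : r ≤ ‖z‖ := hz
  have hk := h.2.1 z
  have hzp : 0 < ‖z‖ := by linarith
  rw [kap1, ← ofReal_norm z, ← ofReal_mul hk, ← ofReal_mul (by positivity)]
  refine ofReal_le_ofReal ?_
  rw [div_le_iff₀ hzp]
  calc κ z = (r ^ 2)⁻¹ * (κ z * r ^ 2) := by field_simp
    _ ≤ (r ^ 2)⁻¹ * (κ z * (‖z‖ * ‖z‖)) := by gcongr; nlinarith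
    _ = _ := by ring

open Classical in
/-- far from the boundary -/
lemma betaD_far {m : ℕ} {Ω : Set (EV m)} {κ : EV m → ℝ} (h : A1 κ) (ℓ : EV m →L[ℝ] ℝ) {x : EV m} {r : ℝ} (hr : 0 < r)
    (hx : x ∉ cthickening r Ωᶜ) :
    ‖betaD κ Ω ℓ x‖ₑ ≤ ‖ℓ‖ₑ * (ofReal (r ^ 2)⁻¹ * ∫⁻ z, ofReal (κ z) * ‖z‖ₑ) := by
  refine (enorm_integral_le_lintegral_enorm _).trans ?_
  refine le_trans ?_ (mul_le_mul_right (kap1_far h hr) _)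
  rw [← lintegral_indicator (measurableSet_le measurable_const (by fun_prop)),
    ← lintegral_const_mul' _ _ enorm_ne_top]
  refine lintegral_mono fun z => ?_
  by_cases hz : x - z ∈ Ω
  · simp [hz]
  · have : r ≤ ‖z‖ := by
      by_contra hc
      push Not at hc
      apply hx
      refine mem_cthickening_of_dist_le x (x - z) r _ hz ?_
      rw [dist_eq_norm]; simpa using hc.le
    simp only [hz, if_false]
    rw [indicator_of_mem (by exact this)]
    exact kap1_bound h ℓ z

open Classical in
/-- near the boundary: replacing the complement of `Ω` by a half space -/
lemma IsChart.betaD_near {m : ℕ} {Ω : Set (EV m)} {κ : EV m → ℝ} {Λ R : ℝ} {K : Set (EV m)} {e : EV m} {t : EV m → ℝ}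
    (hC : IsChart Ω Λ R K e t) (hΩ : IsOpen Ω) (h : A1 κ) (ℓ : EV m →L[ℝ] ℝ) {x : EV m} {r : ℝ} (hr : 0 < r) (hR : 2 * r ≤ R)
    (hxΩ : x ∈ Ω) (hx : x ∈ cthickening r K) :
    ‖betaD κ Ω ℓ x‖ₑ ≤ ‖∫ z in {z | t x ≤ fderiv ℝ t x z}, kernelJ κ z * ℓ z‖ₑ +
      ‖ℓ‖ₑ * (ofReal (r ^ 2)⁻¹ * (∫⁻ z, ofReal (κ z) * ‖z‖ₑ) +
        ∫⁻ z in {z | |t x - fderiv ℝ t x z| ≤ Λ * ‖z‖ ^ 2}, kap1 κ z) := by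
  have hxR : x ∈ cthickening R K := cthickening_mono (by linarith) _ hx
  have ht0 : 0 < t x := (hC.mem_iff x hxR).1 hxΩ
  set ν := fderiv ℝ t x with hν
  set f : EV m → ℝ := fun z => if x - z ∈ Ω then 0 else kernelJ κ z * ℓ z with hf
  set g : EV m → ℝ := {z | t x ≤ ν z}.indicator fun z => kernelJ κ z * ℓ z with hg
  obtain ⟨r1, hr1, hball⟩ := ball_in hΩ hxΩ
  have hfi : Integrable f := by
    have hm : MeasurableSet {z : EV m | x - z ∉ Ω} := by
      have : Measurable fun z : EV m => x - z := by fun_prop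
      exact this hΩ.measurableSet.compl
    have : f = {z : EV m | x - z ∉ Ω}.indicator fun z => kernelJ κ z * ℓ z := by
      funext z; by_cases hz : x - z ∈ Ω <;> simp [hf, hz]
    rw [this, integrable_indicator_iff hm]
    exact (int_odd h ℓ hr1).mono_set fun z hz => hball z hz
  have hgi : Integrable g := by
    rw [hg, integrable_indicator_iff (half_meas _ _)]
    exact int_odd_half h ν ℓ ht0
  have e1 : betaD κ Ω ℓ x = (∫ z, g z) + ∫ z, (f z - g z) := by
    rw [integral_sub hfi hgi, add_sub_cancel]
    rfl
  rw [e1]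
  refine (enorm_add_le _ _).trans ?_
  rw [hg, integral_indicator (half_meas _ _), ← hg]
  refine add_le_add le_rfl ?_
  refine (enorm_integral_le_lintegral_enorm _).trans ?_
  have hs1 : MeasurableSet {z : EV m | r ≤ ‖z‖} := measurableSet_le measurable_const (by fun_prop)
  have hs2 : MeasurableSet {z : EV m | |t x - ν z| ≤ Λ * ‖z‖ ^ 2} := by
    have := ν.continuous.measurable
    exact measurableSet_le (by fun_prop) (by fun_prop)
  refine le_trans ?_ (mul_le_mul_right (add_le_add_left (kap1_far h hr) _) _)
  rw [← lintegral_indicator hs1, ← lintegral_indicator hs2, ← lintegral_add_left ((kap1_meas h).indicator hs1),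
    ← lintegral_const_mul' _ _ enorm_ne_top]
  refine lintegral_mono fun z => ?_
  have hle : ‖f z - g z‖ₑ ≤ ‖ℓ‖ₑ * kap1 κ z := by
    refine le_trans ?_ (kap1_bound h ℓ z)
    by_cases h1 : x - z ∈ Ω <;> by_cases h2 : t x ≤ ν z <;> simp [hf, hg, h1, h2]
  by_cases hz : r ≤ ‖z‖
  · refine hle.trans (mul_le_mul_right ?_ _)
    rw [indicator_of_mem (by exact hz)]
    exact le_self_add
  push Not at hz
  by_cases hz2 : |t x - ν z| ≤ Λ * ‖z‖ ^ 2
  · refine hle.trans (mul_le_mul_right ?_ _)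
    rw [indicator_of_mem (s := {z : EV m | |t x - ν z| ≤ Λ * ‖z‖ ^ 2}) (by exact hz2)]
    exact le_add_self
  have hmove : x - z ∈ cthickening R K := by
    refine cthickening_mono (by linarith : r + r ≤ R) _ (cthick_move hx hr.le ?_)
    rw [dist_eq_norm]; simpa using hz.le
  have hiff := hC.mem_iff _ hmove
  have hta := hC.taylor0 x (-z)
  rw [norm_neg, map_neg, ← sub_eq_add_neg, ← hν] at hta
  have ha := abs_le.1 hta
  have : f z - g z = 0 := by
    by_cases h1 : x - z ∈ Ω
    · have h3 := hiff.1 h1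
      have h2 : ¬ t x ≤ ν z := by
        intro h2
        apply hz2
        rw [abs_le]; constructor <;> nlinarith [ha.1, ha.2, sq_nonneg ‖z‖, hC.lam_ge]
      simp [hf, hg, h1, h2]
    · have h3 : t (x - z) ≤ 0 := by
        by_contra hc; push Not at hc; exact h1 (hiff.2 hc)
      have h2 : t x ≤ ν z := by
        by_contra h2
        push Not at h2
        apply hz2
        rw [abs_le]; constructor <;> nlinarith [ha.1, ha.2, sq_nonneg ‖z‖, hC.lam_ge]
      simp [hf, hg, h1, h2]
  rw [this, enorm_zero]
  exact bot_le

/-- the half space integral is controlled by the conormal derivative -/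
lemma half_bound (h1 : A1 ρ) (h2 : A2 ρ) {lam : ℝ} (hlam : 0 < lam)
    (hg : ∀ ν : EV (n + 1) →L[ℝ] ℝ, lam * ‖ν‖ ^ 2 ≤ ν (MV (momentum ρ) ν))
    {ν : EV (n + 1) →L[ℝ] ℝ} (ℓ : EV (n + 1) →L[ℝ] ℝ) {Λ : ℝ} (hν1 : 1 ≤ ‖ν‖) (hνΛ : ‖ν‖ ≤ Λ) {τ ε : ℝ} (hτ : 0 < τ) (hε : 0 < ε) :
    ‖∫ z in {z | τ ≤ ν z}, kernelJ (scaled ρ ε) z * ℓ z‖ₑ ≤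
      ofReal (Λ / lam) * (‖ℓ (MV (momentum ρ) ν)‖ₑ * ∫⁻ z in {z | τ ≤ Λ * ‖z‖}, kap1 (scaled ρ ε) z) := by
  have hΛ : 0 ≤ Λ := (norm_nonneg _).trans hνΛ
  set G := ℓ (MV (momentum ρ) ν) with hG
  set g := ν (MV (momentum ρ) ν) with hgd
  have hglam : lam ≤ g := by
    refine le_trans ?_ (hg ν)
    exact le_mul_of_one_le_right hlam.le (one_le_pow₀ hν1)
  have hg0 : 0 < g := by linarith
  set ℓ' := ℓ - (G / g) • ν with hℓ'
  have hz : ∫ z in {z | τ ≤ ν z}, kernelJ (scaled ρ ε) z * ℓ' z = 0 := by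
    refine slice_zero_scaled h1 h2 ?_ ?_ hτ hε
    · intro hc; rw [hc, norm_zero] at hν1; linarith
    · simp only [hℓ', ContinuousLinearMap.sub_apply, ContinuousLinearMap.smul_apply, smul_eq_mul, ← hG, ← hgd]
      field_simp
      ring
  have hA := h1.scaled hε
  have e : ∫ z in {z | τ ≤ ν z}, kernelJ (scaled ρ ε) z * ℓ z = ∫ z in {z | τ ≤ ν z}, kernelJ (scaled ρ ε) z * ((G / g) • ν) z := by
    rw [← sub_eq_zero, ← integral_sub (int_odd_half hA ν ℓ hτ) (int_odd_half hA ν _ hτ), ← hz]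
    refine integral_congr_ae (ae_of_all _ fun z => ?_)
    simp only [hℓ', ContinuousLinearMap.sub_apply]
    ring
  rw [e]
  refine (enorm_integral_le_lintegral_enorm _).trans ?_
  calc _ ≤ ∫⁻ z in {z | τ ≤ ν z}, ‖(G / g) • ν‖ₑ * kap1 (scaled ρ ε) z := lintegral_mono fun z => kap1_bound hA _ z
    _ ≤ ∫⁻ z in {z | τ ≤ Λ * ‖z‖}, ‖(G / g) • ν‖ₑ * kap1 (scaled ρ ε) z := by
        refine lintegral_mono_set fun z hz => ?_
        have hz : τ ≤ ν z := hz
        refine hz.trans ((le_abs_self _).trans ((ν.le_opNorm z).trans ?_))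
        gcongr
    _ = ‖(G / g) • ν‖ₑ * ∫⁻ z in {z | τ ≤ Λ * ‖z‖}, kap1 (scaled ρ ε) z := lintegral_const_mul' _ _ enorm_ne_top
    _ ≤ (ofReal (Λ / lam) * ‖G‖ₑ) * ∫⁻ z in {z | τ ≤ Λ * ‖z‖}, kap1 (scaled ρ ε) z := by
        refine mul_le_mul_left ?_ _
        rw [← ofReal_norm, ← ofReal_norm, ← ofReal_mul (by positivity)]
        refine ofReal_le_ofReal ?_
        rw [norm_smul, norm_div, Real.norm_of_nonneg hg0.le]
        calc ‖G‖ / g * ‖ν‖ ≤ ‖G‖ / lam * Λ := by gcongr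
          _ = _ := by ring
    _ = _ := by rw [mul_assoc]
end pointwise
end

section
lemma kap1_eq {m : ℕ} {κ : EV m → ℝ} (h : A1 κ) (z : EV m) : kap1 κ z = ofReal (κ z) * ofReal ‖z‖⁻¹ := by
  rw [kap1, ← ofReal_mul (h.2.1 z), div_eq_mul_inv]

lemma kap1_sq {m : ℕ} {κ : EV m → ℝ} (h : A1 κ) (z : EV m) (c : ℝ) (hc : 0 ≤ c) :
    kap1 κ z * ofReal (c * ‖z‖ ^ 2) = ofReal c * (ofReal (κ z) * ‖z‖ₑ) := by
  have hk := h.2.1 z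
  rw [kap1, ← ofReal_norm z, ← ofReal_mul hk, ← ofReal_mul (by positivity), ← ofReal_mul hc]
  congr 1
  by_cases hz : ‖z‖ = 0
  · simp [hz]
  · field_simp

section T2
variable {m : ℕ} {Ω : Set (EV m)} {κ : EV m → ℝ} {Λ R : ℝ} {K : Set (EV m)} {e : EV m} {t : EV m → ℝ}

lemma IsChart.bandMeas (hC : IsChart Ω Λ R K e t) :
    MeasurableSet {p : EV m × EV m | |t p.1 - fderiv ℝ t p.1 p.2| ≤ Λ * ‖p.2‖ ^ 2} := by
  have h1 : Continuous (fderiv ℝ t) := hC.t_smooth.continuous_fderiv (by norm_num)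
  have h2 : Continuous t := hC.t_smooth.continuous
  have h3 : Continuous fun p : EV m × EV m => fderiv ℝ t p.1 p.2 := (h1.comp continuous_fst).clm_apply continuous_snd
  have h4 : Continuous fun p : EV m × EV m => t p.1 := h2.comp continuous_fst
  refine measurableSet_le ?_ (by fun_prop)
  exact (h4.sub h3).abs.measurable

lemma IsChart.T2 (hC : IsChart Ω Λ R K e t) (hΩ : IsOpen Ω) (h : A1 κ) {q : ℝ} (hq : 1 ≤ q) {r s0 : ℝ} (hr : 0 ≤ r)
    (hs0 : 0 < s0) (hrs : r + s0 ≤ R) {CE : ℝ≥0∞}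
    (hCE : ∀ x, ∫⁻ z in {z | |t x - fderiv ℝ t x z| ≤ Λ * ‖z‖ ^ 2}, kap1 κ z ≤ CE)
    {v : EV m → ℝ} (hv : ContDiff ℝ 2 v) :
    ∫⁻ x in Ω ∩ cthickening r K, (‖fderiv ℝ v x‖ₑ * ∫⁻ z in {z | |t x - fderiv ℝ t x z| ≤ Λ * ‖z‖ ^ 2}, kap1 κ z) ^ q ≤
      CE ^ (q - 1) * (ofReal s0⁻¹ * (2 ^ (q - 1) * (ofReal (2 * Λ) *
        (Lq q Ω (fderiv ℝ v) + ofReal s0 ^ q * Lq q Ω (fderiv ℝ (fderiv ℝ v)))))) * ∫⁻ z, ofReal (κ z) * ‖z‖ₑ := by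
  have hq0 : 0 < q := by linarith
  have hΛ := hC.lam_ge
  have hv1 : ContDiff ℝ 1 (fderiv ℝ v) := hv.fderiv_right (by norm_num)
  have hvm : Measurable fun x => ‖fderiv ℝ v x‖ₑ := hv1.continuous.enorm.measurable
  set A : Set (EV m × EV m) := {p | |t p.1 - fderiv ℝ t p.1 p.2| ≤ Λ * ‖p.2‖ ^ 2} with hA
  have hAm : MeasurableSet A := hC.bandMeas
  have hkm := kap1_meas h
  have hSm : MeasurableSet (Ω ∩ cthickening r K) := hΩ.measurableSet.inter isClosed_cthickening.measurableSet
  have hAx : ∀ x, MeasurableSet {z | |t x - fderiv ℝ t x z| ≤ Λ * ‖z‖ ^ 2} := fun x => hAm.preimage (measurable_prodMk_left (x := x))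
  have hAz : ∀ z, MeasurableSet {x | |t x - fderiv ℝ t x z| ≤ Λ * ‖z‖ ^ 2} := fun z => hAm.preimage (measurable_prodMk_right (y := z))
  set H : EV m × EV m → ℝ≥0∞ := A.indicator fun p => kap1 κ p.2 * ‖fderiv ℝ v p.1‖ₑ ^ q with hH
  have hHm : Measurable H := by
    refine Measurable.indicator ?_ hAm
    exact (hkm.comp measurable_snd).mul ((hvm.comp measurable_fst).pow_const q)
  calc _ ≤ ∫⁻ x in Ω ∩ cthickening r K, CE ^ (q - 1) * ∫⁻ z, H (x, z) := by
        refine lintegral_mono fun x => ?_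
        dsimp only
        have hj := jensen_lint (volume.restrict {z | |t x - fderiv ℝ t x z| ≤ Λ * ‖z‖ ^ 2}) hq (k := kap1 κ)
          (f := fun _ => ‖fderiv ℝ v x‖ₑ) hkm.aemeasurable aemeasurable_const
        rw [lintegral_mul_const' _ _ enorm_ne_top, mul_comm] at hj
        refine hj.trans ?_
        refine mul_le_mul' (ENNReal.rpow_le_rpow (hCE x) (by linarith)) (le_of_eq ?_)
        rw [← lintegral_indicator (hAx x)]
        rfl
    _ = CE ^ (q - 1) * ∫⁻ z, ∫⁻ x in Ω ∩ cthickening r K, H (x, z) := by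
        rw [lintegral_const_mul _ hHm.lintegral_prod_right', lintegral_lintegral_swap]
        exact hHm.aemeasurable
    _ ≤ CE ^ (q - 1) * ∫⁻ z, (ofReal s0⁻¹ * (2 ^ (q - 1) * (ofReal (2 * Λ) *
        (Lq q Ω (fderiv ℝ v) + ofReal s0 ^ q * Lq q Ω (fderiv ℝ (fderiv ℝ v)))))) * (ofReal (κ z) * ‖z‖ₑ) := by
        refine mul_le_mul_right (lintegral_mono fun z => ?_) _
        dsimp only
        have e1 : ∀ x, H (x, z) = {x | |t x - fderiv ℝ t x z| ≤ Λ * ‖z‖ ^ 2}.indicator (fun x => kap1 κ z * ‖fderiv ℝ v x‖ₑ ^ q) x := fun x => rfl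
        simp_rw [e1]
        rw [lintegral_indicator (hAz z), Measure.restrict_restrict (hAz z), lintegral_const_mul' _ _ (by simp [kap1])]
        have := hC.layer_z hΩ hq hr hs0 hrs z (Λ * ‖z‖ ^ 2) (fderiv ℝ v) hv1
        rw [Set.inter_comm]
        refine (mul_le_mul_right this _).trans (le_of_eq ?_)
        have e2 := kap1_sq h z (2 * Λ) (by linarith)
        rw [← mul_assoc 2 Λ]
        calc _ = (kap1 κ z * ofReal (2 * Λ * ‖z‖ ^ 2)) * (ofReal s0⁻¹ * (2 ^ (q - 1) *
                (Lq q Ω (fderiv ℝ v) + ofReal s0 ^ q * Lq q Ω (fderiv ℝ (fderiv ℝ v))))) := by ring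
          _ = _ := by rw [e2]; ring
    _ = _ := by
        rw [lintegral_const_mul]
        · ring
        · have := h.1
          fun_prop
end T2

section T3
variable {m : ℕ} {Ω : Set (EV m)} {κ : EV m → ℝ} {Λ R : ℝ} {K : Set (EV m)} {e : EV m} {t : EV m → ℝ}

lemma N2_parts (q : ℝ) (Ω : Set (EV m)) (v : EV m → ℝ) : Lq q Ω v ≤ N2 q Ω v ∧ Lq q Ω (fderiv ℝ v) ≤ N2 q Ω v ∧
    Lq q Ω (fderiv ℝ (fderiv ℝ v)) ≤ N2 q Ω v := by
  unfold N2
  refine ⟨?_, ?_, ?_⟩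
  · exact le_add_right le_self_add
  · exact le_add_right le_add_self
  · exact le_add_self

lemma N3_parts (q : ℝ) (Ω : Set (EV m)) (v : EV m → ℝ) : N2 q Ω v ≤ N3 q Ω v ∧
    Lq q Ω (fderiv ℝ (fderiv ℝ (fderiv ℝ v))) ≤ N3 q Ω v := by
  unfold N3
  exact ⟨le_self_add, le_add_self⟩

lemma Lq_sub_le {m : ℕ} {F : Type*} [NormedAddCommGroup F] {q : ℝ} (hq : 1 ≤ q)
    {S : Set (EV m)} {g h : EV m → F} (hg : Continuous g) :
    Lq q S (fun x => g x - h x) ≤ 2 ^ (q - 1) * (Lq q S g + Lq q S h) := by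
  unfold Lq
  refine lint_add_rpow_le _ hq _ _ _ hg.enorm.measurable.aemeasurable (ae_of_all _ fun x => ?_)
  exact enorm_sub_le

lemma Lq_apply_le {q Cv : ℝ} (hq : 0 ≤ q) (hCv0 : 0 ≤ Cv) {S : Set (EV m)} (f : EV m → EV m →L[ℝ] ℝ) (V : EV m → EV m) (hCv : ∀ x, ‖V x‖ ≤ Cv) :
    Lq q S (fun x => f x (V x)) ≤ ofReal Cv ^ q * Lq q S f := by
  unfold Lq
  rw [← lint_const_mul_rpow _ hq _ _ ofReal_ne_top]
  refine lintegral_mono fun x => ENNReal.rpow_le_rpow ?_ hq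
  rw [← ofReal_norm, ← ofReal_norm, ← ofReal_mul hCv0, mul_comm]
  refine ofReal_le_ofReal (((f x).le_opNorm _).trans ?_)
  gcongr
  exact hCv x

lemma IsChart.T3z (hC : IsChart Ω Λ R K e t) (hΩ : IsOpen Ω) {q : ℝ} (hq : 1 ≤ q) {r s0 Cv : ℝ} (hr : 0 ≤ r)
    (hs0 : 0 < s0) (hrs : r + 2 * s0 ≤ R) (V : EV m → EV m) (hV : ∀ x (s : ℝ), V (x + s • e) = V x)
    (hCv : ∀ x, ‖V x‖ ≤ Cv) :
    ∃ C : ℝ≥0∞, C ≠ ⊤ ∧ ∀ u w : EV m → ℝ, ContDiff ℝ 3 u → ContDiff ℝ 2 w →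
      (∀ x ∈ frontier Ω, x ∈ cthickening (r + s0) K → fderiv ℝ (fun x => u x - w x) x (V x) = 0) → ∀ z : EV m,
      ofReal ‖z‖⁻¹ ^ q * Lq q (chartLayer Ω r K t (Λ * ‖z‖)) (fun x => fderiv ℝ (fun x => u x - w x) x (V x)) ≤
        C * (‖z‖ₑ * N3 q Ω u + N2 q Ω w) := by
  have hq0 : 0 < q := by linarith
  have hΛ := hC.lam_ge
  have hΛ0 : 0 ≤ Λ := by linarith
  have hCv0 : 0 ≤ Cv := (norm_nonneg _).trans (hCv 0)
  set c1 : ℝ≥0∞ := ofReal s0⁻¹ * (2 ^ (q - 1) * (ofReal Λ * (1 + ofReal s0 ^ q))) with hc1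
  set c2 : ℝ≥0∞ := ofReal (Cv * Λ) ^ q * (2 ^ (q - 1) * (c1 + 1)) with hc2
  set c3 : ℝ≥0∞ := ofReal (Λ / s0) ^ q * (ofReal Cv ^ q * (2 ^ (q - 1) * (ofReal (Λ / s0) + 1))) with hc3
  have hn2 : (2 : ℝ≥0∞) ^ (q - 1) ≠ ⊤ := two_pow_ne_top (by linarith) (by simp)
  have hnf : ∀ a : ℝ, ofReal a ^ q ≠ ⊤ := fun a => two_pow_ne_top hq0.le ofReal_ne_top
  refine ⟨c2 + c3, ?_, ?_⟩
  · have h1 : c1 ≠ ⊤ := ENNReal.mul_ne_top ofReal_ne_top (ENNReal.mul_ne_top hn2 (ENNReal.mul_ne_top ofReal_ne_top (by simp [hnf s0])))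
    refine ENNReal.add_ne_top.2 ⟨ENNReal.mul_ne_top (hnf _) (ENNReal.mul_ne_top hn2 (by simp [h1])), ?_⟩
    exact ENNReal.mul_ne_top (hnf _) (ENNReal.mul_ne_top (hnf _) (ENNReal.mul_ne_top hn2 (by simp)))
  intro u w hu hw hbc z
  have hu2 : ContDiff ℝ 2 u := hu.of_le (by norm_num)
  have hv : ContDiff ℝ 2 (fun x => u x - w x) := hu2.sub hw
  have hu1 : ContDiff ℝ 2 (fderiv ℝ u) := hu.fderiv_right (by norm_num)
  have hu3 : ContDiff ℝ 1 (fderiv ℝ (fderiv ℝ u)) := hu1.fderiv_right (by norm_num)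
  have hz0 := norm_nonneg z
  by_cases hz : Λ * ‖z‖ ≤ s0
  · have h1 := hC.hardy hΩ hq hr (τ := Λ * ‖z‖) (by positivity) (by linarith) hv V hV hCv
      (fun x hx hx2 => hbc x hx (cthickening_mono (by linarith) _ hx2))
    have h2 : Lq q (chartLayer Ω (r + Λ * ‖z‖) K t (Λ * ‖z‖)) (fderiv ℝ (fderiv ℝ (fun x => u x - w x))) ≤
        2 ^ (q - 1) * (c1 * (‖z‖ₑ * N3 q Ω u) + N2 q Ω w) := by
      rw [fderiv2_sub' hu2 hw]
      refine (Lq_sub_le hq hu3.continuous).trans (mul_le_mul_right (add_le_add ?_ ?_) _)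
      · refine (hC.layer_t hΩ hq (by positivity) hs0 (by linarith) (Λ * ‖z‖) _ hu3).trans ?_
        rw [ofReal_mul hΛ0, ofReal_norm]
        calc _ ≤ ofReal s0⁻¹ * (2 ^ (q - 1) * (ofReal Λ * ‖z‖ₑ * (N3 q Ω u + ofReal s0 ^ q * N3 q Ω u))) := by
              gcongr
              · exact (N2_parts q Ω u).2.2.trans (N3_parts q Ω u).1
              · exact (N3_parts q Ω u).2
          _ = _ := by rw [hc1]; ring
      · exact (Lq_mono_set (chartLayer_sub _ _ _) _).trans (N2_parts q Ω w).2.2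
    calc _ ≤ ofReal ‖z‖⁻¹ ^ q * (ofReal (Cv * (Λ * ‖z‖)) ^ q * (2 ^ (q - 1) * (c1 * (‖z‖ₑ * N3 q Ω u) + N2 q Ω w))) := by
          refine mul_le_mul_right (h1.trans (mul_le_mul_right h2 _)) _
      _ = ofReal (‖z‖⁻¹ * (Cv * (Λ * ‖z‖))) ^ q * (2 ^ (q - 1) * (c1 * (‖z‖ₑ * N3 q Ω u) + N2 q Ω w)) := by
          rw [← mul_assoc, ← ENNReal.mul_rpow_of_nonneg _ _ hq0.le, ← ofReal_mul (by positivity)]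
      _ ≤ ofReal (Cv * Λ) ^ q * (2 ^ (q - 1) * ((c1 + 1) * (‖z‖ₑ * N3 q Ω u) + (c1 + 1) * N2 q Ω w)) := by
          have h3 : ‖z‖⁻¹ * (Cv * (Λ * ‖z‖)) ≤ Cv * Λ := by
            by_cases h0 : ‖z‖ = 0
            · simp [h0]; positivity
            · apply le_of_eq; field_simp
          refine mul_le_mul' (ENNReal.rpow_le_rpow (ofReal_le_ofReal h3) hq0.le) ?_
          gcongr
          · exact le_self_add
          · nth_rewrite 1 [← one_mul (N2 q Ω w)]
            gcongr
            exact le_add_self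
      _ = c2 * (‖z‖ₑ * N3 q Ω u + N2 q Ω w) := by rw [hc2]; ring
      _ ≤ _ := mul_le_mul_left le_self_add _
  · push Not at hz
    have hzp : 0 < ‖z‖ := by
      by_contra hc
      have : ‖z‖ = 0 := by linarith
      rw [this] at hz; linarith
    have h1 : Lq q (chartLayer Ω r K t (Λ * ‖z‖)) (fun x => fderiv ℝ (fun x => u x - w x) x (V x)) ≤
        ofReal Cv ^ q * (2 ^ (q - 1) * (N3 q Ω u + N2 q Ω w)) := by
      refine (Lq_apply_le hq0.le hCv0 _ V hCv).trans (mul_le_mul_right ?_ _)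
      refine (Lq_mono_set (chartLayer_sub _ _ _) _).trans ?_
      rw [fderiv_sub' hu2 hw]
      refine (Lq_sub_le hq hu1.continuous).trans (mul_le_mul_right (add_le_add ?_ ?_) _)
      · exact (N2_parts q Ω u).2.1.trans (N3_parts q Ω u).1
      · exact (N2_parts q Ω w).2.1
    have h2 : (1 : ℝ≥0∞) ≤ ofReal (Λ / s0) * ‖z‖ₑ := by
      rw [← ofReal_norm z, ← ofReal_mul (by positivity), ← ofReal_one]
      apply ofReal_le_ofReal
      rw [div_mul_eq_mul_div, le_div_iff₀ hs0]; linarith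
    calc _ ≤ ofReal (Λ / s0) ^ q * (ofReal Cv ^ q * (2 ^ (q - 1) * (N3 q Ω u + N2 q Ω w))) := by
          refine mul_le_mul' (ENNReal.rpow_le_rpow (ofReal_le_ofReal ?_) hq0.le) h1
          rw [le_div_iff₀ hs0, inv_mul_le_iff₀ hzp]; linarith
      _ ≤ ofReal (Λ / s0) ^ q * (ofReal Cv ^ q * (2 ^ (q - 1) * ((ofReal (Λ / s0) + 1) * (‖z‖ₑ * N3 q Ω u) + (ofReal (Λ / s0) + 1) * N2 q Ω w))) := by
          gcongr
          · calc N3 q Ω u = 1 * N3 q Ω u := (one_mul _).symm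
              _ ≤ (ofReal (Λ / s0) * ‖z‖ₑ) * N3 q Ω u := by gcongr
              _ ≤ ((ofReal (Λ / s0) + 1) * ‖z‖ₑ) * N3 q Ω u := by gcongr; exact le_self_add
              _ = _ := by ring
          · nth_rewrite 1 [← one_mul (N2 q Ω w)]
            gcongr
            exact le_add_self
      _ = c3 * (‖z‖ₑ * N3 q Ω u + N2 q Ω w) := by rw [hc3]; ring
      _ ≤ _ := mul_le_mul_left le_add_self _

lemma IsChart.T3 (hC : IsChart Ω Λ R K e t) (hΩ : IsOpen Ω) {q : ℝ} (hq : 1 ≤ q) {r s0 Cv : ℝ} (hr : 0 ≤ r)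
    (hs0 : 0 < s0) (hrs : r + 2 * s0 ≤ R) (V : EV m → EV m) (hVc : Continuous V) (hV : ∀ x (s : ℝ), V (x + s • e) = V x)
    (hCv : ∀ x, ‖V x‖ ≤ Cv) :
    ∃ C : ℝ≥0∞, C ≠ ⊤ ∧ ∀ κ : EV m → ℝ, A1 κ → ∀ u w : EV m → ℝ, ContDiff ℝ 3 u → ContDiff ℝ 2 w →
      (∀ x ∈ frontier Ω, x ∈ cthickening (r + s0) K → fderiv ℝ (fun x => u x - w x) x (V x) = 0) →
      ∫⁻ x in Ω ∩ cthickening r K, (‖fderiv ℝ (fun x => u x - w x) x (V x)‖ₑ * ∫⁻ z in {z | t x ≤ Λ * ‖z‖}, kap1 κ z) ^ q ≤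
        C * (∫⁻ z, ofReal (κ z)) ^ (q - 1) *
          ((∫⁻ z, ofReal (κ z) * ‖z‖ₑ) * N3 q Ω u + (∫⁻ z, ofReal (κ z)) * N2 q Ω w) := by
  have hq0 : 0 < q := by linarith
  obtain ⟨C, hCt, hCb⟩ := hC.T3z hΩ hq hr hs0 hrs V hV hCv
  refine ⟨C, hCt, ?_⟩
  intro κ h u w hu hw hbc
  have hv : ContDiff ℝ 2 (fun x => u x - w x) := (hu.of_le (by norm_num)).sub hw
  have hv1 : Continuous (fderiv ℝ (fun x => u x - w x)) := hv.continuous_fderiv (by norm_num)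
  have htc : Continuous t := hC.t_smooth.continuous
  set G : EV m → ℝ := fun x => fderiv ℝ (fun x => u x - w x) x (V x) with hG
  have hGc : Continuous G := hv1.clm_apply hVc
  have hκ := h.1
  set A : Set (EV m × EV m) := {p | t p.1 ≤ Λ * ‖p.2‖} with hA
  have hAm : MeasurableSet A := measurableSet_le (htc.comp continuous_fst).measurable (by fun_prop)
  have hAx : ∀ x, MeasurableSet {z : EV m | t x ≤ Λ * ‖z‖} := fun x => hAm.preimage (measurable_prodMk_left (x := x))
  have hAz : ∀ z : EV m, MeasurableSet {x | t x ≤ Λ * ‖z‖} := fun z => hAm.preimage (measurable_prodMk_right (y := z))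
  have hSm : MeasurableSet (Ω ∩ cthickening r K) := hΩ.measurableSet.inter isClosed_cthickening.measurableSet
  set F : EV m → EV m → ℝ≥0∞ := fun x z => A.indicator (fun p => ofReal ‖p.2‖⁻¹ * ‖G p.1‖ₑ) (x, z) with hF
  have hFm : Measurable (Function.uncurry F) := by
    have hGm : Measurable fun x => ‖G x‖ₑ := hGc.enorm.measurable
    have h1 : Measurable fun p : EV m × EV m => ofReal ‖p.2‖⁻¹ := by fun_prop
    exact (h1.mul (hGm.comp measurable_fst)).indicator hAm
  have hkm : Measurable fun z => ofReal (κ z) := by fun_prop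
  have hj := jensen_fubini hq (Ω ∩ cthickening r K) (Set.univ : Set (EV m)) hkm hFm
  rw [Measure.restrict_univ] at hj
  calc _ = ∫⁻ x in Ω ∩ cthickening r K, (∫⁻ z, ofReal (κ z) * F x z) ^ q := by
        refine lintegral_congr fun x => ?_
        congr 1
        rw [← lintegral_indicator (hAx x), ← lintegral_const_mul' _ _ enorm_ne_top]
        refine lintegral_congr fun z => ?_
        by_cases hz : t x ≤ Λ * ‖z‖
        · have : (x, z) ∈ A := hz
          simp only [hF, indicator_of_mem this]
          rw [indicator_of_mem (by exact hz), kap1_eq h]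
          ring
        · have : (x, z) ∉ A := hz
          simp only [hF, indicator_of_notMem this]
          rw [indicator_of_notMem (by exact hz)]
          ring
    _ ≤ _ := hj
    _ ≤ (∫⁻ z, ofReal (κ z)) ^ (q - 1) * ∫⁻ z, ofReal (κ z) * (C * (‖z‖ₑ * N3 q Ω u + N2 q Ω w)) := by
        refine mul_le_mul_right (lintegral_mono fun z => mul_le_mul_right ?_ _) _
        refine le_trans (le_of_eq ?_) (hCb u w hu hw hbc z)
        have e1 : ∀ x, F x z ^ q = {x | t x ≤ Λ * ‖z‖}.indicator (fun x => (ofReal ‖z‖⁻¹ * ‖G x‖ₑ) ^ q) x := by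
          intro x
          by_cases hz : t x ≤ Λ * ‖z‖
          · have : (x, z) ∈ A := hz
            simp only [hF, indicator_of_mem this]
            rw [indicator_of_mem (by exact hz)]
          · have : (x, z) ∉ A := hz
            simp only [hF, indicator_of_notMem this]
            rw [indicator_of_notMem (by exact hz), ENNReal.zero_rpow_of_pos hq0]
        simp_rw [e1]
        rw [lintegral_indicator (hAz z), Measure.restrict_restrict (hAz z), lint_const_mul_rpow _ hq0.le _ _ ofReal_ne_top,
          Set.inter_comm]
        rfl
    _ = _ := by
        have e2 : ∀ z : EV m, ofReal (κ z) * (C * (‖z‖ₑ * N3 q Ω u + N2 q Ω w)) =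
          (C * N3 q Ω u) * (ofReal (κ z) * ‖z‖ₑ) + (C * N2 q Ω w) * ofReal (κ z) := fun z => by ring
        simp_rw [e2]
        rw [lintegral_add_left (by fun_prop), lintegral_const_mul _ (by fun_prop), lintegral_const_mul _ (by fun_prop)]
        ring
end T3
end

section
lemma sec_meas {m : ℕ} {A : Set (EV m × EV m)} (hA : MeasurableSet A) {k : EV m → ℝ≥0∞} (hk : Measurable k) :
    Measurable fun x => ∫⁻ z in {z | (x, z) ∈ A}, k z := by
  have hm : Measurable (A.indicator fun p : EV m × EV m => k p.2) := (hk.comp measurable_snd).indicator hA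
  have : (fun x => ∫⁻ z in {z | (x, z) ∈ A}, k z) = fun x => ∫⁻ z, A.indicator (fun p : EV m × EV m => k p.2) (x, z) := by
    funext x
    have hA' : MeasurableSet {z | (x, z) ∈ A} := hA.preimage (measurable_prodMk_left (x := x))
    rw [← lintegral_indicator hA']
    rfl
  rw [this]
  exact hm.lintegral_prod_right'

lemma N2_sub {m : ℕ} {Ω : Set (EV m)} {q : ℝ} (hq : 1 ≤ q) {u w : EV m → ℝ} (hu : ContDiff ℝ 2 u) (hw : ContDiff ℝ 2 w) :
    N2 q Ω (fun x => u x - w x) ≤ 2 ^ (q - 1) * (N2 q Ω u + N2 q Ω w) := by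
  have h1 : ContDiff ℝ 1 (fderiv ℝ u) := hu.fderiv_right (by norm_num)
  unfold N2
  rw [fderiv2_sub' hu hw, fderiv_sub' hu hw]
  calc _ ≤ 2 ^ (q - 1) * (Lq q Ω u + Lq q Ω w) + 2 ^ (q - 1) * (Lq q Ω (fderiv ℝ u) + Lq q Ω (fderiv ℝ w)) +
        2 ^ (q - 1) * (Lq q Ω (fderiv ℝ (fderiv ℝ u)) + Lq q Ω (fderiv ℝ (fderiv ℝ w))) := by
        gcongr
        · exact Lq_sub_le hq hu.continuous
        · exact Lq_sub_le hq h1.continuous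
        · exact Lq_sub_le hq (h1.continuous_fderiv (by norm_num))
    _ = _ := by ring

section core
variable {n : ℕ} {ρ : EV (n + 1) → ℝ} {Ω : Set (EV (n + 1))} {ι : Type} [Fintype ι] {Λ R : ℝ}
  {e : ι → EV (n + 1)} {t : ι → EV (n + 1) → ℝ} {ζ : ι → EV (n + 1) → ℝ}

/-- pointwise bound of `betaD` -/
lemma IsAtlas.beta_pt (hA : IsAtlas Ω Λ R e t ζ) (h1 : A1 ρ) (h2 : A2 ρ) {lam : ℝ} (hlam : 0 < lam)
    (hg : ∀ ν : EV (n + 1) →L[ℝ] ℝ, lam * ‖ν‖ ^ 2 ≤ ν (MV (momentum ρ) ν)) {r0 : ℝ} (hr0 : 0 < r0) (hr2 : 2 * r0 ≤ R)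
    {ε : ℝ} (hε : 0 < ε) (ℓ : EV (n + 1) → EV (n + 1) →L[ℝ] ℝ) {x : EV (n + 1)} (hx : x ∈ Ω) :
    ‖betaD (scaled ρ ε) Ω (ℓ x) x‖ₑ ≤ ‖ℓ x‖ₑ * (ofReal (r0 ^ 2)⁻¹ * ∫⁻ z, ofReal (scaled ρ ε z) * ‖z‖ₑ) +
      ((∑ j, (Ω ∩ cthickening r0 (tsupport (ζ j))).indicator (fun x => ‖ℓ x‖ₑ * ∫⁻ z in {z | |t j x - fderiv ℝ (t j) x z| ≤ Λ * ‖z‖ ^ 2}, kap1 (scaled ρ ε) z) x)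
       + (∑ j, (Ω ∩ cthickening r0 (tsupport (ζ j))).indicator (fun x => ofReal (Λ / lam) * (‖ℓ x (MV (momentum ρ) (fderiv ℝ (t j) x))‖ₑ *
          ∫⁻ z in {z | t j x ≤ Λ * ‖z‖}, kap1 (scaled ρ ε) z)) x)) := by
  have hS := h1.scaled hε
  have hR := hA.R_pos
  by_cases hc : x ∈ cthickening r0 Ωᶜ
  · obtain ⟨j, hj, -⟩ := hA.cover hx hr0.le le_rfl (by linarith) hc
    have hC := hA.chart j
    have hxr : x ∈ cthickening r0 (tsupport (ζ j)) := cthick_self hj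
    have ht0 : 0 < t j x := (hC.mem_iff x (cthickening_mono (by linarith) _ hxr)).1 hx
    have hνe := hC.fderiv_e x
    have hν1 : 1 ≤ ‖fderiv ℝ (t j) x‖ := by
      have := (fderiv ℝ (t j) x).le_opNorm (e j)
      rw [hνe, hC.e_norm, mul_one] at this
      simpa using this
    have hb := hC.betaD_near hA.isOpen hS (ℓ x) hr0 hr2 hx hxr
    have hh := half_bound h1 h2 hlam hg (ℓ x) hν1 (hC.t_lip x) ht0 hε
    have hmem : x ∈ Ω ∩ cthickening r0 (tsupport (ζ j)) := ⟨hx, hxr⟩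
    refine hb.trans ?_
    rw [mul_add, add_comm, add_assoc]
    refine add_le_add le_rfl (add_le_add ?_ (hh.trans ?_))
    · refine le_trans (le_of_eq ?_) (Finset.single_le_sum (fun _ _ => bot_le) (Finset.mem_univ j))
      rw [indicator_of_mem hmem]
    · refine le_trans (le_of_eq ?_) (Finset.single_le_sum (fun _ _ => bot_le) (Finset.mem_univ j))
      rw [indicator_of_mem hmem]
  · exact (betaD_far hS (ℓ x) hr0 hc).trans le_self_add

/-- the `L^q` estimate for `betaD` -/
lemma IsAtlas.beta_est (hA : IsAtlas Ω Λ R e t ζ) (h1 : A1 ρ) (h2 : A2 ρ) {q : ℝ} (hq : 1 ≤ q) :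
    ∃ C : ℝ≥0∞, C ≠ ⊤ ∧ ∀ ε : ℝ, 0 < ε → ε ≤ 1 → ∀ u w : EV (n + 1) → ℝ, ContDiff ℝ 3 u → ContDiff ℝ 2 w →
      (∀ j, ∀ x ∈ frontier Ω, x ∈ cthickening (R / 2) (tsupport (ζ j)) →
        fderiv ℝ (fun x => u x - w x) x (MV (momentum ρ) (fderiv ℝ (t j) x)) = 0) →
      ∫⁻ x in Ω, ‖betaD (scaled ρ ε) Ω (fderiv ℝ (fun x => u x - w x) x) x‖ₑ ^ q ≤
        C * (ofReal ε * N3 q Ω u + N2 q Ω w) := by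
  have hq0 : 0 < q := by linarith
  obtain ⟨lam, hlam, hg⟩ := gpos h2
  obtain ⟨CM, hCM0, hCM⟩ := norm_MV_le (momentum ρ)
  have hΛ := hA.lam_ge
  obtain ⟨CE, hCEt, hCE⟩ := supE h2 (Θ := Λ) (by linarith)
  have hR := hA.R_pos
  obtain ⟨r0, hr0, hr0d⟩ : ∃ r0 : ℝ, 0 < r0 ∧ R = 8 * r0 := ⟨R / 8, by positivity, by ring⟩
  have hΩ := hA.isOpen
  have hΩm := hΩ.measurableSet
  have hVc : ∀ j, Continuous fun x => MV (momentum ρ) (fderiv ℝ (t j) x) := by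
    intro j
    have h0 : Continuous (fderiv ℝ (t j)) := (hA.chart j).t_smooth.continuous_fderiv (by norm_num)
    have hc : Continuous fun ν : EV (n + 1) →L[ℝ] ℝ => MV (momentum ρ) ν := by
      unfold MV
      refine (PiLp.continuous_toLp 2 _).comp (continuous_pi fun k => ?_)
      fun_prop
    exact hc.comp h0
  have hT3 : ∀ j, _ := fun j => (hA.chart j).T3 hΩ hq hr0.le hr0 (by linarith) (fun x => MV (momentum ρ) (fderiv ℝ (t j) x)) (hVc j)
    (fun x s => by rw [(hA.chart j).fderiv_shift]) (Cv := CM * Λ)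
    (fun x => (hCM _).trans (mul_le_mul_of_nonneg_left ((hA.chart j).t_lip x) hCM0))
  choose C3 hC3t hC3 using hT3
  set I0 := ∫⁻ z, ofReal (ρ z) with hI0
  set I1 := ∫⁻ z, ofReal (ρ z) * ‖z‖ₑ with hI1
  have hI0t : I0 ≠ ⊤ := by
    have := h1.int0.2
    rw [HasFiniteIntegral] at this
    refine ne_top_of_le_ne_top this.ne (lintegral_mono fun z => ?_)
    rw [← ofReal_norm, Real.norm_of_nonneg (h1.2.1 z)]
  have hI1t : I1 ≠ ⊤ := by
    have := h1.int1.2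
    rw [HasFiniteIntegral] at this
    refine ne_top_of_le_ne_top this.ne (lintegral_mono fun z => ?_)
    rw [enorm_mul, ← ofReal_norm (ρ z), Real.norm_of_nonneg (h1.2.1 z), enorm_norm]
  set P : ℝ≥0∞ := 2 ^ (q - 1) with hP
  have hPt : P ≠ ⊤ := hP ▸ two_pow_ne_top (by linarith) (by simp)
  set Nι : ℝ≥0∞ := ((Finset.univ : Finset ι).card : ℝ≥0∞) ^ (q - 1) with hNι
  have hNt : Nι ≠ ⊤ := two_pow_ne_top (by linarith) (by simp)
  set k1 := (ofReal (r0 ^ 2)⁻¹ * I1) ^ q * P with hk1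
  set k2 := CE ^ (q - 1) * (ofReal r0⁻¹ * (P * (ofReal (2 * Λ) * (1 + ofReal r0 ^ q)))) * I1 * P with hk2
  set k3 : ι → ℝ≥0∞ := fun j => ofReal (Λ / lam) ^ q * (C3 j * I0 ^ (q - 1) * (I1 + I0)) with hk3
  have hpt : ∀ {a : ℝ≥0∞}, a ≠ ⊤ → a ^ q ≠ ⊤ := fun h => two_pow_ne_top hq0.le h
  have hpt1 : ∀ {a : ℝ≥0∞}, a ≠ ⊤ → a ^ (q - 1) ≠ ⊤ := fun h => two_pow_ne_top (by linarith) h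
  have hk1t : k1 ≠ ⊤ := ENNReal.mul_ne_top (hpt (ENNReal.mul_ne_top ofReal_ne_top hI1t)) hPt
  have hk2t : k2 ≠ ⊤ := by
    refine ENNReal.mul_ne_top (ENNReal.mul_ne_top (ENNReal.mul_ne_top (hpt1 hCEt) (ENNReal.mul_ne_top ofReal_ne_top
      (ENNReal.mul_ne_top hPt (ENNReal.mul_ne_top ofReal_ne_top ?_)))) hI1t) hPt
    simp [hpt ofReal_ne_top]
  have hk3t : ∀ j, k3 j ≠ ⊤ := fun j => ENNReal.mul_ne_top (hpt ofReal_ne_top)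
    (ENNReal.mul_ne_top (ENNReal.mul_ne_top (hC3t j) (hpt1 hI0t)) (by simp [hI0t, hI1t]))
  refine ⟨P * (k1 + P * (Nι * (∑ _j : ι, k2) + Nι * ∑ j, k3 j)), ?_, ?_⟩
  · refine ENNReal.mul_ne_top hPt (ENNReal.add_ne_top.2 ⟨hk1t, ENNReal.mul_ne_top hPt (ENNReal.add_ne_top.2 ⟨?_, ?_⟩)⟩)
    · exact ENNReal.mul_ne_top hNt (ENNReal.sum_ne_top.2 fun _ _ => hk2t)
    · exact ENNReal.mul_ne_top hNt (ENNReal.sum_ne_top.2 fun j _ => hk3t j)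
  clear_value k1 k2 k3 Nι I0 I1
  intro ε hε hε1 u w hu hw hbc
  have hu2 : ContDiff ℝ 2 u := hu.of_le (by norm_num)
  have hS := h1.scaled hε
  set v : EV (n + 1) → ℝ := fun x => u x - w x with hvd
  have hv : ContDiff ℝ 2 v := hu2.sub hw
  have hv1 : Continuous (fderiv ℝ v) := hv.continuous_fderiv (by norm_num)
  set X := ofReal ε * N3 q Ω u + N2 q Ω w with hX
  have hεo : ofReal ε ≤ 1 := by simpa using hε1
  have hN2 : ofReal ε * N2 q Ω v ≤ P * X := by
    calc ofReal ε * N2 q Ω v ≤ ofReal ε * (P * (N2 q Ω u + N2 q Ω w)) := mul_le_mul_right (hP ▸ N2_sub hq hu2 hw) _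
      _ = P * (ofReal ε * N2 q Ω u + ofReal ε * N2 q Ω w) := by ring
      _ ≤ P * (ofReal ε * N3 q Ω u + 1 * N2 q Ω w) := by
          gcongr
          exact (N3_parts q Ω u).1
      _ = _ := by rw [one_mul]
  have hJ1 : ∫⁻ z, ofReal (scaled ρ ε z) * ‖z‖ₑ = ofReal ε * I1 := (lint_scaled1 h1.1 hε).trans (by rw [hI1])
  have hJ0 : ∫⁻ z, ofReal (scaled ρ ε z) = I0 := (lint_scaled0 h1.1 hε).trans hI0.symm
  have hSm : ∀ j, MeasurableSet (Ω ∩ cthickening r0 (tsupport (ζ j))) := fun j => hΩm.inter isClosed_cthickening.measurableSet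
  have hvm : Measurable fun x => ‖fderiv ℝ v x‖ₑ := hv1.enorm.measurable
  set a : EV (n + 1) → ℝ≥0∞ := fun x => ‖fderiv ℝ v x‖ₑ * (ofReal (r0 ^ 2)⁻¹ * (ofReal ε * I1)) with ha
  set b : ι → EV (n + 1) → ℝ≥0∞ := fun j => (Ω ∩ cthickening r0 (tsupport (ζ j))).indicator (fun x => ‖fderiv ℝ v x‖ₑ *
    ∫⁻ z in {z | |t j x - fderiv ℝ (t j) x z| ≤ Λ * ‖z‖ ^ 2}, kap1 (scaled ρ ε) z) with hb
  set c : ι → EV (n + 1) → ℝ≥0∞ := fun j => (Ω ∩ cthickening r0 (tsupport (ζ j))).indicator (fun x => ofReal (Λ / lam) *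
    (‖fderiv ℝ v x (MV (momentum ρ) (fderiv ℝ (t j) x))‖ₑ * ∫⁻ z in {z | t j x ≤ Λ * ‖z‖}, kap1 (scaled ρ ε) z)) with hc
  have ham : Measurable a := by
    rw [ha]; exact hvm.mul_const _
  have hbm : ∀ j, Measurable (b j) := fun j =>
    (hvm.mul (sec_meas (hA.chart j).bandMeas (kap1_meas hS))).indicator (hSm j)
  have hcm : ∀ j, Measurable (c j) := fun j => by
    have hAm : MeasurableSet {p : EV (n + 1) × EV (n + 1) | t j p.1 ≤ Λ * ‖p.2‖} :=
      measurableSet_le ((hA.chart j).t_smooth.continuous.comp continuous_fst).measurable (by fun_prop)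
    have hGm : Measurable fun x => ‖fderiv ℝ v x (MV (momentum ρ) (fderiv ℝ (t j) x))‖ₑ := (hv1.clm_apply (hVc j)).enorm.measurable
    exact ((hGm.mul (sec_meas hAm (kap1_meas hS))).const_mul _).indicator (hSm j)
  have hpoint : ∀ᵐ x ∂(volume.restrict Ω), ‖betaD (scaled ρ ε) Ω (fderiv ℝ v x) x‖ₑ ≤ a x + ((∑ j, b j x) + ∑ j, c j x) := by
    rw [ae_restrict_iff' hΩm]
    refine ae_of_all _ fun x hx => ?_
    have := hA.beta_pt h1 h2 hlam hg hr0 (by linarith) hε (fderiv ℝ v) hx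
    rw [hJ1] at this
    exact this
  have hsub : ∀ j, Ω ∩ cthickening r0 (tsupport (ζ j)) ⊆ Ω := fun j => Set.inter_subset_left
  have est_a : ∫⁻ x in Ω, a x ^ q ≤ k1 * X := by
    have : ∀ x, a x = (ofReal (r0 ^ 2)⁻¹ * (ofReal ε * I1)) * ‖fderiv ℝ v x‖ₑ := fun x => mul_comm _ _
    simp_rw [this]
    rw [lint_const_mul_rpow _ hq0.le _ _ (ENNReal.mul_ne_top ofReal_ne_top (ENNReal.mul_ne_top ofReal_ne_top hI1t))]
    have e1 : ofReal (r0 ^ 2)⁻¹ * (ofReal ε * I1) = ofReal ε * (ofReal (r0 ^ 2)⁻¹ * I1) := by ring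
    rw [e1, ENNReal.mul_rpow_of_nonneg _ _ hq0.le]
    calc _ ≤ ofReal ε * (ofReal (r0 ^ 2)⁻¹ * I1) ^ q * N2 q Ω v := by
          refine mul_le_mul' (mul_le_mul_left ?_ _) (N2_parts q Ω v).2.1
          calc ofReal ε ^ q ≤ ofReal ε ^ (1 : ℝ) := ENNReal.rpow_le_rpow_of_exponent_ge hεo hq
            _ = _ := ENNReal.rpow_one _
      _ = (ofReal (r0 ^ 2)⁻¹ * I1) ^ q * (ofReal ε * N2 q Ω v) := by ring
      _ ≤ (ofReal (r0 ^ 2)⁻¹ * I1) ^ q * (P * X) := mul_le_mul_right hN2 _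
      _ = _ := by rw [hk1]; ring
  have hind : ∀ j (f : EV (n + 1) → ℝ≥0∞), ∫⁻ x in Ω, (Ω ∩ cthickening r0 (tsupport (ζ j))).indicator f x ^ q =
      ∫⁻ x in Ω ∩ cthickening r0 (tsupport (ζ j)), f x ^ q := by
    intro j f
    have : ∀ x, (Ω ∩ cthickening r0 (tsupport (ζ j))).indicator f x ^ q = (Ω ∩ cthickening r0 (tsupport (ζ j))).indicator (fun x => f x ^ q) x := by
      intro x
      by_cases hx : x ∈ Ω ∩ cthickening r0 (tsupport (ζ j))
      · rw [indicator_of_mem hx, indicator_of_mem hx]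
      · rw [indicator_of_notMem hx, indicator_of_notMem hx, ENNReal.zero_rpow_of_pos hq0]
    simp_rw [this]
    rw [lintegral_indicator (hSm j), Measure.restrict_restrict (hSm j), Set.inter_eq_left.2 (hsub j)]
  have est_b : ∀ j, ∫⁻ x in Ω, b j x ^ q ≤ k2 * X := by
    intro j
    rw [hb]
    dsimp only
    rw [hind]
    refine ((hA.chart j).T2 hΩ hS hq hr0.le hr0 (by linarith) (CE := CE) (fun x => hCE ε hε (e j) _ _ (hA.chart j).e_norm ((hA.chart j).fderiv_e x)) hv).trans ?_
    rw [hJ1, ← hP]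
    calc _ ≤ CE ^ (q - 1) * (ofReal r0⁻¹ * (P * (ofReal (2 * Λ) * (N2 q Ω v + ofReal r0 ^ q * N2 q Ω v)))) * (ofReal ε * I1) := by
          gcongr
          · exact (N2_parts q Ω v).2.1
          · exact (N2_parts q Ω v).2.2
      _ = CE ^ (q - 1) * (ofReal r0⁻¹ * (P * (ofReal (2 * Λ) * (1 + ofReal r0 ^ q)))) * I1 * (ofReal ε * N2 q Ω v) := by ring
      _ ≤ CE ^ (q - 1) * (ofReal r0⁻¹ * (P * (ofReal (2 * Λ) * (1 + ofReal r0 ^ q)))) * I1 * (P * X) := mul_le_mul_right hN2 _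
      _ = _ := by rw [hk2]; ring
  have est_c : ∀ j, ∫⁻ x in Ω, c j x ^ q ≤ k3 j * X := by
    intro j
    rw [hc]
    dsimp only
    rw [hind, lint_const_mul_rpow _ hq0.le _ _ ofReal_ne_top]
    have := hC3 j (scaled ρ ε) hS u w hu hw (fun x hx hx2 => hbc j x hx (cthickening_mono (by linarith) _ hx2))
    rw [hJ1, hJ0] at this
    refine (mul_le_mul_right this _).trans ?_
    rw [hk3]
    dsimp only
    rw [mul_assoc (ofReal (Λ / lam) ^ q), mul_assoc (C3 j * I0 ^ (q - 1))]
    refine mul_le_mul_right (mul_le_mul_right ?_ _) _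
    calc ofReal ε * I1 * N3 q Ω u + I0 * N2 q Ω w = I1 * (ofReal ε * N3 q Ω u) + I0 * N2 q Ω w := by ring
      _ ≤ I1 * X + I0 * X := by
          gcongr
          · exact le_self_add
          · exact le_add_self
      _ = _ := by ring
  calc _ ≤ P * ((∫⁻ x in Ω, a x ^ q) + ∫⁻ x in Ω, ((∑ j, b j x) + ∑ j, c j x) ^ q) :=
        (lint_add_rpow_le _ hq _ _ _ ham.aemeasurable hpoint).trans (by rw [hP])
    _ ≤ P * (k1 * X + P * ((∫⁻ x in Ω, (∑ j, b j x) ^ q) + ∫⁻ x in Ω, (∑ j, c j x) ^ q)) := by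
        refine mul_le_mul_right (add_le_add est_a ?_) _
        rw [hP]
        refine lint_add_rpow_le _ hq _ (fun x => ∑ j, b j x) _ ?_ (ae_of_all _ fun x => le_rfl)
        exact (Finset.measurable_fun_sum _ fun j _ => hbm j).aemeasurable
    _ ≤ P * (k1 * X + P * (Nι * (∑ j : ι, k2 * X) + Nι * (∑ j, k3 j * X))) := by
        refine mul_le_mul_right (add_le_add le_rfl (mul_le_mul_right (add_le_add ?_ ?_) _)) _
        · rw [hNι]; exact (lint_sum_rpow_le _ Finset.univ hq _ b (fun j _ => (hbm j).aemeasurable) (ae_of_all _ fun x => le_rfl)).trans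
            (mul_le_mul_right (sum_le_sum fun j _ => est_b j) _)
        · rw [hNι]; exact (lint_sum_rpow_le _ Finset.univ hq _ c (fun j _ => (hcm j).aemeasurable) (ae_of_all _ fun x => le_rfl)).trans
            (mul_le_mul_right (sum_le_sum fun j _ => est_c j) _)
    _ = _ := by
        have s1 : (∑ _j : ι, k2 * X) = (∑ _j : ι, k2) * X := (sum_mul _ _ _).symm
        have s2 : (∑ j : ι, k3 j * X) = (∑ j : ι, k3 j) * X := (sum_mul _ _ _).symm
        rw [s1, s2]
        generalize (∑ j : ι, k3 j) = S3
        generalize (∑ j : ι, k2) = S2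
        ring

/-- core estimate for `C²` functions satisfying the boundary condition -/
theorem IsAtlas.core (hA : IsAtlas Ω Λ R e t ζ) (h1 : A1 ρ) (h2 : A2 ρ) {q : ℝ} (hq : 1 ≤ q) :
    ∃ C : ℝ≥0∞, C ≠ ⊤ ∧ ∀ ε : ℝ, 0 < ε → ε ≤ 1 → ∀ u w : EV (n + 1) → ℝ, ContDiff ℝ 3 u → ContDiff ℝ 2 w →
      HasCompactSupport (fun x => u x - w x) →
      (∀ j, ∀ x ∈ frontier Ω, x ∈ cthickening (R / 2) (tsupport (ζ j)) →
        fderiv ℝ (fun x => u x - w x) x (MV (momentum ρ) (fderiv ℝ (t j) x)) = 0) →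
      ∀ T : EV (n + 1) → ℝ, (∀ᵐ x ∂(volume.restrict Ω), pvAt Ω ρ ε (fun x => u x - w x) x (T x)) →
      ∫⁻ x in Ω, ‖T x + MHess (momentum ρ) (fun x => u x - w x) x‖ₑ ^ q ≤
        C * (ofReal ε * N3 q Ω u + N2 q Ω w) := by
  have hq0 : 0 < q := by linarith
  obtain ⟨Cb, hCbt, hCb⟩ := hA.beta_est h1 h2 hq
  obtain ⟨Cr, hCrt, hCr⟩ := hA.rem_est hq
  set I0 := ∫⁻ z, ofReal (ρ z) with hI0
  set I1 := ∫⁻ z, ofReal (ρ z) * ‖z‖ₑ with hI1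
  have hI0t : I0 ≠ ⊤ := by
    have := h1.int0.2
    rw [HasFiniteIntegral] at this
    refine ne_top_of_le_ne_top this.ne (lintegral_mono fun z => ?_)
    rw [← ofReal_norm, Real.norm_of_nonneg (h1.2.1 z)]
  have hI1t : I1 ≠ ⊤ := by
    have := h1.int1.2
    rw [HasFiniteIntegral] at this
    refine ne_top_of_le_ne_top this.ne (lintegral_mono fun z => ?_)
    rw [enorm_mul, ← ofReal_norm (ρ z), Real.norm_of_nonneg (h1.2.1 z), enorm_norm]
  refine ⟨2 ^ (q - 1) * (Cr * I0 ^ (q - 1) * (I1 + I0) + Cb), ?_, ?_⟩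
  · refine ENNReal.mul_ne_top (two_pow_ne_top (by linarith) (by simp)) (ENNReal.add_ne_top.2 ⟨?_, hCbt⟩)
    exact ENNReal.mul_ne_top (ENNReal.mul_ne_top hCrt (two_pow_ne_top (by linarith) hI0t)) (by simp [hI0t, hI1t])
  intro ε hε hε1 u w hu hw hcs hbc T hT
  have hS := h1.scaled hε
  have hΩ := hA.isOpen
  have hJ1 : ∫⁻ z, ofReal (scaled ρ ε z) * ‖z‖ₑ = ofReal ε * I1 := lint_scaled1 h1.1 hε
  have hJ0 : ∫⁻ z, ofReal (scaled ρ ε z) = I0 := lint_scaled0 h1.1 hε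
  set X := ofReal ε * N3 q Ω u + N2 q Ω w with hX
  set v : EV (n + 1) → ℝ := fun x => u x - w x with hvd
  have hv : ContDiff ℝ 2 v := (hu.of_le (by norm_num)).sub hw
  have hpt : ∀ᵐ x ∂(volume.restrict Ω), ‖T x + MHess (momentum ρ) v x‖ₑ ≤
      (∫⁻ z, ofReal (scaled ρ ε z) * ‖remP Ω v x z‖ₑ) + ‖betaD (scaled ρ ε) Ω (fderiv ℝ v x) x‖ₑ := by
    filter_upwards [hT, ae_restrict_mem hΩ.measurableSet] with x hx hxΩ
    obtain ⟨l, hl, hle⟩ := pv_formula hS hΩ hv hcs hxΩ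
    have : T x = l := tendsto_nhds_unique hx hl
    rw [momentum_scaled hε] at hle
    rw [this]
    calc ‖l + MHess (momentum ρ) v x‖ₑ = ‖(l + betaD (scaled ρ ε) Ω (fderiv ℝ v x) x + MHess (momentum ρ) v x) - betaD (scaled ρ ε) Ω (fderiv ℝ v x) x‖ₑ := by
          congr 1; ring
      _ ≤ _ := enorm_sub_le
      _ ≤ _ := add_le_add hle le_rfl
  have hm : Measurable fun x => ∫⁻ z, ofReal (scaled ρ ε z) * ‖remP Ω v x z‖ₑ := by
    have h3 : Measurable fun p : EV (n + 1) × EV (n + 1) => ofReal (scaled ρ ε p.2) * ‖remP Ω v p.1 p.2‖ₑ :=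
      ((hS.1.comp measurable_snd).ennreal_ofReal).mul (remP_meas_enorm hΩ hv)
    exact h3.lintegral_prod_right'
  refine (lint_add_rpow_le _ hq _ _ _ hm.aemeasurable hpt).trans ?_
  rw [mul_assoc, add_mul]
  refine mul_le_mul_right (add_le_add ?_ (hCb ε hε hε1 u w hu hw hbc)) _
  refine (hCr _ hS u w hu hw).trans ?_
  rw [hJ1, hJ0, mul_assoc (Cr * I0 ^ (q - 1))]
  refine mul_le_mul_right ?_ _
  calc ofReal ε * I1 * N3 q Ω u + I0 * N2 q Ω w = I1 * (ofReal ε * N3 q Ω u) + I0 * N2 q Ω w := by ring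
    _ ≤ I1 * X + I0 * X := by
        gcongr
        · exact le_self_add
        · exact le_add_self
    _ = _ := by ring
end core
end

section
section leib
variable {m : ℕ}

lemma partialD_smooth {f : EV m → ℝ} (hf : ContDiff ℝ (⊤ : ℕ∞) f) (i : Fin m) : ContDiff ℝ (⊤ : ℕ∞) (partialD i f) := by
  have h1 : ContDiff ℝ (⊤ : ℕ∞) (fderiv ℝ f) := hf.fderiv_right (by norm_cast)
  exact h1.clm_apply contDiff_const

lemma partialDList_smooth {f : EV m → ℝ} (hf : ContDiff ℝ (⊤ : ℕ∞) f) (l : List (Fin m)) : ContDiff ℝ (⊤ : ℕ∞) (partialDList l f) := by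
  induction l with
  | nil => exact hf
  | cons i l ih => exact partialD_smooth ih i

/-- all ways of splitting a list of directions between two factors -/
def splits : List (Fin m) → List (List (Fin m) × List (Fin m))
  | [] => [([], [])]
  | i :: l => (splits l).map (fun ab => (i :: ab.1, ab.2)) ++ (splits l).map (fun ab => (ab.1, i :: ab.2))

lemma splits_len (l : List (Fin m)) : ∀ ab ∈ splits l, ab.1.length + ab.2.length = l.length := by
  induction l with
  | nil => simp [splits]
  | cons i l ih =>
    intro ab hab
    simp only [splits, List.mem_append, List.mem_map] at hab
    rcases hab with ⟨cd, h1, h2⟩ | ⟨cd, h1, h2⟩ <;> subst h2 <;> have := ih cd h1 <;> simp <;> omega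

lemma partialD_listsum {α : Type*} (L : List α) (F : α → EV m → ℝ) (hF : ∀ a ∈ L, Differentiable ℝ (F a)) (i : Fin m) (x : EV m) :
    partialD i (fun x => (L.map fun a => F a x).sum) x = (L.map fun a => partialD i (F a) x).sum ∧
      Differentiable ℝ (fun x => (L.map fun a => F a x).sum) := by
  induction L with
  | nil => simp [partialD]
  | cons a L ih =>
    obtain ⟨h1, h2⟩ := ih fun b hb => hF b (by simp [hb])
    have h3 := hF a (by simp)
    simp only [List.map_cons, List.sum_cons]
    refine ⟨?_, h3.add h2⟩
    rw [← h1]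
    unfold partialD
    rw [fderiv_fun_add (h3 x) (h2 x)]
    rfl

lemma leibniz {f g : EV m → ℝ} (hf : ContDiff ℝ (⊤ : ℕ∞) f) (hg : ContDiff ℝ (⊤ : ℕ∞) g) (l : List (Fin m)) :
    partialDList l (fun x => f x * g x) = fun x => ((splits l).map fun ab => partialDList ab.1 f x * partialDList ab.2 g x).sum := by
  induction l with
  | nil => funext x; simp [splits, partialDList]
  | cons i l ih =>
    funext x
    have hd : ∀ (h : EV m → ℝ), ContDiff ℝ (⊤ : ℕ∞) h → ∀ l, Differentiable ℝ (partialDList l h) := fun h hh l =>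
      (partialDList_smooth hh l).differentiable (by simp)
    show partialD i (partialDList l fun x => f x * g x) x = _
    rw [ih, (partialD_listsum (splits l) (fun ab x => partialDList ab.1 f x * partialDList ab.2 g x)
      (fun ab _ => (hd f hf _).mul (hd g hg _)) i x).1]
    simp only [splits, List.map_append, List.map_map, List.sum_append]
    rw [← List.sum_map_add]
    congr 1
    refine List.map_congr_left fun ab _ => ?_
    simp only [Function.comp, partialDList, partialD]
    rw [fderiv_fun_mul (hd f hf _ x) (hd g hg _ x)]
    simp only [ContinuousLinearMap.add_apply, ContinuousLinearMap.smul_apply, smul_eq_mul]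
    ring

lemma partialDList_notin {f : EV m → ℝ} (l : List (Fin m)) : tsupport (partialDList l f) ⊆ tsupport f := by
  induction l with
  | nil => exact subset_rfl
  | cons i l ih =>
    refine subset_trans ?_ ih
    refine closure_minimal ?_ (isClosed_tsupport _)
    intro x hx
    by_contra hc
    apply hx
    show fderiv ℝ (partialDList l f) x _ = 0
    have : fderiv ℝ (partialDList l f) x = 0 := by
      by_contra h0
      exact hc (support_fderiv_subset ℝ h0)
    rw [this]; rfl

lemma partialDList_zero {f : EV m → ℝ} (l : List (Fin m)) {x : EV m} (hx : x ∉ tsupport f) : partialDList l f x = 0 :=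
  image_eq_zero_of_notMem_tsupport fun h => hx (partialDList_notin l h)

lemma partialDList_compact {f : EV m → ℝ} (hf : HasCompactSupport f) (l : List (Fin m)) : HasCompactSupport (partialDList l f) :=
  hf.mono' ((subset_tsupport _).trans (partialDList_notin l))

lemma partialDList_bdd {f : EV m → ℝ} (hf : ContDiff ℝ (⊤ : ℕ∞) f) (hc : HasCompactSupport f) (l : List (Fin m)) :
    ∃ C, 0 ≤ C ∧ ∀ x, |partialDList l f x| ≤ C := by
  obtain ⟨C, hC⟩ := (partialDList_compact hc l).exists_bound_of_continuous (partialDList_smooth hf l).continuous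
  exact ⟨C, (norm_nonneg _).trans (hC 0), hC⟩

lemma partialDList_add {f g : EV m → ℝ} (hf : ContDiff ℝ (⊤ : ℕ∞) f) (hg : ContDiff ℝ (⊤ : ℕ∞) g) (l : List (Fin m)) :
    partialDList l (fun x => f x + g x) = fun x => partialDList l f x + partialDList l g x := by
  induction l with
  | nil => rfl
  | cons i l ih =>
    funext x
    show partialD i (partialDList l fun x => f x + g x) x = _
    rw [ih]
    unfold partialD
    rw [fderiv_fun_add ((partialDList_smooth hf l).differentiable (by simp) x) ((partialDList_smooth hg l).differentiable (by simp) x)]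
    rfl

lemma partialDList_fsum {ι : Type*} (s : Finset ι) (f : ι → EV m → ℝ) (hf : ∀ j ∈ s, ContDiff ℝ (⊤ : ℕ∞) (f j)) (l : List (Fin m)) :
    partialDList l (fun x => ∑ j ∈ s, f j x) = fun x => ∑ j ∈ s, partialDList l (f j) x := by
  classical
  induction s using Finset.induction_on with
  | empty =>
    simp only [Finset.sum_empty]
    induction l with
    | nil => rfl
    | cons i l ih =>
      funext x
      show partialD i (partialDList l fun x => (0 : ℝ)) x = _
      rw [ih]
      simp [partialD]
  | insert a s ha ih =>
    have h1 : ∀ j ∈ s, ContDiff ℝ (⊤ : ℕ∞) (f j) := fun j hj => hf j (by simp [hj])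
    simp only [Finset.sum_insert ha]
    rw [partialDList_add (hf a (by simp)) (ContDiff.sum h1), ih h1]

lemma partialDList_congr_open {f g : EV m → ℝ} {U : Set (EV m)} (hU : IsOpen U) (h : ∀ x ∈ U, f x = g x) (l : List (Fin m)) :
    ∀ x ∈ U, partialDList l f x = partialDList l g x := by
  induction l with
  | nil => exact h
  | cons i l ih =>
    intro x hx
    have : partialDList l f =ᶠ[𝓝 x] partialDList l g := by
      filter_upwards [hU.mem_nhds hx] with y hy using ih y hy
    simp only [partialDList, partialD]
    rw [this.fderiv_eq]
end leib
end

section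
variable {m : ℕ}

def mol (φ f : EV m → ℝ) (x : EV m) : ℝ := ∫ y, f y * φ (x - y)

lemma mol_eq (φ f : EV m → ℝ) : mol φ f = MeasureTheory.convolution f φ (ContinuousLinearMap.lsmul ℝ ℝ) volume := by
  ext x
  rw [convolution_lsmul]
  rfl

lemma mol_swap (φ f : EV m → ℝ) (x : EV m) : mol φ f x = ∫ z, f (x - z) * φ z := by
  rw [mol_eq, convolution_lsmul_swap]; rfl

lemma mol_smooth {φ f : EV m → ℝ} (hf : LocallyIntegrable f volume) (hφ : ContDiff ℝ (⊤ : ℕ∞) φ) (hc : HasCompactSupport φ) :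
    ContDiff ℝ (⊤ : ℕ∞) (mol φ f) := by
  rw [mol_eq]
  exact hc.contDiff_convolution_right _ hf hφ

lemma mol_partial {φ f : EV m → ℝ} (hf : LocallyIntegrable f volume) (hφ : ContDiff ℝ (⊤ : ℕ∞) φ) (hc : HasCompactSupport φ)
    (i : Fin m) : partialD i (mol φ f) = mol (partialD i φ) f := by
  ext x
  have h1 : ContDiff ℝ 1 φ := hφ.of_le (by norm_cast)
  have := hc.hasFDerivAt_convolution_right (ContinuousLinearMap.lsmul ℝ ℝ) hf h1 x
  rw [← mol_eq] at this
  unfold partialD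
  rw [this.fderiv, mol_eq]
  exact convolution_precompR_apply _ hf (hc.fderiv ℝ) (h1.continuous_fderiv one_ne_zero) x _

lemma tsupport_refl {φ : EV m → ℝ} (x : EV m) : tsupport (fun y => φ (x - y)) ⊆ {y | x - y ∈ tsupport φ} := by
  refine closure_minimal ?_ ((isClosed_tsupport φ).preimage (by fun_prop))
  intro y hy
  exact subset_tsupport φ hy

lemma mol_weak {φ u v : EV m → ℝ} {Ω : Set (EV m)} (hΩ : MeasurableSet Ω) {i : Fin m} (huv : WeakDerivOn Ω i u v) (hφ : ContDiff ℝ (⊤ : ℕ∞) φ)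
    (hc : HasCompactSupport φ) {x : EV m} (hx : ∀ z ∈ tsupport φ, x - z ∈ Ω) :
    mol (partialD i φ) (Ω.indicator u) x = mol φ (Ω.indicator v) x := by
  have hts : tsupport (fun y => φ (x - y)) ⊆ Ω := fun y hy => by
    have := hx _ (tsupport_refl x hy)
    simpa using this
  have hcs : HasCompactSupport (fun y => φ (x - y)) := by
    refine HasCompactSupport.of_support_subset_isCompact (K := (fun z => x - z) '' tsupport φ) (hc.isCompact.image (by fun_prop)) ?_
    intro y hy
    exact ⟨x - y, subset_tsupport φ hy, by simp⟩
  have h := huv (fun y => φ (x - y)) (hφ.comp (contDiff_const.sub contDiff_id)) hcs hts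
  have hp : ∀ y, partialD i (fun y => φ (x - y)) y = - partialD i φ (x - y) := by
    intro y
    unfold partialD
    have h1 : HasFDerivAt (fun y => φ (x - y)) ((fderiv ℝ φ (x - y)).comp (-(ContinuousLinearMap.id ℝ (EV m)))) y := by
      have h2 : HasFDerivAt φ (fderiv ℝ φ (x - y)) (x - y) := (hφ.differentiable (by simp) _).hasFDerivAt
      exact h2.comp y ((hasFDerivAt_id y).const_sub x)
    rw [h1.fderiv]
    simp
  simp only [hp, mul_neg, integral_neg, neg_inj] at h
  have key : ∀ (w ψ : EV m → ℝ), ∫ y, Ω.indicator w y * ψ y = ∫ y in Ω, w y * ψ y := by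
    intro w ψ
    rw [← integral_indicator hΩ]
    congr 1; ext y
    by_cases hy : y ∈ Ω <;> simp [hy]
  unfold mol
  rw [key u (fun y => partialD i φ (x - y)), key v (fun y => φ (x - y))]
  exact h

lemma mol_derivs {φ u : EV m → ℝ} {Ω U : Set (EV m)} {k : ℕ} {p : ℝ≥0∞} (hp : 1 ≤ p) {D : List (Fin m) → EV m → ℝ} (hΩ : MeasurableSet Ω) (hD : IsSobDerivs Ω k p u D)
    (hφ : ContDiff ℝ (⊤ : ℕ∞) φ) (hc : HasCompactSupport φ) (hU : IsOpen U) (hx : ∀ x ∈ U, ∀ z ∈ tsupport φ, x - z ∈ Ω) (l : List (Fin m)) (hl : l.length ≤ k) :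
    ∀ x ∈ U, partialDList l (mol φ (Ω.indicator u)) x = mol φ (Ω.indicator (D l)) x := by
  have hLI : ∀ l : List (Fin m), l.length ≤ k → LocallyIntegrable (Ω.indicator (D l)) volume := fun l hl =>
    ((memLp_indicator_iff_restrict hΩ).2 (hD.2.2 l hl)).locallyIntegrable hp
  induction l with
  | nil => intro x hx; simp only [partialDList]; rw [hD.1]
  | cons i l ih =>
    intro x hxU
    have hl' : l.length < k := by simpa using hl
    have h1 : partialDList (i :: l) (mol φ (Ω.indicator u)) x = partialD i (mol φ (Ω.indicator (D l))) x := by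
      simp only [partialDList]
      exact partialDList_congr_open hU (ih hl'.le) [i] x hxU
    rw [h1, mol_partial (hLI l hl'.le) hφ hc]
    exact mol_weak hΩ (hD.2.1 l hl' i) hφ hc (hx x hxU)
end

section
variable {m : ℕ}

lemma eLp_pow {α F : Type*} [MeasurableSpace α] [NormedAddCommGroup F] (μ : Measure α) {p : ℝ≥0∞} (hp1 : 1 ≤ p) (hp : p ≠ ⊤) (f : α → F) :
    eLpNorm f p μ ^ p.toReal = ∫⁻ x, ‖f x‖ₑ ^ p.toReal ∂μ := by
  have h0 : p ≠ 0 := (lt_of_lt_of_le one_pos hp1).ne'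
  have h1 : p.toReal ≠ 0 := (ENNReal.toReal_pos h0 hp).ne'
  rw [eLpNorm_eq_lintegral_rpow_enorm_toReal h0 hp, ← ENNReal.rpow_mul, one_div, inv_mul_cancel₀ h1, ENNReal.rpow_one]

lemma toReal_one_le {p : ℝ≥0∞} (hp1 : 1 ≤ p) (hp : p ≠ ⊤) : 1 ≤ p.toReal := by
  have := ENNReal.toReal_mono hp hp1
  simpa using this

lemma transl_cont {f : EV m → ℝ} {p : ℝ≥0∞} (hp1 : 1 ≤ p) (hp : p ≠ ⊤) (hf : MemLp f p volume) {η : ℝ≥0∞} (hη : 0 < η) :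
    ∃ σ : ℝ, 0 < σ ∧ ∀ z : EV m, ‖z‖ < σ → eLpNorm (fun x => f (x - z) - f x) p volume ≤ η := by
  have : Fact (1 ≤ p) := ⟨hp1⟩
  have hmp : ∀ z : EV m, MeasurePreserving (fun x : EV m => x - z) volume volume := fun z => measurePreserving_sub_right volume z
  let g : C(EV m, C(EV m, EV m)) := (ContinuousMap.mk (fun a : EV m × EV m => a.2 - a.1) (by fun_prop)).curry
  have hc := (continuous_const (y := hf.toLp f) (X := EV m)).compMeasurePreservingLp (μ := volume) (ν := volume) g.continuous (fun z => hmp z) hp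
  have h0 := hc.continuousAt (x := 0)
  have h1 := (EMetric.tendsto_nhds.1 h0) η hη
  obtain ⟨σ, hσ, h2⟩ := Metric.eventually_nhds_iff.1 h1
  refine ⟨σ, hσ, fun z hz => ?_⟩
  have h3 := (h2 (y := z) (by simpa using hz)).le
  rw [Lp.edist_def] at h3
  refine le_trans (le_of_eq (eLpNorm_congr_ae ?_)) h3
  have e1 := Lp.coeFn_compMeasurePreserving (hf.toLp f) (hmp z)
  have e2 := Lp.coeFn_compMeasurePreserving (hf.toLp f) (hmp 0)
  have e3 := (hmp z).quasiMeasurePreserving.ae_eq_comp hf.coeFn_toLp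
  have e4 := hf.coeFn_toLp
  filter_upwards [e1, e2, e3, e4] with x h1 h2 h3 h4
  have h1' : (Lp.compMeasurePreserving (g z) (hmp z) (hf.toLp f) : EV m → ℝ) x = f (x - z) := by
    refine h1.trans h3
  have h2' : (Lp.compMeasurePreserving (g 0) (hmp 0) (hf.toLp f) : EV m → ℝ) x = f x := by
    refine h2.trans ?_
    simp [h4]
  simp only [Pi.sub_apply]
  rw [h1', h2']

lemma mol_congr_ae {φ f g : EV m → ℝ} (h : f =ᵐ[volume] g) : mol φ f = mol φ g := by
  ext x
  exact integral_congr_ae (by filter_upwards [h] with y hy; rw [hy])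

lemma mol_approx {f : EV m → ℝ} {p : ℝ≥0∞} (hp1 : 1 ≤ p) (hp : p ≠ ⊤) (hf : MemLp f p volume) {η : ℝ≥0∞} (hη : 0 < η) :
    ∃ σ : ℝ, 0 < σ ∧ ∀ φ : EV m → ℝ, Continuous φ → HasCompactSupport φ → (∀ x, 0 ≤ φ x) → ∫ x, φ x = 1 → (∀ z, φ z ≠ 0 → ‖z‖ < σ) →
      eLpNorm (fun x => mol φ f x - f x) p volume ≤ η := by
  have hq := toReal_one_le hp1 hp
  obtain ⟨g, hg, hfg⟩ := hf.1
  have hgL : MemLp g p volume := (memLp_congr_ae hfg).1 hf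
  obtain ⟨σ, hσ, h⟩ := transl_cont hp1 hp hgL hη
  refine ⟨σ, hσ, fun φ hφ hc hpos hitg hsupp => ?_⟩
  rw [mol_congr_ae hfg, eLpNorm_congr_ae (g := fun x => mol φ g x - g x) (by filter_upwards [hfg] with x hx; rw [hx])]
  have hφi : Integrable φ volume := hφ.integrable_of_hasCompactSupport hc
  have hk1 : ∫⁻ z, ofReal (φ z) = 1 := by
    rw [← ofReal_integral_eq_lintegral_ofReal hφi (Eventually.of_forall hpos), hitg]; simp
  have hpt : ∀ x, ‖mol φ g x - g x‖ₑ ≤ ∫⁻ z in Set.univ, ofReal (φ z) * ‖g (x - z) - g x‖ₑ := by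
    intro x
    have e1 : mol φ g x - g x = ∫ z, φ z * (g (x - z) - g x) := by
      rw [mol_swap]
      have hi : Integrable (fun z => g (x - z) * φ z) volume := by
        have := hc.convolutionExists_right (ContinuousLinearMap.lsmul ℝ ℝ) (hgL.locallyIntegrable hp1) hφ x
        have := this.integrable_swap
        simpa using this
      calc _ = (∫ z, g (x - z) * φ z) - ∫ z, g x * φ z := by rw [integral_const_mul, hitg, mul_one]
        _ = ∫ z, (g (x - z) * φ z - g x * φ z) := by rw [integral_sub hi (hφi.const_mul _)]
        _ = _ := by congr 1; ext z; ring
    rw [e1, setLIntegral_univ]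
    refine (enorm_integral_le_lintegral_enorm _).trans (lintegral_mono fun z => ?_)
    simp only [enorm_mul]
    rw [Real.enorm_of_nonneg (hpos z)]
  have hJ := jensen_fubini hq (Set.univ : Set (EV m)) (Set.univ : Set (EV m)) (k := fun z => ofReal (φ z))
    (F := fun x z => ‖g (x - z) - g x‖ₑ) (by fun_prop) (by
      have := hg.measurable
      have h1 : Measurable fun a : EV m × EV m => g (a.1 - a.2) - g a.1 := (this.comp (measurable_fst.sub measurable_snd)).sub (this.comp measurable_fst)
      exact h1.enorm)
  simp only [Measure.restrict_univ] at hJ hpt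
  rw [hk1, ENNReal.one_rpow, one_mul] at hJ
  have hfin : ∫⁻ z, ofReal (φ z) * ∫⁻ x, ‖g (x - z) - g x‖ₑ ^ p.toReal ≤ ∫⁻ z, ofReal (φ z) * η ^ p.toReal := by
    refine lintegral_mono fun z => ?_
    by_cases hz : φ z = 0
    · simp [hz]
    · refine mul_le_mul_right ?_ _
      rw [← eLp_pow volume hp1 hp (fun x => g (x - z) - g x)]
      exact ENNReal.rpow_le_rpow (h z (hsupp z hz)) (by linarith)
  rw [lintegral_mul_const _ (by fun_prop), hk1, one_mul] at hfin
  have htot : eLpNorm (fun x => mol φ g x - g x) p volume ^ p.toReal ≤ η ^ p.toReal := by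
    rw [eLp_pow volume hp1 hp]
    refine le_trans (lintegral_mono fun x => ENNReal.rpow_le_rpow (hpt x) (by linarith)) (hJ.trans hfin)
  exact (ENNReal.rpow_le_rpow_iff (by linarith)).1 htot
end

section
variable {m : ℕ}

lemma eLp_listsum {α : Type*} {X : Type*} [MeasurableSpace X] (μ : Measure X) {p : ℝ≥0∞} (hp : 1 ≤ p) (L : List α) (F : α → X → ℝ)
    (hF : ∀ a ∈ L, AEStronglyMeasurable (F a) μ) :
    eLpNorm (fun x => (L.map fun a => F a x).sum) p μ ≤ (L.map fun a => eLpNorm (F a) p μ).sum ∧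
      AEStronglyMeasurable (fun x => (L.map fun a => F a x).sum) μ := by
  induction L with
  | nil => simp [aestronglyMeasurable_const]
  | cons a L ih =>
    have ih' := ih (fun b hb => hF b (List.mem_cons_of_mem _ hb))
    have ha := hF a List.mem_cons_self
    simp only [List.map_cons, List.sum_cons]
    exact ⟨(eLpNorm_add_le ha ih'.2 hp).trans (add_le_add le_rfl ih'.1), ha.add ih'.2⟩

lemma tendsto_listsum_zero {α : Type*} (L : List α) (F : ℕ → α → ℝ≥0∞) (h : ∀ a ∈ L, Tendsto (fun k => F k a) atTop (𝓝 0)) :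
    Tendsto (fun k => (L.map fun a => F k a).sum) atTop (𝓝 0) := by
  induction L with
  | nil => simp
  | cons a L ih =>
    simp only [List.map_cons, List.sum_cons]
    have := (h a List.mem_cons_self).add (ih fun b hb => h b (List.mem_cons_of_mem _ hb))
    simpa using this

lemma eLp_mul_bdd {X : Type*} [MeasurableSpace X] (μ : Measure X) (p : ℝ≥0∞) (f g : X → ℝ) (C : ℝ) (hf : ∀ x, |f x| ≤ C) :
    eLpNorm (fun x => f x * g x) p μ ≤ ofReal C * eLpNorm g p μ := by
  refine eLpNorm_le_mul_eLpNorm_of_ae_le_mul (Eventually.of_forall fun x => ?_) p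
  simp only [norm_mul, Real.norm_eq_abs]
  exact mul_le_mul_of_nonneg_right (hf x) (abs_nonneg _)

lemma listsum_sub {α : Type*} (L : List α) (f g : α → ℝ) : (L.map f).sum - (L.map g).sum = (L.map fun a => f a - g a).sum := by
  induction L with
  | nil => simp
  | cons a L ih => simp only [List.map_cons, List.sum_cons, ← ih]; ring

lemma density_piece {Ω : Set (EV m)} (hΩ : MeasurableSet Ω) {κ : EV m → ℝ} (hκ : ContDiff ℝ (⊤ : ℕ∞) κ) (hκc : HasCompactSupport κ)
    (e : EV m) {c σ1 : ℝ} (hc : 0 < c) (hσ1 : 0 < σ1)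
    (hin : ∀ σ, 0 < σ → σ < σ1 → ∀ x ∈ Ω, x ∈ tsupport κ → closedBall (x + σ • e) (c * σ) ⊆ Ω)
    {p : ℝ≥0∞} (hp1 : 1 ≤ p) (hp : p ≠ ⊤) {k : ℕ} {u : EV m → ℝ} {D : List (Fin m) → EV m → ℝ} (hD : IsSobDerivs Ω k p u D) :
    ∃ w : ℕ → EV m → ℝ, (∀ i, ContDiff ℝ (⊤ : ℕ∞) (w i) ∧ HasCompactSupport (w i)) ∧ ∀ l : List (Fin m), l.length ≤ k →
      Tendsto (fun i => eLpNorm (fun x => partialDList l (w i) x - ((splits l).map fun ab => partialDList ab.1 κ x * D ab.2 x).sum) p (volume.restrict Ω)) atTop (𝓝 0) := by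
  have hσp : ∀ i : ℕ, 0 < σ1 / (i + 2) := fun i => by positivity
  have hσl : ∀ i : ℕ, σ1 / (i + 2) < σ1 := fun i => by
    rw [div_lt_iff₀ (by positivity)]
    have : (0 : ℝ) ≤ i := by positivity
    nlinarith
  let bmp : (i : ℕ) → ContDiffBump (-((σ1 / (i + 2)) • e)) := fun i =>
    { rIn := c * (σ1 / (i + 2)) / 4, rOut := c * (σ1 / (i + 2)) / 2, rIn_pos := by have := hσp i; positivity,
      rIn_lt_rOut := by have := mul_pos hc (hσp i); linarith }
  let φ : ℕ → EV m → ℝ := fun i => (bmp i).normed volume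
  have hφs : ∀ i, ContDiff ℝ (⊤ : ℕ∞) (φ i) := fun i => (bmp i).contDiff_normed
  have hφc : ∀ i, HasCompactSupport (φ i) := fun i => (bmp i).hasCompactSupport_normed
  have hfL : ∀ l : List (Fin m), l.length ≤ k → MemLp (Ω.indicator (D l)) p volume := fun l hl =>
    (memLp_indicator_iff_restrict hΩ).2 (hD.2.2 l hl)
  have hfu : LocallyIntegrable (Ω.indicator u) volume := by
    have := (hfL [] (by simp)).locallyIntegrable hp1
    rwa [hD.1] at this
  have hms : ∀ i, ContDiff ℝ (⊤ : ℕ∞) (mol (φ i) (Ω.indicator u)) := fun i => mol_smooth hfu (hφs i) (hφc i)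
  have happ : ∀ b : List (Fin m), b.length ≤ k → Tendsto (fun i => eLpNorm (fun x => mol (φ i) (Ω.indicator (D b)) x - Ω.indicator (D b) x) p volume) atTop (𝓝 0) := by
    intro b hb
    rw [ENNReal.tendsto_nhds_zero]
    intro η hη
    obtain ⟨σ, hσ, h⟩ := mol_approx hp1 hp (hfL b hb) hη
    have h1 : Tendsto (fun i : ℕ => (σ1 / ((i : ℝ) + 2)) * (‖e‖ + c)) atTop (𝓝 0) := by
      have : Tendsto (fun i : ℕ => σ1 / ((i : ℝ) + 2)) atTop (𝓝 0) :=
        tendsto_const_nhds.div_atTop (tendsto_atTop_add_const_right _ _ tendsto_natCast_atTop_atTop)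
      simpa using this.mul_const (‖e‖ + c)
    filter_upwards [h1.eventually_lt_const hσ] with i hi
    refine h (φ i) (hφs i).continuous (hφc i) (fun x => (bmp i).nonneg_normed x) (bmp i).integral_normed (fun z hz => ?_)
    have hz' : z ∈ ball (-((σ1 / (i + 2)) • e)) (c * (σ1 / (i + 2)) / 2) := by
      have := (bmp i).support_normed_eq (μ := volume)
      rw [← show (bmp i).rOut = c * (σ1 / (i + 2)) / 2 from rfl, ← this]; exact hz
    rw [mem_ball_iff_norm] at hz'
    have h2 : ‖z‖ ≤ ‖z - -((σ1 / (i + 2)) • e)‖ + ‖-((σ1 / ((i : ℝ) + 2)) • e)‖ := by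
      have := norm_add_le (z - -((σ1 / ((i : ℝ) + 2)) • e)) (-((σ1 / ((i : ℝ) + 2)) • e))
      simpa using this
    rw [norm_neg, norm_smul, Real.norm_of_nonneg (hσp i).le] at h2
    have := hσp i
    nlinarith
  refine ⟨fun i x => κ x * mol (φ i) (Ω.indicator u) x, fun i => ⟨hκ.mul (hms i), hκc.mul_right⟩, fun l hl => ?_⟩
  have hsl : ∀ ab ∈ splits l, ab.1.length ≤ k ∧ ab.2.length ≤ k := fun ab hab => by
    have := splits_len l ab hab; omega
  have heq : ∀ i, ∀ x ∈ Ω, partialDList l (fun x => κ x * mol (φ i) (Ω.indicator u) x) x - ((splits l).map fun ab => partialDList ab.1 κ x * D ab.2 x).sum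
      = ((splits l).map fun ab => partialDList ab.1 κ x * (mol (φ i) (Ω.indicator (D ab.2)) x - Ω.indicator (D ab.2) x)).sum := by
    intro i x hx
    rw [leibniz hκ (hms i) l]
    dsimp only
    rw [listsum_sub]
    congr 1
    refine List.map_congr_left fun ab hab => ?_
    rw [← mul_sub]
    by_cases hxt : x ∈ tsupport κ
    · congr 1
      rw [indicator_of_mem hx]
      congr 1
      refine mol_derivs hp1 hΩ hD (hφs i) (hφc i) (U := thickening (c * (σ1 / (i + 2)) / 2) (Ω ∩ tsupport κ)) isOpen_thickening ?_ _ (hsl ab hab).2 x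
        (self_subset_thickening (by have := mul_pos hc (hσp i); linarith) _ ⟨hx, hxt⟩)
      intro y hy z hz
      obtain ⟨x0, hx0, hd⟩ := mem_thickening_iff.1 hy
      refine hin (σ1 / (i + 2)) (hσp i) (hσl i) x0 hx0.1 hx0.2 ?_
      have hz' : z ∈ closedBall (-((σ1 / (i + 2)) • e)) (c * (σ1 / (i + 2)) / 2) := by
        have := (bmp i).tsupport_normed_eq (μ := volume)
        rw [← show (bmp i).rOut = c * (σ1 / (i + 2)) / 2 from rfl, ← this]; exact hz
      rw [mem_closedBall_iff_norm] at hz' ⊢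
      rw [dist_eq_norm] at hd
      have := norm_sub_le (y - x0) (z - -((σ1 / ((i : ℝ) + 2)) • e))
      have e1 : (y - x0) - (z - -((σ1 / ((i : ℝ) + 2)) • e)) = y - z - (x0 + (σ1 / ((i : ℝ) + 2)) • e) := by abel
      rw [e1] at this
      linarith
    · rw [partialDList_zero ab.1 hxt]; simp
  choose! Cb hCb0 hCb using fun a : List (Fin m) => partialDList_bdd hκ hκc a
  refine tendsto_of_tendsto_of_tendsto_of_le_of_le tendsto_const_nhds
    (tendsto_listsum_zero (splits l) (fun i ab => ofReal (Cb ab.1) * eLpNorm (fun x => mol (φ i) (Ω.indicator (D ab.2)) x - Ω.indicator (D ab.2) x) p volume) ?_)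
    (fun i => bot_le) (fun i => ?_)
  · intro ab hab
    have := ENNReal.Tendsto.const_mul (a := ofReal (Cb ab.1)) (happ ab.2 (hsl ab hab).2) (Or.inr ofReal_ne_top)
    simpa using this
  · dsimp only
    rw [eLpNorm_congr_ae ((ae_restrict_iff' hΩ).2 (Eventually.of_forall (heq i)))]
    refine (eLp_listsum _ hp1 _ _ ?_).1.trans ?_
    · intro ab hab
      refine ((partialDList_smooth hκ ab.1).continuous.aestronglyMeasurable).mul (AEStronglyMeasurable.sub ?_ ((hfL _ (hsl ab hab).2).1.restrict))
      exact (mol_smooth ((hfL _ (hsl ab hab).2).locallyIntegrable hp1) (hφs i) (hφc i)).continuous.aestronglyMeasurable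
    · refine List.sum_le_sum fun ab hab => ?_
      exact (eLp_mul_bdd _ p _ _ (Cb ab.1) (hCb ab.1)).trans (mul_le_mul_right (eLpNorm_mono_measure _ Measure.restrict_le_self) _)
end

section
variable {m : ℕ}

lemma partialDList_scale {f : EV m → ℝ} (hf : ContDiff ℝ (⊤ : ℕ∞) f) (s : ℝ) (l : List (Fin m)) :
    partialDList l (fun x => f (s • x)) = fun x => s ^ l.length * partialDList l f (s • x) := by
  induction l with
  | nil => ext x; simp [partialDList]
  | cons i l ih =>
    ext x
    simp only [partialDList]
    rw [ih]
    have hg := partialDList_smooth hf l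
    generalize partialDList l f = g at hg
    unfold partialD
    have h2 : HasFDerivAt g (fderiv ℝ g (s • x)) (s • x) := (hg.differentiable (by simp) _).hasFDerivAt
    have h1 : HasFDerivAt (fun x => g (s • x)) ((fderiv ℝ g (s • x)).comp (s • (ContinuousLinearMap.id ℝ (EV m)))) x :=
      h2.comp x ((hasFDerivAt_id x).const_smul s)
    have h3 := h1.const_mul (s ^ l.length)
    rw [h3.fderiv]
    simp [pow_succ]
    ring

lemma splits_one (l : List (Fin m)) : ∀ (g : List (Fin m) → ℝ) (x : EV m),
    ((splits l).map fun ab => partialDList ab.1 (fun _ => (1 : ℝ)) x * g ab.2).sum = g l := by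
  have hz : ∀ (i : Fin m) (a : List (Fin m)), partialDList (i :: a) (fun _ : EV m => (1 : ℝ)) = fun _ => 0 := by
    intro i a
    induction a generalizing i with
    | nil => ext x; simp [partialDList, partialD]
    | cons j a ih =>
      have := ih j
      rw [partialDList, this]; ext x; simp [partialD]
  induction l with
  | nil => intro g x; simp [splits, partialDList]
  | cons i l ih =>
    intro g x
    simp only [splits, List.map_append, List.map_map, List.sum_append]
    have h1 := ih (fun b => g (i :: b)) x
    have h2 : ((splits l).map ((fun ab : List (Fin m) × List (Fin m) => partialDList ab.1 (fun _ => (1 : ℝ)) x * g ab.2) ∘ fun ab => (i :: ab.1, ab.2))).sum = 0 := by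
      refine List.sum_eq_zero ?_
      intro y hy
      obtain ⟨ab, hab, rfl⟩ := List.mem_map.1 hy
      simp only [Function.comp]
      rw [hz]; simp
    rw [h2, zero_add]
    exact h1

lemma tail_tendsto {μ : Measure (EV m)} {p : ℝ≥0∞} (hp1 : 1 ≤ p) (hp : p ≠ ⊤) {g : EV m → ℝ} (hg : MemLp g p μ) :
    Tendsto (fun k : ℕ => eLpNorm ({x : EV m | (k : ℝ) ≤ ‖x‖}.indicator g) p μ) atTop (𝓝 0) := by
  have hq := toReal_one_le hp1 hp
  have hms : ∀ k : ℕ, MeasurableSet {x : EV m | (k : ℝ) ≤ ‖x‖} := fun k => measurableSet_le measurable_const measurable_norm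
  have h1 : Tendsto (fun k : ℕ => ∫⁻ x, ‖{x : EV m | (k : ℝ) ≤ ‖x‖}.indicator g x‖ₑ ^ p.toReal ∂μ) atTop (𝓝 (∫⁻ x, 0 ∂μ)) := by
    refine tendsto_lintegral_of_dominated_convergence' (fun x => ‖g x‖ₑ ^ p.toReal) ?_ ?_ ?_ ?_
    · intro k
      exact ((hg.1.indicator (hms k)).enorm.pow_const _)
    · intro k
      refine Eventually.of_forall fun x => ENNReal.rpow_le_rpow ?_ (by linarith)
      exact enorm_indicator_le_enorm_self _ _
    · rw [← eLp_pow μ hp1 hp]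
      exact ENNReal.rpow_ne_top_of_nonneg (by linarith) hg.2.ne
    · refine Eventually.of_forall fun x => ?_
      refine tendsto_const_nhds.congr' ?_
      filter_upwards [(tendsto_natCast_atTop_atTop (R := ℝ)).eventually_gt_atTop ‖x‖] with k hk
      rw [indicator_of_notMem (by simpa using hk)]
      simp [show 0 < p.toReal by linarith]
  rw [lintegral_zero] at h1
  have h2 := h1.ennrpow_const (1 / p.toReal)
  rw [ENNReal.zero_rpow_of_pos (by positivity)] at h2
  refine h2.congr fun k => ?_
  rw [← eLp_pow μ hp1 hp, ← ENNReal.rpow_mul, mul_one_div_cancel (by linarith), ENNReal.rpow_one]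

lemma cutoff_tendsto {μ : Measure (EV m)} {p : ℝ≥0∞} (hp1 : 1 ≤ p) (hp : p ≠ ⊤) {χ : EV m → ℝ} (hχ : ContDiff ℝ (⊤ : ℕ∞) χ) (hχc : HasCompactSupport χ)
    (hχ1 : ∀ x, ‖x‖ < 1 → χ x = 1) {k : ℕ} {D : List (Fin m) → EV m → ℝ} (hD : ∀ l : List (Fin m), l.length ≤ k → MemLp (D l) p μ)
    (l : List (Fin m)) (hl : l.length ≤ k) :
    Tendsto (fun i : ℕ => eLpNorm (fun x => ((splits l).map fun ab => partialDList ab.1 (fun x => χ (((i : ℝ) + 1)⁻¹ • x)) x * D ab.2 x).sum - D l x) p μ) atTop (𝓝 0) := by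
  have hsl : ∀ ab ∈ splits l, ab.1.length ≤ k ∧ ab.2.length ≤ k := fun ab hab => by
    have := splits_len l ab hab; omega
  have hχi : ∀ i : ℕ, ContDiff ℝ (⊤ : ℕ∞) (fun x => χ (((i : ℝ) + 1)⁻¹ • x)) := fun i => hχ.comp (contDiff_const_smul _)
  have h1s : ContDiff ℝ (⊤ : ℕ∞) (fun _ : EV m => (1 : ℝ)) := contDiff_const
  choose! Cb hCb0 hCb using fun a : List (Fin m) => partialDList_bdd hχ hχc a
  have hone : ∀ (a : List (Fin m)) (x : EV m), |partialDList a (fun _ => (1 : ℝ)) x| ≤ 1 := by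
    intro a x
    have : ∀ a : List (Fin m), (partialDList a (fun _ : EV m => (1 : ℝ)) = fun _ => 1) ∨ (partialDList a (fun _ : EV m => (1 : ℝ)) = fun _ => 0) := by
      intro a
      induction a with
      | nil => left; rfl
      | cons i a ih => right; rw [partialDList]; rcases ih with h | h <;> · rw [h]; ext x; simp [partialD]
    rcases this a with h | h <;> simp [h]
  have hbd : ∀ (i : ℕ) (a : List (Fin m)) (x : EV m), |partialDList a (fun x => χ (((i : ℝ) + 1)⁻¹ • x)) x - partialDList a (fun _ => 1) x| ≤ Cb a + 1 := by
    intro i a x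
    refine (abs_sub _ _).trans (add_le_add ?_ (hone a x))
    rw [partialDList_scale hχ]
    dsimp only
    rw [abs_mul, abs_pow]
    have h1 : |((i : ℝ) + 1)⁻¹| ≤ 1 := by
      rw [abs_of_nonneg (by positivity)]
      exact inv_le_one_of_one_le₀ (by linarith [(Nat.cast_nonneg i : (0 : ℝ) ≤ i)])
    calc _ ≤ 1 * Cb a := mul_le_mul (pow_le_one₀ (abs_nonneg _) h1) (hCb a _) (abs_nonneg _) zero_le_one
      _ = _ := one_mul _
  refine tendsto_of_tendsto_of_tendsto_of_le_of_le tendsto_const_nhds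
    (tendsto_listsum_zero (splits l) (fun i ab => ofReal (Cb ab.1 + 1) * eLpNorm ({x : EV m | (i : ℝ) ≤ ‖x‖}.indicator (D ab.2)) p μ) ?_)
    (fun i => bot_le) (fun i => ?_)
  · intro ab hab
    have := ENNReal.Tendsto.const_mul (a := ofReal (Cb ab.1 + 1)) (tail_tendsto hp1 hp (hD ab.2 (hsl ab hab).2)) (Or.inr ofReal_ne_top)
    simpa using this
  · dsimp only
    have heq : ∀ x, ((splits l).map fun ab => partialDList ab.1 (fun x => χ (((i : ℝ) + 1)⁻¹ • x)) x * D ab.2 x).sum - D l x =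
        ((splits l).map fun ab => (partialDList ab.1 (fun x => χ (((i : ℝ) + 1)⁻¹ • x)) x - partialDList ab.1 (fun _ => 1) x) * D ab.2 x).sum := by
      intro x
      conv_lhs => rw [← splits_one l (fun b => D b x) x]
      rw [listsum_sub]
      congr 1
      refine List.map_congr_left fun ab hab => ?_
      ring
    simp only [heq]
    refine (eLp_listsum _ hp1 _ _ ?_).1.trans ?_
    · intro ab hab
      exact (((partialDList_smooth (hχi i) ab.1).continuous.sub (partialDList_smooth h1s ab.1).continuous).aestronglyMeasurable).mul (hD _ (hsl ab hab).2).1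
    · refine List.sum_le_sum fun ab hab => ?_
      refine eLpNorm_le_mul_eLpNorm_of_ae_le_mul (Eventually.of_forall fun x => ?_) p
      by_cases hx : (i : ℝ) ≤ ‖x‖
      · rw [indicator_of_mem (by simpa using hx), norm_mul]
        exact mul_le_mul_of_nonneg_right (hbd i ab.1 x) (norm_nonneg _)
      · rw [partialDList_congr_open (f := fun x => χ (((i : ℝ) + 1)⁻¹ • x)) (g := fun _ => (1 : ℝ)) (isOpen_ball (x := (0 : EV m)) (ε := (i : ℝ) + 1)) ?_ ab.1 x ?_]
        · rw [sub_self, zero_mul, norm_zero]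
          have := hCb0 ab.1
          positivity
        · intro y hy
          refine hχ1 _ ?_
          have : ‖y‖ < i + 1 := by simpa using hy
          rw [norm_smul, Real.norm_of_nonneg (by positivity), inv_mul_lt_iff₀ (by positivity)]
          linarith
        · push Not at hx
          simp; linarith
end

section
variable {m : ℕ}

lemma fsum_listsum {α ι : Type*} (s : Finset ι) (L : List α) (f : ι → α → ℝ) :
    ∑ j ∈ s, (L.map (f j)).sum = (L.map fun a => ∑ j ∈ s, f j a).sum := by
  induction L with
  | nil => simp
  | cons a L ih => simp only [List.map_cons, List.sum_cons, sum_add_distrib, ih]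

namespace IsAtlas
variable {ι : Type} [Fintype ι] {Ω : Set (EV m)} {Λ R : ℝ} {e : ι → EV m} {t : ι → EV m → ℝ} {ζ : ι → EV m → ℝ}

lemma in_chart (h : IsAtlas Ω Λ R e t ζ) (j : ι) {σ : ℝ} (hσ : 0 < σ) (hσ1 : σ < R / 2) {x : EV m} (hx : x ∈ Ω) (hxt : x ∈ tsupport (ζ j)) :
    closedBall (x + σ • e j) ((2 * Λ)⁻¹ * σ) ⊆ Ω := by
  have hΛ := h.lam_ge
  have hc := h.chart j
  have hR := h.R_pos
  intro y hy
  rw [mem_closedBall_iff_norm] at hy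
  have hin1 : (2 * Λ)⁻¹ ≤ 1 := inv_le_one_of_one_le₀ (by linarith)
  have hd : dist y x ≤ R := by
    rw [dist_eq_norm]
    have h1 := norm_add_le (y - (x + σ • e j)) (σ • e j)
    have h2 : y - (x + σ • e j) + σ • e j = y - x := by abel
    rw [h2, norm_smul, hc.e_norm, Real.norm_of_nonneg hσ.le] at h1
    nlinarith
  have hyt : y ∈ cthickening R (tsupport (ζ j)) := by
    have := cthick_move (cthick_self (r := 0) hxt) le_rfl hd
    simpa using this
  rw [hc.mem_iff y hyt]
  have hx0 : 0 < t j x := (hc.mem_iff x (cthick_self hxt)).1 hx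
  have h1 := hc.lip y (x + σ • e j)
  rw [hc.t_shift] at h1
  have h2 : Λ * ‖y - (x + σ • e j)‖ ≤ σ / 2 := by
    calc _ ≤ Λ * ((2 * Λ)⁻¹ * σ) := by gcongr
      _ = σ / 2 := by field_simp
  have := (abs_le.1 (h1.trans h2)).1
  linarith

lemma in_interior (h : IsAtlas Ω Λ R e t ζ) {σ : ℝ} (hσ : 0 < σ) (hσ1 : σ < R) {x : EV m} (hx : x ∈ Ω)
    (hxt : x ∈ tsupport (fun x => 1 - ∑ j, ζ j x)) : closedBall x σ ⊆ Ω := by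
  intro y hy
  by_contra hyn
  obtain ⟨y', hy', hd⟩ := exists_frontier h.isOpen hx hσ.le (mem_cthickening_of_dist_le x y σ Ωᶜ hyn (by rwa [dist_comm]))
  have h1 : x ∈ thickening R (frontier Ω) := mem_thickening_iff.2 ⟨y', hy', lt_of_le_of_lt hd hσ1⟩
  have h2 : thickening R (frontier Ω) ∩ tsupport (fun x => 1 - ∑ j, ζ j x) = ∅ := by
    rw [tsupport, ← Set.disjoint_iff_inter_eq_empty]
    refine Disjoint.closure_right ?_ isOpen_thickening
    rw [Set.disjoint_left]
    intro z hz hz'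
    exact hz' (by show 1 - ∑ j, ζ j z = 0; rw [h.sum_one z (thickening_subset_cthickening _ _ hz)]; simp)
  have : x ∈ (∅ : Set (EV m)) := h2 ▸ ⟨h1, hxt⟩
  exact this

lemma density (h : IsAtlas Ω Λ R e t ζ) {p : ℝ≥0∞} (hp1 : 1 ≤ p) (hp : p ≠ ⊤) {k : ℕ} {u : EV m → ℝ} {D : List (Fin m) → EV m → ℝ}
    (hD : IsSobDerivs Ω k p u D) {η : ℝ≥0∞} (hη : 0 < η) :
    ∃ w : EV m → ℝ, ContDiff ℝ (⊤ : ℕ∞) w ∧ HasCompactSupport w ∧ ∀ l : List (Fin m), l.length ≤ k →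
      eLpNorm (fun x => partialDList l w x - D l x) p (volume.restrict Ω) ≤ η := by
  have hΩm := h.isOpen.measurableSet
  have hfin : {l : List (Fin m) | l.length ≤ k}.Finite := List.finite_length_le _ _
  let bmp : ContDiffBump (0 : EV m) := { rIn := 1, rOut := 2, rIn_pos := one_pos, rIn_lt_rOut := by norm_num }
  have hχ : ContDiff ℝ (⊤ : ℕ∞) bmp := bmp.contDiff
  have hχc : HasCompactSupport bmp := bmp.hasCompactSupport
  have hχ1 : ∀ x, ‖x‖ < 1 → bmp x = 1 := fun x hx => bmp.one_of_mem_closedBall (by simpa using hx.le)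
  have hη2 : 0 < η / 2 := ENNReal.half_pos hη.ne'
  have hev := (hfin.eventually_all (l := (atTop : Filter ℕ))).2 fun l (hl : l.length ≤ k) =>
    (ENNReal.tendsto_nhds_zero.1 (cutoff_tendsto hp1 hp hχ hχc hχ1 (μ := volume.restrict Ω) hD.2.2 l hl)) (η / 2) hη2
  obtain ⟨i, hi⟩ := hev.exists
  set X : EV m → ℝ := fun x => bmp (((i : ℝ) + 1)⁻¹ • x) with hX
  have hXs : ContDiff ℝ (⊤ : ℕ∞) X := hχ.comp (contDiff_const_smul _)
  have hXc : HasCompactSupport X := hχc.comp_smul (by positivity)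
  clear_value X
  have hss : ContDiff ℝ (⊤ : ℕ∞) (fun x => 1 - ∑ j, ζ j x) := contDiff_const.sub (ContDiff.sum fun j _ => h.ζ_smooth j)
  let κ : Option ι → EV m → ℝ := fun o => match o with
    | none => fun x => (1 - ∑ j, ζ j x) * X x
    | some j => fun x => ζ j x * X x
  have hκs : ∀ o, ContDiff ℝ (⊤ : ℕ∞) (κ o) := by
    rintro (_ | j)
    · exact hss.mul hXs
    · exact (h.ζ_smooth j).mul hXs
  have hκsum : ∀ x, ∑ o, κ o x = X x := by
    intro x
    rw [Fintype.sum_option]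
    simp only [κ]
    rw [← sum_mul]; ring
  have hκc : ∀ o, HasCompactSupport (κ o) := by
    rintro (_ | j) <;> exact hXc.mul_left
  have hR := h.R_pos
  have hpc : ∀ o, ∃ w : ℕ → EV m → ℝ, (∀ i, ContDiff ℝ (⊤ : ℕ∞) (w i) ∧ HasCompactSupport (w i)) ∧ ∀ l : List (Fin m), l.length ≤ k →
      Tendsto (fun i => eLpNorm (fun x => partialDList l (w i) x - ((splits l).map fun ab => partialDList ab.1 (κ o) x * D ab.2 x).sum) p (volume.restrict Ω)) atTop (𝓝 0) := by
    intro o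
    have hts : ∀ f : EV m → ℝ, tsupport (fun x => f x * X x) ⊆ tsupport f := fun f => closure_mono fun x hx => by
      intro h0
      exact hx (by simp [h0])
    rcases o with _ | j
    · refine density_piece hΩm (hκs none) (hκc none) 0 one_pos hR ?_ hp1 hp hD
      intro σ hσ hσ1 x hx hxt
      have := h.in_interior hσ hσ1 hx (hts _ hxt)
      simpa using this
    · refine density_piece hΩm (hκs (some j)) (hκc (some j)) (e j) (c := (2 * Λ)⁻¹) (σ1 := R / 2) ?_ (by linarith) ?_ hp1 hp hD
      · have := h.lam_ge; positivity
      · intro σ hσ hσ1 x hx hxt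
        exact h.in_chart j hσ hσ1 hx (hts _ hxt)
  choose w hws hwt using hpc
  have hκl : ∀ (l : List (Fin m)) x, ∑ o, partialDList l (κ o) x = partialDList l X x := by
    intro l x
    have h1 := partialDList_fsum Finset.univ κ (fun o _ => hκs o) l
    simp only [hκsum] at h1
    exact (congrFun h1 x).symm
  have hmain : ∀ l : List (Fin m), l.length ≤ k → Tendsto (fun i => ∑ o, eLpNorm (fun x => partialDList l (w o i) x - ((splits l).map fun ab => partialDList ab.1 (κ o) x * D ab.2 x).sum) p (volume.restrict Ω)) atTop (𝓝 0) := by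
    intro l hl
    have := tendsto_finsetSum Finset.univ (fun o _ => hwt o l hl)
    simpa using this
  have hev2 := (hfin.eventually_all (l := (atTop : Filter ℕ))).2 fun l (hl : l.length ≤ k) =>
    (ENNReal.tendsto_nhds_zero.1 (hmain l hl)) (η / 2) hη2
  obtain ⟨i2, hi2⟩ := hev2.exists
  refine ⟨fun x => ∑ o, w o i2 x, ContDiff.sum fun o _ => (hws o i2).1, ?_, fun l hl => ?_⟩
  · refine HasCompactSupport.of_support_subset_isCompact (K := ⋃ o, tsupport (w o i2)) (isCompact_iUnion fun o => (hws o i2).2) ?_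
    intro x hx
    obtain ⟨o, _, ho⟩ := Finset.exists_ne_zero_of_sum_ne_zero hx
    exact Set.mem_iUnion.2 ⟨o, subset_tsupport _ ho⟩
  · have hsl : ∀ ab ∈ splits l, ab.1.length ≤ k ∧ ab.2.length ≤ k := fun ab hab => by
      have := splits_len l ab hab; omega
    have hmS : ∀ f : EV m → ℝ, ContDiff ℝ (⊤ : ℕ∞) f → AEStronglyMeasurable (fun x => ((splits l).map fun ab => partialDList ab.1 f x * D ab.2 x).sum) (volume.restrict Ω) := by
      intro f hf
      refine (eLp_listsum _ hp1 _ _ ?_).2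
      intro ab hab
      exact (partialDList_smooth hf ab.1).continuous.aestronglyMeasurable.mul (hD.2.2 _ (hsl ab hab).2).1
    have heq : (fun x => partialDList l (fun x => ∑ o, w o i2 x) x - D l x) =
        (fun x => ∑ o, (partialDList l (w o i2) x - ((splits l).map fun ab => partialDList ab.1 (κ o) x * D ab.2 x).sum)) +
        (fun x => ((splits l).map fun ab => partialDList ab.1 X x * D ab.2 x).sum - D l x) := by
      ext x
      simp only [Pi.add_apply]
      rw [partialDList_fsum Finset.univ (fun o => w o i2) (fun o _ => (hws o i2).1) l, Finset.sum_sub_distrib, fsum_listsum]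
      have : (fun ab : List (Fin m) × List (Fin m) => ∑ o, partialDList ab.1 (κ o) x * D ab.2 x) = fun ab => partialDList ab.1 X x * D ab.2 x := by
        ext ab
        rw [← sum_mul, hκl]
      rw [this]; ring
    have hm1 : ∀ o ∈ (Finset.univ : Finset (Option ι)), AEStronglyMeasurable (fun x => partialDList l (w o i2) x - ((splits l).map fun ab => partialDList ab.1 (κ o) x * D ab.2 x).sum) (volume.restrict Ω) :=
      fun o _ => (partialDList_smooth (hws o i2).1 l).continuous.aestronglyMeasurable.sub (hmS _ (hκs o))
    have hA := Finset.aestronglyMeasurable_fun_sum Finset.univ hm1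
    rw [heq]
    refine (eLpNorm_add_le hA ((hmS X hXs).sub (hD.2.2 l hl).1) hp1).trans ?_
    refine (add_le_add ?_ (hi l hl)).trans (ENNReal.add_halves η).le
    refine le_trans ?_ (hi2 l hl)
    have := eLpNorm_sum_le (p := p) hm1 hp1
    refine le_trans (le_of_eq ?_) this
    congr 1
    ext x; simp
end IsAtlas
end

section
variable {m : ℕ}

lemma int_partial_zero {f : EV m → ℝ} (hf : ContDiff ℝ 1 f) (hc : HasCompactSupport f) (i : Fin m) : ∫ x, partialD i f x = 0 := by
  have h1 : Integrable (partialD i f) volume := by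
    refine Continuous.integrable_of_hasCompactSupport ?_ (partialDList_compact hc [i])
    exact (hf.continuous_fderiv one_ne_zero).clm_apply continuous_const
  have := integral_mul_fderiv_eq_neg_fderiv_mul_of_integrable (μ := volume) (f := f) (g := fun _ => (1 : ℝ)) (v := single i 1)
    (by simp only [mul_one]; exact h1) (by simp) (by simpa using hf.continuous.integrable_of_hasCompactSupport hc)
    (fun x _ => hf.differentiable one_ne_zero x) (fun x _ => by fun_prop)
  simp at this
  exact this

lemma deriv_ST_zero {s : ℝ} (hs : s < 0 ∨ 1 < s) : deriv smoothTransition s = 0 := by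
  rcases hs with hs | hs
  · have : smoothTransition =ᶠ[𝓝 s] fun _ => 0 := by
      filter_upwards [Iio_mem_nhds hs] with x hx
      exact smoothTransition.zero_of_nonpos (le_of_lt hx)
    rw [this.deriv_eq]; simp
  · have : smoothTransition =ᶠ[𝓝 s] fun _ => 1 := by
      filter_upwards [Ioi_mem_nhds hs] with x hx
      exact smoothTransition.one_of_one_le (le_of_lt hx)
    rw [this.deriv_eq]; simp

lemma deriv_ST_bdd : ∃ C, 0 ≤ C ∧ ∀ s, |deriv smoothTransition s| ≤ C := by
  have hc : Continuous (deriv smoothTransition) := (smoothTransition.contDiff (n := 1)).continuous_deriv le_rfl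
  obtain ⟨C, hC⟩ := isCompact_Icc.exists_bound_of_continuousOn (s := Icc (0 : ℝ) 1) hc.continuousOn
  refine ⟨max C 0, le_max_right _ _, fun s => ?_⟩
  by_cases hs : s ∈ Icc (0 : ℝ) 1
  · exact (hC s hs).trans (le_max_left _ _)
  · rw [deriv_ST_zero (by by_contra h; push Not at h; exact hs h)]; simp

namespace IsChart
variable {Ω K : Set (EV m)} {Λ R : ℝ} {e : EV m} {t : EV m → ℝ}

lemma zero_t_lip (h : IsChart Ω Λ R K e t) (hΩ : IsOpen Ω) (hR : 0 < R) {b : EV m → ℝ} (hb : ContDiff ℝ 1 b) (hbc : HasCompactSupport b)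
    (hbK : tsupport b ⊆ K) (hb0 : ∀ x ∈ frontier Ω, x ∈ K → b x = 0) : ∃ C, 0 ≤ C ∧ ∀ x, 0 < t x → |b x| ≤ C * t x := by
  obtain ⟨C1, hC1⟩ := hbc.exists_bound_of_continuous hb.continuous
  obtain ⟨L, hL⟩ := hb.lipschitzWith_of_hasCompactSupport hbc one_ne_zero
  have hC10 : 0 ≤ C1 := (norm_nonneg _).trans (hC1 0)
  refine ⟨L + C1 * (2 / R), by positivity, fun x hx => ?_⟩
  by_cases hxK : x ∈ K
  · by_cases hxt : t x ≤ R / 2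
    · have hy0 : t (x + (-t x) • e) = 0 := by rw [h.t_shift]; ring
      have hd : dist (x + (-t x) • e) x = t x := by
        rw [dist_eq_norm, add_sub_cancel_left, norm_smul, h.e_norm]; simp [abs_of_pos hx]
      have hyK : x + (-t x) • e ∈ cthickening (R / 2) K := by
        have := cthick_move (cthick_self (r := 0) hxK) le_rfl (hd.le.trans hxt)
        simpa using this
      have hfr := h.zero_frontier hΩ (by linarith : 0 ≤ R / 2) (by linarith) hyK hy0
      have hby : b (x + (-t x) • e) = 0 := by
        by_cases hyK' : x + (-t x) • e ∈ K
        · exact hb0 _ hfr hyK'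
        · exact image_eq_zero_of_notMem_tsupport (fun hh => hyK' (hbK hh))
      have := hL.dist_le_mul x (x + (-t x) • e)
      rw [hby, dist_comm x, hd, Real.dist_eq, sub_zero] at this
      have h2 : 0 ≤ C1 * (2 / R) * t x := by positivity
      linarith
    · push Not at hxt
      have h1 : |b x| ≤ C1 := hC1 x
      have h2 : C1 ≤ C1 * (2 / R) * t x := by
        have : 1 ≤ 2 / R * t x := by
          rw [div_mul_eq_mul_div, le_div_iff₀ hR]; linarith
        nlinarith
      have h3 : 0 ≤ (L : ℝ) * t x := by positivity
      linarith
  · rw [image_eq_zero_of_notMem_tsupport (fun hh => hxK (hbK hh))]; simp; positivity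

lemma div_zero (h : IsChart Ω Λ R K e t) (hΩ : IsOpen Ω) (hR : 0 < R) {F : Fin m → EV m → ℝ} (hF : ∀ i, ContDiff ℝ 1 (F i)) (hFc : ∀ i, HasCompactSupport (F i))
    (hFK : ∀ i, tsupport (F i) ⊆ K) (hb0 : ∀ x ∈ frontier Ω, x ∈ K → ∑ i, F i x * fderiv ℝ t x (single i 1) = 0) :
    ∫ x in Ω, ∑ i, partialD i (F i) x = 0 := by
  set b : EV m → ℝ := fun x => ∑ i, F i x * fderiv ℝ t x (single i 1) with hbdef
  have hν : ContDiff ℝ 1 (fderiv ℝ t) := h.t_smooth.fderiv_right (by norm_num)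
  have hb : ContDiff ℝ 1 b := ContDiff.sum fun i _ => (hF i).mul (hν.clm_apply contDiff_const)
  have hbsup : Function.support b ⊆ ⋃ i, tsupport (F i) := by
    intro x hx
    obtain ⟨i, _, hi⟩ := Finset.exists_ne_zero_of_sum_ne_zero hx
    exact Set.mem_iUnion.2 ⟨i, subset_tsupport _ (left_ne_zero_of_mul hi)⟩
  have hUc : IsCompact (⋃ i, tsupport (F i)) := isCompact_iUnion fun i => hFc i
  have hbc : HasCompactSupport b := HasCompactSupport.of_support_subset_isCompact hUc hbsup
  have hbK : tsupport b ⊆ K := (closure_minimal hbsup hUc.isClosed).trans (Set.iUnion_subset hFK)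
  obtain ⟨C, hC0, hC⟩ := h.zero_t_lip hΩ hR hb hbc hbK hb0
  obtain ⟨C', hC'0, hC'⟩ := deriv_ST_bdd
  clear_value b
  have hts : ContDiff ℝ 1 t := h.t_smooth.of_le (by norm_num)
  let dF : EV m → ℝ := fun x => ∑ i, partialD i (F i) x
  have hdFc : Continuous dF := continuous_finset_sum _ fun i _ => ((hF i).continuous_fderiv one_ne_zero).clm_apply continuous_const
  have hdF0 : ∀ x, x ∉ (⋃ i, tsupport (F i)) → dF x = 0 := by
    intro x hx
    refine Finset.sum_eq_zero fun i _ => ?_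
    exact partialDList_zero [i] (fun hh => hx (Set.mem_iUnion.2 ⟨i, hh⟩))
  have hdFcs : HasCompactSupport dF := HasCompactSupport.of_support_subset_isCompact hUc fun x hx => by
    by_contra hh; exact hx (hdF0 x hh)
  have hdFi : Integrable dF volume := hdFc.integrable_of_hasCompactSupport hdFcs
  let δ : ℕ → ℝ := fun k => 1 / ((k : ℝ) + 1)
  have hδ : ∀ k, 0 < δ k := fun k => by positivity
  have hδ0 : Tendsto δ atTop (𝓝 0) := tendsto_one_div_add_atTop_nhds_zero_nat
  have hSc : ContDiff ℝ 1 smoothTransition := smoothTransition.contDiff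
  have key : ∀ k, ∫ x, smoothTransition (t x / δ k) * dF x = - ∫ x, (δ k)⁻¹ * deriv smoothTransition (t x / δ k) * b x := by
    intro k
    have hS : ContDiff ℝ 1 (fun x => smoothTransition (t x / δ k)) := hSc.comp (hts.div_const _)
    have hprod : ∀ i x, partialD i (fun x => smoothTransition (t x / δ k) * F i x) x = smoothTransition (t x / δ k) * partialD i (F i) x +
        (δ k)⁻¹ * deriv smoothTransition (t x / δ k) * (F i x * fderiv ℝ t x (single i 1)) := by
      intro i x
      unfold partialD
      have h1 : HasFDerivAt t (fderiv ℝ t x) x := (h.diff x).hasFDerivAt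
      have h2 : HasFDerivAt (fun x => t x / δ k) ((δ k)⁻¹ • fderiv ℝ t x) x := by
        simp only [div_eq_inv_mul]; exact h1.const_mul _
      have h3 : HasDerivAt smoothTransition (deriv smoothTransition (t x / δ k)) (t x / δ k) := (hSc.differentiable one_ne_zero _).hasDerivAt
      have h4 := (h3.comp_hasFDerivAt x h2).mul ((hF i).differentiable one_ne_zero x).hasFDerivAt
      have h5 := h4.fderiv
      rw [show (fun x => smoothTransition (t x / δ k) * F i x) = (smoothTransition ∘ fun x => t x / δ k) * F i from rfl, h5]
      simp
      ring
    have hz : ∑ i, ∫ x, partialD i (fun x => smoothTransition (t x / δ k) * F i x) x = 0 :=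
      Finset.sum_eq_zero fun i _ => int_partial_zero (hS.mul (hF i)) (hFc i).mul_left i
    rw [← integral_finsetSum] at hz
    · have e1 : ∀ x, ∑ i, partialD i (fun x => smoothTransition (t x / δ k) * F i x) x = smoothTransition (t x / δ k) * dF x + (δ k)⁻¹ * deriv smoothTransition (t x / δ k) * b x := by
        intro x
        simp only [hprod, sum_add_distrib, ← mul_sum, hbdef, dF]
      simp only [e1] at hz
      have hi1 : Integrable (fun x => smoothTransition (t x / δ k) * dF x) volume :=
        (hS.continuous.mul hdFc).integrable_of_hasCompactSupport hdFcs.mul_left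
      have hi2 : Integrable (fun x => (δ k)⁻¹ * deriv smoothTransition (t x / δ k) * b x) volume := by
        refine Continuous.integrable_of_hasCompactSupport ?_ hbc.mul_left
        refine (continuous_const.mul ?_).mul hb.continuous
        exact (hSc.continuous_deriv le_rfl).comp (hts.continuous.div_const _)
      rw [integral_add hi1 hi2] at hz
      linarith
    · intro i _
      refine Continuous.integrable_of_hasCompactSupport ?_ (partialDList_compact ((hFc i).mul_left) [i])
      exact ((hS.mul (hF i)).continuous_fderiv one_ne_zero).clm_apply continuous_const
  have hL1 : Tendsto (fun k => ∫ x, smoothTransition (t x / δ k) * dF x) atTop (𝓝 (∫ x, Ω.indicator dF x)) := by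
    refine tendsto_integral_of_dominated_convergence (fun x => ‖dF x‖) ?_ hdFi.norm ?_ ?_
    · intro k
      exact ((smoothTransition.continuous.comp (hts.continuous.div_const _)).mul hdFc).aestronglyMeasurable
    · intro k
      refine Eventually.of_forall fun x => ?_
      rw [norm_mul]
      refine mul_le_of_le_one_left (norm_nonneg _) ?_
      rw [Real.norm_of_nonneg (smoothTransition.nonneg _)]
      exact smoothTransition.le_one _
    · refine Eventually.of_forall fun x => ?_
      by_cases hxU : x ∈ ⋃ i, tsupport (F i)
      · have hxK : x ∈ K := Set.iUnion_subset hFK hxU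
        have hm := h.mem_iff x (cthick_self hxK)
        by_cases hx : x ∈ Ω
        · rw [indicator_of_mem hx]
          have hx0 := hm.1 hx
          refine tendsto_const_nhds.congr' ?_
          filter_upwards [hδ0.eventually_lt_const hx0] with k hk
          rw [smoothTransition.one_of_one_le ((one_le_div (hδ k)).2 hk.le), one_mul]
        · rw [indicator_of_notMem hx]
          have hx0 : t x ≤ 0 := not_lt.1 fun hh => hx (hm.2 hh)
          refine tendsto_const_nhds.congr fun k => ?_
          rw [smoothTransition.zero_of_nonpos (div_nonpos_of_nonpos_of_nonneg hx0 (hδ k).le), zero_mul]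
      · have h0 := hdF0 x hxU
        have h1 : Ω.indicator dF x = 0 := by by_cases hx : x ∈ Ω <;> simp [hx, h0]
        rw [h1]; simp [h0]
  have hL2 : Tendsto (fun k => ∫ x, (δ k)⁻¹ * deriv smoothTransition (t x / δ k) * b x) atTop (𝓝 (∫ x : EV m, (0 : ℝ))) := by
    have hout : ∀ k x, (t x ≤ 0 ∨ δ k < t x) → (δ k)⁻¹ * deriv smoothTransition (t x / δ k) * b x = 0 := by
      intro k x hx
      rcases hx with hx | hx
      · rcases hx.lt_or_eq with hx | hx
        · rw [deriv_ST_zero (Or.inl (div_neg_of_neg_of_pos hx (hδ k)))]; simp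
        · by_cases hxK : x ∈ K
          · have := h.zero_frontier hΩ (le_refl 0) hR (cthick_self hxK) hx
            rw [hbdef]; dsimp only; rw [hb0 x this hxK, mul_zero]
          · rw [image_eq_zero_of_notMem_tsupport (fun hh => hxK (hbK hh)), mul_zero]
      · rw [deriv_ST_zero (Or.inr ((one_lt_div (hδ k)).2 hx))]; simp
    refine tendsto_integral_of_dominated_convergence ((tsupport b).indicator fun _ => C' * C) ?_ ?_ ?_ ?_
    · intro k
      refine Continuous.aestronglyMeasurable ((continuous_const.mul ?_).mul hb.continuous)
      exact (hSc.continuous_deriv le_rfl).comp (hts.continuous.div_const _)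
    · rw [integrable_indicator_iff (isClosed_tsupport b).measurableSet]
      exact integrableOn_const (hbc.isCompact.measure_lt_top.ne)
    · intro k
      refine Eventually.of_forall fun x => ?_
      by_cases hxb : x ∈ tsupport b
      · rw [indicator_of_mem hxb]
        by_cases hx : t x ≤ 0 ∨ δ k < t x
        · rw [hout k x hx, norm_zero]; positivity
        · push Not at hx
          rw [norm_mul, norm_mul, Real.norm_of_nonneg (by have := hδ k; positivity : 0 ≤ (δ k)⁻¹), Real.norm_eq_abs, Real.norm_eq_abs]
          have h1 := hC x hx.1
          have h2 : |b x| ≤ C * δ k := h1.trans (mul_le_mul_of_nonneg_left hx.2 hC0)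
          calc _ ≤ (δ k)⁻¹ * C' * (C * δ k) := by
                have := hδ k
                gcongr
                exact hC' _
            _ = C' * C := by have := (hδ k).ne'; field_simp
      · rw [image_eq_zero_of_notMem_tsupport hxb, mul_zero, norm_zero, indicator_of_notMem hxb]
    · refine Eventually.of_forall fun x => ?_
      refine tendsto_const_nhds.congr' ?_
      by_cases hx0 : t x ≤ 0
      · exact Eventually.of_forall fun k => (hout k x (Or.inl hx0)).symm
      · filter_upwards [hδ0.eventually_lt_const (not_le.1 hx0)] with k hk
        exact (hout k x (Or.inr hk)).symm
  have hL3 := hL2.neg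
  simp only [integral_zero, neg_zero] at hL3
  have := tendsto_nhds_unique hL1 (hL3.congr fun k => (key k).symm)
  rw [integral_indicator hΩ.measurableSet] at this
  exact this
end IsChart
end

section
variable {m : ℕ}

lemma mol_dir {φ f : EV m → ℝ} (hf : LocallyIntegrable f volume) (hφ : ContDiff ℝ (⊤ : ℕ∞) φ) (hc : HasCompactSupport φ)
    (e x : EV m) : fderiv ℝ (mol φ f) x e = mol (fun y => fderiv ℝ φ y e) f x := by
  have h1 : ContDiff ℝ 1 φ := hφ.of_le (by norm_cast)
  have := hc.hasFDerivAt_convolution_right (ContinuousLinearMap.lsmul ℝ ℝ) hf h1 x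
  rw [← mol_eq] at this
  rw [this.fderiv, mol_eq]
  exact convolution_precompR_apply _ hf (hc.fderiv ℝ) (h1.continuous_fderiv one_ne_zero) x _

lemma mol_dir_weak {φ g h : EV m → ℝ} {e : EV m} (hg : LocallyIntegrable g volume)
    (hw : ∀ ψ : EV m → ℝ, ContDiff ℝ (⊤ : ℕ∞) ψ → HasCompactSupport ψ → ∫ x, g x * fderiv ℝ ψ x e = - ∫ x, h x * ψ x)
    (hφ : ContDiff ℝ (⊤ : ℕ∞) φ) (hc : HasCompactSupport φ) (x : EV m) : fderiv ℝ (mol φ g) x e = mol φ h x := by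
  rw [mol_dir hg hφ hc]
  have hcs : HasCompactSupport (fun y => φ (x - y)) := by
    refine HasCompactSupport.of_support_subset_isCompact (K := (fun z => x - z) '' tsupport φ) (hc.isCompact.image (by fun_prop)) ?_
    intro y hy
    exact ⟨x - y, subset_tsupport φ hy, by simp⟩
  have h := hw (fun y => φ (x - y)) (hφ.comp (contDiff_const.sub contDiff_id)) hcs
  have hp : ∀ y, fderiv ℝ (fun y => φ (x - y)) y e = - fderiv ℝ φ (x - y) e := by
    intro y
    have h1 : HasFDerivAt (fun y => φ (x - y)) ((fderiv ℝ φ (x - y)).comp (-(ContinuousLinearMap.id ℝ (EV m)))) y := by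
      have h2 : HasFDerivAt φ (fderiv ℝ φ (x - y)) (x - y) := (hφ.differentiable (by simp) _).hasFDerivAt
      exact h2.comp y ((hasFDerivAt_id y).const_sub x)
    rw [h1.fderiv]
    simp
  simp only [hp, mul_neg, integral_neg, neg_inj] at h
  exact h

lemma weak_hardy_abs {p : ℝ≥0∞} (hp1 : 1 ≤ p) (hp : p ≠ ⊤) {g h : EV m → ℝ} {e : EV m} (hg : MemLp g p volume) (hh : MemLp h p volume)
    (hw : ∀ ψ : EV m → ℝ, ContDiff ℝ (⊤ : ℕ∞) ψ → HasCompactSupport ψ → ∫ x, g x * fderiv ℝ ψ x e = - ∫ x, h x * ψ x)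
    {S T : Set (EV m)} (hS : MeasurableSet S) (hT : MeasurableSet T) {τ : ℝ} (hτ : 0 < τ)
    (hST : ∀ x ∈ S, ∀ r ∈ Icc (0 : ℝ) τ, x + (0 + r • (-e)) ∈ T) (hS0 : ∀ x ∈ S, g (x - τ • e) = 0) :
    eLpNorm g p (volume.restrict S) ≤ ofReal τ * eLpNorm h p (volume.restrict T) := by
  have hq := toReal_one_le hp1 hp
  have main : ∀ η : ℝ≥0∞, 0 < η → eLpNorm g p (volume.restrict S) ≤ (η + η) + ofReal τ * (η + eLpNorm h p (volume.restrict T)) := by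
    intro η hη
    obtain ⟨σa, hσa, ha⟩ := mol_approx hp1 hp hg hη
    obtain ⟨σb, hσb, hb⟩ := mol_approx hp1 hp hh hη
    have hσ : 0 < min σa σb := lt_min hσa hσb
    let bmp : ContDiffBump (0 : EV m) := { rIn := min σa σb / 2, rOut := min σa σb, rIn_pos := by linarith, rIn_lt_rOut := by linarith }
    let φ : EV m → ℝ := bmp.normed volume
    have hφs : ContDiff ℝ (⊤ : ℕ∞) φ := bmp.contDiff_normed
    have hφc : HasCompactSupport φ := bmp.hasCompactSupport_normed
    have hsup : ∀ z, φ z ≠ 0 → ‖z‖ < min σa σb := by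
      intro z hz
      have : z ∈ Function.support (bmp.normed volume) := hz
      rw [bmp.support_normed_eq] at this
      exact mem_ball_zero_iff.mp this
    have ha' := ha φ hφs.continuous hφc (fun x => bmp.nonneg_normed x) bmp.integral_normed (fun z hz => (hsup z hz).trans_le (min_le_left _ _))
    have hb' := hb φ hφs.continuous hφc (fun x => bmp.nonneg_normed x) bmp.integral_normed (fun z hz => (hsup z hz).trans_le (min_le_right _ _))
    have hgL := hg.locallyIntegrable hp1
    have hhL := hh.locallyIntegrable hp1
    have hGs := mol_smooth hgL hφs hφc
    have hHs := mol_smooth hhL hφs hφc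
    have hder : ∀ x, fderiv ℝ (mol φ g) x e = mol φ h x := fun x => mol_dir_weak hgL hw hφs hφc x
    clear_value φ
    have hGd : Differentiable ℝ (mol φ g) := hGs.differentiable (by simp)
    -- pointwise path bound
    have hpath : ∀ x, ‖mol φ g x - mol φ g (x - τ • e)‖ₑ ≤ ∫⁻ s in Icc (0 : ℝ) τ, ‖mol φ h (x + (0 + s • (-e)))‖ₑ := by
      intro x
      have hd : ∀ s : ℝ, HasDerivAt (fun s : ℝ => mol φ g (x + s • (-e))) (-(mol φ h (x + s • (-e)))) s := by
        intro s
        have := hasDerivAt_line x (-e) s (hGd _)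
        rwa [map_neg, hder] at this
      have hcont : Continuous fun s : ℝ => -(mol φ h (x + s • (-e))) := (hHs.continuous.comp (by fun_prop)).neg
      have hI := intervalIntegral.integral_eq_sub_of_hasDerivAt (a := 0) (b := τ) (fun s _ => hd s) (hcont.intervalIntegrable _ _)
      have e1 : mol φ g x - mol φ g (x - τ • e) = - ∫ s in (0 : ℝ)..τ, -(mol φ h (x + s • (-e))) := by
        rw [hI]; simp [sub_eq_add_neg]
      rw [e1, enorm_neg, intervalIntegral.integral_of_le hτ.le, ← integral_Icc_eq_integral_Ioc]
      refine (enorm_integral_le_lintegral_enorm _).trans (le_of_eq ?_)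
      simp
    have hA : eLpNorm (fun x => mol φ g x - mol φ g (x - τ • e)) p (volume.restrict S) ≤ ofReal τ * eLpNorm (mol φ h) p (volume.restrict T) := by
      refine (ENNReal.rpow_le_rpow_iff (show 0 < p.toReal by linarith)).1 ?_
      rw [ENNReal.mul_rpow_of_nonneg _ _ (by linarith), eLp_pow _ hp1 hp, eLp_pow _ hp1 hp]
      refine le_trans (lintegral_mono fun x => ENNReal.rpow_le_rpow (hpath x) (by linarith)) ?_
      exact path_avg hq S T hS hT (mol φ h) hHs.continuous 0 (-e) τ hτ.le hST
    have hB : eLpNorm (mol φ h) p (volume.restrict T) ≤ η + eLpNorm h p (volume.restrict T) := by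
      have : mol φ h = (fun x => mol φ h x - h x) + h := by ext x; simp
      rw [this]
      refine (eLpNorm_add_le (hHs.continuous.aestronglyMeasurable.sub hh.1.restrict) hh.1.restrict hp1).trans (add_le_add ?_ le_rfl)
      exact (eLpNorm_mono_measure _ Measure.restrict_le_self).trans hb'
    have hmp : MeasurePreserving (fun x : EV m => x - τ • e) volume volume := measurePreserving_sub_right volume _
    have hm1 : AEStronglyMeasurable (fun x => mol φ g x - g x) volume := hGs.continuous.aestronglyMeasurable.sub hg.1
    have hC : eLpNorm (fun x => mol φ g (x - τ • e) - g (x - τ • e)) p (volume.restrict S) ≤ η := by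
      refine (eLpNorm_mono_measure _ Measure.restrict_le_self).trans ?_
      have := eLpNorm_comp_measurePreserving (p := p) hm1 hmp
      exact (le_of_eq this).trans ha'
    have heq : g =ᵐ[volume.restrict S] ((fun x => -(mol φ g x - g x)) + (fun x => mol φ g (x - τ • e) - g (x - τ • e))) + (fun x => mol φ g x - mol φ g (x - τ • e)) := by
      refine (ae_restrict_iff' hS).2 (Eventually.of_forall fun x hx => ?_)
      simp only [Pi.add_apply]
      rw [hS0 x hx]; ring
    rw [eLpNorm_congr_ae heq]
    have hm2 : AEStronglyMeasurable (fun x => mol φ g (x - τ • e) - g (x - τ • e)) volume := hm1.comp_measurePreserving hmp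
    refine (eLpNorm_add_le (hm1.neg.restrict.add hm2.restrict) ?_ hp1).trans (add_le_add ?_ (hA.trans (mul_le_mul_right hB _)))
    · exact (hGs.continuous.sub (hGs.continuous.comp (by fun_prop))).aestronglyMeasurable
    · refine (eLpNorm_add_le hm1.neg.restrict hm2.restrict hp1).trans (add_le_add ?_ hC)
      have := eLpNorm_neg (f := fun x => mol φ g x - g x) (p := p) (μ := volume.restrict S)
      exact (le_of_eq this).trans ((eLpNorm_mono_measure _ Measure.restrict_le_self).trans ha')
  have hlim : Tendsto (fun η : ℝ≥0∞ => (η + η) + ofReal τ * (η + eLpNorm h p (volume.restrict T))) (𝓝[>] 0) (𝓝 ((0 + 0) + ofReal τ * (0 + eLpNorm h p (volume.restrict T)))) := by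
    have hid : Tendsto (fun η : ℝ≥0∞ => η) (𝓝[>] 0) (𝓝 0) := tendsto_nhdsWithin_of_tendsto_nhds tendsto_id
    refine (hid.add hid).add (ENNReal.Tendsto.const_mul (hid.add tendsto_const_nhds) (Or.inr ofReal_ne_top))
  simp only [zero_add] at hlim
  exact ge_of_tendsto hlim (by filter_upwards [self_mem_nhdsWithin] with η hη; exact main η hη)
end

section
variable {m : ℕ}

lemma hold_c {Ω : Set (EV m)} {p : ℝ≥0∞} (hp1 : 1 ≤ p) {c : EV m → ℝ} (hc : Continuous c) (hcc : HasCompactSupport c) :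
    ∃ C : ℝ≥0∞, C ≠ ⊤ ∧ ∀ f : EV m → ℝ, AEStronglyMeasurable f (volume.restrict Ω) →
      ∫⁻ x in Ω, ‖c x * f x‖ₑ ≤ C * eLpNorm f p (volume.restrict Ω) := by
  have hh : ENNReal.HolderConjugate (ENNReal.conjExponent p) p := (ENNReal.HolderConjugate.conjExponent hp1).symm
  refine ⟨eLpNorm c (ENNReal.conjExponent p) (volume.restrict Ω), ((hc.memLp_of_hasCompactSupport hcc).mono_measure Measure.restrict_le_self).2.ne, fun f hf => ?_⟩
  have := eLpNorm_smul_le_mul_eLpNorm (r := 1) hf hc.aestronglyMeasurable (p := ENNReal.conjExponent p) (q := p)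
  rw [eLpNorm_one_eq_lintegral_enorm] at this
  exact this

lemma hold_int {Ω : Set (EV m)} {p : ℝ≥0∞} (hp1 : 1 ≤ p) {c f : EV m → ℝ} (hc : Continuous c) (hcc : HasCompactSupport c)
    (hf : MemLp f p (volume.restrict Ω)) : Integrable (fun x => c x * f x) (volume.restrict Ω) := by
  obtain ⟨C, hC, h⟩ := hold_c (Ω := Ω) hp1 hc hcc
  exact ⟨hc.aestronglyMeasurable.mul hf.1, (h f hf.1).trans_lt (ENNReal.mul_lt_top hC.lt_top hf.2)⟩

lemma enn_zero {a C : ℝ≥0∞} (hC : C ≠ ⊤) (h : ∀ η : ℝ≥0∞, 0 < η → a ≤ C * η) : a = 0 := by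
  by_contra ha
  have h0 : 0 < a := pos_iff_ne_zero.mpr ha
  have ht : Tendsto (fun η : ℝ≥0∞ => C * η) (𝓝[>] 0) (𝓝 (C * 0)) :=
    (ENNReal.Tendsto.const_mul tendsto_id (Or.inr hC)).mono_left nhdsWithin_le_nhds
  have := ge_of_tendsto ht (by filter_upwards [self_mem_nhdsWithin] with η hη using h η hη)
  simp at this
  exact ha this

lemma partialDList_cont {w : EV m → ℝ} (hw : ContDiff ℝ (⊤ : ℕ∞) w) (l : List (Fin m)) : Continuous (partialDList l w) :=
  (partialDList_smooth hw l).continuous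

variable {ι : Type} [Fintype ι] {Ω : Set (EV m)} {Λ R : ℝ} {e : ι → EV m} {t : ι → EV m → ℝ} {ζ : ι → EV m → ℝ}

lemma IsAtlas.pass_limit (hA : IsAtlas Ω Λ R e t ζ) {p : ℝ≥0∞} (hp1 : 1 ≤ p) (hp : p ≠ ⊤) {k : ℕ} {u : EV m → ℝ} {D : List (Fin m) → EV m → ℝ}
    (hD : IsSobDerivs Ω k p u D) {κ : Type} [Fintype κ] (l : κ → List (Fin m)) (hl : ∀ a, (l a).length ≤ k) (c : κ → EV m → ℝ)
    (hc : ∀ a, Continuous (c a)) (hcc : ∀ a, HasCompactSupport (c a))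
    (h0 : ∀ w : EV m → ℝ, ContDiff ℝ (⊤ : ℕ∞) w → HasCompactSupport w → ∫ x in Ω, ∑ a, c a x * partialDList (l a) w x = 0) :
    ∫ x in Ω, ∑ a, c a x * D (l a) x = 0 := by
  choose C hC hb using fun a => hold_c (Ω := Ω) hp1 (hc a) (hcc a)
  rw [← enorm_eq_zero]
  refine enn_zero (C := ∑ a, C a) (by simpa using hC) fun η hη => ?_
  obtain ⟨w, hw, hwc, hwD⟩ := hA.density hp1 hp hD hη
  have hi1 : ∀ a, Integrable (fun x => c a x * D (l a) x) (volume.restrict Ω) := fun a => hold_int hp1 (hc a) (hcc a) (hD.2.2 _ (hl a))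
  have hi2 : ∀ a, Integrable (fun x => c a x * partialDList (l a) w x) (volume.restrict Ω) := fun a =>
    (((hc a).mul (partialDList_cont hw _)).integrable_of_hasCompactSupport (hcc a).mul_right).restrict
  have e1 : ∫ x in Ω, ∑ a, c a x * D (l a) x = -∫ x in Ω, ∑ a, c a x * (partialDList (l a) w x - D (l a) x) := by
    have : (fun x => ∑ a, c a x * (partialDList (l a) w x - D (l a) x)) = fun x => (∑ a, c a x * partialDList (l a) w x) - ∑ a, c a x * D (l a) x := by
      funext x; rw [← Finset.sum_sub_distrib]; simp only [mul_sub]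
    rw [this, integral_sub (integrable_finset_sum _ fun a _ => hi2 a) (integrable_finset_sum _ fun a _ => hi1 a), h0 w hw hwc]
    simp
  rw [e1, enorm_neg]
  refine (enorm_integral_le_lintegral_enorm _).trans ?_
  calc ∫⁻ x in Ω, ‖∑ a, c a x * (partialDList (l a) w x - D (l a) x)‖ₑ ≤ ∫⁻ x in Ω, ∑ a, ‖c a x * (partialDList (l a) w x - D (l a) x)‖ₑ :=
        lintegral_mono fun x => enorm_sum_le _ _
    _ = ∑ a, ∫⁻ x in Ω, ‖c a x * (partialDList (l a) w x - D (l a) x)‖ₑ := lintegral_finsetSum' _ fun a _ =>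
        ((hc a).aestronglyMeasurable.mul ((partialDList_cont hw _).aestronglyMeasurable.sub (hD.2.2 _ (hl a)).1)).enorm
    _ ≤ ∑ a, C a * η := sum_le_sum fun a _ => (hb a _ ((partialDList_cont hw _).aestronglyMeasurable.sub (hD.2.2 _ (hl a)).1)).trans
        (mul_le_mul_right (hwD _ (hl a)) _)
    _ = (∑ a, C a) * η := by rw [sum_mul]
end

section
lemma HasCompactSupport.fsum' {m : ℕ} {κ : Type*} (s : Finset κ) {f : κ → EV m → ℝ} (h : ∀ a, HasCompactSupport (f a)) :
    HasCompactSupport (fun x => ∑ a ∈ s, f a x) := by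
  classical
  induction s using Finset.induction_on with
  | empty => simp only [Finset.sum_empty]; exact HasCompactSupport.zero
  | insert a s ha ih => simp only [Finset.sum_insert ha]; exact (h a).add ih

variable {m : ℕ} {ι : Type} [Fintype ι] {Ω : Set (EV m)} {Λ R : ℝ} {e : ι → EV m} {t : ι → EV m → ℝ} {ζ : ι → EV m → ℝ}

lemma partialD_mul' {f g : EV m → ℝ} (hf : Differentiable ℝ f) (hg : Differentiable ℝ g) (x v : EV m) :
    fderiv ℝ (fun y => f y * g y) x v = f x * fderiv ℝ g x v + g x * fderiv ℝ f x v := by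
  rw [fderiv_fun_mul (hf x) (hg x)]; simp

lemma IsAtlas.tang (hA : IsAtlas Ω Λ R e t ζ) (j : ι) {p : ℝ≥0∞} (hp1 : 1 ≤ p) (hp : p ≠ ⊤) {u : EV m → ℝ} {D : List (Fin m) → EV m → ℝ}
    (hD : IsSobDerivs Ω 2 p u D) {c : Fin m → Fin m → EV m → ℝ} (hb : ∀ i k, ContDiff ℝ 1 (c i k)) (hcc : ∀ i k, HasCompactSupport (c i k))
    (hcK : ∀ i k, tsupport (c i k) ⊆ tsupport (ζ j))
    (hν : ∀ k x, ∑ i, c i k x * fderiv ℝ (t j) x (single i 1) = 0) :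
    ∫ x in Ω, ((∑ k, (∑ i, partialD i (c i k) x) * D [k] x) + ∑ i, ∑ k, c i k x * D [i, k] x) = 0 := by
  have hc1 : ∀ i k, Continuous (partialD i (c i k)) := fun i k => ((hb i k).continuous_fderiv one_ne_zero).clm_apply continuous_const
  have hc2 : ∀ i k, HasCompactSupport (partialD i (c i k)) := fun i k => (hcc i k).fderiv_apply ℝ _
  have key := hA.pass_limit hp1 hp hD (κ := Fin m ⊕ Fin m × Fin m) (fun a => a.elim (fun k => [k]) (fun a => [a.1, a.2]))
    (by rintro (a | a) <;> simp) (fun a => a.elim (fun k x => ∑ i, partialD i (c i k) x) (fun a => c a.1 a.2))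
    (by rintro (a | a); exacts [continuous_finset_sum _ fun i _ => hc1 i a, (hb _ _).continuous])
    (by rintro (a | a); exacts [HasCompactSupport.fsum' Finset.univ (fun i => hc2 i a), hcc _ _])
  simp only [Fintype.sum_sum_type, Fintype.sum_prod_type, Sum.elim_inl, Sum.elim_inr] at key
  refine key fun w hw hwc => ?_
  have hw1 : ∀ k, ContDiff ℝ (⊤ : ℕ∞) (partialDList [k] w) := fun k => partialDList_smooth hw [k]
  have hF : ∀ i k, ContDiff ℝ 1 (fun x => c i k x * partialDList [k] w x) := fun i k => (hb i k).mul ((hw1 k).of_le (by norm_cast))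
  have hdz := (hA.chart j).div_zero hA.isOpen hA.R_pos (F := fun i x => ∑ k, c i k x * partialDList [k] w x)
    (fun i => ContDiff.sum fun k _ => hF i k) (fun i => HasCompactSupport.fsum' Finset.univ (fun k => (hcc i k).mul_right)) (fun i => ?_) ?_
  · rw [← hdz]
    refine integral_congr_ae (ae_of_all _ fun x => ?_)
    have : ∀ i, partialD i (fun x => ∑ k, c i k x * partialDList [k] w x) x = ∑ k, (c i k x * partialDList [i, k] w x + partialDList [k] w x * partialD i (c i k) x) := by
      intro i
      unfold partialD
      rw [fderiv_fun_sum fun k _ => (hF i k).differentiable one_ne_zero x]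
      simp only [ContinuousLinearMap.sum_apply]
      exact sum_congr rfl fun k _ => partialD_mul' ((hb i k).differentiable one_ne_zero) ((hw1 k).differentiable (by simp)) x _
    simp only [this, sum_add_distrib]
    rw [add_comm, Finset.sum_comm (f := fun i k => partialDList [k] w x * _)]
    simp only [sum_mul]
    exact congrArg₂ _ rfl (sum_congr rfl fun k _ => sum_congr rfl fun i _ => mul_comm _ _)
  · refine closure_minimal (fun x hx => ?_) (isClosed_tsupport _)
    by_contra hn
    exact hx (Finset.sum_eq_zero fun k _ => by rw [image_eq_zero_of_notMem_tsupport fun h => hn (hcK i k h), zero_mul])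
  · intro x _ _
    simp only [sum_mul]
    rw [Finset.sum_comm]
    refine Finset.sum_eq_zero fun k _ => ?_
    have := congrArg (· * partialDList [k] w x) (hν k x)
    simp only [zero_mul, sum_mul] at this
    rw [← this]
    exact sum_congr rfl fun i _ => by ring
end

section
variable {m : ℕ} {ι : Type} [Fintype ι] {Ω : Set (EV m)} {Λ R : ℝ} {e : ι → EV m} {t : ι → EV m → ℝ} {ζ : ι → EV m → ℝ}

/-- coordinates of the conormal `Mν` -/
def coN (M : Matrix (Fin m) (Fin m) ℝ) (t : EV m → ℝ) (k : Fin m) (x : EV m) : ℝ := ∑ i, M i k * fderiv ℝ t x (single i 1)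

lemma coN_smooth {M : Matrix (Fin m) (Fin m) ℝ} {t : EV m → ℝ} (ht : ContDiff ℝ 3 t) (k : Fin m) : ContDiff ℝ 2 (coN M t k) :=
  ContDiff.sum fun i _ => contDiff_const.mul ((ht.fderiv_right (m := 2) (by norm_num)).clm_apply contDiff_const)

lemma IsChart.coN_e {K : Set (EV m)} {e : EV m} {t : EV m → ℝ} (h : IsChart Ω Λ R K e t) (M : Matrix (Fin m) (Fin m) ℝ) (k : Fin m) (x : EV m) :
    fderiv ℝ (coN M t k) x e = 0 := by
  have hd : HasDerivAt (fun s : ℝ => coN M t k (x + s • e)) (fderiv ℝ (coN M t k) (x + (0 : ℝ) • e) e) 0 :=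
    hasDerivAt_line x e 0 ((coN_smooth h.t_smooth k).differentiable (by norm_num) _)
  have hc : (fun s : ℝ => coN M t k (x + s • e)) = fun _ => coN M t k x := by
    funext s; simp only [coN, h.fderiv_shift]
  rw [hc] at hd
  simpa using hd.unique (hasDerivAt_const _ _)

lemma memLp_c_mul {c f : EV m → ℝ} {p : ℝ≥0∞} {μ : Measure (EV m)} (hc : Continuous c) (hcc : HasCompactSupport c) (hf : MemLp f p μ) :
    MemLp (fun x => c x * f x) p μ := by
  obtain ⟨C, hC⟩ := hcc.exists_bound_of_continuous hc
  exact ⟨hc.aestronglyMeasurable.mul hf.1, (eLp_mul_bdd μ p c f C hC).trans_lt (ENNReal.mul_lt_top ofReal_lt_top hf.2)⟩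

lemma absc {p : ℝ≥0∞} (hp1 : 1 ≤ p) (hp : p ≠ ⊤) {h : EV m → ℝ} (hh : MemLp h p volume) (T : ℝ → Set (EV m)) (hT : ∀ τ, MeasurableSet (T τ))
    (h0 : ∀ x, h x ≠ 0 → ∀ᶠ τ in 𝓝[>] (0 : ℝ), x ∉ T τ) : Tendsto (fun τ => eLpNorm h p (volume.restrict (T τ))) (𝓝[>] 0) (𝓝 0) := by
  have hq := toReal_one_le hp1 hp
  have hq0 : 0 < p.toReal := by linarith
  have key : Tendsto (fun τ => ∫⁻ x, (T τ).indicator (fun x => ‖h x‖ₑ ^ p.toReal) x) (𝓝[>] 0) (𝓝 (∫⁻ x : EV m, 0)) := by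
    refine tendsto_lintegral_filter_of_dominated_convergence' (fun x => ‖h x‖ₑ ^ p.toReal) (Eventually.of_forall fun τ => (hh.1.enorm.pow_const _).indicator (hT τ))
      (Eventually.of_forall fun τ => ae_of_all _ fun x => Set.indicator_le_self _ _ x) ?_ (ae_of_all _ fun x => ?_)
    · rw [← eLp_pow volume hp1 hp]
      exact ENNReal.rpow_ne_top_of_nonneg hq0.le hh.2.ne
    · refine tendsto_const_nhds.congr' ?_
      by_cases hx : h x = 0
      · refine Eventually.of_forall fun τ => ?_
        by_cases hτ : x ∈ T τ <;> simp [hτ, hx, hq0]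
      · filter_upwards [h0 x hx] with τ hτ
        simp [hτ]
  simp only [lintegral_zero] at key
  have k2 := (ENNReal.continuous_rpow_const (y := p.toReal⁻¹)).tendsto 0 |>.comp key
  rw [ENNReal.zero_rpow_of_pos (by positivity)] at k2
  refine k2.congr fun τ => ?_
  simp only [Function.comp]
  rw [lintegral_indicator (hT τ), ← eLp_pow _ hp1 hp, ← ENNReal.rpow_mul, mul_inv_cancel₀ hq0.ne', ENNReal.rpow_one]

lemma IsAtlas.hardy_weak (hA : IsAtlas Ω Λ R e t ζ) (j : ι) {p : ℝ≥0∞} (hp1 : 1 ≤ p) (hp : p ≠ ⊤) {u : EV m → ℝ} {D : List (Fin m) → EV m → ℝ}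
    {M : Matrix (Fin m) (Fin m) ℝ} (hD : IsSobDerivs Ω 2 p u D) (hN : NeumannBC Ω M p u) {η : ℝ≥0∞} (hη : 0 < η) :
    ∀ᶠ τ in 𝓝[>] (0 : ℝ), eLpNorm (fun x => ∑ k, (ζ j x * coN M (t j) k x) * D [k] x) p (volume.restrict (chartLayer Ω 0 (tsupport (ζ j)) (t j) τ)) ≤ ofReal τ * η := by
  have hch := hA.chart j
  have hζ := hA.ζ_smooth j
  have hζc := hA.ζ_compact j
  have hΩm := hA.isOpen.measurableSet
  have hζ1 : ContDiff ℝ 2 (ζ j) := hζ.of_le (by norm_cast)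
  have hζd : ContDiff ℝ 1 (fun x => fderiv ℝ (ζ j) x (e j)) := (hζ1.fderiv_right (m := 1) (by norm_num)).clm_apply contDiff_const
  have ha : ∀ k, ContDiff ℝ 2 (coN M (t j) k) := fun k => coN_smooth hch.t_smooth k
  have ha1 : ∀ k, ContDiff ℝ 1 (coN M (t j) k) := fun k => (ha k).of_le (by norm_num)
  set K := tsupport (ζ j) with hK
  let a := coN M (t j)
  let G : EV m → ℝ := fun x => ∑ k, (ζ j x * a k x) * D [k] x
  let H : EV m → ℝ := fun x => (∑ k, (fderiv ℝ (ζ j) x (e j) * a k x) * D [k] x) + ∑ i, ∑ k, (ζ j x * (e j i * a k x)) * D [i, k] x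
  have hm1 : ∀ k, MemLp (D [k]) p (volume.restrict Ω) := fun k => hD.2.2 _ (by simp)
  have hm2 : ∀ i k, MemLp (D [i, k]) p (volume.restrict Ω) := fun i k => hD.2.2 _ (by simp)
  have hG : MemLp G p (volume.restrict Ω) := memLp_finset_sum _ fun k _ => memLp_c_mul (hζ.continuous.mul (ha k).continuous) hζc.mul_right (hm1 k)
  have hH : MemLp H p (volume.restrict Ω) := by
    refine MemLp.add (memLp_finset_sum _ fun k _ => memLp_c_mul (hζd.continuous.mul (ha k).continuous) (hζc.fderiv_apply ℝ _).mul_right (hm1 k))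
      (memLp_finset_sum _ fun i _ => memLp_finset_sum _ fun k _ => memLp_c_mul (hζ.continuous.mul (continuous_const.mul (ha k).continuous)) hζc.mul_right (hm2 i k))
  have hweak : ∀ ψ : EV m → ℝ, ContDiff ℝ (⊤ : ℕ∞) ψ → HasCompactSupport ψ → ∫ x, Ω.indicator G x * fderiv ℝ ψ x (e j) = - ∫ x, Ω.indicator H x * ψ x := by
    intro ψ hψ hψc
    have hψd : ContDiff ℝ (⊤ : ℕ∞) (fun x => fderiv ℝ ψ x (e j)) := (hψ.fderiv_right (by norm_cast)).clm_apply contDiff_const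
    let φ : EV m → ℝ := fun x => ζ j x * ψ x
    have hφ : ContDiff ℝ (⊤ : ℕ∞) φ := hζ.mul hψ
    have hφc : HasCompactSupport φ := hζc.mul_right
    have hφ1 : ContDiff ℝ 1 φ := hφ.of_le (by norm_cast)
    have hφe : ∀ x v, fderiv ℝ φ x v = ζ j x * fderiv ℝ ψ x v + ψ x * fderiv ℝ (ζ j) x v :=
      fun x v => partialD_mul' (hζ.differentiable (by simp)) (hψ.differentiable (by simp)) x v
    let c : Fin m → Fin m → EV m → ℝ := fun i k x => φ x * (e j i * a k x - M i k)
    have hb : ∀ i k, ContDiff ℝ 1 (fun x => e j i * a k x - M i k) := fun i k => (contDiff_const.mul (ha1 k)).sub contDiff_const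
    have h1 := hA.tang j hp1 hp hD (c := c) (fun i k => hφ1.mul (hb i k)) (fun i k => hφc.mul_right)
      (fun i k => (tsupport_mul_subset_left).trans tsupport_mul_subset_left) ?_
    swap
    · intro k x
      have : ∑ i, e j i * fderiv ℝ (t j) x (single i 1) = 1 := by rw [← clm_sum, hch.fderiv_e]
      have e2 : ∀ i, c i k x * fderiv ℝ (t j) x (single i 1) = φ x * a k x * (e j i * fderiv ℝ (t j) x (single i 1)) - φ x * (M i k * fderiv ℝ (t j) x (single i 1)) := by
        intro i; simp only [c]; ring
      simp only [e2, Finset.sum_sub_distrib, ← mul_sum, this]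
      change φ x * a k x * 1 - φ x * a k x = 0
      ring
    have hdiv : ∀ k x, ∑ i, partialD i (c i k) x = a k x * fderiv ℝ φ x (e j) - ∑ i, M i k * partialD i φ x := by
      intro k x
      have e2 : ∀ i, partialD i (c i k) x = φ x * (e j i * fderiv ℝ (a k) x (single i 1)) + a k x * (e j i * fderiv ℝ φ x (single i 1)) - M i k * partialD i φ x := by
        intro i
        have e3 : fderiv ℝ (fun x => e j i * a k x - M i k) x = e j i • fderiv ℝ (a k) x := by
          rw [fderiv_sub_const]; exact fderiv_const_mul ((ha1 k).differentiable one_ne_zero x) _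
        have := partialD_mul' (hφ1.differentiable one_ne_zero) ((hb i k).differentiable one_ne_zero) x (single i 1)
        change fderiv ℝ (fun x => φ x * (e j i * a k x - M i k)) x _ = _
        rw [this, e3]
        simp only [partialD, ContinuousLinearMap.smul_apply, smul_eq_mul]
        ring
      simp only [e2, Finset.sum_sub_distrib, sum_add_distrib, ← mul_sum, ← clm_sum]
      rw [show fderiv ℝ (a k) x (e j) = 0 from hch.coN_e M k x]
      ring
    have hd2 : ∀ i, Continuous (partialD i φ) := fun i => (hφ1.continuous_fderiv one_ne_zero).clm_apply continuous_const
    have hdc : ∀ i, HasCompactSupport (partialD i φ) := fun i => hφc.fderiv_apply ℝ _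
    have i1 : ∀ i k, Integrable (fun x => M i k * (φ x * D [i, k] x)) (volume.restrict Ω) := fun i k => (hold_int hp1 hφ.continuous hφc (hm2 i k)).const_mul _
    have i2 : ∀ i k, Integrable (fun x => M i k * (partialD i φ x * D [k] x)) (volume.restrict Ω) := fun i k => (hold_int hp1 (hd2 i) (hdc i) (hm1 k)).const_mul _
    have h2 : ∫ x in Ω, ((∑ i, ∑ k, M i k * (φ x * D [i, k] x)) + ∑ i, ∑ k, M i k * (partialD i φ x * D [k] x)) = 0 := by
      rw [integral_add (integrable_finset_sum _ fun i _ => integrable_finset_sum _ fun k _ => i1 i k) (integrable_finset_sum _ fun i _ => integrable_finset_sum _ fun k _ => i2 i k),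
        integral_finsetSum _ (fun i _ => integrable_finset_sum _ fun k _ => i1 i k), integral_finsetSum _ (fun i _ => integrable_finset_sum _ fun k _ => i2 i k)]
      simp only [integral_finsetSum _ (fun k _ => i1 _ k), integral_finsetSum _ (fun k _ => i2 _ k), integral_const_mul]
      have := hN D hD φ hφ hφc
      simp only [mul_comm (φ _), mul_comm (partialD _ φ _)]
      rw [this]; ring
    have j1 : Integrable (fun x => G x * fderiv ℝ ψ x (e j)) (volume.restrict Ω) := by
      have := hold_int hp1 hψd.continuous (hψc.fderiv_apply ℝ _) hG
      simpa only [mul_comm] using this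
    have j2 : Integrable (fun x => H x * ψ x) (volume.restrict Ω) := by
      have := hold_int hp1 hψ.continuous hψc hH
      simpa only [mul_comm] using this
    have ind : ∀ f g : EV m → ℝ, ∫ x, Ω.indicator f x * g x = ∫ x in Ω, f x * g x := by
      intro f g
      rw [← integral_indicator hΩm]
      exact integral_congr_ae (ae_of_all _ fun x => by by_cases hx : x ∈ Ω <;> simp [hx])
    rw [ind, ind, eq_neg_iff_add_eq_zero, ← integral_add j1 j2]
    have i3 : Integrable (fun x => (∑ k, (∑ i, partialD i (c i k) x) * D [k] x) + ∑ i, ∑ k, c i k x * D [i, k] x) (volume.restrict Ω) := by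
      refine (integrable_finset_sum _ fun k _ => hold_int hp1 (continuous_finset_sum _ fun i _ => ((hφ1.mul (hb i k)).continuous_fderiv one_ne_zero).clm_apply continuous_const)
        (HasCompactSupport.fsum' Finset.univ fun i => (hφc.mul_right.fderiv_apply ℝ _)) (hm1 k)).add
        (integrable_finset_sum _ fun i _ => integrable_finset_sum _ fun k _ => hold_int hp1 (hφ1.mul (hb i k)).continuous hφc.mul_right (hm2 i k))
    have h3 := integral_add i3 ((integrable_finset_sum Finset.univ fun i _ => integrable_finset_sum Finset.univ fun k _ => i1 i k).add (integrable_finset_sum Finset.univ fun i _ => integrable_finset_sum Finset.univ fun k _ => i2 i k))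
    simp only [Pi.add_apply] at h3
    rw [h1, h2, add_zero] at h3
    rw [← h3]
    refine integral_congr_ae (ae_of_all _ fun x => ?_)
    simp only [hdiv, hφe, G, H]
    have e5 : ∑ i, ∑ k, M i k * (partialD i φ x * D [k] x) = ∑ k, (∑ i, M i k * partialD i φ x) * D [k] x := by
      rw [Finset.sum_comm]; simp only [sum_mul, mul_assoc]
    have e6 : ∑ i, ∑ k, c i k x * D [i, k] x + ∑ i, ∑ k, M i k * (φ x * D [i, k] x) = (∑ i, ∑ k, ζ j x * (e j i * a k x) * D [i, k] x) * ψ x := by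
      simp only [← sum_add_distrib, sum_mul]
      exact sum_congr rfl fun i _ => sum_congr rfl fun k _ => by simp only [c, φ]; ring
    have e7 : ∑ k, (a k x * (ζ j x * fderiv ℝ ψ x (e j) + ψ x * fderiv ℝ (ζ j) x (e j)) - ∑ i, M i k * partialD i φ x) * D [k] x
        = (∑ k, ζ j x * a k x * D [k] x) * fderiv ℝ ψ x (e j) + (∑ k, fderiv ℝ (ζ j) x (e j) * a k x * D [k] x) * ψ x - ∑ k, (∑ i, M i k * partialD i φ x) * D [k] x := by
      rw [sum_mul, sum_mul, ← sum_add_distrib, ← Finset.sum_sub_distrib]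
      exact sum_congr rfl fun k _ => by ring
    rw [e5, e7]
    linear_combination -e6
  have hKt : ∀ x ∈ K, (x ∈ Ω ↔ 0 < t j x) := fun x hx => hch.mem_iff x (cthick_self hx)
  have hG0 : ∀ x, x ∉ K → G x = 0 := fun x hx => Finset.sum_eq_zero fun k _ => by rw [image_eq_zero_of_notMem_tsupport hx]; ring
  have hH0 : ∀ x, x ∉ K → H x = 0 := fun x hx => by
    have : fderiv ℝ (ζ j) x = 0 := image_eq_zero_of_notMem_tsupport fun h => hx (tsupport_fderiv_subset ℝ h)
    simp [H, this, image_eq_zero_of_notMem_tsupport hx]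
  have htc : Continuous (t j) := hch.t_smooth.continuous
  have hTm : ∀ τ : ℝ, MeasurableSet {x | -τ ≤ t j x ∧ t j x ≤ τ} := fun τ => (measurableSet_le measurable_const htc.measurable).inter (measurableSet_le htc.measurable measurable_const)
  have hlim := absc hp1 hp ((memLp_indicator_iff_restrict hΩm).mpr hH) (fun τ => {x | -τ ≤ t j x ∧ t j x ≤ τ}) hTm (fun x hx => by
    have hxΩ : x ∈ Ω := by by_contra h; simp [h] at hx
    have hxK : x ∈ K := by by_contra h; simp [hH0 x h] at hx
    have := (hKt x hxK).mp hxΩ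
    filter_upwards [Ioo_mem_nhdsGT this] with τ hτ h
    exact absurd h.2 (not_le.mpr hτ.2))
  filter_upwards [self_mem_nhdsWithin, hlim.eventually_le_const hη] with τ hτ hle
  have hτ : 0 < τ := hτ
  have key := weak_hardy_abs hp1 hp ((memLp_indicator_iff_restrict hΩm).mpr hG) ((memLp_indicator_iff_restrict hΩm).mpr hH) hweak
    (S := {x | 0 ≤ t j x ∧ t j x ≤ τ}) (T := {x | -τ ≤ t j x ∧ t j x ≤ τ}) ((measurableSet_le measurable_const htc.measurable).inter (measurableSet_le htc.measurable measurable_const)) (hTm τ) hτ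
    (fun x hx r hr => by
      have : t j (x + (0 + r • (-e j))) = t j x - r := by rw [zero_add, smul_neg, ← neg_smul, hch.t_shift]; ring
      have h1 := hx.1; have h2 := hx.2; have h3 := hr.1; have h4 := hr.2
      constructor <;> rw [this] <;> linarith)
    (fun x hx => by
      by_cases hK' : x - τ • e j ∈ K
      · refine indicator_of_notMem (fun h => ?_) _
        have h2 := (hKt _ hK').mp h
        rw [sub_eq_add_neg, ← neg_smul, hch.t_shift] at h2
        linarith [hx.2]
      · simp [Set.indicator, hG0 _ hK'])
  refine le_trans ?_ (key.trans (mul_le_mul_right hle _))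
  have hsub : chartLayer Ω 0 K (t j) τ ⊆ {x | 0 ≤ t j x ∧ t j x ≤ τ} := fun x hx => by
    have hxK : x ∈ K := by
      have := hx.1.2
      rwa [cthickening_zero, (isClosed_tsupport _).closure_eq] at this
    exact ⟨((hKt x hxK).mp hx.1.1).le, hx.2⟩
  refine le_trans (le_of_eq ?_) (eLpNorm_mono_measure _ (Measure.restrict_mono hsub le_rfl))
  refine eLpNorm_congr_ae ?_
  filter_upwards [ae_restrict_mem (chartLayer_meas hA.isOpen 0 K htc τ)] with x hx
  rw [indicator_of_mem hx.1.1]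
end

section
variable {m : ℕ}

def cutB : ContDiffBump (0 : ℝ) := { rIn := 1 / 2, rOut := 1, rIn_pos := by norm_num, rIn_lt_rOut := by norm_num }

def thetaF (s : ℝ) : ℝ := s * cutB s

lemma thetaF_smooth : ContDiff ℝ (⊤ : ℕ∞) thetaF := contDiff_id.mul cutB.contDiff

lemma thetaF_compact : HasCompactSupport thetaF := cutB.hasCompactSupport.mul_left

lemma thetaF_zero {s : ℝ} (hs : 1 ≤ |s|) : thetaF s = 0 := by
  rw [thetaF, cutB.zero_of_le_dist (by simpa [cutB] using hs), mul_zero]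

lemma thetaF_deriv : HasDerivAt thetaF 1 0 := by
  have h1 : cutB (0 : ℝ) = 1 := cutB.one_of_mem_closedBall (by simp [cutB])
  have : HasDerivAt thetaF (1 * cutB (0 : ℝ) + 0 * deriv cutB 0) 0 := (hasDerivAt_id (0 : ℝ)).mul ((cutB.contDiff (n := 1)).differentiable one_ne_zero 0).hasDerivAt
  simpa [h1] using this

lemma theta_bdd : ∃ B : ℝ, 1 ≤ B ∧ ∀ s, |thetaF s| ≤ B ∧ |deriv thetaF s| ≤ B ∧ |deriv (deriv thetaF) s| ≤ B := by
  have h1 : ContDiff ℝ (⊤ : ℕ∞) (deriv thetaF) := ((contDiff_succ_iff_deriv (n := (⊤ : ℕ∞))).mp (by simpa using thetaF_smooth)).2.2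
  have h2 : ContDiff ℝ (⊤ : ℕ∞) (deriv (deriv thetaF)) := ((contDiff_succ_iff_deriv (n := (⊤ : ℕ∞))).mp (by simpa using h1)).2.2
  obtain ⟨B0, hB0⟩ := thetaF_compact.exists_bound_of_continuous thetaF_smooth.continuous
  obtain ⟨B1, hB1⟩ := thetaF_compact.deriv.exists_bound_of_continuous h1.continuous
  obtain ⟨B2, hB2⟩ := thetaF_compact.deriv.deriv.exists_bound_of_continuous h2.continuous
  have p0 := (norm_nonneg _).trans (hB0 0); have p1 := (norm_nonneg _).trans (hB1 0); have p2 := (norm_nonneg _).trans (hB2 0)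
  refine ⟨1 + B0 + B1 + B2, by linarith, fun s => ⟨?_, ?_, ?_⟩⟩ <;> rw [← Real.norm_eq_abs]
  · linarith [hB0 s]
  · linarith [hB1 s]
  · linarith [hB2 s]

lemma clm_norm_le {F : Type*} [NormedAddCommGroup F] [NormedSpace ℝ F] (T : EV m →L[ℝ] F) : ‖T‖ ≤ ∑ i, ‖T (single i 1)‖ := by
  refine T.opNorm_le_bound (Finset.sum_nonneg fun i _ => norm_nonneg _) fun x => ?_
  conv_lhs => rw [vec_sum x]
  simp only [map_sum, map_smul]
  refine (norm_sum_le _ _).trans ?_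
  rw [sum_mul]
  refine sum_le_sum fun i _ => ?_
  rw [norm_smul, mul_comm]
  exact mul_le_mul_of_nonneg_left (abs_coord_le x i) (norm_nonneg _)

def S1 (v : EV m → ℝ) (x : EV m) : ℝ := ∑ k, |partialDList [k] v x|
def S2 (v : EV m → ℝ) (x : EV m) : ℝ := ∑ i, ∑ k, |partialDList [i, k] v x|
def S3 (v : EV m → ℝ) (x : EV m) : ℝ := ∑ l, ∑ i, ∑ k, |partialDList [l, i, k] v x|

lemma S1_nonneg (v : EV m → ℝ) (x : EV m) : 0 ≤ S1 v x := by unfold S1; positivity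
lemma S2_nonneg (v : EV m → ℝ) (x : EV m) : 0 ≤ S2 v x := by unfold S2; positivity
lemma S3_nonneg (v : EV m → ℝ) (x : EV m) : 0 ≤ S3 v x := by unfold S3; positivity

lemma fderiv_app {F : Type*} [NormedAddCommGroup F] [NormedSpace ℝ F] {f : EV m → EV m →L[ℝ] F} {x : EV m} (hf : DifferentiableAt ℝ f x) (w v : EV m) :
    fderiv ℝ f x w v = fderiv ℝ (fun y => f y v) x w := by
  rw [fderiv_clm_apply hf (differentiableAt_const v)]
  simp

lemma nD1 (v : EV m → ℝ) (x : EV m) : ‖fderiv ℝ v x‖ ≤ S1 v x := clm_norm_le _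

lemma d2_eq {v : EV m → ℝ} (hv : ContDiff ℝ 2 v) (x : EV m) (i k : Fin m) :
    fderiv ℝ (fderiv ℝ v) x (single i 1) (single k 1) = partialDList [i, k] v x :=
  fderiv_app ((hv.fderiv_right (m := 1) (by norm_num)).differentiable one_ne_zero x) _ _

lemma nD2 {v : EV m → ℝ} (hv : ContDiff ℝ 2 v) (x : EV m) : ‖fderiv ℝ (fderiv ℝ v) x‖ ≤ S2 v x := by
  refine (clm_norm_le _).trans (sum_le_sum fun i _ => (clm_norm_le _).trans (sum_le_sum fun k _ => ?_))
  rw [d2_eq hv, Real.norm_eq_abs]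

lemma nD3 {v : EV m → ℝ} (hv : ContDiff ℝ 3 v) (x : EV m) : ‖fderiv ℝ (fderiv ℝ (fderiv ℝ v)) x‖ ≤ S3 v x := by
  have h1 : ContDiff ℝ 2 (fderiv ℝ v) := hv.fderiv_right (by norm_num)
  have h2 : ContDiff ℝ 1 (fderiv ℝ (fderiv ℝ v)) := h1.fderiv_right (by norm_num)
  refine (clm_norm_le _).trans (sum_le_sum fun l _ => ?_)
  have e1 : ∀ i k : Fin m, fderiv ℝ (fderiv ℝ (fderiv ℝ v)) x (single l 1) (single i 1) (single k 1) = partialDList [l, i, k] v x := by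
    intro i k
    rw [fderiv_app (h2.differentiable one_ne_zero x), fderiv_app (f := fun y => fderiv ℝ (fderiv ℝ v) y (single i 1))
      (((h2.clm_apply contDiff_const).differentiable one_ne_zero) x)]
    have : (fun y => fderiv ℝ (fderiv ℝ v) y (single i 1) (single k 1)) = partialDList [i, k] v := by
      funext y; exact d2_eq (hv.of_le (by norm_num)) y i k
    rw [this]; rfl
  refine (clm_norm_le _).trans (sum_le_sum fun i _ => (clm_norm_le _).trans (sum_le_sum fun k _ => ?_))
  rw [e1, Real.norm_eq_abs]

lemma d1_mul {f g : EV m → ℝ} (hf : ContDiff ℝ 2 f) (hg : ContDiff ℝ 2 g) (x : EV m) :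
    ‖fderiv ℝ (fun y => f y * g y) x‖ ≤ |f x| * ‖fderiv ℝ g x‖ + ‖fderiv ℝ f x‖ * |g x| := by
  rw [fderiv_fun_mul (hf.differentiable (by norm_num) x) (hg.differentiable (by norm_num) x)]
  refine (norm_add_le _ _).trans ?_
  rw [norm_smul, norm_smul, Real.norm_eq_abs, Real.norm_eq_abs, mul_comm |g x|]

lemma d2_mul {f g : EV m → ℝ} (hf : ContDiff ℝ 2 f) (hg : ContDiff ℝ 2 g) (x : EV m) :
    ‖fderiv ℝ (fderiv ℝ (fun y => f y * g y)) x‖ ≤ |f x| * ‖fderiv ℝ (fderiv ℝ g) x‖ + 2 * (‖fderiv ℝ f x‖ * ‖fderiv ℝ g x‖) + ‖fderiv ℝ (fderiv ℝ f) x‖ * |g x| := by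
  have df := hf.differentiable (by norm_num); have dg := hg.differentiable (by norm_num)
  have df2 := ((hf.fderiv_right (m := 1) (by norm_num)).differentiable one_ne_zero x)
  have dg2 := ((hg.fderiv_right (m := 1) (by norm_num)).differentiable one_ne_zero x)
  have e1 : fderiv ℝ (fun y => f y * g y) = fun y => f y • fderiv ℝ g y + g y • fderiv ℝ f y := by
    funext y; exact fderiv_fun_mul (df y) (dg y)
  rw [e1, fderiv_fun_add ((df x).fun_smul dg2) ((dg x).fun_smul df2), fderiv_fun_smul (df x) dg2, fderiv_fun_smul (dg x) df2]
  refine (norm_add_le _ _).trans ((add_le_add (norm_add_le _ _) (norm_add_le _ _)).trans ?_)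
  rw [norm_smul, norm_smul, ContinuousLinearMap.norm_smulRight_apply, ContinuousLinearMap.norm_smulRight_apply, Real.norm_eq_abs, Real.norm_eq_abs]
  nlinarith

lemma IsChart.theta_est {Ω K : Set (EV m)} {Λ R : ℝ} {e : EV m} {t : EV m → ℝ} (h : IsChart Ω Λ R K e t) :
    ∃ B : ℝ, 0 ≤ B ∧ ∀ δ : ℝ, 0 < δ → δ ≤ 1 → ContDiff ℝ 3 (fun y => δ * thetaF (t y / δ)) ∧ ∀ x,
      |δ * thetaF (t x / δ)| ≤ B * δ ∧ ‖fderiv ℝ (fun y => δ * thetaF (t y / δ)) x‖ ≤ B ∧ ‖fderiv ℝ (fderiv ℝ (fun y => δ * thetaF (t y / δ))) x‖ ≤ B * δ⁻¹ := by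
  obtain ⟨B, hB1, hB⟩ := theta_bdd
  have hΛ := h.lam_ge
  have h1 : ContDiff ℝ (⊤ : ℕ∞) (deriv thetaF) := ((contDiff_succ_iff_deriv (n := (⊤ : ℕ∞))).mp (by simpa using thetaF_smooth)).2.2
  refine ⟨B + B * Λ + (B * Λ * Λ + B * Λ), by positivity, fun δ hδ hδ1 => ⟨contDiff_const.mul ((thetaF_smooth.of_le (by norm_cast)).comp (h.t_smooth.div_const δ)), fun x => ?_⟩⟩
  have hD : ∀ y, fderiv ℝ (fun y => δ * thetaF (t y / δ)) y = deriv thetaF (t y / δ) • fderiv ℝ t y := by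
    intro y
    have a1 : HasFDerivAt (fun y => t y / δ) (δ⁻¹ • fderiv ℝ t y) y := by
      simpa only [div_eq_mul_inv] using (h.diff y).hasFDerivAt.mul_const δ⁻¹
    have a2 := ((((thetaF_smooth.differentiable (by simp)) (t y / δ)).hasDerivAt).comp_hasFDerivAt y a1).const_mul δ
    rw [HasFDerivAt.fderiv (f := fun y => δ * thetaF (t y / δ)) a2]
    simp only [smul_smul]
    congr 1; field_simp
  have hDt2 : ‖fderiv ℝ (fderiv ℝ t) x‖ ≤ Λ := by
    have hl : LipschitzWith (Real.toNNReal Λ) (fderiv ℝ t) := LipschitzWith.of_dist_le_mul fun y z => by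
      rw [Real.coe_toNNReal _ (by linarith), dist_eq_norm, dist_eq_norm]; exact h.t_lip2 y z
    have := norm_fderiv_le_of_lipschitz ℝ hl (x₀ := x)
    rwa [Real.coe_toNNReal _ (by linarith)] at this
  have hδi : 1 ≤ δ⁻¹ := (one_le_inv₀ hδ).mpr hδ1
  have p1 : 0 ≤ B * Λ := by positivity
  have p2 : 0 ≤ B * Λ * Λ := by positivity
  have hb := hB (t x / δ)
  refine ⟨?_, ?_, ?_⟩
  · rw [abs_mul, abs_of_pos hδ]; nlinarith [hb.1]
  · rw [hD, norm_smul, Real.norm_eq_abs]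
    have := mul_le_mul hb.2.1 (h.t_lip x) (norm_nonneg _) (by linarith)
    nlinarith
  · rw [show fderiv ℝ (fun y => δ * thetaF (t y / δ)) = fun y => deriv thetaF (t y / δ) • fderiv ℝ t y from funext hD]
    have a1 : HasFDerivAt (fun y => t y / δ) (δ⁻¹ • fderiv ℝ t x) x := by
      simpa only [div_eq_mul_inv] using (h.diff x).hasFDerivAt.mul_const δ⁻¹
    have a2 := (((h1.differentiable (by simp)) (t x / δ)).hasDerivAt).comp_hasFDerivAt x a1
    have a3 := HasFDerivAt.fun_smul a2 (((h.t_smooth.fderiv_right (m := 1) (by norm_num)).differentiable one_ne_zero x).hasFDerivAt)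
    rw [HasFDerivAt.fderiv (f := fun y => deriv thetaF (t y / δ) • fderiv ℝ t y) a3]
    refine (norm_add_le _ _).trans ?_
    rw [norm_smul, ContinuousLinearMap.norm_smulRight_apply, norm_smul, norm_smul, Real.norm_eq_abs, Real.norm_eq_abs, Real.norm_eq_abs, abs_of_pos (by positivity : 0 < δ⁻¹)]
    have b1 := mul_le_mul hb.2.1 hDt2 (norm_nonneg _) (by linarith)
    have b2 := mul_le_mul (mul_le_mul hb.2.2 (h.t_lip x) (norm_nonneg _) (by linarith)) (h.t_lip x) (norm_nonneg _) (by positivity)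
    have b3 := mul_le_mul_of_nonneg_left b2 (by positivity : 0 ≤ δ⁻¹)
    have b4 : B * Λ ≤ B * Λ * δ⁻¹ := le_mul_of_one_le_right p1 hδi
    simp only [Function.comp] at *
    nlinarith [mul_nonneg p1 (by positivity : 0 ≤ δ⁻¹), mul_nonneg (by linarith : 0 ≤ B) (by positivity : 0 ≤ δ⁻¹)]
end

section
variable {m : ℕ}

def lc (b : Fin m → EV m → ℝ) (u : EV m → ℝ) (x : EV m) : ℝ := ∑ k, b k x * partialDList [k] u x

lemma lc_smooth {b : Fin m → EV m → ℝ} (hb : ∀ k, ContDiff ℝ 2 (b k)) {u : EV m → ℝ} (hu : ContDiff ℝ (⊤ : ℕ∞) u) : ContDiff ℝ 2 (lc b u) :=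
  ContDiff.sum fun k _ => (hb k).mul ((partialDList_smooth hu [k]).of_le (by norm_cast))

lemma c2_bdd {b : Fin m → EV m → ℝ} (hb : ∀ k, ContDiff ℝ 2 (b k)) (hbc : ∀ k, HasCompactSupport (b k)) :
    ∃ B : ℝ, 0 ≤ B ∧ ∀ k x, |b k x| ≤ B ∧ ‖fderiv ℝ (b k) x‖ ≤ B ∧ ‖fderiv ℝ (fderiv ℝ (b k)) x‖ ≤ B := by
  choose B0 h0 using fun k => (hbc k).exists_bound_of_continuous (hb k).continuous
  choose B1 h1 using fun k => ((hbc k).fderiv ℝ).exists_bound_of_continuous ((hb k).continuous_fderiv (by norm_num))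
  choose B2 h2 using fun k => (((hbc k).fderiv ℝ).fderiv ℝ).exists_bound_of_continuous (((hb k).fderiv_right (m := 1) (by norm_num)).continuous_fderiv one_ne_zero)
  have hp : ∀ k, B0 k ≤ |B0 k| + |B1 k| + |B2 k| ∧ B1 k ≤ |B0 k| + |B1 k| + |B2 k| ∧ B2 k ≤ |B0 k| + |B1 k| + |B2 k| := fun k => by
    have := abs_nonneg (B0 k); have := abs_nonneg (B1 k); have := abs_nonneg (B2 k)
    have := le_abs_self (B0 k); have := le_abs_self (B1 k); have := le_abs_self (B2 k)
    refine ⟨?_, ?_, ?_⟩ <;> linarith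
  have hs : ∀ k, |B0 k| + |B1 k| + |B2 k| ≤ ∑ k, (|B0 k| + |B1 k| + |B2 k|) := fun k =>
    Finset.single_le_sum (f := fun k => |B0 k| + |B1 k| + |B2 k|) (fun i _ => by positivity) (Finset.mem_univ k)
  exact ⟨∑ k, (|B0 k| + |B1 k| + |B2 k|), by positivity, fun k x => ⟨((h0 k x).trans (hp k).1).trans (hs k), ((h1 k x).trans (hp k).2.1).trans (hs k), ((h2 k x).trans (hp k).2.2).trans (hs k)⟩⟩

lemma lc_est {b : Fin m → EV m → ℝ} (hb : ∀ k, ContDiff ℝ 2 (b k)) (hbc : ∀ k, HasCompactSupport (b k)) :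
    ∃ B : ℝ, 0 ≤ B ∧ ∀ u : EV m → ℝ, ContDiff ℝ (⊤ : ℕ∞) u → ∀ x, ‖fderiv ℝ (lc b u) x‖ ≤ B * (S1 u x + S2 u x) ∧
      ‖fderiv ℝ (fderiv ℝ (lc b u)) x‖ ≤ B * (S1 u x + S2 u x + S3 u x) := by
  obtain ⟨B, hB0, hB⟩ := c2_bdd hb hbc
  refine ⟨∑ k : Fin m, 2 * B, by positivity, fun u hu x => ?_⟩
  have hv : ∀ k, ContDiff ℝ 2 (partialDList [k] u) := fun k => (partialDList_smooth hu [k]).of_le (by norm_cast)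
  have hp : ∀ k, ContDiff ℝ 2 (fun y => b k y * partialDList [k] u y) := fun k => (hb k).mul (hv k)
  have v0 : ∀ k, |partialDList [k] u x| ≤ S1 u x := fun k => Finset.single_le_sum (f := fun k => |partialDList [k] u x|) (fun i _ => abs_nonneg _) (Finset.mem_univ k)
  have v1 : ∀ k, ‖fderiv ℝ (partialDList [k] u) x‖ ≤ S2 u x := fun k => (nD1 _ x).trans
    (sum_le_sum fun i _ => Finset.single_le_sum (f := fun k => |partialDList [i, k] u x|) (fun i _ => abs_nonneg _) (Finset.mem_univ k))
  have v2 : ∀ k, ‖fderiv ℝ (fderiv ℝ (partialDList [k] u)) x‖ ≤ S3 u x := fun k => (nD2 (hv k) x).trans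
    (sum_le_sum fun l _ => sum_le_sum fun i _ => Finset.single_le_sum (f := fun k => |partialDList [l, i, k] u x|) (fun i _ => abs_nonneg _) (Finset.mem_univ k))
  have n1 := S1_nonneg u x; have n2 := S2_nonneg u x; have n3 := S3_nonneg u x
  have e1 : fderiv ℝ (lc b u) = fun x => ∑ k, fderiv ℝ (fun y => b k y * partialDList [k] u y) x := by
    funext y; exact fderiv_fun_sum fun k _ => (hp k).differentiable (by norm_num) y
  constructor
  · rw [e1, sum_mul]
    refine (norm_sum_le _ _).trans (sum_le_sum fun k _ => (d1_mul (hb k) (hv k) x).trans ?_)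
    have a1 := mul_le_mul (hB k x).1 (v1 k) (norm_nonneg _) hB0
    have a2 := mul_le_mul (hB k x).2.1 (v0 k) (abs_nonneg _) hB0
    nlinarith [mul_nonneg hB0 n1, mul_nonneg hB0 n2]
  · rw [e1, fderiv_fun_sum fun k _ => ((hp k).fderiv_right (m := 1) (by norm_num)).differentiable one_ne_zero x, sum_mul]
    refine (norm_sum_le _ _).trans (sum_le_sum fun k _ => (d2_mul (hb k) (hv k) x).trans ?_)
    have a1 := mul_le_mul (hB k x).1 (v2 k) (norm_nonneg _) hB0
    have a2 := mul_le_mul (hB k x).2.1 (v1 k) (norm_nonneg _) hB0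
    have a3 := mul_le_mul (hB k x).2.2 (v0 k) (abs_nonneg _) hB0
    nlinarith [mul_nonneg hB0 n1, mul_nonneg hB0 n2, mul_nonneg hB0 n3]

/-- boundary corrector -/
def corr (t : EV m → ℝ) (b : Fin m → EV m → ℝ) (δ : ℝ) (u : EV m → ℝ) (x : EV m) : ℝ := δ * thetaF (t x / δ) * lc b u x

variable {Ω K : Set (EV m)} {Λ R : ℝ} {e : EV m} {t : EV m → ℝ}

lemma IsChart.corr_est (h : IsChart Ω Λ R K e t) {b : Fin m → EV m → ℝ} (hb : ∀ k, ContDiff ℝ 2 (b k)) (hbc : ∀ k, HasCompactSupport (b k)) :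
    ∃ B : ℝ, 0 ≤ B ∧ ∀ δ : ℝ, 0 < δ → δ ≤ 1 → ∀ u : EV m → ℝ, ContDiff ℝ (⊤ : ℕ∞) u → ContDiff ℝ 2 (corr t b δ u) ∧ ∀ x,
      ‖corr t b δ u x‖ ≤ B * (δ⁻¹ * |lc b u x| + S1 u x + S2 u x + δ * S3 u x) ∧
      ‖fderiv ℝ (corr t b δ u) x‖ ≤ B * (δ⁻¹ * |lc b u x| + S1 u x + S2 u x + δ * S3 u x) ∧
      ‖fderiv ℝ (fderiv ℝ (corr t b δ u)) x‖ ≤ B * (δ⁻¹ * |lc b u x| + S1 u x + S2 u x + δ * S3 u x) := by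
  obtain ⟨B, hB0, hB⟩ := h.theta_est
  obtain ⟨B', hB0', hB'⟩ := lc_est hb hbc
  refine ⟨B + 3 * B * B', by positivity, fun δ hδ hδ1 u hu => ?_⟩
  obtain ⟨hs, hx⟩ := hB δ hδ hδ1
  have hs2 : ContDiff ℝ 2 (fun y => δ * thetaF (t y / δ)) := hs.of_le (by norm_num)
  have hA := lc_smooth hb hu
  refine ⟨hs2.mul hA, fun x => ?_⟩
  obtain ⟨f0, f1, f2⟩ := hx x
  obtain ⟨a1, a2⟩ := hB' u hu x
  have n1 := S1_nonneg u x; have n2 := S2_nonneg u x; have n3 := S3_nonneg u x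
  have n0 := abs_nonneg (lc b u x)
  have hδi : 1 ≤ δ⁻¹ := (one_le_inv₀ hδ).mpr hδ1
  set A := |lc b u x|
  have k1 : 0 ≤ B * B' := by positivity
  have k2 : A ≤ δ⁻¹ * A := le_mul_of_one_le_left n0 hδi
  have k3 : δ * S1 u x ≤ S1 u x := mul_le_of_le_one_left n1 hδ1
  have k4 : δ * S2 u x ≤ S2 u x := mul_le_of_le_one_left n2 hδ1
  have k5 : 0 ≤ δ⁻¹ * A := by positivity
  have k6 : 0 ≤ δ * S3 u x := by positivity
  have E0 : B * (δ⁻¹ * A) + 3 * (B * B') * (S1 u x + S2 u x + δ * S3 u x) ≤ (B + 3 * B * B') * (δ⁻¹ * A + S1 u x + S2 u x + δ * S3 u x) := by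
    nlinarith [mul_nonneg hB0 (add_nonneg (add_nonneg n1 n2) k6), mul_nonneg k1 k5]
  refine ⟨?_, ?_, ?_⟩ <;> refine le_trans ?_ E0
  · unfold corr
    rw [norm_mul, Real.norm_eq_abs, Real.norm_eq_abs]
    have c1 := mul_le_mul f0 (le_refl A) n0 (by positivity)
    have c2 : B * δ * A ≤ B * (δ⁻¹ * A) := by rw [mul_assoc]; exact mul_le_mul_of_nonneg_left ((mul_le_of_le_one_left n0 hδ1).trans k2) hB0
    nlinarith [mul_nonneg k1 (add_nonneg (add_nonneg n1 n2) k6)]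
  · refine (d1_mul hs2 hA x).trans ?_
    have c1 := mul_le_mul f0 a1 (norm_nonneg _) (by positivity)
    have c2 := mul_le_mul f1 (k2) n0 (by positivity)
    have c3 : B * δ * (B' * (S1 u x + S2 u x)) ≤ B * B' * (S1 u x + S2 u x) := by
      calc _ = B * B' * (δ * S1 u x + δ * S2 u x) := by ring
        _ ≤ _ := by gcongr
    nlinarith [mul_nonneg k1 (add_nonneg (add_nonneg n1 n2) k6)]
  · refine (d2_mul hs2 hA x).trans ?_
    have c1 := mul_le_mul f0 a2 (norm_nonneg _) (by positivity)
    have c2 := mul_le_mul f1 a1 (norm_nonneg _) hB0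
    have c3 := mul_le_mul f2 (le_refl A) n0 (by positivity)
    have c4 : B * δ * (B' * (S1 u x + S2 u x + S3 u x)) ≤ B * B' * (S1 u x + S2 u x + δ * S3 u x) := by
      calc _ = B * B' * (δ * S1 u x + δ * S2 u x + δ * S3 u x) := by ring
        _ ≤ _ := by gcongr
    nlinarith [mul_nonneg k1 k6, mul_nonneg k1 (add_nonneg n1 n2)]

lemma lc_zero {b : Fin m → EV m → ℝ} (hbK : ∀ k, tsupport (b k) ⊆ K) {u : EV m → ℝ} {x : EV m} (hx : x ∉ K) : lc b u x = 0 :=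
  Finset.sum_eq_zero fun k _ => by rw [image_eq_zero_of_notMem_tsupport fun h => hx (hbK k h), zero_mul]

lemma IsChart.corr_supp (h : IsChart Ω Λ R K e t) (hK : IsClosed K) {b : Fin m → EV m → ℝ} (hbK : ∀ k, tsupport (b k) ⊆ K) {δ : ℝ} (hδ : 0 < δ) {u : EV m → ℝ}
    {x : EV m} (hx : x ∈ Ω) (hL : x ∉ chartLayer Ω 0 K t δ) : corr t b δ u =ᶠ[𝓝 x] fun _ => 0 := by
  by_cases hxK : x ∈ K
  · have ht : δ < t x := by
      by_contra hn
      exact hL ⟨⟨hx, cthick_self hxK⟩, not_lt.mp hn⟩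
    filter_upwards [(isOpen_lt continuous_const h.t_smooth.continuous).mem_nhds ht] with y hy
    have hy : δ < t y := hy
    unfold corr
    rw [thetaF_zero, mul_zero, zero_mul]
    rw [abs_of_pos (by positivity [hδ.trans hy]), one_le_div hδ]
    exact hy.le
  · filter_upwards [hK.isOpen_compl.mem_nhds hxK] with y hy
    rw [corr, lc_zero hbK hy, mul_zero]

lemma IsChart.corr_grad (h : IsChart Ω Λ R K e t) (hΩ : IsOpen Ω) (hR : 0 < R) (hK : IsClosed K) {b : Fin m → EV m → ℝ} (hb : ∀ k, ContDiff ℝ 2 (b k)) (hbK : ∀ k, tsupport (b k) ⊆ K) {δ : ℝ} (hδ : 0 < δ) {u : EV m → ℝ}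
    (hu : ContDiff ℝ (⊤ : ℕ∞) u) {x : EV m} (hx : x ∈ frontier Ω) : HasFDerivAt (corr t b δ u) (lc b u x • fderiv ℝ t x) x := by
  by_cases hxK : x ∈ K
  · have ht : t x = 0 := h.frontier_zero hΩ le_rfl hR (cthick_self hxK) hx
    have a1 : HasFDerivAt (fun y => t y / δ) (δ⁻¹ • fderiv ℝ t x) x := by
      simpa only [div_eq_mul_inv] using (h.diff x).hasFDerivAt.mul_const δ⁻¹
    have a0 : HasDerivAt thetaF 1 (t x / δ) := by rw [ht, zero_div]; exact thetaF_deriv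
    have a2 := (a0.comp_hasFDerivAt x a1).const_mul δ
    have a3 := a2.mul (((lc_smooth hb hu).differentiable (by norm_num) x).hasFDerivAt)
    refine HasFDerivAt.congr_fderiv (f := corr t b δ u) a3 ?_
    have h0 : thetaF 0 = 0 := by simp [thetaF]
    simp [ht, h0, smul_smul, mul_inv_cancel₀ hδ.ne']
  · have : corr t b δ u =ᶠ[𝓝 x] fun _ => 0 := by
      filter_upwards [hK.isOpen_compl.mem_nhds hxK] with y hy
      rw [corr, lc_zero hbK hy, mul_zero]
    rw [lc_zero hbK hxK, zero_smul]
    exact (hasFDerivAt_const 0 x).congr_of_eventuallyEq this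
end

section
variable {m : ℕ} {ι : Type} [Fintype ι] {Ω : Set (EV m)} {Λ R : ℝ} {e : ι → EV m} {t : ι → EV m → ℝ} {ζ : ι → EV m → ℝ}

lemma IsAtlas.nu_par (hA : IsAtlas Ω Λ R e t ζ) (i j : ι) {x : EV m} (hx : x ∈ frontier Ω) (hj : x ∈ cthickening (R / 2) (tsupport (ζ j))) (hi : x ∈ tsupport (ζ i)) :
    fderiv ℝ (t i) x = fderiv ℝ (t i) x (e j) • fderiv ℝ (t j) x ∧ fderiv ℝ (t i) x (e j) ≠ 0 := by
  have hR := hA.R_pos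
  have ci := hA.chart i; have cj := hA.chart j
  have h0 : t j x = 0 := cj.frontier_zero hA.isOpen (by linarith) (by linarith) hj hx
  have key : fderiv ℝ (t i) x = fderiv ℝ (t i) x (e j) • fderiv ℝ (t j) x := by
    ext h
    let y : ℝ → EV m := fun s => x + s • h + (-(t j (x + s • h))) • e j
    have hy0 : y 0 = x := by simp [y, h0]
    have d1 : HasDerivAt (fun s : ℝ => t j (x + s • h)) (fderiv ℝ (t j) x h) 0 := by
      simpa using hasDerivAt_line x h 0 (cj.diff _)
    have d2 : HasDerivAt y (h + (-(fderiv ℝ (t j) x h)) • e j) 0 := by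
      have := ((((hasDerivAt_id (0 : ℝ)).smul_const h).const_add x).add (d1.neg.smul_const (e j)))
      simpa [y] using! this
    have d3 : HasDerivAt (fun s => t i (y s)) (fderiv ℝ (t i) x (h + (-(fderiv ℝ (t j) x h)) • e j)) 0 := by
      have : HasFDerivAt (t i) (fderiv ℝ (t i) x) (y 0) := by rw [hy0]; exact (ci.diff x).hasFDerivAt
      exact this.comp_hasDerivAt 0 d2
    have hz : (fun s => t i (y s)) =ᶠ[𝓝 0] fun _ => 0 := by
      have hc : Tendsto y (𝓝 0) (𝓝 x) := by have := d2.continuousAt.tendsto; rwa [hy0] at this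
      filter_upwards [hc.eventually (closedBall_mem_nhds x (by linarith : 0 < R / 4))] with s hs
      have tz : t j (y s) = 0 := by simp only [y, cj.t_shift]; ring
      have f := cj.zero_frontier hA.isOpen (by linarith) (by linarith : R / 2 + R / 4 < R) (cthick_move hj (by linarith) hs) tz
      exact ci.frontier_zero hA.isOpen (by linarith) (by linarith : 0 + R / 4 < R) (cthick_move (cthick_self hi) le_rfl hs) f
    have := d3.unique ((hasDerivAt_const (0 : ℝ) (0 : ℝ)).congr_of_eventuallyEq hz)
    simp only [map_add, map_smul, smul_eq_mul] at this
    simp only [ContinuousLinearMap.smul_apply, smul_eq_mul]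
    linarith
  refine ⟨key, fun h0 => ?_⟩
  have := ci.fderiv_e x
  rw [key, h0] at this
  simp at this

def gQ (M : Matrix (Fin m) (Fin m) ℝ) (t : EV m → ℝ) (x : EV m) : ℝ := fderiv ℝ t x (MV M (fderiv ℝ t x))

lemma lc_MV {M : Matrix (Fin m) (Fin m) ℝ} {t : EV m → ℝ} (u : EV m → ℝ) (x : EV m) : ∑ k, coN M t k x * partialDList [k] u x = fderiv ℝ u x (MV M (fderiv ℝ t x)) := by
  rw [apply_MV]; simp only [coN, sum_mul]; rfl

lemma gQ_smooth {M : Matrix (Fin m) (Fin m) ℝ} {t : EV m → ℝ} (ht : ContDiff ℝ 3 t) : ContDiff ℝ 2 (gQ M t) := by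
  have : gQ M t = fun x => ∑ k, coN M t k x * fderiv ℝ t x (single k 1) := by
    funext x; rw [gQ, ← lc_MV]; rfl
  rw [this]
  exact ContDiff.sum fun k _ => (coN_smooth ht k).mul ((ht.fderiv_right (m := 2) (by norm_num)).clm_apply contDiff_const)

lemma MV_smul (M : Matrix (Fin m) (Fin m) ℝ) (c : ℝ) (ν : EV m →L[ℝ] ℝ) : MV M (c • ν) = c • MV M ν := by
  ext k
  simp only [MV, ContinuousLinearMap.smul_apply, smul_eq_mul, PiLp.smul_apply, mul_sum]
  exact sum_congr rfl fun i _ => by ring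

/-- coefficients of the corrector -/
def bco (M : Matrix (Fin m) (Fin m) ℝ) (t ζ : EV m → ℝ) (k : Fin m) (x : EV m) : ℝ := (gQ M t x)⁻¹ * (ζ x * coN M t k x)

lemma lc_bco {M : Matrix (Fin m) (Fin m) ℝ} {t ζ : EV m → ℝ} (u : EV m → ℝ) (x : EV m) : lc (bco M t ζ) u x = (gQ M t x)⁻¹ * ∑ k, ζ x * coN M t k x * partialDList [k] u x := by
  simp only [lc, bco, mul_sum, mul_assoc]

lemma IsAtlas.bc_corr (hA : IsAtlas Ω Λ R e t ζ) {M : Matrix (Fin m) (Fin m) ℝ} {lam : ℝ} (hl : 0 < lam) (hg : ∀ j x, lam ≤ gQ M (t j) x)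
    {δ : ℝ} (hδ : 0 < δ) {u : EV m → ℝ} (hu : ContDiff ℝ (⊤ : ℕ∞) u) (hb : ∀ i k, ContDiff ℝ 2 (bco M (t i) (ζ i) k)) (hbK : ∀ i k, tsupport (bco M (t i) (ζ i) k) ⊆ tsupport (ζ i))
    (j : ι) {x : EV m} (hx : x ∈ frontier Ω) (hj : x ∈ cthickening (R / 2) (tsupport (ζ j))) :
    fderiv ℝ (fun x => u x - ∑ i, corr (t i) (bco M (t i) (ζ i)) δ u x) x (MV M (fderiv ℝ (t j) x)) = 0 := by
  have hd := fun i => (hA.chart i).corr_grad hA.isOpen hA.R_pos (isClosed_tsupport _) (hb i) (hbK i) hδ hu hx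
  have hs := HasFDerivAt.fun_sum (u := Finset.univ) fun i _ => hd i
  have hgj : gQ M (t j) x ≠ 0 := (hl.trans_le (hg j x)).ne'
  rw [(((hu.differentiable (by simp)) x).hasFDerivAt.fun_sub hs).fderiv]
  simp only [ContinuousLinearMap.sub_apply, ContinuousLinearMap.sum_apply, ContinuousLinearMap.smul_apply, smul_eq_mul]
  have : ∀ i, lc (bco M (t i) (ζ i)) u x * fderiv ℝ (t i) x (MV M (fderiv ℝ (t j) x)) = ζ i x * fderiv ℝ u x (MV M (fderiv ℝ (t j) x)) := by
    intro i
    have e1 : ∑ k, ζ i x * coN M (t i) k x * partialDList [k] u x = ζ i x * fderiv ℝ u x (MV M (fderiv ℝ (t i) x)) := by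
      rw [← lc_MV, mul_sum]; simp only [mul_assoc]
    rw [lc_bco, e1]
    by_cases hi : x ∈ tsupport (ζ i)
    · obtain ⟨h1, h2⟩ := hA.nu_par i j hx hj hi
      have hgi : gQ M (t i) x = fderiv ℝ (t i) x (e j) ^ 2 * gQ M (t j) x := by
        unfold gQ
        generalize fderiv ℝ (t i) x (e j) = c at *
        rw [h1, MV_smul]
        simp only [map_smul, ContinuousLinearMap.smul_apply, smul_eq_mul]
        ring
      rw [hgi]
      have h3 : fderiv ℝ (t i) x (MV M (fderiv ℝ (t j) x)) = fderiv ℝ (t i) x (e j) * gQ M (t j) x := by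
        conv_lhs => rw [h1]
        rfl
      rw [h3, show MV M (fderiv ℝ (t i) x) = fderiv ℝ (t i) x (e j) • MV M (fderiv ℝ (t j) x) by conv_lhs => rw [h1, MV_smul]]
      rw [map_smul, smul_eq_mul]
      field_simp
    · rw [image_eq_zero_of_notMem_tsupport hi]; ring
  simp only [this, ← sum_mul]
  rw [hA.sum_one x (cthick_self hx)]
  ring
end

section
variable {m : ℕ} {ι : Type} [Fintype ι] {Ω : Set (EV m)} {Λ R : ℝ} {e : ι → EV m} {t : ι → EV m → ℝ} {ζ : ι → EV m → ℝ}

lemma eLp_fsum_le {κ : Type*} [Fintype κ] {F : Type*} [NormedAddCommGroup F] {p : ℝ≥0∞} (hp1 : 1 ≤ p) {μ : Measure (EV m)} {f : κ → EV m → F} (hf : ∀ a, AEStronglyMeasurable (f a) μ) :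
    eLpNorm (fun x => ∑ a, f a x) p μ ≤ ∑ a, eLpNorm (f a) p μ := by
  have := eLpNorm_sum_le (s := Finset.univ) (fun a _ => hf a) hp1
  convert this using 2
  funext x; simp

lemma eLp_S {κ : Type*} [Fintype κ] {p : ℝ≥0∞} (hp1 : 1 ≤ p) {μ : Measure (EV m)} {f : κ → EV m → ℝ} (hf : ∀ a, Continuous (f a)) {η : ℝ≥0∞} (h : ∀ a, eLpNorm (f a) p μ ≤ η) :
    eLpNorm (fun x => ∑ a, |f a x|) p μ ≤ Fintype.card κ * η := by
  refine (eLp_fsum_le hp1 fun a => (hf a).abs.aestronglyMeasurable).trans ((sum_le_sum fun a _ => (?_ : _ ≤ η)).trans (by simp))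
  exact le_trans (le_of_eq (eLpNorm_norm (f a))) (h a)

lemma eLp_layer {F : Type*} [NormedAddCommGroup F] {p : ℝ≥0∞} {L : Set (EV m)} (hL : MeasurableSet L) (hΩ : MeasurableSet Ω) (hLΩ : L ⊆ Ω) {f : EV m → F} {E : EV m → ℝ} (h0 : ∀ x ∈ Ω, x ∉ L → f x = 0)
    (hE : ∀ x, ‖f x‖ ≤ E x) : eLpNorm f p (volume.restrict Ω) ≤ eLpNorm E p (volume.restrict L) := by
  have h1 : f =ᵐ[volume.restrict Ω] L.indicator f := by
    filter_upwards [ae_restrict_mem hΩ] with x hx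
    by_cases hxL : x ∈ L
    · rw [indicator_of_mem hxL]
    · rw [indicator_of_notMem hxL, h0 x hx hxL]
  rw [eLpNorm_congr_ae h1, eLpNorm_indicator_eq_eLpNorm_restrict hL, Measure.restrict_restrict hL, Set.inter_eq_left.mpr hLΩ]
  exact eLpNorm_mono_real hE

lemma IsAtlas.approx (hA : IsAtlas Ω Λ R e t ζ) {p : ℝ≥0∞} (hp1 : 1 ≤ p) (hp : p ≠ ⊤) {M : Matrix (Fin m) (Fin m) ℝ} {lam : ℝ} (hl : 0 < lam)
    (hg : ∀ j x, lam ≤ gQ M (t j) x) :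
    ∃ C : ℝ≥0∞, C ≠ ⊤ ∧ ∀ (u : EV m → ℝ) (D : List (Fin m) → EV m → ℝ), IsSobDerivs Ω 3 p u D → NeumannBC Ω M p u → ∀ η : ℝ≥0∞, 0 < η → η ≠ ⊤ →
      ∃ u' w : EV m → ℝ, ContDiff ℝ (⊤ : ℕ∞) u' ∧ HasCompactSupport u' ∧ ContDiff ℝ 2 w ∧ HasCompactSupport w ∧
        (∀ l : List (Fin m), l.length ≤ 3 → eLpNorm (fun x => partialDList l u' x - D l x) p (volume.restrict Ω) ≤ η) ∧
        (∀ j, ∀ x ∈ frontier Ω, x ∈ cthickening (R / 2) (tsupport (ζ j)) → fderiv ℝ (fun x => u' x - w x) x (MV M (fderiv ℝ (t j) x)) = 0) ∧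
        eLpNorm w p (volume.restrict Ω) ≤ C * η ∧ eLpNorm (fderiv ℝ w) p (volume.restrict Ω) ≤ C * η ∧ eLpNorm (fderiv ℝ (fderiv ℝ w)) p (volume.restrict Ω) ≤ C * η := by
  have hΩm := hA.isOpen.measurableSet
  have hζ2 : ∀ j, ContDiff ℝ 2 (ζ j) := fun j => (hA.ζ_smooth j).of_le (by norm_cast)
  have hco : ∀ j k, ContDiff ℝ 2 (coN M (t j) k) := fun j k => coN_smooth (hA.chart j).t_smooth k
  have hcc : ∀ j k, ContDiff ℝ 2 (fun x => ζ j x * coN M (t j) k x) := fun j k => (hζ2 j).mul (hco j k)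
  have hg0 : ∀ j x, gQ M (t j) x ≠ 0 := fun j x => (hl.trans_le (hg j x)).ne'
  have hb : ∀ j k, ContDiff ℝ 2 (bco M (t j) (ζ j) k) := fun j k => ((gQ_smooth (hA.chart j).t_smooth).inv (hg0 j)).mul (hcc j k)
  have hbK : ∀ j k, tsupport (bco M (t j) (ζ j) k) ⊆ tsupport (ζ j) := fun j k => (tsupport_mul_subset_right).trans tsupport_mul_subset_left
  have hbc : ∀ j k, HasCompactSupport (bco M (t j) (ζ j) k) := fun j k => ((hA.ζ_compact j).mul_right).mul_left
  choose B hB0 hB using fun j => (hA.chart j).corr_est (hb j) (hbc j)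
  choose B' hB0' hB' using fun j => c2_bdd (hcc j) fun k => (hA.ζ_compact j).mul_right
  let c : ι → ℝ≥0∞ := fun j => ofReal (B j) * (ofReal lam⁻¹ * (1 + Fintype.card (Fin m) * ofReal (B' j)) + Fintype.card (Fin m) * 2
    + Fintype.card (Fin m × Fin m) * 2 + Fintype.card (Fin m × Fin m × Fin m) * 2)
  have hc : ∀ j, c j ≠ ⊤ := fun j => by
    simp only [c]
    finiteness
  refine ⟨∑ j, c j, by simpa using hc, fun u D hD hN η hη hηt => ?_⟩
  have hD2 : IsSobDerivs Ω 2 p u D := ⟨hD.1, fun l hl i => hD.2.1 l (by omega) i, fun l hl => hD.2.2 l (by omega)⟩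
  set L : ι → ℝ → Set (EV m) := fun j τ => chartLayer Ω 0 (tsupport (ζ j)) (t j) τ with hL
  have hLm : ∀ j τ, MeasurableSet (L j τ) := fun j τ => chartLayer_meas hA.isOpen 0 _ (hA.chart j).t_smooth.continuous τ
  have hLΩ : ∀ j τ, L j τ ⊆ Ω := fun j τ x hx => hx.1.1
  have hkey : ∀ j x, ∀ᶠ τ in 𝓝[>] (0 : ℝ), x ∉ L j τ := by
    intro j x
    by_cases hx : x ∈ Ω ∩ cthickening 0 (tsupport (ζ j))
    · have hK : x ∈ tsupport (ζ j) := by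
        have := hx.2
        rwa [cthickening_zero, (isClosed_tsupport _).closure_eq] at this
      filter_upwards [Ioo_mem_nhdsGT (((hA.chart j).mem_iff x (cthick_self hK)).mp hx.1)] with τ hτ h
      exact absurd h.2 (not_le.mpr hτ.2)
    · exact Eventually.of_forall fun τ h => hx h.1
  have ev1 : ∀ j, ∀ l : List (Fin m), l.length ≤ 3 → ∀ᶠ τ in 𝓝[>] (0 : ℝ), eLpNorm (D l) p (volume.restrict (L j τ)) ≤ η := by
    intro j l hl
    have := absc hp1 hp ((memLp_indicator_iff_restrict hΩm).mpr (hD.2.2 l hl)) (L j) (hLm j) (fun x _ => hkey j x)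
    filter_upwards [this.eventually_le_const hη] with τ hτ
    refine le_trans (le_of_eq (eLpNorm_congr_ae ?_)) hτ
    filter_upwards [ae_restrict_mem (hLm j τ)] with x hx
    rw [indicator_of_mem (hLΩ j τ hx)]
  have ev3 : ∀ l : List (Fin m), l.length ≤ 3 → ∀ᶠ τ in 𝓝[>] (0 : ℝ), ofReal τ * eLpNorm (D l) p (volume.restrict Ω) ≤ η := by
    intro l hl
    have h1 : Tendsto (fun τ : ℝ => ofReal τ * eLpNorm (D l) p (volume.restrict Ω)) (𝓝[>] 0) (𝓝 (ofReal 0 * eLpNorm (D l) p (volume.restrict Ω))) :=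
      ENNReal.Tendsto.mul_const ((ENNReal.continuous_ofReal.tendsto 0).mono_left nhdsWithin_le_nhds) (Or.inr (hD.2.2 l hl).2.ne)
    rw [ENNReal.ofReal_zero, zero_mul] at h1
    exact h1.eventually_le_const hη
  obtain ⟨δ, hH, h1, h2, h3, hδ⟩ := ((eventually_all.mpr fun j => hA.hardy_weak j hp1 hp hD2 hN hη).and
    ((eventually_all.mpr fun j => eventually_all.mpr fun k => ev1 j [k] (by simp)).and
    ((eventually_all.mpr fun j => eventually_all.mpr fun a : Fin m × Fin m => ev1 j [a.1, a.2] (by simp)).and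
    ((eventually_all.mpr fun a : Fin m × Fin m × Fin m => ev3 [a.1, a.2.1, a.2.2] (by simp)).and (Ioo_mem_nhdsGT (by norm_num : (0 : ℝ) < 1)))))).exists
  have hδ0 := hδ.1
  have hδ1 := hδ.2.le
  have ho1 : ofReal δ ≤ 1 := ENNReal.ofReal_le_one.mpr hδ1
  obtain ⟨u', hu', huc, hud⟩ := hA.density hp1 hp hD (η := ofReal δ * η) (ENNReal.mul_pos (by simpa using hδ0) hη.ne')
  have hud1 : ∀ l : List (Fin m), l.length ≤ 3 → eLpNorm (fun x => partialDList l u' x - D l x) p (volume.restrict Ω) ≤ η := fun l hl =>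
    (hud l hl).trans (mul_le_of_le_one_left bot_le ho1)
  have hcor := fun j => hB j δ hδ0 hδ1 u' hu'
  let w : ι → EV m → ℝ := fun j => corr (t j) (bco M (t j) (ζ j)) δ u'
  have hw2 : ∀ j, ContDiff ℝ 2 (w j) := fun j => (hcor j).1
  have hmono : ∀ j l, l.length ≤ 3 → eLpNorm (partialDList l u') p (volume.restrict (L j δ)) ≤ eLpNorm (D l) p (volume.restrict (L j δ)) + eLpNorm (fun x => partialDList l u' x - D l x) p (volume.restrict Ω) := by
    intro j l hl
    have m1 : AEStronglyMeasurable (D l) (volume.restrict (L j δ)) := (hD.2.2 l hl).1.mono_set (hLΩ j δ)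
    have := eLpNorm_add_le m1 ((partialDList_cont hu' l).aestronglyMeasurable.sub m1) hp1
    refine le_trans (le_of_eq ?_) (this.trans (add_le_add le_rfl (eLpNorm_mono_measure _ (Measure.restrict_mono (hLΩ j δ) le_rfl))))
    congr 1; funext x; simp
  have hA1 : ∀ j, ofReal δ⁻¹ * eLpNorm (lc (bco M (t j) (ζ j)) u') p (volume.restrict (L j δ)) ≤ ofReal lam⁻¹ * (1 + Fintype.card (Fin m) * ofReal (B' j)) * η := by
    intro j
    have e1 : lc (bco M (t j) (ζ j)) u' = fun x => (gQ M (t j) x)⁻¹ * ∑ k, ζ j x * coN M (t j) k x * partialDList [k] u' x := funext fun x => lc_bco u' x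
    have m1 : ∀ k, AEStronglyMeasurable (D [k]) (volume.restrict (L j δ)) := fun k => (hD.2.2 [k] (by simp)).1.mono_set (hLΩ j δ)
    have m2 : ∀ k, AEStronglyMeasurable (fun x => ζ j x * coN M (t j) k x * (partialDList [k] u' x - D [k] x)) (volume.restrict (L j δ)) := fun k =>
      (hcc j k).continuous.aestronglyMeasurable.mul ((partialDList_cont hu' [k]).aestronglyMeasurable.sub (m1 k))
    have e2 : eLpNorm (fun x => ∑ k, ζ j x * coN M (t j) k x * partialDList [k] u' x) p (volume.restrict (L j δ)) ≤
        ofReal δ * η + ∑ k : Fin m, ofReal (B' j) * (ofReal δ * η) := by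
      have e3 : (fun x => ∑ k, ζ j x * coN M (t j) k x * partialDList [k] u' x) = (fun x => ∑ k, ζ j x * coN M (t j) k x * D [k] x) + fun x => ∑ k, ζ j x * coN M (t j) k x * (partialDList [k] u' x - D [k] x) := by
        funext x
        simp only [Pi.add_apply, ← sum_add_distrib]
        exact sum_congr rfl fun k _ => by ring
      rw [e3]
      refine (eLpNorm_add_le (Finset.aestronglyMeasurable_fun_sum _ fun k _ => (hcc j k).continuous.aestronglyMeasurable.mul (m1 k)) (Finset.aestronglyMeasurable_fun_sum _ fun k _ => m2 k) hp1).trans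
        (add_le_add (hH j) ((eLp_fsum_le hp1 m2).trans (sum_le_sum fun k _ => ?_)))
      refine (eLp_mul_bdd _ p _ _ (B' j) fun x => (hB' j k x).1).trans (mul_le_mul_right ?_ _)
      exact (eLpNorm_mono_measure _ (Measure.restrict_mono (hLΩ j δ) le_rfl)).trans (hud [k] (by simp))
    have e4 : eLpNorm (lc (bco M (t j) (ζ j)) u') p (volume.restrict (L j δ)) ≤ ofReal lam⁻¹ * (ofReal δ * η + ∑ k : Fin m, ofReal (B' j) * (ofReal δ * η)) := by
      rw [e1]
      exact (eLp_mul_bdd _ p _ _ lam⁻¹ fun x => by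
        rw [abs_of_pos (inv_pos.mpr (hl.trans_le (hg j x)))]
        exact inv_anti₀ hl (hg j x)).trans (mul_le_mul_right e2 _)
    refine (mul_le_mul_right e4 _).trans (le_of_eq ?_)
    have hδδ : ofReal δ⁻¹ * ofReal δ = 1 := by
      rw [← ofReal_mul (by positivity), inv_mul_cancel₀ hδ0.ne', ofReal_one]
    simp only [Finset.sum_const, Finset.card_univ, nsmul_eq_mul]
    calc _ = (ofReal δ⁻¹ * ofReal δ) * (ofReal lam⁻¹ * (1 + Fintype.card (Fin m) * ofReal (B' j)) * η) := by ring
      _ = _ := by rw [hδδ, one_mul]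
  have pc := fun l => partialDList_cont hu' l
  let E : ι → EV m → ℝ := fun j x => B j * (δ⁻¹ * |lc (bco M (t j) (ζ j)) u' x| + S1 u' x + S2 u' x + δ * S3 u' x)
  have hS2 : S2 u' = fun x => ∑ a : Fin m × Fin m, |partialDList [a.1, a.2] u' x| := by funext x; simp only [S2, Fintype.sum_prod_type]
  have hS3 : S3 u' = fun x => ∑ a : Fin m × Fin m × Fin m, |partialDList [a.1, a.2.1, a.2.2] u' x| := by funext x; simp only [S3, Fintype.sum_prod_type]
  have hE : ∀ j, eLpNorm (E j) p (volume.restrict (L j δ)) ≤ c j * η := by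
    intro j
    have c0 : Continuous fun x => δ⁻¹ * |lc (bco M (t j) (ζ j)) u' x| := continuous_const.mul (lc_smooth (hb j) hu').continuous.abs
    have c1 : Continuous (S1 u') := continuous_finset_sum _ fun k _ => (pc [k]).abs
    have c2 : Continuous (S2 u') := by rw [hS2]; exact continuous_finset_sum _ fun a _ => (pc _).abs
    have c3 : Continuous fun x => δ * S3 u' x := by rw [hS3]; exact continuous_const.mul (continuous_finset_sum _ fun a _ => (pc _).abs)
    have b0 : eLpNorm (fun x => δ⁻¹ * |lc (bco M (t j) (ζ j)) u' x|) p (volume.restrict (L j δ)) ≤ _ :=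
      ((eLp_mul_bdd _ p (fun _ => δ⁻¹) _ δ⁻¹ fun x => (abs_of_pos (by positivity)).le).trans (le_of_eq (congrArg _ (eLpNorm_norm (lc (bco M (t j) (ζ j)) u'))))).trans (hA1 j)
    have b1 : eLpNorm (S1 u') p (volume.restrict (L j δ)) ≤ Fintype.card (Fin m) * (η + η) :=
      eLp_S hp1 (fun k => pc [k]) fun k => (hmono j [k] (by simp)).trans (add_le_add (h1 j k) (hud1 _ (by simp)))
    have b2 : eLpNorm (S2 u') p (volume.restrict (L j δ)) ≤ Fintype.card (Fin m × Fin m) * (η + η) := by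
      rw [hS2]
      exact eLp_S hp1 (fun a : Fin m × Fin m => pc [a.1, a.2]) fun a => (hmono j _ (by simp)).trans (add_le_add (h2 j a) (hud1 _ (by simp)))
    have b3 : eLpNorm (fun x => δ * S3 u' x) p (volume.restrict (L j δ)) ≤ Fintype.card (Fin m × Fin m × Fin m) * (η + η) := by
      have : (fun x => δ * S3 u' x) = fun x => ∑ a : Fin m × Fin m × Fin m, |δ * partialDList [a.1, a.2.1, a.2.2] u' x| := by
        rw [hS3]; funext x; simp only [mul_sum, abs_mul, abs_of_pos hδ0]
      rw [this]
      refine eLp_S hp1 (fun a => continuous_const.mul (pc _)) fun a => (eLp_mul_bdd _ p (fun _ => δ) _ δ fun x => (abs_of_pos hδ0).le).trans ?_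
      refine (mul_le_mul_right (hmono j _ (by simp)) _).trans ?_
      rw [mul_add]
      exact add_le_add ((mul_le_mul_right (eLpNorm_mono_measure _ (Measure.restrict_mono (hLΩ j δ) le_rfl)) _).trans (h3 a)) ((mul_le_of_le_one_left bot_le ho1).trans (hud1 _ (by simp)))
    refine (eLp_mul_bdd _ p (fun _ => B j) _ (B j) fun x => (abs_of_nonneg (hB0 j)).le).trans ?_
    simp only [c, mul_assoc]
    refine mul_le_mul_right ?_ _
    refine (eLpNorm_add_le ((c0.add c1).add c2).aestronglyMeasurable c3.aestronglyMeasurable hp1).trans ((add_le_add ((eLpNorm_add_le (c0.add c1).aestronglyMeasurable c2.aestronglyMeasurable hp1).trans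
      (add_le_add ((eLpNorm_add_le c0.aestronglyMeasurable c1.aestronglyMeasurable hp1).trans (add_le_add b0 b1)) b2)) b3).trans (le_of_eq (by ring)))
  have hz : ∀ j, ∀ x ∈ Ω, x ∉ L j δ → w j =ᶠ[𝓝 x] fun _ => 0 := fun j x hx hxL => (hA.chart j).corr_supp (isClosed_tsupport _) (hbK j) hδ0 hx hxL
  have hd1 : ∀ j, ContDiff ℝ 1 (fderiv ℝ (w j)) := fun j => (hw2 j).fderiv_right (by norm_num)
  have f1 : fderiv ℝ (fun x => ∑ j, w j x) = fun x => ∑ j, fderiv ℝ (w j) x := by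
    funext x; exact fderiv_fun_sum fun j _ => (hw2 j).differentiable (by norm_num) x
  have f2 : fderiv ℝ (fderiv ℝ (fun x => ∑ j, w j x)) = fun x => ∑ j, fderiv ℝ (fderiv ℝ (w j)) x := by
    rw [f1]; funext x; exact fderiv_fun_sum fun j _ => (hd1 j).differentiable one_ne_zero x
  refine ⟨u', fun x => ∑ j, w j x, hu', huc, ContDiff.sum fun j _ => hw2 j, HasCompactSupport.fsum' _ fun j => (HasCompactSupport.fsum' _ fun k => (hbc j k).mul_right).mul_left, hud1,
    fun j x hx hxj => hA.bc_corr hl hg hδ0 hu' hb hbK j hx hxj, ?_, ?_, ?_⟩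
  · refine (eLp_fsum_le hp1 fun j => (hw2 j).continuous.aestronglyMeasurable).trans ?_
    rw [sum_mul]
    exact sum_le_sum fun j _ => (eLp_layer (hLm j δ) hΩm (hLΩ j δ) (fun x hx hxL => (hz j x hx hxL).eq_of_nhds) fun x => ((hcor j).2 x).1).trans (hE j)
  · rw [f1]
    refine (eLp_fsum_le hp1 fun j => (hd1 j).continuous.aestronglyMeasurable).trans ?_
    rw [sum_mul]
    exact sum_le_sum fun j _ => (eLp_layer (hLm j δ) hΩm (hLΩ j δ) (fun x hx hxL => by rw [(hz j x hx hxL).fderiv_eq]; simp) fun x => ((hcor j).2 x).2.1).trans (hE j)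
  · rw [f2]
    refine (eLp_fsum_le hp1 fun j => ((hd1 j).continuous_fderiv one_ne_zero).aestronglyMeasurable).trans ?_
    rw [sum_mul]
    exact sum_le_sum fun j _ => (eLp_layer (hLm j δ) hΩm (hLΩ j δ) (fun x hx hxL => by rw [((hz j x hx hxL).fderiv (𝕜 := ℝ)).fderiv_eq]; simp) fun x => ((hcor j).2 x).2.2).trans (hE j)
end

section
variable {m : ℕ} {Ω : Set (EV m)}

lemma int_dom_zero (hΩ : IsOpen Ω) {f : EV m → ℝ} (hf : ContDiff ℝ 1 f) (hc : HasCompactSupport f) (h0 : ∀ x ∈ frontier Ω, x ∉ tsupport f) (i : Fin m) :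
    ∫ x in Ω, partialD i f x = 0 := by
  have e1 : ∀ x ∈ Ω, Ω.indicator f =ᶠ[𝓝 x] f := fun x hx => by
    filter_upwards [hΩ.mem_nhds hx] with y hy using indicator_of_mem hy f
  have e2 : ∀ x, x ∉ Ω → Ω.indicator f =ᶠ[𝓝 x] fun _ => 0 := fun x hx => by
    by_cases hxf : x ∈ closure Ω
    · filter_upwards [(isClosed_tsupport f).isOpen_compl.mem_nhds (h0 x ⟨hxf, fun h => hx (interior_subset h)⟩)] with y hy
      simp [Set.indicator_apply, image_eq_zero_of_notMem_tsupport hy]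
    · filter_upwards [isClosed_closure.isOpen_compl.mem_nhds hxf] with y hy using indicator_of_notMem (fun h => hy (subset_closure h)) f
  have hg : ContDiff ℝ 1 (Ω.indicator f) := contDiff_iff_contDiffAt.mpr fun x => by
    by_cases hx : x ∈ Ω
    · exact hf.contDiffAt.congr_of_eventuallyEq (e1 x hx)
    · exact contDiffAt_const.congr_of_eventuallyEq (e2 x hx)
  have hgc : HasCompactSupport (Ω.indicator f) := hc.mono fun x hx => by
    intro h; exact hx (by simp [Set.indicator_apply, h])
  rw [← integral_indicator hΩ.measurableSet, ← int_partial_zero hg hgc i]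
  congr 1; funext x
  unfold partialD
  by_cases hx : x ∈ Ω
  · rw [indicator_of_mem hx, (e1 x hx).fderiv_eq]
  · rw [indicator_of_notMem hx, (e2 x hx).fderiv_eq]; simp

lemma pD_cd {v : EV m → ℝ} {k : ℕ} (hv : ContDiff ℝ (k + 1 : ℕ) v) (i : Fin m) : ContDiff ℝ k (partialD i v) :=
  (hv.fderiv_right (by norm_cast)).clm_apply contDiff_const

lemma weak_cls (hΩ : IsOpen Ω) {v : EV m → ℝ} (hv : ContDiff ℝ 1 v) (hc : HasCompactSupport v) (i : Fin m) : WeakDerivOn Ω i v (partialD i v) := by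
  intro φ hφ hφc hφΩ
  have hφ1 : ContDiff ℝ 1 φ := hφ.of_le (by norm_cast)
  have h := int_dom_zero (f := fun y => v y * φ y) hΩ (hv.mul hφ1) (hc.mul_right) (fun x hx hxs => by
    rw [hΩ.frontier_eq] at hx
    exact hx.2 (hφΩ (tsupport_mul_subset_right hxs))) i
  have e : ∀ x, partialD i (fun y => v y * φ y) x = v x * partialD i φ x + partialD i v x * φ x := fun x => by
    have := partialD_mul' (hv.differentiable one_ne_zero) (hφ1.differentiable one_ne_zero) x (single i 1)
    unfold partialD; rw [mul_comm (fderiv ℝ v x _)]; exact this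
  simp only [e] at h
  rw [integral_add] at h
  · linarith
  · exact ((hv.continuous.mul ((hφ1.continuous_fderiv one_ne_zero).clm_apply continuous_const)).integrable_of_hasCompactSupport hc.mul_right).restrict
  · exact ((((hv.continuous_fderiv one_ne_zero).clm_apply continuous_const).mul hφ.continuous).integrable_of_hasCompactSupport hφc.mul_left).restrict

lemma sob_cls (hΩ : IsOpen Ω) {p : ℝ≥0∞} {v : EV m → ℝ} (hv : ContDiff ℝ 2 v) (hc : HasCompactSupport v) : IsSobDerivs Ω 2 p v (fun l => partialDList l v) := by
  have c1 : ∀ i, ContDiff ℝ 1 (partialD i v) := fun i => pD_cd (k := 1) (by exact_mod_cast hv) i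
  have c2 : ∀ i j, Continuous (partialD j (partialD i v)) := fun i j => ((c1 i).continuous_fderiv one_ne_zero).clm_apply continuous_const
  refine ⟨rfl, fun l hl i => ?_, fun l hl => ?_⟩
  · match l, hl with
    | [], _ => exact weak_cls hΩ (hv.of_le (by norm_num)) hc i
    | [k], _ => exact weak_cls hΩ (c1 k) (partialDList_compact hc [k]) i
  · have : Continuous (partialDList l v) := by
      match l, hl with
      | [], _ => exact hv.continuous
      | [k], _ => exact (c1 k).continuous
      | [k, j], _ => exact c2 j k
    exact (this.memLp_of_hasCompactSupport (partialDList_compact hc l)).restrict Ω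

lemma weak_ae (hΩ : IsOpen Ω) {p : ℝ≥0∞} (hp1 : 1 ≤ p) {u u' v v' : EV m → ℝ} {i : Fin m} (h : WeakDerivOn Ω i u v) (h' : WeakDerivOn Ω i u' v')
    (he : u =ᵐ[volume.restrict Ω] u') (hv : MemLp v p (volume.restrict Ω)) (hv' : MemLp v' p (volume.restrict Ω)) : v =ᵐ[volume.restrict Ω] v' := by
  have hs := hv.sub hv'
  have := hΩ.ae_eq_zero_of_integral_contDiff_smul_eq_zero (μ := volume) (f := v - v') ?_ fun g hg hgc hgΩ => ?_
  · refine (ae_restrict_iff' hΩ.measurableSet).mpr ?_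
    filter_upwards [this] with x hx hxΩ using sub_eq_zero.mp (hx hxΩ)
  · exact locallyIntegrableOn_of_locallyIntegrable_restrict (hs.locallyIntegrable hp1)
  · have a := h g hg hgc hgΩ
    have b := h' g hg hgc hgΩ
    have c : ∫ x in Ω, u x * partialD i g x = ∫ x in Ω, u' x * partialD i g x := integral_congr_ae (by filter_upwards [he] with x hx; rw [hx])
    have d : ∫ x in Ω, g x • (v - v') x = ∫ x, g x • (v - v') x := setIntegral_eq_integral_of_forall_compl_eq_zero fun x hx => by
      rw [image_eq_zero_of_notMem_tsupport (fun h => hx (hgΩ h)), zero_smul]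
    rw [← d]
    simp only [Pi.sub_apply, smul_eq_mul, mul_sub]
    rw [integral_sub (hold_int hp1 hg.continuous hgc hv) (hold_int hp1 hg.continuous hgc hv')]
    simp only [mul_comm (g _)]
    linarith

lemma sob_unique (hΩ : IsOpen Ω) {p : ℝ≥0∞} (hp1 : 1 ≤ p) {k : ℕ} {u : EV m → ℝ} {D E : List (Fin m) → EV m → ℝ} (hD : IsSobDerivs Ω k p u D)
    (hE : IsSobDerivs Ω k p u E) (l : List (Fin m)) (hl : l.length ≤ k) : D l =ᵐ[volume.restrict Ω] E l := by
  induction l with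
  | nil => rw [hD.1, hE.1]
  | cons i l ih => exact weak_ae hΩ hp1 (hD.2.1 l hl i) (hE.2.1 l hl i) (ih (Nat.le_of_lt hl)) (hD.2.2 _ hl) (hE.2.2 _ hl)

lemma sob_comb {p : ℝ≥0∞} (hp1 : 1 ≤ p) {k : ℕ} {u v : EV m → ℝ} {D E : List (Fin m) → EV m → ℝ} (hD : IsSobDerivs Ω k p u D)
    (hE : IsSobDerivs Ω k p v E) (a b : ℝ) : IsSobDerivs Ω k p (fun x => a * u x + b * v x) (fun l x => a * D l x + b * E l x) := by
  refine ⟨by simp only [hD.1, hE.1], fun l hl i φ hφ hφc hφΩ => ?_, fun l hl => ((hD.2.2 l hl).const_mul a).add ((hE.2.2 l hl).const_mul b)⟩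
  have I : ∀ {f : EV m → ℝ} {g : EV m → ℝ}, Continuous f → HasCompactSupport f → MemLp g p (volume.restrict Ω) → ∀ c : ℝ, Integrable (fun x => c * (g x * f x)) (volume.restrict Ω) :=
    fun hf hfc hg c => by
      have := (hold_int hp1 hf hfc hg).const_mul c
      simpa only [mul_comm (_ : ℝ) (_ : ℝ)] using this
  have c1 : Continuous (partialD i φ) := (partialD_smooth hφ i).continuous
  have s1 : HasCompactSupport (partialD i φ) := hφc.fderiv_apply ℝ _
  simp only [add_mul, mul_assoc]
  rw [integral_add (I c1 s1 (hD.2.2 l hl.le) a) (I c1 s1 (hE.2.2 l hl.le) b), integral_add (I hφ.continuous hφc (hD.2.2 (i :: l) hl) a) (I hφ.continuous hφc (hE.2.2 (i :: l) hl) b)]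
  simp only [integral_const_mul]
  rw [hD.2.1 l hl i φ hφ hφc hφΩ, hE.2.1 l hl i φ hφ hφc hφΩ]
  ring

lemma bc_of (hΩ : IsOpen Ω) {p : ℝ≥0∞} (hp1 : 1 ≤ p) {M : Matrix (Fin m) (Fin m) ℝ} {u : EV m → ℝ} {D : List (Fin m) → EV m → ℝ} (hD : IsSobDerivs Ω 2 p u D)
    (h : ∀ φ : EV m → ℝ, ContDiff ℝ (⊤ : ℕ∞) φ → HasCompactSupport φ → (∑ i, ∑ j, M i j * ∫ x in Ω, D [i, j] x * φ x) = - ∑ i, ∑ j, M i j * ∫ x in Ω, D [j] x * partialD i φ x) :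
    NeumannBC Ω M p u := by
  intro E hE φ hφ hφc
  have h1 : ∀ l : List (Fin m), l.length ≤ 2 → ∀ f : EV m → ℝ, ∫ x in Ω, E l x * f x = ∫ x in Ω, D l x * f x := fun l hl f =>
    integral_congr_ae (by filter_upwards [sob_unique hΩ hp1 hE hD l hl] with x hx; rw [hx])
  rw [sum_congr rfl fun i _ => sum_congr rfl fun j _ => by rw [h1 [i, j] (by simp)], h φ hφ hφc]
  exact congrArg _ (sum_congr rfl fun i _ => sum_congr rfl fun j _ => by rw [h1 [j] (by simp)])

lemma bc_comb (hΩ : IsOpen Ω) {p : ℝ≥0∞} (hp1 : 1 ≤ p) {M : Matrix (Fin m) (Fin m) ℝ} {u v : EV m → ℝ} {D E : List (Fin m) → EV m → ℝ} (hD : IsSobDerivs Ω 2 p u D)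
    (hE : IsSobDerivs Ω 2 p v E) (hu : NeumannBC Ω M p u) (hv : NeumannBC Ω M p v) (a b : ℝ) : NeumannBC Ω M p (fun x => a * u x + b * v x) := by
  refine bc_of hΩ hp1 (sob_comb hp1 hD hE a b) fun φ hφ hφc => ?_
  have I : ∀ l : List (Fin m), l.length ≤ 2 → ∀ f : EV m → ℝ, Continuous f → HasCompactSupport f → ∫ x in Ω, (a * D l x + b * E l x) * f x = a * (∫ x in Ω, D l x * f x) + b * ∫ x in Ω, E l x * f x := by
    intro l hl f hf hfc
    rw [← integral_const_mul, ← integral_const_mul, ← integral_add]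
    · exact integral_congr_ae (.of_forall fun x => by ring)
    · simpa only [mul_comm (f _)] using (hold_int hp1 hf hfc (hD.2.2 l hl)).const_mul a
    · simpa only [mul_comm (f _)] using (hold_int hp1 hf hfc (hE.2.2 l hl)).const_mul b
  have h1 := hu D hD φ hφ hφc
  have h2 := hv E hE φ hφ hφc
  simp only [I _ (show [_, _].length ≤ 2 by simp) φ hφ.continuous hφc]
  simp only [I _ (show [_].length ≤ 2 by simp) _ (partialD_smooth hφ _).continuous (show HasCompactSupport (partialD _ φ) from hφc.fderiv_apply ℝ _)]
  simp only [mul_add, sum_add_distrib, mul_left_comm _ a, mul_left_comm _ b, ← mul_sum]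
  rw [h1, h2]; ring
end

section
variable {m : ℕ} {ι : Type} [Fintype ι] {Ω : Set (EV m)} {Λ R : ℝ} {e : ι → EV m} {t ζ : ι → EV m → ℝ}

lemma IsAtlas.bc_cls (hA : IsAtlas Ω Λ R e t ζ) {p : ℝ≥0∞} (hp1 : 1 ≤ p) {M : Matrix (Fin m) (Fin m) ℝ} {v : EV m → ℝ} (hv : ContDiff ℝ 2 v) (hc : HasCompactSupport v)
    (hbc : ∀ j, ∀ x ∈ frontier Ω, x ∈ cthickening (R / 2) (tsupport (ζ j)) → fderiv ℝ v x (MV M (fderiv ℝ (t j) x)) = 0) : NeumannBC Ω M p v := by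
  refine bc_of hA.isOpen hp1 (sob_cls hA.isOpen hv hc) fun φ hφ hφc => ?_
  have c1 : ∀ i, ContDiff ℝ 1 (partialD i v) := fun i => pD_cd (k := 1) (by exact_mod_cast hv) i
  have hφ1 : ContDiff ℝ 1 φ := hφ.of_le (by norm_cast)
  have hζ1 : ∀ j, ContDiff ℝ 1 (ζ j) := fun j => (hA.ζ_smooth j).of_le (by norm_cast)
  let G : Fin m → EV m → ℝ := fun i x => ∑ k, M i k * partialD k v x
  have hG : ∀ i, ContDiff ℝ 1 (G i) := fun i => ContDiff.sum fun k _ => contDiff_const.mul (c1 k)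
  have hφG : ∀ i, ContDiff ℝ 1 (fun x => φ x * G i x) := fun i => hφ1.mul (hG i)
  have hcG : ∀ i, HasCompactSupport (fun x => φ x * G i x) := fun i => hφc.mul_right
  have z1 : ∀ j, ∫ x in Ω, ∑ i, partialD i (fun x => ζ j x * (φ x * G i x)) x = 0 := fun j => by
    refine (hA.chart j).div_zero hA.isOpen hA.R_pos (fun i => (hζ1 j).mul (hφG i)) (fun i => (hcG i).mul_left) (fun i => tsupport_mul_subset_left) fun x hx hxK => ?_
    have := hbc j x hx (self_subset_cthickening _ hxK)
    rw [apply_MV, Finset.sum_comm] at this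
    calc _ = ζ j x * φ x * ∑ i, ∑ k, M i k * fderiv ℝ (t j) x (single i 1) * fderiv ℝ v x (single k 1) := by
          rw [mul_sum]
          refine sum_congr rfl fun i _ => ?_
          simp only [G, partialD, mul_sum, sum_mul]
          exact sum_congr rfl fun k _ => by ring
      _ = 0 := by rw [this, mul_zero]
  have hχ : ContDiff ℝ 1 (fun x => 1 - ∑ j, ζ j x) := contDiff_const.sub (ContDiff.sum fun j _ => hζ1 j)
  have z2 : ∀ i, ∫ x in Ω, partialD i (fun x => (1 - ∑ j, ζ j x) * (φ x * G i x)) x = 0 := fun i => by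
    refine int_dom_zero hA.isOpen (hχ.mul (hφG i)) (hcG i).mul_left (fun x hx hxs => ?_) i
    refine notMem_tsupport_iff_eventuallyEq.mpr ?_ (tsupport_mul_subset_left hxs)
    filter_upwards [ball_mem_nhds x hA.R_pos] with y hy
    simp [hA.sum_one y (mem_cthickening_of_dist_le y x R _ hx (mem_ball.mp hy).le)]
  have I : ∀ {f : EV m → ℝ}, ContDiff ℝ 1 f → HasCompactSupport f → ∀ i, Integrable (partialD i f) (volume.restrict Ω) := fun hf hfc i =>
    (((hf.continuous_fderiv one_ne_zero).clm_apply continuous_const).integrable_of_hasCompactSupport (hfc.fderiv_apply ℝ _)).restrict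
  have z3 : ∑ i, ∫ x in Ω, partialD i (fun x => φ x * G i x) x = 0 := by
    have s1 : ∀ i x, partialD i (fun x => φ x * G i x) x = (∑ j, partialD i (fun x => ζ j x * (φ x * G i x)) x) + partialD i (fun x => (1 - ∑ j, ζ j x) * (φ x * G i x)) x := by
      intro i x
      have hd : ∀ j, DifferentiableAt ℝ (fun x => ζ j x * (φ x * G i x)) x := fun j => (((hζ1 j).mul (hφG i)).differentiable one_ne_zero).differentiableAt
      have : (fun x => φ x * G i x) = fun x => (∑ j, ζ j x * (φ x * G i x)) + (1 - ∑ j, ζ j x) * (φ x * G i x) := by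
        funext y; rw [← sum_mul]; ring
      unfold partialD
      conv_lhs => rw [this]
      rw [fderiv_fun_add (DifferentiableAt.fun_sum fun j _ => hd j) ((hχ.mul (hφG i)).differentiable one_ne_zero).differentiableAt, fderiv_fun_sum fun j _ => hd j]
      simp
    have s2 : ∀ i, ∫ x in Ω, partialD i (fun x => φ x * G i x) x = ∑ j, ∫ x in Ω, partialD i (fun x => ζ j x * (φ x * G i x)) x := by
      intro i
      have Ij : ∀ j, Integrable (partialD i (fun x => ζ j x * (φ x * G i x))) (volume.restrict Ω) := fun j => I ((hζ1 j).mul (hφG i)) (hcG i).mul_left i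
      simp only [s1 i]
      rw [integral_add (integrable_finset_sum _ fun j _ => Ij j) (I (hχ.mul (hφG i)) (hcG i).mul_left i), z2, add_zero, integral_finsetSum _ fun j _ => Ij j]
    simp only [s2]
    rw [Finset.sum_comm]
    refine Finset.sum_eq_zero fun j _ => ?_
    rw [← integral_finsetSum _ fun i _ => I ((hζ1 j).mul (hφG i)) (hcG i).mul_left i]
    exact z1 j
  have s3 : ∀ i x, partialD i (fun x => φ x * G i x) x = ∑ k, (M i k * (partialDList [i, k] v x * φ x) + M i k * (partialDList [k] v x * partialD i φ x)) := by
    intro i x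
    have := partialD_mul' (hφ1.differentiable one_ne_zero) ((hG i).differentiable one_ne_zero) x (single i 1)
    have h2 : fderiv ℝ (G i) x (single i 1) = ∑ k, M i k * partialDList [i, k] v x := by
      simp only [G]
      rw [fderiv_fun_sum fun k _ => (((c1 k).differentiable one_ne_zero).differentiableAt).const_mul _, ContinuousLinearMap.sum_apply]
      refine sum_congr rfl fun k _ => ?_
      rw [fderiv_const_mul (((c1 k).differentiable one_ne_zero).differentiableAt)]
      rfl
    rw [h2] at this
    refine this.trans ?_
    simp only [G, mul_sum, sum_mul, ← sum_add_distrib]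
    exact sum_congr rfl fun k _ => by simp only [partialDList, partialD]; ring
  have J1 : ∀ i k, Integrable (fun x => M i k * (partialDList [i, k] v x * φ x)) (volume.restrict Ω) := fun i k =>
    ((((((c1 k).continuous_fderiv one_ne_zero).clm_apply continuous_const).mul hφ.continuous).integrable_of_hasCompactSupport hφc.mul_left).restrict).const_mul _
  have J2 : ∀ i k, Integrable (fun x => M i k * (partialDList [k] v x * partialD i φ x)) (volume.restrict Ω) := fun i k =>
    (((((c1 k).continuous).mul (partialD_smooth hφ i).continuous).integrable_of_hasCompactSupport (HasCompactSupport.mul_left (hφc.fderiv_apply ℝ _))).restrict).const_mul _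
  have s4 : ∀ i, ∫ x in Ω, partialD i (fun x => φ x * G i x) x = (∑ k, M i k * ∫ x in Ω, partialDList [i, k] v x * φ x) + ∑ k, M i k * ∫ x in Ω, partialDList [k] v x * partialD i φ x := by
    intro i
    refine (integral_congr_ae (.of_forall (s3 i))).trans ((integral_finsetSum Finset.univ fun k _ => (J1 i k).add (J2 i k)).trans ?_)
    rw [← sum_add_distrib]
    refine sum_congr rfl fun k _ => ?_
    rw [← integral_const_mul, ← integral_const_mul]
    exact integral_add (J1 i k) (J2 i k)
  rw [sum_congr rfl fun i _ => s4 i, sum_add_distrib] at z3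
  linarith
end

section
lemma enn_lim {a b K : ℝ≥0∞} (hK : K ≠ ⊤) (h : ∀ η : ℝ≥0∞, 0 < η → η ≠ ⊤ → a ≤ b + K * η) : a ≤ b := by
  refine tsub_eq_zero_iff_le.mp (enn_zero hK fun η hη => tsub_le_iff_left.mpr ((h (min η 1) (lt_min hη one_pos) (by simp)).trans ?_))
  gcongr; exact min_le_left _ _

lemma Lq_root {m : ℕ} {F : Type*} [NormedAddCommGroup F] {Ω : Set (EV m)} {p : ℝ≥0∞} (hp1 : 1 ≤ p) (hp : p ≠ ⊤) (f : EV m → F) : Lq p.toReal Ω f ^ (1 / p.toReal) = eLpNorm f p (volume.restrict Ω) := by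
  rw [Lq, ← eLp_pow _ hp1 hp f, ← ENNReal.rpow_mul, mul_one_div_cancel (by linarith [toReal_one_le hp1 hp]), ENNReal.rpow_one]

lemma root_add {q : ℝ} (hq : 1 ≤ q) (a b : ℝ≥0∞) : (a + b) ^ (1 / q) ≤ a ^ (1 / q) + b ^ (1 / q) :=
  ENNReal.rpow_add_le_add_rpow a b (by positivity) (by rw [div_le_one (by linarith)]; exact hq)

lemma N2_root {m : ℕ} {Ω : Set (EV m)} {p : ℝ≥0∞} (hp1 : 1 ≤ p) (hp : p ≠ ⊤) (f : EV m → ℝ) : N2 p.toReal Ω f ^ (1 / p.toReal) ≤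
    eLpNorm f p (volume.restrict Ω) + eLpNorm (fderiv ℝ f) p (volume.restrict Ω) + eLpNorm (fderiv ℝ (fderiv ℝ f)) p (volume.restrict Ω) := by
  have hq := toReal_one_le hp1 hp
  simp only [N2, ← Lq_root hp1 hp]
  exact (root_add hq _ _).trans (add_le_add (root_add hq _ _) le_rfl)

lemma N3_root {m : ℕ} {Ω : Set (EV m)} {p : ℝ≥0∞} (hp1 : 1 ≤ p) (hp : p ≠ ⊤) : ∃ κ : ℝ≥0∞, κ ≠ ⊤ ∧ ∀ f : EV m → ℝ, ContDiff ℝ (⊤ : ℕ∞) f → ∀ X : ℝ≥0∞,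
    (∀ l : List (Fin m), l.length ≤ 3 → eLpNorm (partialDList l f) p (volume.restrict Ω) ≤ X) → N3 p.toReal Ω f ^ (1 / p.toReal) ≤ κ * X := by
  refine ⟨1 + Fintype.card (Fin m) + Fintype.card (Fin m × Fin m) + Fintype.card (Fin m × Fin m × Fin m), by finiteness, fun f hf X hX => ?_⟩
  have pc := fun l => partialDList_cont hf l
  have hq := toReal_one_le hp1 hp
  rw [N3]
  refine (root_add hq _ _).trans ((add_le_add (N2_root hp1 hp f) (Lq_root hp1 hp _).le).trans ?_)
  rw [add_mul, add_mul, add_mul, one_mul]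
  refine add_le_add (add_le_add (add_le_add (hX [] (by simp)) ?_) ?_) ?_
  · exact (eLpNorm_mono_real fun x => nD1 f x).trans (eLp_S hp1 (fun k => pc [k]) fun k => hX [k] (by simp))
  · refine (eLpNorm_mono_real fun x => (nD2 (hf.of_le (by norm_cast)) x)).trans (le_trans (le_of_eq ?_) (eLp_S hp1 (fun a : Fin m × Fin m => pc [a.1, a.2]) fun a => hX _ (by simp)))
    congr 1; funext x; simp only [S2, Fintype.sum_prod_type]
  · refine (eLpNorm_mono_real fun x => (nD3 (hf.of_le (by norm_cast)) x)).trans (le_trans (le_of_eq ?_) (eLp_S hp1 (fun a : Fin m × Fin m × Fin m => pc [a.1, a.2.1, a.2.2]) fun a => hX _ (by simp)))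
    congr 1; funext x; simp only [S3, Fintype.sum_prod_type]

lemma W_le (m k : ℕ) (p : ℝ≥0∞) (μ : Measure (EV m)) : ∃ κ : ℝ≥0∞, κ ≠ ⊤ ∧ ∀ (E : List (Fin m) → EV m → ℝ) (X : ℝ≥0∞),
    (∀ l : List (Fin m), l.length ≤ k → eLpNorm (E l) p μ ≤ X) → WNormD k p μ E ≤ κ * X := by
  have hf := List.finite_length_le (Fin m) k
  refine ⟨hf.toFinset.card, by finiteness, fun E X h => ?_⟩
  rw [WNormD, tsum_eq_sum (s := hf.toFinset) fun l hl => if_neg (by simpa using hl), ← nsmul_eq_mul]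
  refine Finset.sum_le_card_nsmul _ _ _ fun l hl => ?_
  have hl : l.length ≤ k := by simpa using hl
  rw [if_pos hl]; exact h l hl

lemma le_W {m k : ℕ} {p : ℝ≥0∞} {μ : Measure (EV m)} (E : List (Fin m) → EV m → ℝ) (l : List (Fin m)) (hl : l.length ≤ k) : eLpNorm (E l) p μ ≤ WNormD k p μ E := by
  have := ENNReal.le_tsum (f := fun l : List (Fin m) => if l.length ≤ k then eLpNorm (E l) p μ else 0) l
  simpa only [if_pos hl, WNormD] using this

lemma pDL_sub {m : ℕ} {u w : EV m → ℝ} (hu : ContDiff ℝ 2 u) (hw : ContDiff ℝ 2 w) (l : List (Fin m)) (hl : l.length ≤ 2) (x : EV m) :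
    partialDList l (fun x => u x - w x) x = partialDList l u x - partialDList l w x := by
  match l, hl with
  | [], _ => rfl
  | [k], _ => simp only [partialDList, partialD, fderiv_sub' hu hw]; rfl
  | [i, k], _ => rw [← d2_eq (hu.sub hw), ← d2_eq hu, ← d2_eq hw, fderiv2_sub' hu hw]; rfl

lemma pDL_le {m : ℕ} {w : EV m → ℝ} (hw : ContDiff ℝ 2 w) {p : ℝ≥0∞} {μ : Measure (EV m)} {X : ℝ≥0∞} (h0 : eLpNorm w p μ ≤ X) (h1 : eLpNorm (fderiv ℝ w) p μ ≤ X)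
    (h2 : eLpNorm (fderiv ℝ (fderiv ℝ w)) p μ ≤ X) (l : List (Fin m)) (hl : l.length ≤ 2) : eLpNorm (partialDList l w) p μ ≤ X := by
  match l, hl with
  | [], _ => exact h0
  | [k], _ =>
    refine (eLpNorm_mono fun x => ?_).trans h1
    simpa [partialDList, partialD] using (fderiv ℝ w x).le_opNorm (single k 1)
  | [i, k], _ =>
    refine (eLpNorm_mono fun x => ?_).trans h2
    rw [← d2_eq hw]
    simpa using (fderiv ℝ (fderiv ℝ w) x).le_opNorm₂ (single i 1) (single k 1)
end

section
variable {n : ℕ} {ι : Type} [Fintype ι] {Ω : Set (EV (n + 1))} {Λ R : ℝ} {e : ι → EV (n + 1)} {t ζ : ι → EV (n + 1) → ℝ} {ρ : EV (n + 1) → ℝ}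

set_option maxHeartbeats 800000 in
lemma IsAtlas.rate (hA : IsAtlas Ω Λ R e t ζ) (h1 : A1 ρ) (h2 : A2 ρ) {p : ℝ≥0∞} (hp1 : 1 ≤ p) (hp : p ≠ ⊤)
    (L : ℝ → (EV (n + 1) → ℝ) → EV (n + 1) → ℝ) (hL : ∀ ε : ℝ, 0 < ε → ε ≤ 1 → ∃ c : ℝ, 0 < c ∧ IsNLExtOn Ω (momentum ρ) ρ p ε c (L ε)) :
    ∃ C : ℝ≥0∞, C ≠ ⊤ ∧ ∀ ε : ℝ, 0 < ε → ε ≤ 1 → ∀ (u : EV (n + 1) → ℝ) (D : List (Fin (n + 1)) → EV (n + 1) → ℝ), NeumannBC Ω (momentum ρ) p u →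
      IsSobDerivs Ω 3 p u D → eLpNorm (fun x => L ε u x + ∑ i, ∑ j, momentum ρ i j * D [i, j] x) p (volume.restrict Ω)
        ≤ C * ofReal (ε ^ (1 / p.toReal)) * WNormD 3 p (volume.restrict Ω) D := by
  obtain ⟨lam, hlam, hg⟩ := gpos h2
  have hgQ : ∀ j x, lam ≤ gQ (momentum ρ) (t j) x := fun j x => by
    have h := (fderiv ℝ (t j) x).le_opNorm (e j)
    rw [(hA.chart j).fderiv_e x, (hA.chart j).e_norm, mul_one, norm_one] at h
    have := hg (fderiv ℝ (t j) x)
    unfold gQ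
    nlinarith [mul_le_mul_of_nonneg_left (one_le_pow₀ h : 1 ≤ ‖fderiv ℝ (t j) x‖ ^ 2) hlam.le]
  have hq := toReal_one_le hp1 hp
  set q := p.toReal with hqd
  obtain ⟨C1, hC1, happ⟩ := hA.approx hp1 hp hlam hgQ
  obtain ⟨C2, hC2, hcore⟩ := hA.core h1 h2 hq
  obtain ⟨κ, hκ, hN3⟩ := N3_root (Ω := Ω) hp1 hp
  obtain ⟨κ', hκ', hW⟩ := W_le (n + 1) 2 p (volume.restrict Ω)
  have hr0 : 0 ≤ 1 / q := by positivity
  have hC2' : C2 ^ (1 / q) ≠ ⊤ := ENNReal.rpow_ne_top_of_nonneg hr0 hC2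
  refine ⟨C2 ^ (1 / q) * κ, by finiteness, fun ε hε hε1 u D hN hD => ?_⟩
  obtain ⟨c, hc, hL1, hL2, hL3, hL4⟩ := hL ε hε hε1
  set μ := volume.restrict Ω with hμ
  set W := WNormD 3 p μ D with hWd
  set M := momentum ρ with hM
  set E := ofReal (ε ^ (1 / q)) with hE
  have hE1 : ofReal ε ^ (1 / q) = E := ENNReal.ofReal_rpow_of_nonneg hε.le hr0
  let K : ℝ≥0∞ := ofReal c * (κ' * (1 + C1)) + C2 ^ (1 / q) * (E * κ + 3 * C1) + ∑ a : Fin (n + 1) × Fin (n + 1), ofReal |M a.1 a.2| * (1 + C1)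
  have hK : K ≠ ⊤ := by
    refine ENNReal.add_ne_top.mpr ⟨by finiteness, ENNReal.sum_ne_top.mpr fun a _ => by finiteness⟩
  refine enn_lim hK fun η hη hηt => ?_
  obtain ⟨u', w, hu', hu'c, hw, hwc, hud, hbc, w0, w1, w2⟩ := happ u D hD hN η hη hηt
  have hu2 : ContDiff ℝ 2 u' := hu'.of_le (by norm_cast)
  have hv : ContDiff ℝ 2 (fun x => u' x - w x) := hu2.sub hw
  have hvc : HasCompactSupport (fun x => u' x - w x) := hu'c.sub hwc
  have hvS := sob_cls (p := p) hA.isOpen hv hvc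
  have hvN := hA.bc_cls hp1 hv hvc hbc
  set v := fun x => u' x - w x with hvd
  have hD2 : IsSobDerivs Ω 2 p u D := ⟨hD.1, fun l hl => hD.2.1 l (hl.trans (by norm_num)), fun l hl => hD.2.2 l (hl.trans (by norm_num))⟩
  have hS := sob_comb hp1 hD2 hvS 1 (-1)
  have hB := bc_comb hA.isOpen hp1 hD2 hvS hN hvN 1 (-1)
  have hdl : ∀ l : List (Fin (n + 1)), l.length ≤ 2 → eLpNorm (fun x => 1 * D l x + (-1) * partialDList l v x) p μ ≤ (1 + C1) * η := by
    intro l hl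
    have e1 : (fun x => 1 * D l x + (-1) * partialDList l v x) = fun x => partialDList l w x - (partialDList l u' x - D l x) := by
      funext x; rw [pDL_sub hu2 hw l hl]; ring
    have m1 : AEStronglyMeasurable (partialDList l w) μ := ((sob_cls (p := p) hA.isOpen hw hwc).2.2 l hl).1
    rw [e1, add_mul, one_mul, add_comm η]
    exact (eLpNorm_sub_le m1 ((partialDList_cont hu' l).aestronglyMeasurable.sub (hD2.2.2 l hl).1) hp1).trans (add_le_add (pDL_le hw w0 w1 w2 l hl) (hud l (by omega)))
  have t1 : eLpNorm (L ε (fun x => 1 * u x + (-1) * v x)) p μ ≤ ofReal c * (κ' * (1 + C1)) * η := by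
    refine (hL4 _ _ ⟨⟨_, hS⟩, hB⟩ hS).trans ?_
    rw [mul_assoc, mul_assoc κ']
    exact mul_le_mul_right (hW _ _ hdl) _
  have t2 : eLpNorm (fun x => L ε v x + MHess M v x) p μ ≤ C2 ^ (1 / q) * κ * E * W + C2 ^ (1 / q) * (E * κ + 3 * C1) * η := by
    have h := hcore ε hε hε1 u' w (hu'.of_le (by norm_cast)) hw hvc hbc (L ε v) (hL1 v hv hvc ⟨⟨_, hvS⟩, hvN⟩)
    have h' := ENNReal.rpow_le_rpow h hr0
    have hx : (∫⁻ x in Ω, ‖L ε v x + MHess M v x‖ₑ ^ q) ^ (1 / q) = eLpNorm (fun x => L ε v x + MHess M v x) p μ := Lq_root hp1 hp _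
    rw [← hx]
    refine h'.trans ?_
    rw [ENNReal.mul_rpow_of_nonneg _ _ hr0]
    have n3 := hN3 u' hu' (W + η) fun l hl => by
      have : partialDList l u' = D l + fun x => partialDList l u' x - D l x := by funext x; simp
      rw [this]
      exact (eLpNorm_add_le (hD.2.2 l hl).1 ((partialDList_cont hu' l).aestronglyMeasurable.sub (hD.2.2 l hl).1) hp1).trans (add_le_add (le_W D l hl) (hud l hl))
    have n2 := (N2_root (Ω := Ω) hp1 hp w).trans (add_le_add (add_le_add w0 w1) w2)
    calc _ ≤ C2 ^ (1 / q) * (E * (κ * (W + η)) + (C1 * η + C1 * η + C1 * η)) := by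
          refine mul_le_mul_right ((root_add hq _ _).trans (add_le_add ?_ n2)) _
          rw [ENNReal.mul_rpow_of_nonneg _ _ hr0, hE1]
          exact mul_le_mul_right n3 _
      _ = _ := by ring
  have t3 : eLpNorm (fun x => ∑ a : Fin (n + 1) × Fin (n + 1), M a.1 a.2 * (1 * D [a.1, a.2] x + (-1) * partialDList [a.1, a.2] v x)) p μ ≤
      (∑ a : Fin (n + 1) × Fin (n + 1), ofReal |M a.1 a.2| * (1 + C1)) * η := by
    rw [sum_mul]
    refine (eLp_fsum_le (f := fun (a : Fin (n + 1) × Fin (n + 1)) x => M a.1 a.2 * (1 * D [a.1, a.2] x + (-1) * partialDList [a.1, a.2] v x)) hp1 fun a => (hS.2.2 [a.1, a.2] (by simp)).1.const_mul _).trans (sum_le_sum fun a _ => ?_)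
    rw [mul_assoc]
    exact (eLp_mul_bdd _ p (fun _ => M a.1 a.2) _ _ fun x => le_rfl).trans (mul_le_mul_right (hdl _ (by simp)) _)
  have hMH : ∀ x, MHess M v x = ∑ i, ∑ j, M i j * partialDList [i, j] v x := fun x =>
    sum_congr rfl fun i _ => sum_congr rfl fun j _ => by rw [d2_eq hv]
  have key : (fun x => L ε u x + ∑ i, ∑ j, M i j * D [i, j] x) =ᵐ[μ] fun x => (L ε (fun x => 1 * u x + (-1) * v x) x + (L ε v x + MHess M v x)) +
      ∑ a : Fin (n + 1) × Fin (n + 1), M a.1 a.2 * (1 * D [a.1, a.2] x + (-1) * partialDList [a.1, a.2] v x) := by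
    filter_upwards [hL2 u v ⟨⟨_, hD2⟩, hN⟩ ⟨⟨_, hvS⟩, hvN⟩ 1 (-1)] with x hx
    rw [hx, hMH, Fintype.sum_prod_type]
    simp only [mul_add, sum_add_distrib, one_mul, neg_mul, mul_neg, Finset.sum_neg_distrib]
    ring
  have q1 := (hL3 _ ⟨⟨_, hS⟩, hB⟩).1
  have q2 : AEStronglyMeasurable (fun x => L ε v x + MHess M v x) μ := by
    refine (hL3 v ⟨⟨_, hvS⟩, hvN⟩).1.add ?_
    simp only [funext hMH]
    exact Finset.aestronglyMeasurable_fun_sum _ fun i _ => Finset.aestronglyMeasurable_fun_sum _ fun j _ => (hvS.2.2 [i, j] (by simp)).1.const_mul _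
  have q3 : AEStronglyMeasurable (fun x => ∑ a : Fin (n + 1) × Fin (n + 1), M a.1 a.2 * (1 * D [a.1, a.2] x + (-1) * partialDList [a.1, a.2] v x)) μ :=
    Finset.aestronglyMeasurable_fun_sum _ fun a _ => (hS.2.2 [a.1, a.2] (by simp)).1.const_mul _
  rw [eLpNorm_congr_ae key]
  refine (eLpNorm_add_le (q1.add q2) q3 hp1).trans ((add_le_add ((eLpNorm_add_le q1 q2 hp1).trans (add_le_add t1 t2)) t3).trans (le_of_eq ?_))
  simp only [K]
  ring
end

section
variable {n : ℕ}

lemma graph_chart {Q : Matrix (Fin (n + 1)) (Fin (n + 1)) ℝ} {γ : EV n → ℝ} (hQ : Qᵀ * Q = 1) (hγ : Ckb 3 γ) :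
    ∃ (Λ : ℝ) (e : EV (n + 1)) (t : EV (n + 1) → ℝ), 1 ≤ Λ ∧ ∀ (Ω U : Set (EV (n + 1))) (R Λ' : ℝ) (K : Set (EV (n + 1))), Λ ≤ Λ' →
      Ω ∩ U = (mulVecE Q '' halfSpace γ) ∩ U → cthickening R K ⊆ U → IsChart Ω Λ' R K e t := by
  obtain ⟨hs, hb⟩ := hγ
  obtain ⟨c1, hc1⟩ := hb 1 (by norm_num)
  obtain ⟨c2, hc2⟩ := hb 2 (by norm_num)
  have hQ' : Q * Qᵀ = 1 := mul_eq_one_comm.mp hQ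
  let A : EV (n + 1) →L[ℝ] EV (n + 1) := LinearMap.toContinuousLinearMap (mvL Qᵀ)
  let F : EV (n + 1) →ₗ[ℝ] EV n := { toFun := firstCoords, map_add' := fun x y => by ext i; simp [firstCoords], map_smul' := fun a x => by ext i; simp [firstCoords] }
  let B : EV (n + 1) →L[ℝ] EV n := (LinearMap.toContinuousLinearMap F).comp A
  let P : EV (n + 1) →L[ℝ] ℝ := (EuclideanSpace.proj (Fin.last n) : EV (n + 1) →L[ℝ] ℝ).comp A
  let e : EV (n + 1) := mulVecE Q (single (Fin.last n) 1)
  have hAe : A e = single (Fin.last n) 1 := by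
    show mulVecE Qᵀ (mulVecE Q _) = _
    rw [← mulVecE_mul, hQ, mulVecE_one]
  have hPe : P e = 1 := by show (A e) (Fin.last n) = 1; rw [hAe]; simp
  have hBe : B e = 0 := by
    show firstCoords (A e) = 0
    rw [hAe]; ext i; simp [firstCoords, (Fin.castSucc_lt_last i).ne]
  have hc1' : ∀ y, ‖fderiv ℝ γ y‖ ≤ c1 := fun y => by rw [← norm_iteratedFDeriv_one]; exact hc1 y
  have hc2' : ∀ y, ‖fderiv ℝ (fderiv ℝ γ) y‖ ≤ c2 := fun y => by rw [← norm_iteratedFDeriv_one, norm_iteratedFDeriv_fderiv]; exact hc2 y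
  have h10 : 0 ≤ c1 := (norm_nonneg _).trans (hc1' 0)
  have h20 : 0 ≤ c2 := (norm_nonneg _).trans (hc2' 0)
  have hs' : ContDiff ℝ 3 γ := by exact_mod_cast hs
  have hfd : ∀ x, fderiv ℝ (fun x => P x - γ (B x)) x = P - (fderiv ℝ γ (B x)).comp B := fun x =>
    (P.hasFDerivAt.sub (((hs'.differentiable (by norm_num)) (B x)).hasFDerivAt.comp x B.hasFDerivAt)).fderiv
  refine ⟨1 + (‖P‖ + c1 * ‖B‖) + c2 * ‖B‖ * ‖B‖, e, fun x => P x - γ (B x), by have := norm_nonneg P; nlinarith [mul_nonneg h10 (norm_nonneg B), mul_nonneg (mul_nonneg h20 (norm_nonneg B)) (norm_nonneg B)], fun Ω U R Λ' K hΛ hU hK => ⟨?_, P.contDiff.sub (hs'.comp B.contDiff), fun x s => ?_, fun x => ?_, fun x y => ?_, fun x hx => ?_⟩⟩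
  · have : inner ℝ e e = (1 : ℝ) := by
      show inner ℝ e (mulVecE Q _) = (1 : ℝ)
      rw [inner_mulVecE]
      show inner ℝ (A e) _ = (1 : ℝ)
      rw [hAe]; simp
    rw [real_inner_self_eq_norm_sq] at this
    exact (pow_eq_one_iff_of_nonneg (norm_nonneg e) two_ne_zero).mp this
  · simp only [map_add, map_smul, hPe, hBe, smul_zero, add_zero, smul_eq_mul, mul_one]; ring
  · rw [hfd]
    refine (norm_sub_le _ _).trans (le_trans ?_ hΛ)
    have := ((fderiv ℝ γ (B x)).opNorm_comp_le B).trans (mul_le_mul_of_nonneg_right (hc1' _) (norm_nonneg B))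
    nlinarith [mul_nonneg (mul_nonneg h20 (norm_nonneg B)) (norm_nonneg B)]
  · rw [hfd, hfd]
    have h1 : P - (fderiv ℝ γ (B x)).comp B - (P - (fderiv ℝ γ (B y)).comp B) = (fderiv ℝ γ (B y) - fderiv ℝ γ (B x)).comp B := by
      rw [ContinuousLinearMap.sub_comp]; abel
    have h2 : ‖fderiv ℝ γ (B y) - fderiv ℝ γ (B x)‖ ≤ c2 * ‖B y - B x‖ :=
      convex_univ.norm_image_sub_le_of_norm_fderiv_le (fun z _ => ((hs'.fderiv_right (m := 2) (by norm_num)).differentiable (by norm_num)) z) (fun z _ => hc2' z) (Set.mem_univ _) (Set.mem_univ _)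
    have h3 : ‖B y - B x‖ ≤ ‖B‖ * ‖x - y‖ := by rw [← map_sub, norm_sub_rev x y]; exact B.le_opNorm _
    rw [h1]
    calc _ ≤ ‖fderiv ℝ γ (B y) - fderiv ℝ γ (B x)‖ * ‖B‖ := ContinuousLinearMap.opNorm_comp_le _ _
      _ ≤ (c2 * (‖B‖ * ‖x - y‖)) * ‖B‖ := mul_le_mul_of_nonneg_right (h2.trans (mul_le_mul_of_nonneg_left h3 h20)) (norm_nonneg _)
      _ = (c2 * ‖B‖ * ‖B‖) * ‖x - y‖ := by ring
      _ ≤ _ := mul_le_mul_of_nonneg_right (by nlinarith [mul_nonneg h10 (norm_nonneg B), norm_nonneg P]) (norm_nonneg _)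
  · have hxU := hK hx
    have h1 : x ∈ Ω ↔ x ∈ mulVecE Q '' halfSpace γ :=
      ⟨fun h => (hU ▸ (⟨h, hxU⟩ : x ∈ Ω ∩ U) : x ∈ (mulVecE Q '' halfSpace γ) ∩ U).1, fun h => (hU.symm ▸ (⟨h, hxU⟩ : x ∈ (mulVecE Q '' halfSpace γ) ∩ U) : x ∈ Ω ∩ U).1⟩
    have h2 : 0 < P x - γ (B x) ↔ mulVecE Qᵀ x ∈ halfSpace γ := sub_pos
    rw [h1, h2]
    constructor
    · rintro ⟨y, hy, rfl⟩
      rwa [← mulVecE_mul, hQ, mulVecE_one]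
    · exact fun h => ⟨_, h, by rw [← mulVecE_mul, hQ', mulVecE_one]⟩

lemma atlas_exists {Ω : Set (EV (n + 1))} (hΩ : IsGraphDomain 3 Ω) (hc : IsCompact (frontier Ω)) :
    ∃ (ι : Type) (_ : Fintype ι) (Λ R : ℝ) (e : ι → EV (n + 1)) (t ζ : ι → EV (n + 1) → ℝ), IsAtlas Ω Λ R e t ζ := by
  obtain ⟨ho, hloc⟩ := hΩ
  have h : ∀ z : frontier Ω, ∃ (r Λ : ℝ) (e : EV (n + 1)) (t : EV (n + 1) → ℝ), 0 < r ∧ 1 ≤ Λ ∧ ∀ (R Λ' : ℝ) (K : Set (EV (n + 1))), Λ ≤ Λ' → 0 ≤ R → R ≤ r →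
      K ⊆ ball (z : EV (n + 1)) r → IsChart Ω Λ' R K e t := by
    rintro ⟨z, hz⟩
    obtain ⟨U, Q, γ, hUo, hzU, hQ, -, hγ, hU⟩ := hloc z hz
    obtain ⟨r, hr, hrU⟩ := nhds_basis_closedBall.mem_iff.mp (hUo.mem_nhds hzU)
    obtain ⟨Λ, e, t, hΛ, hch⟩ := graph_chart hQ hγ
    refine ⟨r / 2, Λ, e, t, by positivity, hΛ, fun R Λ' K h1 h0 h2 h3 => hch Ω U R Λ' K h1 hU fun x hx => hrU ?_⟩
    have := cthickening_subset_of_subset R (h3.trans ball_subset_closedBall) hx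
    rw [cthickening_closedBall h0 (by positivity)] at this
    exact closedBall_subset_closedBall (by linarith) this
  choose r Λ e t hr hΛ hch using h
  obtain ⟨s, hs⟩ := hc.elim_finite_subcover (fun z : frontier Ω => ball (z : EV (n + 1)) (r z)) (fun z => isOpen_ball) fun x hx =>
    Set.mem_iUnion.mpr ⟨⟨x, hx⟩, mem_ball_self (hr _)⟩
  have hUo : IsOpen (⋃ z ∈ s, ball ((z : frontier Ω) : EV (n + 1)) (r z)) := isOpen_biUnion fun z _ => isOpen_ball
  obtain ⟨δ, hδ, hδs⟩ := hc.exists_cthickening_subset_open hUo hs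
  obtain ⟨f, hf⟩ := SmoothPartitionOfUnity.exists_isSubordinate (modelWithCornersSelf ℝ (EV (n + 1))) (isClosed_cthickening (δ := δ) (E := frontier Ω))
    (fun z : s => ball ((z : frontier Ω) : EV (n + 1)) (r z)) (fun z => isOpen_ball) (hδs.trans fun x hx => by
      simp only [Set.mem_iUnion] at hx ⊢
      obtain ⟨z, hz, hx⟩ := hx
      exact ⟨⟨z, hz⟩, hx⟩)
  obtain ⟨R, hR, hRδ, hRr⟩ : ∃ R : ℝ, 0 < R ∧ R ≤ δ ∧ ∀ z ∈ s, R ≤ r z := by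
    have : ∀ᶠ R in 𝓝[>] (0 : ℝ), R ≤ δ ∧ ∀ z ∈ s, R ≤ r z := by
      have g : ∀ c : ℝ, 0 < c → ∀ᶠ R in 𝓝[>] (0 : ℝ), R ≤ c := fun c hc => nhdsWithin_le_nhds (eventually_le_nhds hc)
      exact (g δ hδ).and ((Finset.eventually_all s).mpr fun z _ => g _ (hr z))
    obtain ⟨R, h1, h2⟩ := (this.and self_mem_nhdsWithin).exists
    exact ⟨R, h2, h1⟩
  have hΛs : ∀ z : s, Λ z ≤ 1 + ∑ z ∈ s, Λ z := fun z => by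
    have := Finset.single_le_sum (f := Λ) (fun z _ => zero_le_one.trans (hΛ z)) z.2
    linarith
  refine ⟨s, inferInstance, 1 + ∑ z ∈ s, Λ z, R, fun z => e z, fun z => t z, fun z => f z, ho, hR, ?_, fun z => hch z R _ _ (hΛs z) hR.le (hRr z z.2) (hf z), fun z => ?_, fun z => ?_, fun z x => f.nonneg z x, fun x hx => ?_⟩
  · have := Finset.sum_nonneg (s := s) fun z _ => zero_le_one.trans (hΛ z)
    linarith
  · exact (f z).contMDiff.contDiff
  · exact isCompact_of_isClosed_isBounded (isClosed_tsupport _) (isBounded_ball.subset (hf z))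
  · have := f.sum_eq_one (cthickening_mono hRδ _ hx)
    rwa [finsum_eq_sum_of_fintype] at this
end

end

/-- convergence rate on a domain with compact `C³` boundary: let
`Ω ⊂ ℝⁿ` be a domain with compact boundary of class `C³`, `p ∈ [1,∞)`, and let `ρ`
satisfy (A1) and (A2). Then there is `C_Ω > 0`, depending only on `Ω`, `ρ` and `p`,
such that for all `ε ∈ (0,1]` and all `u ∈ W^{3,p}_M(Ω)`:
`‖L_ε^Ω u - L^Ω u‖_{L^p(Ω)} ≤ C_Ω ε^{1/p} ‖u‖_{W^{3,p}(Ω)}`, where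
`L^Ω u = -div(M∇u) = -∑_{i,j} M_{ij} ∂ᵢ∂ⱼ u` is expressed through the weak
derivatives `D`, and `L_ε^Ω` is (any choice of) the bounded linear extension of the
nonlocal operator to `W^{2,p}_M(Ω)`. -/
theorem nlOp_rate_domain (n : ℕ) (Ω : Set (EV (n + 1)))
    (hΩ : IsGraphDomain 3 Ω) (hconn : IsConnected Ω) (hcpt : IsCompact (frontier Ω))
    (ρ : EV (n + 1) → ℝ) (hρ1 : A1 ρ) (hρ2 : A2 ρ)
    (p : ℝ≥0∞) (hp1 : 1 ≤ p) (hp : p ≠ ⊤)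
    (L : ℝ → (EV (n + 1) → ℝ) → EV (n + 1) → ℝ)
    (hL : ∀ ε : ℝ, 0 < ε → ε ≤ 1 → ∃ c : ℝ, 0 < c ∧
      IsNLExtOn Ω (momentum ρ) ρ p ε c (L ε)) :
    ∃ C : ℝ, 0 < C ∧ ∀ ε : ℝ, 0 < ε → ε ≤ 1 →
      ∀ (u : EV (n + 1) → ℝ) (D : List (Fin (n + 1)) → EV (n + 1) → ℝ),
        NeumannBC Ω (momentum ρ) p u →
        IsSobDerivs Ω 3 p u D →
        eLpNorm
            (fun x => L ε u x
              + ∑ i : Fin (n + 1), ∑ j : Fin (n + 1), momentum ρ i j * D [i, j] x)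
            p (volume.restrict Ω)
          ≤ ENNReal.ofReal (C * ε ^ (1 / p.toReal)) * WNormD 3 p (volume.restrict Ω) D := by
  obtain ⟨ι, _, Λ, R, e, t, ζ, hA⟩ := atlas_exists hΩ hcpt
  obtain ⟨C, hC, h⟩ := hA.rate hρ1 hρ2 hp1 hp L hL
  refine ⟨C.toReal + 1, by positivity, fun ε hε hε1 u D hN hD => (h ε hε hε1 u D hN hD).trans ?_⟩
  rw [ENNReal.ofReal_mul (by positivity)]
  gcongr
  exact (ENNReal.ofReal_toReal hC).symm.le.trans (ENNReal.ofReal_le_ofReal (by linarith))
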